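/- The quadratically twisted second moment of traces of Frobenius of Legendre elliptic curves satisfies Σ_{λ ∈ F_p \ {0,1,−1}} φ(λ)·a_p(λ)² = o(p²) as p → ∞; precisely, for every ε > 0 there exists N such that for every prime p > N, |Σ_{λ ∈ F_p \ {0,1,−1}} φ(λ)·a_p(λ)²| < ε·p², where a_p(λ) := −Σ_{x ∈ F_p} φ(x(x−1)(x−λ)). -/

import Mathlib

open Finset

open scoped Classical in
/-- The quadratic character of `F_p`, with `φ(0) = 0`. -/
noncomputable def phi (p : ℕ) (a : ZMod p) : ℤ :=
  if a = 0 then 0 else if IsSquare a then 1 else -1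

/-- The trace of Frobenius of the Legendre elliptic curve `y² = x(x−1)(x−λ)`:
`a_p(λ) = −Σ_{x ∈ F_p} φ(x(x−1)(x−λ))`. -/
noncomputable def ap (p : ℕ) [NeZero p] (l : ZMod p) : ℤ :=
  -∑ x : ZMod p, phi p (x * (x - 1) * (x - l))

section FiniteField

variable {p : ℕ} [hp : Fact p.Prime]

lemma phi_eq_quadraticChar (a : ZMod p) : phi p a = quadraticChar (ZMod p) a := by
  classical
  simp only [phi, quadraticChar_apply, quadraticCharFun]
  congr

lemma phi_mul (a b : ZMod p) : phi p (a * b) = phi p a * phi p b := by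
  simp only [phi_eq_quadraticChar, map_mul]

lemma phi_cast (hp2 : p ≠ 2) (a : ZMod p) : (phi p a : ZMod p) = a ^ (p / 2) := by
  rw [phi_eq_quadraticChar, quadraticChar_eq_pow_of_char_ne_two' (by rwa [ZMod.ringChar_zmod_n]),
    ZMod.card]

lemma phi_sq_le_one (a : ZMod p) : phi p a ^ 2 ≤ 1 := by
  unfold phi; split_ifs <;> norm_num

lemma sum_phi (hp2 : p ≠ 2) : ∑ x : ZMod p, phi p x = 0 := by
  simp_rw [phi_eq_quadraticChar]
  exact quadraticChar_sum_zero (by rwa [ZMod.ringChar_zmod_n])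

lemma phi_one : phi p 1 = 1 := by simp [phi_eq_quadraticChar]

lemma phi_sq_mul {a : ZMod p} (ha : a ≠ 0) (b : ZMod p) : phi p (a ^ 2 * b) = phi p b := by
  rw [phi_mul, phi_eq_quadraticChar, quadraticChar_sq_one' ha, one_mul]

lemma sum_phi_mul_add (hp2 : p ≠ 2) {d : ZMod p} (hd : d ≠ 0) :
    ∑ u : ZMod p, phi p (u * (u + d)) = -1 := by
  have h1 : ∑ u : ZMod p, phi p (u * (u + d)) =
      ∑ u ∈ univ.erase (0 : ZMod p), phi p (1 + d * u⁻¹) := by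
    rw [← Finset.add_sum_erase univ _ (Finset.mem_univ (0 : ZMod p))]
    simp only [zero_mul]
    rw [show phi p (0 : ZMod p) = 0 by simp [phi], zero_add]
    refine Finset.sum_congr rfl fun u hu => ?_
    have hu : u ≠ 0 := (Finset.mem_erase.mp hu).1
    rw [← phi_sq_mul hu (1 + d * u⁻¹)]
    congr 1; field_simp
  have h2 : ∑ u ∈ univ.erase (0 : ZMod p), phi p (1 + d * u⁻¹) =
      ∑ v ∈ univ.erase (1 : ZMod p), phi p v := by
    refine Finset.sum_bij' (fun u _ => 1 + d * u⁻¹) (fun v _ => d * (v - 1)⁻¹) ?_ ?_ ?_ ?_ ?_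
    · intro u hu; have hu : u ≠ 0 := (Finset.mem_erase.mp hu).1
      simp [hd, hu]
    · intro v hv; have hv : v ≠ 1 := (Finset.mem_erase.mp hv).1
      simp [sub_ne_zero.mpr hv, hd]
    · intro u hu; have hu : u ≠ 0 := (Finset.mem_erase.mp hu).1
      simp only [add_sub_cancel_left]
      field_simp
    · intro v hv; have hv : v ≠ 1 := (Finset.mem_erase.mp hv).1
      have := sub_ne_zero.mpr hv
      field_simp; ring
    · intros; rfl
  have h3 := Finset.add_sum_erase univ (phi p) (Finset.mem_univ (1 : ZMod p))
  rw [sum_phi hp2, phi_one] at h3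
  rw [h1, h2]; linarith

lemma sum_phi_mul_sub (hp2 : p ≠ 2) (x y : ZMod p) :
    ∑ l : ZMod p, phi p (x - l) * phi p (y - l) = (if x = y then (p : ℤ) else 0) - 1 := by
  have h0 : ∑ l : ZMod p, phi p (x - l) * phi p (y - l) =
      ∑ u : ZMod p, phi p (u * (u + (y - x))) := by
    refine Fintype.sum_equiv (Equiv.subLeft x) _ _ fun l => ?_
    rw [← phi_mul]; congr 2; simp
  rw [h0]
  split_ifs with h
  · subst h
    have : ∀ u : ZMod p, phi p (u * (u + (x - x))) = if u = 0 then 0 else 1 := by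
      intro u
      split_ifs with hu
      · simp [hu, phi]
      · have := phi_sq_mul hu 1
        rw [phi_one] at this
        rw [← this]; congr 1; ring
    simp_rw [this]
    rw [Finset.sum_ite]
    simp only [Finset.sum_const_zero, zero_add, Finset.sum_const, nsmul_eq_mul, mul_one]
    rw [Finset.filter_not, Finset.card_sdiff]
    simp [Finset.filter_eq', ZMod.card, hp.out.one_le]
  · rw [sum_phi_mul_add hp2 (sub_ne_zero.mpr (Ne.symm h))]; simp

lemma sum_ap_sq_le (hp2 : p ≠ 2) : ∑ l : ZMod p, ap p l ^ 2 ≤ (p : ℤ) ^ 2 := by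
  have h1 : ∑ l : ZMod p, ap p l ^ 2 = ∑ x : ZMod p, ∑ y : ZMod p,
      phi p (x * (x - 1)) * phi p (y * (y - 1)) * ((if x = y then (p : ℤ) else 0) - 1) := by
    simp_rw [← sum_phi_mul_sub hp2, Finset.mul_sum]
    have : ∀ l : ZMod p, ap p l ^ 2 = ∑ x : ZMod p, ∑ y : ZMod p,
        phi p (x * (x - 1)) * phi p (y * (y - 1)) * (phi p (x - l) * phi p (y - l)) := by
      intro l
      rw [ap, neg_sq, sq, Finset.sum_mul_sum]
      refine Finset.sum_congr rfl fun x _ => Finset.sum_congr rfl fun y _ => ?_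
      rw [phi_mul (x * (x - 1)), phi_mul (y * (y - 1))]; ring
    simp_rw [this]
    rw [Finset.sum_comm]
    refine Finset.sum_congr rfl fun x _ => ?_
    rw [Finset.sum_comm]
  have h2 : ∑ x : ZMod p, ∑ y : ZMod p,
      phi p (x * (x - 1)) * phi p (y * (y - 1)) * ((if x = y then (p : ℤ) else 0) - 1) =
      p * ∑ x : ZMod p, phi p (x * (x - 1)) ^ 2 - (∑ x : ZMod p, phi p (x * (x - 1))) ^ 2 := by
    rw [sq (∑ x : ZMod p, _), Finset.sum_mul_sum, Finset.mul_sum, ← Finset.sum_sub_distrib]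
    refine Finset.sum_congr rfl fun x _ => ?_
    simp only [mul_sub, Finset.sum_sub_distrib, mul_one, mul_ite, mul_zero, Finset.sum_ite_eq,
      Finset.mem_univ, if_true]
    ring
  have h3 : ∑ x : ZMod p, phi p (x * (x - 1)) ^ 2 ≤ p := by
    calc _ ≤ ∑ x : ZMod p, (1 : ℤ) := Finset.sum_le_sum fun x _ => phi_sq_le_one _
      _ = p := by simp [ZMod.card]
  rw [h1, h2]
  nlinarith [sq_nonneg (∑ x : ZMod p, phi p (x * (x - 1))), hp.out.pos]

lemma ap_zero_sq (hp2 : p ≠ 2) : ap p 0 ^ 2 ≤ 1 := by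
  have : ∀ x : ZMod p, phi p (x * (x - 1) * (x - 0)) = phi p (x - 1) -
      (if x = 0 then phi p (-1) else 0) := by
    intro x
    split_ifs with h
    · subst h; simp only [zero_mul, zero_sub, sub_self]; simp [phi]
    · rw [← phi_sq_mul h (x - 1), sub_zero, sub_zero]; congr 1; ring
  rw [ap]
  simp_rw [this]
  rw [Finset.sum_sub_distrib, Fintype.sum_equiv (Equiv.subRight (1 : ZMod p)) _ (phi p) (by simp),
    sum_phi hp2]
  simpa using phi_sq_le_one (-1 : ZMod p)

lemma sum_pow_zmod {m : ℕ} (hm : 0 < m) (hm2 : m < 2 * (p - 1)) :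
    ∑ x : ZMod p, x ^ m = if m = p - 1 then -1 else 0 := by
  have h1 : ∑ x : ZMod p, x ^ m = ∑ x : (ZMod p)ˣ, (x : ZMod p) ^ m := by
    rw [← Finset.add_sum_erase univ _ (Finset.mem_univ (0 : ZMod p)), zero_pow hm.ne', zero_add]
    symm
    refine Finset.sum_bij' (fun u _ => (u : ZMod p))
      (fun v hv => Units.mk0 v (Finset.mem_erase.mp hv).1) ?_ ?_ ?_ ?_ ?_ <;> simp
  rw [h1, FiniteField.sum_pow_units, ZMod.card]
  congr 1
  apply propext
  constructor
  · rintro ⟨k, hk⟩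
    have : 0 < k := Nat.pos_of_ne_zero (by rintro rfl; omega)
    have : k < 2 := by
      by_contra h
      have : (p - 1) * 2 ≤ (p - 1) * k := Nat.mul_le_mul_left _ (by omega)
      omega
    have : k = 1 := by omega
    subst this; omega
  · rintro rfl; exact dvd_rfl

/-- The Hasse polynomial `∑ C(n,i)² Xⁱ` of the Legendre family, `n = (p-1)/2`. -/
noncomputable def hassePoly (p : ℕ) : Polynomial ℤ :=
  ∑ i ∈ range (p / 2 + 1), Polynomial.C (((p / 2).choose i : ℤ) ^ 2) * Polynomial.X ^ i

lemma aeval_hassePoly {R : Type*} [CommRing R] (p : ℕ) (x : R) :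
    Polynomial.aeval x (hassePoly p) = ∑ i ∈ range (p / 2 + 1), ((p / 2).choose i : R) ^ 2 * x ^ i := by
  simp [hassePoly]

lemma ap_cast (hp2 : p ≠ 2) (l : ZMod p) :
    (ap p l : ZMod p) = (-1) ^ (p / 2) * Polynomial.aeval l (hassePoly p) := by
  obtain ⟨n, hn⟩ := hp.out.odd_of_ne_two hp2
  have hn2 : p / 2 = n := by omega
  have hnpos : 0 < n := by have := hp.out.two_le; omega
  have e1 : ∀ x : ZMod p, x ^ n * (x - 1) ^ n * (x - l) ^ n =
      ∑ i ∈ range (n + 1), ∑ j ∈ range (n + 1),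
        ((-1) ^ (n - i) * (n.choose i) * ((-l) ^ (n - j) * n.choose j)) * x ^ (n + i + j) := by
    intro x
    rw [sub_eq_add_neg, sub_eq_add_neg, add_pow, add_pow, mul_assoc, Finset.sum_mul_sum,
      Finset.mul_sum]
    refine Finset.sum_congr rfl fun i _ => ?_
    rw [Finset.mul_sum]
    refine Finset.sum_congr rfl fun j _ => ?_
    ring
  rw [ap, aeval_hassePoly]
  push_cast
  simp_rw [phi_cast hp2, hn2, mul_pow, e1]
  rw [Finset.sum_comm, Finset.mul_sum, ← Finset.sum_neg_distrib]
  refine Finset.sum_congr rfl fun i hi => ?_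
  have hi : i ≤ n := by simpa [Nat.lt_succ_iff] using hi
  rw [Finset.sum_comm]
  simp_rw [← Finset.mul_sum]
  rw [Finset.sum_eq_single (n - i)]
  · rw [sum_pow_zmod (by omega) (by omega), if_pos (by omega)]
    have h1 : n - (n - i) = i := by omega
    rw [h1, Nat.choose_symm hi, neg_pow l]
    have : (-1 : ZMod p) ^ (n - i) * (-1) ^ i = (-1) ^ n := by rw [← pow_add]; congr 1; omega
    linear_combination ((n.choose i : ZMod p) ^ 2 * l ^ i) * this
  · intro j hj hji
    have hj : j ≤ n := by simpa [Nat.lt_succ_iff] using hj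
    rw [sum_pow_zmod (by omega) (by omega), if_neg (by omega), mul_zero]
  · intro h; exact absurd (Finset.mem_range.mpr (by omega)) h

lemma ap_sq_cast (hp2 : p ≠ 2) (l : ZMod p) :
    (ap p l : ZMod p) ^ 2 = (Polynomial.aeval l (hassePoly p)) ^ 2 := by
  rw [ap_cast hp2, mul_pow, ← pow_mul, mul_comm (p / 2), pow_mul]; simp

lemma choose_mul_four_pow (hp2 : p ≠ 2) {i : ℕ} (hi : i ≤ p / 2) :
    ((p / 2).choose i : ZMod p) * 4 ^ i = (-1) ^ i * (i.centralBinom : ZMod p) := by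
  induction i with
  | zero => simp
  | succ i ih =>
    have ih := ih (by omega)
    obtain ⟨n, hn⟩ := hp.out.odd_of_ne_two hp2
    have hn2 : p / 2 = n := by omega
    rw [hn2] at ih hi ⊢
    have hne : ((i + 1 : ℕ) : ZMod p) ≠ 0 := by
      rw [Ne, ZMod.natCast_eq_zero_iff]
      intro h; have := Nat.le_of_dvd (by omega) h; omega
    have h1 : ((n.choose (i + 1) : ℕ) : ZMod p) * ((i + 1 : ℕ) : ZMod p) = n.choose i * (n - i) := by
      have := Nat.choose_succ_right_eq n i
      rw [← Nat.cast_mul, this]; push_cast [show i ≤ n by omega]; ring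
    have h2 : ((i + 1 : ℕ) : ZMod p) * (i + 1).centralBinom = 2 * (2 * i + 1) * i.centralBinom := by
      have := Nat.succ_mul_centralBinom_succ i
      rw [← Nat.cast_mul, this]; push_cast; ring
    have h3 : (2 * n + 1 : ZMod p) = 0 := by
      have : ((2 * n + 1 : ℕ) : ZMod p) = 0 := by rw [← hn]; simp
      simpa using this
    apply mul_left_cancel₀ hne
    calc ((i + 1 : ℕ) : ZMod p) * (n.choose (i + 1) * 4 ^ (i + 1))
        = (((n.choose (i + 1) : ℕ) : ZMod p) * ((i + 1 : ℕ) : ZMod p)) * 4 ^ i * 4 := by ring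
      _ = (n.choose i * 4 ^ i) * (4 * (n - i)) := by rw [h1]; ring
      _ = (-1) ^ (i + 1) * (((i + 1 : ℕ) : ZMod p) * (i + 1).centralBinom) := by
        rw [ih, h2]; linear_combination 2 * (-1) ^ i * (i.centralBinom : ZMod p) * h3
      _ = _ := by ring

lemma sum_choose_sq_mul_pow {R : Type*} [CommRing R] (n : ℕ) (k : R) :
    ∑ i ∈ range (n + 1), (n.choose i : R) ^ 2 * (k ^ 2) ^ i =
      ∑ i ∈ range (n + 1), (n.choose i : R) * ((-1) ^ i * i.centralBinom) * k ^ i *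
        ((1 + k) ^ 2) ^ (n - i) := by
  classical
  have key : ((1 + Polynomial.C k * Polynomial.X) ^ n * (Polynomial.X + Polynomial.C k) ^ n :
      Polynomial R).coeff n = ((Polynomial.C k * (Polynomial.X + Polynomial.C (-1)) ^ 2 +
        Polynomial.C ((1 + k) ^ 2) * Polynomial.X) ^ n : Polynomial R).coeff n := by
    rw [← mul_pow]; congr 2; simp only [map_pow, map_add, map_neg, map_one]; ring
  have hl : ((1 + Polynomial.C k * Polynomial.X) ^ n * (Polynomial.X + Polynomial.C k) ^ n :
      Polynomial R).coeff n = ∑ i ∈ range (n + 1), (n.choose i : R) ^ 2 * (k ^ 2) ^ i := by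
    rw [add_comm (1 : Polynomial R), add_pow, Finset.sum_mul, Polynomial.finsetSum_coeff]
    refine Finset.sum_congr rfl fun i hi => ?_
    have hi : i ≤ n := by simpa [Nat.lt_succ_iff] using hi
    have : ((Polynomial.C k * Polynomial.X) ^ i * 1 ^ (n - i) * (n.choose i : Polynomial R) *
        (Polynomial.X + Polynomial.C k) ^ n) =
        Polynomial.C (k ^ i * n.choose i) * ((Polynomial.X + Polynomial.C k) ^ n *
          Polynomial.X ^ i) := by
      simp only [map_mul, map_pow, map_natCast, one_pow]; ring
    rw [this, Polynomial.coeff_C_mul]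
    conv_lhs => rw [show n = (n - i) + i by omega]
    rw [Polynomial.coeff_mul_X_pow, show n - i + i = n by omega, Polynomial.coeff_X_add_C_pow,
      Nat.choose_symm hi, show n - (n - i) = i by omega]
    ring
  have hr : ((Polynomial.C k * (Polynomial.X + Polynomial.C (-1)) ^ 2 +
        Polynomial.C ((1 + k) ^ 2) * Polynomial.X) ^ n : Polynomial R).coeff n =
      ∑ i ∈ range (n + 1), (n.choose i : R) * ((-1) ^ i * i.centralBinom) * k ^ i *
        ((1 + k) ^ 2) ^ (n - i) := by
    rw [add_pow, Polynomial.finsetSum_coeff]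
    refine Finset.sum_congr rfl fun i hi => ?_
    have hi : i ≤ n := by simpa [Nat.lt_succ_iff] using hi
    have : (Polynomial.C k * (Polynomial.X + Polynomial.C (-1)) ^ 2) ^ i *
        (Polynomial.C ((1 + k) ^ 2) * Polynomial.X) ^ (n - i) * (n.choose i : Polynomial R) =
        Polynomial.C (k ^ i * ((1 + k) ^ 2) ^ (n - i) * n.choose i) *
          ((Polynomial.X + Polynomial.C (-1)) ^ (2 * i) * Polynomial.X ^ (n - i)) := by
      rw [pow_mul]
      generalize (Polynomial.X + Polynomial.C (-1) : Polynomial R) ^ 2 = A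
      simp only [map_mul, map_pow, map_natCast]; ring
    rw [this, Polynomial.coeff_C_mul, Polynomial.coeff_mul_X_pow', if_pos (by omega),
      show n - (n - i) = i by omega, Polynomial.coeff_X_add_C_pow,
      show 2 * i - i = i by omega, Nat.centralBinom_eq_two_mul_choose]
    ring
  rw [← hl, key, hr]

/-- Landen's transformation of the Hasse polynomial in characteristic `p`. -/
lemma hassePoly_landen {R : Type*} [CommRing R] [CharP R p] (hp2 : p ≠ 2) (k : R) :
    ∑ i ∈ range (p / 2 + 1), ((p / 2).choose i : R) ^ 2 * (4 * k) ^ i *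
      ((1 + k) ^ 2) ^ (p / 2 - i) = Polynomial.aeval (k ^ 2) (hassePoly p) := by
  rw [aeval_hassePoly, sum_choose_sq_mul_pow]
  refine Finset.sum_congr rfl fun i hi => ?_
  have hi : i ≤ p / 2 := by simpa [Nat.lt_succ_iff] using hi
  have h := congrArg (ZMod.castHom dvd_rfl R) (choose_mul_four_pow hp2 hi)
  simp only [map_mul, map_pow, map_natCast, map_neg, map_one, map_ofNat] at h
  rw [← h]; ring

end FiniteField

section Theta

open Complex

/-- The theta constant `θ₃` on the upper half plane. -/
noncomputable def theta3 (τ : ℂ) : ℂ := jacobiTheta₂ 0 τ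

/-- The theta constant `θ₄` on the upper half plane. -/
noncomputable def theta4 (τ : ℂ) : ℂ := jacobiTheta₂ (1 / 2) τ

/-- The theta constant `θ₂` on the upper half plane. -/
noncomputable def theta2 (τ : ℂ) : ℂ := cexp (Real.pi * I * τ / 4) * jacobiTheta₂ (τ / 2) τ

lemma two_mul_im_pos {τ : ℂ} (hτ : 0 < τ.im) : 0 < (2 * τ).im := by simp [hτ]

lemma HasSum.of_eq {β : Type*} {f g : β → ℂ} {a : ℂ} (h : HasSum g a) (hfg : ∀ x, f x = g x) :
    HasSum f a := by rwa [funext hfg]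

lemma HasSum.add_of_injective {β γ : Type*} {f : β → ℂ} {e0 e1 : γ → β} {a b : ℂ}
    (i0 : Function.Injective e0) (i1 : Function.Injective e1) (hd : ∀ x y, e0 x ≠ e1 y)
    (hc : ∀ z, (∃ x, e0 x = z) ∨ ∃ x, e1 x = z) (h0 : HasSum (fun x => f (e0 x)) a)
    (h1 : HasSum (fun x => f (e1 x)) b) : HasSum f (a + b) := by
  refine HasSum.add_isCompl (s := Set.range e0) (t := Set.range e1) ⟨?_, ?_⟩
    (i0.hasSum_range_iff.mpr h0) (i1.hasSum_range_iff.mpr h1)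
  · rw [Set.disjoint_iff]
    rintro z ⟨⟨x, rfl⟩, ⟨y, hy⟩⟩
    exact hd x y hy.symm
  · rw [codisjoint_iff_le_sup]
    intro z _
    exact hc z

lemma HasSum.mul_prod {ι : Type*} {f g : ι → ℂ} {a b : ℂ} (hf : HasSum f a) (hg : HasSum g b) :
    HasSum (fun m : ι × ι => f m.1 * g m.2) (a * b) :=
  hf.mul hg (summable_mul_of_summable_norm hf.summable.norm hg.summable.norm)

lemma hasSum_jacobiTheta₂_mul (x y : ℂ) {τ : ℂ} (hτ : 0 < τ.im) : HasSum (fun m : ℤ × ℤ =>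
    jacobiTheta₂_term m.1 x τ * jacobiTheta₂_term m.2 y τ)
    (jacobiTheta₂ x τ * jacobiTheta₂ y τ) :=
  HasSum.mul_prod (f := fun n => jacobiTheta₂_term n x τ) (g := fun n => jacobiTheta₂_term n y τ)
    (hasSum_jacobiTheta₂_term x hτ) (hasSum_jacobiTheta₂_term y hτ)

lemma jacobiTheta₂_mul (x y : ℂ) {τ : ℂ} (hτ : 0 < τ.im) :
    jacobiTheta₂ x τ * jacobiTheta₂ y τ =
      jacobiTheta₂ (x + y) (2 * τ) * jacobiTheta₂ (x - y) (2 * τ) +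
      cexp (2 * Real.pi * I * x + Real.pi * I * τ) *
        (jacobiTheta₂ (x + y + τ) (2 * τ) * jacobiTheta₂ (x - y + τ) (2 * τ)) := by
  have hτ2 := two_mul_im_pos hτ
  have h0 := hasSum_jacobiTheta₂_mul (x + y) (x - y) hτ2
  have h1 := (hasSum_jacobiTheta₂_mul (x + y + τ) (x - y + τ) hτ2).mul_left
    (cexp (2 * Real.pi * I * x + Real.pi * I * τ))
  refine (hasSum_jacobiTheta₂_mul x y hτ).unique (HasSum.add_of_injective
    (e0 := fun u : ℤ × ℤ => (u.1 + u.2, u.1 - u.2))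
    (e1 := fun u : ℤ × ℤ => (u.1 + u.2 + 1, u.1 - u.2)) ?_ ?_ ?_ ?_ ?_ ?_)
  · rintro ⟨a, b⟩ ⟨c, d⟩ h; simp only [Prod.mk.injEq] at h ⊢; omega
  · rintro ⟨a, b⟩ ⟨c, d⟩ h; simp only [Prod.mk.injEq] at h ⊢; omega
  · rintro ⟨a, b⟩ ⟨c, d⟩ h; simp only [Prod.mk.injEq] at h; omega
  · rintro ⟨a, b⟩
    rcases Int.even_or_odd' (a - b) with ⟨c, h | h⟩
    · exact Or.inl ⟨(b + c, c), by simp only [Prod.mk.injEq]; omega⟩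
    · exact Or.inr ⟨(b + c, c), by simp only [Prod.mk.injEq]; omega⟩
  · refine h0.of_eq fun u => ?_
    simp only [jacobiTheta₂_term, ← Complex.exp_add]
    congr 1; push_cast; ring
  · refine h1.of_eq fun u => ?_
    simp only [jacobiTheta₂_term]
    rw [← Complex.exp_add, ← Complex.exp_add, ← Complex.exp_add]
    congr 1; push_cast; ring

lemma jacobiTheta₂_split (z : ℂ) {τ : ℂ} (hτ : 0 < τ.im) :
    jacobiTheta₂ z τ = jacobiTheta₂ (2 * z) (4 * τ) +
      cexp (2 * Real.pi * I * z + Real.pi * I * τ) * jacobiTheta₂ (2 * z + 2 * τ) (4 * τ) := by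
  have hτ4 : 0 < (4 * τ).im := by simp [hτ]
  refine (hasSum_jacobiTheta₂_term z hτ).unique (HasSum.add_of_injective
    (e0 := fun u : ℤ => 2 * u) (e1 := fun u : ℤ => 2 * u + 1) ?_ ?_ ?_ ?_ ?_ ?_)
  · intro a b h; simp only at h; omega
  · intro a b h; simp only at h; omega
  · intro a b h; omega
  · intro a
    rcases Int.even_or_odd' a with ⟨c, h | h⟩
    · exact Or.inl ⟨c, h.symm⟩
    · exact Or.inr ⟨c, h.symm⟩
  · refine (hasSum_jacobiTheta₂_term (2 * z) hτ4).of_eq fun u => ?_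
    simp only [jacobiTheta₂_term]
    congr 1; push_cast; ring
  · refine ((hasSum_jacobiTheta₂_term (2 * z + 2 * τ) hτ4).mul_left
      (cexp (2 * Real.pi * I * z + Real.pi * I * τ))).of_eq fun u => ?_
    simp only [jacobiTheta₂_term]
    rw [← Complex.exp_add]
    congr 1; push_cast; ring

lemma jacobiTheta₂_add_one_right (z τ : ℂ) :
    jacobiTheta₂ z (τ + 1) = jacobiTheta₂ (z + 1 / 2) τ := by
  refine tsum_congr fun n => ?_
  rw [jacobiTheta₂_term, jacobiTheta₂_term, Complex.exp_eq_exp_iff_exists_int]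
  obtain ⟨m, hm⟩ : Even (n * (n - 1)) := by
    rcases Int.even_or_odd n with h | h
    · exact h.mul_right _
    · exact (h.sub_odd odd_one).mul_left _
  refine ⟨m, ?_⟩
  have hm' : (n : ℂ) * (n - 1) = m + m := by exact_mod_cast hm
  linear_combination (Real.pi * I : ℂ) * hm'

lemma theta3_add_one (τ : ℂ) : theta3 (τ + 1) = theta4 τ := by
  rw [theta3, jacobiTheta₂_add_one_right, theta4]; simp

lemma theta4_add_one (τ : ℂ) : theta4 (τ + 1) = theta3 τ := by
  rw [theta4, jacobiTheta₂_add_one_right, theta3, show (1 / 2 : ℂ) + 1 / 2 = 0 + 1 by norm_num,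
    jacobiTheta₂_add_left]

lemma theta2_add_one (τ : ℂ) : theta2 (τ + 1) = cexp (Real.pi * I / 4) * theta2 τ := by
  rw [theta2, jacobiTheta₂_add_one_right, theta2, show (τ + 1) / 2 + 1 / 2 = τ / 2 + 1 by ring,
    jacobiTheta₂_add_left, ← mul_assoc, ← Complex.exp_add]
  congr 2; ring

lemma theta2_sq_add_one (τ : ℂ) : theta2 (τ + 1) ^ 2 = I * theta2 τ ^ 2 := by
  rw [theta2_add_one, mul_pow, ← Complex.exp_nat_mul,
    show ((2 : ℕ) : ℂ) * (Real.pi * I / 4) = Real.pi / 2 * I by push_cast; ring,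
    Complex.exp_pi_div_two_mul_I]

lemma theta3_sq {τ : ℂ} (hτ : 0 < τ.im) :
    theta3 τ ^ 2 = theta3 (2 * τ) ^ 2 + theta2 (2 * τ) ^ 2 := by
  have := jacobiTheta₂_mul 0 0 hτ
  simp only [add_zero, sub_zero, zero_add, mul_zero] at this
  rw [sq, theta3, this, theta2, mul_pow, ← Complex.exp_nat_mul, mul_div_cancel_left₀ _ two_ne_zero,
    theta3, sq, sq]
  congr 3; push_cast; ring

lemma theta4_sq {τ : ℂ} (hτ : 0 < τ.im) :
    theta4 τ ^ 2 = theta3 (2 * τ) ^ 2 - theta2 (2 * τ) ^ 2 := by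
  have := jacobiTheta₂_mul (1 / 2) (1 / 2) hτ
  rw [show (1 / 2 : ℂ) + 1 / 2 = 0 + 1 by norm_num, sub_self, add_right_comm,
    jacobiTheta₂_add_left, jacobiTheta₂_add_left, zero_add] at this
  rw [sq, theta4, this, theta2, mul_pow, ← Complex.exp_nat_mul, mul_div_cancel_left₀ _ two_ne_zero,
    theta3, sq, sq, show 2 * Real.pi * I * (1 / 2) + Real.pi * I * τ =
      Real.pi * I + Real.pi * I * τ by ring, Complex.exp_add, Complex.exp_pi_mul_I, sub_eq_add_neg,
      neg_one_mul, neg_mul]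
  congr 4; push_cast; ring

lemma jacobiTheta₂_half_add (τ : ℂ) : jacobiTheta₂ (1 / 2 + τ) (2 * τ) = 0 := by
  have h := jacobiTheta₂_add_left' (-1 / 2 - τ) (2 * τ)
  rw [show -1 / 2 - τ + 2 * τ = (-1 / 2 + τ) by ring, ← jacobiTheta₂_add_left,
    show (-1 / 2 + τ + 1) = 1 / 2 + τ by ring,
    show (-1 / 2 - τ) = -(1 / 2 + τ) by ring, jacobiTheta₂_neg_left,
    show -Real.pi * I * (2 * τ + 2 * -(1 / 2 + τ)) = Real.pi * I by ring, Complex.exp_pi_mul_I] at h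
  linear_combination h / 2

lemma theta3_mul_theta4 {τ : ℂ} (hτ : 0 < τ.im) : theta3 τ * theta4 τ = theta4 (2 * τ) ^ 2 := by
  have := jacobiTheta₂_mul 0 (1 / 2) hτ
  rw [zero_add, jacobiTheta₂_half_add, zero_mul, mul_zero, add_zero, zero_sub,
    jacobiTheta₂_neg_left] at this
  rw [theta3, theta4, this, theta4, sq]

lemma theta2_sq {τ : ℂ} (hτ : 0 < τ.im) : theta2 τ ^ 2 = 2 * theta2 (2 * τ) * theta3 (2 * τ) := by
  have := jacobiTheta₂_mul (τ / 2) (τ / 2) hτ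
  rw [add_halves, sub_self, zero_add] at this
  have h2 := jacobiTheta₂_add_left' 0 (2 * τ)
  rw [zero_add] at h2
  rw [← two_mul τ, h2] at this
  rw [theta2, mul_pow, sq (jacobiTheta₂ _ _), this, theta2, theta3, mul_div_cancel_left₀ _ two_ne_zero,
    ← Complex.exp_nat_mul]
  have e1 : cexp (2 * Real.pi * I * (τ / 2) + Real.pi * I * τ) *
      cexp (-Real.pi * I * (2 * τ + 2 * 0)) = 1 := by
    rw [← Complex.exp_add, Complex.exp_eq_one_iff]; exact ⟨0, by push_cast; ring⟩
  have e2 : ((2 : ℕ) : ℂ) * (Real.pi * I * τ / 4) = Real.pi * I * (2 * τ) / 4 := by push_cast; ring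
  rw [e2]
  linear_combination cexp (Real.pi * I * (2 * τ) / 4) * jacobiTheta₂ 0 (2 * τ) *
    jacobiTheta₂ τ (2 * τ) * e1

lemma theta3_pow_four {τ : ℂ} (hτ : 0 < τ.im) : theta3 τ ^ 4 = theta2 τ ^ 4 + theta4 τ ^ 4 := by
  have h1 := theta3_sq hτ
  have h2 := theta4_sq hτ
  have h3 := theta2_sq hτ
  calc theta3 τ ^ 4 = (theta3 τ ^ 2) ^ 2 := by ring
    _ = (theta2 τ ^ 2) ^ 2 + (theta4 τ ^ 2) ^ 2 := by rw [h1, h2, h3]; ring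
    _ = _ := by ring

lemma theta3_eq {τ : ℂ} (hτ : 0 < τ.im) : theta3 τ = theta3 (4 * τ) + theta2 (4 * τ) := by
  have := jacobiTheta₂_split 0 hτ
  simp only [mul_zero, zero_add] at this
  rw [theta3, this, theta3, theta2]
  congr 2 <;> ring_nf

lemma theta4_eq {τ : ℂ} (hτ : 0 < τ.im) : theta4 τ = theta3 (4 * τ) - theta2 (4 * τ) := by
  have := jacobiTheta₂_split (1 / 2) hτ
  rw [show 2 * (1 / 2 : ℂ) = 0 + 1 by norm_num, jacobiTheta₂_add_left, add_right_comm,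
    jacobiTheta₂_add_left, zero_add, show 2 * Real.pi * I * (1 / 2) + Real.pi * I * τ =
      Real.pi * I + Real.pi * I * τ by ring, Complex.exp_add, Complex.exp_pi_mul_I] at this
  rw [theta4, this, theta3, theta2, sub_eq_add_neg, neg_one_mul, neg_mul]
  congr 3 <;> ring_nf

lemma cpow_half_sq (z : ℂ) : (z ^ (1 / 2 : ℂ)) ^ 2 = z := by
  rw [← Complex.cpow_nat_mul]; simp

lemma neg_I_mul_cpow_ne_zero {τ : ℂ} (hτ : 0 < τ.im) : (-I * τ) ^ (1 / 2 : ℂ) ≠ 0 := by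
  have h0 : τ ≠ 0 := by rintro rfl; simp at hτ
  intro h
  have := cpow_half_sq (-I * τ)
  rw [h] at this
  simp [h0] at this

lemma theta3_neg_inv {τ : ℂ} (hτ : 0 < τ.im) :
    theta3 (-1 / τ) = (-I * τ) ^ (1 / 2 : ℂ) * theta3 τ := by
  have := jacobiTheta₂_functional_equation 0 τ
  simp only [zero_div, mul_zero, ne_eq, OfNat.ofNat_ne_zero, not_false_eq_true, zero_pow,
    Complex.exp_zero, mul_one] at this
  rw [theta3, theta3, this, ← mul_assoc, mul_one_div_cancel (neg_I_mul_cpow_ne_zero hτ), one_mul]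

lemma theta4_neg_inv {τ : ℂ} (hτ : 0 < τ.im) :
    theta4 (-1 / τ) = (-I * τ) ^ (1 / 2 : ℂ) * theta2 τ := by
  have h0 : τ ≠ 0 := by rintro rfl; simp at hτ
  have := jacobiTheta₂_functional_equation (τ / 2) τ
  rw [show τ / 2 / τ = 1 / 2 by field_simp] at this
  rw [theta4, theta2, this]
  have e : cexp (Real.pi * I * τ / 4) * cexp (-Real.pi * I * (τ / 2) ^ 2 / τ) = 1 := by
    rw [← Complex.exp_add, Complex.exp_eq_one_iff]
    exact ⟨0, by field_simp; push_cast; ring⟩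
  have h1 := neg_I_mul_cpow_ne_zero hτ
  generalize (-I * τ) ^ (1 / 2 : ℂ) = c at *
  generalize jacobiTheta₂ (1 / 2) (-1 / τ) = d
  generalize cexp (-Real.pi * I * (τ / 2) ^ 2 / τ) = u at *
  field_simp
  linear_combination (-d) * e

lemma theta2_neg_inv {τ : ℂ} (hτ : 0 < τ.im) :
    theta2 (-1 / τ) = (-I * τ) ^ (1 / 2 : ℂ) * theta4 τ := by
  have h0 : τ ≠ 0 := by rintro rfl; simp at hτ
  have := jacobiTheta₂_functional_equation (1 / 2) τ
  rw [theta4, theta2, this]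
  have h1 := neg_I_mul_cpow_ne_zero hτ
  rw [show (-1 / τ / 2) = -(1 / 2 / τ) by field_simp, jacobiTheta₂_neg_left,
    show Real.pi * I * (-1 / τ) / 4 = -Real.pi * I * (1 / 2) ^ 2 / τ by ring]
  field_simp

lemma neg_inv_im_pos {τ : ℂ} (hτ : 0 < τ.im) : 0 < (-1 / τ).im := by
  have h0 : τ ≠ 0 := by rintro rfl; simp at hτ
  rw [neg_div, one_div, Complex.neg_im, Complex.inv_im]
  have := Complex.normSq_pos.mpr h0
  rw [neg_div, neg_neg]; positivity

end Theta

section Modulus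

open Complex Filter Topology

lemma tendsto_theta3 {f : ℕ → ℂ} (hf : Tendsto (fun n => (f n).im) atTop atTop) :
    Tendsto (fun n => theta3 (f n)) atTop (𝓝 1) := by
  have h1 : Tendsto f atTop (comap im atTop) := tendsto_comap_iff.mpr hf
  have h2 := isBigO_at_im_infty_jacobiTheta_sub_one.trans_tendsto
    (g'' := fun τ : ℂ => Real.exp (-Real.pi * τ.im)) (by
      refine Real.tendsto_exp_atBot.comp ?_
      exact tendsto_comap.const_mul_atTop_of_neg (by simp [Real.pi_pos]))
  have h3 := (h2.comp h1).add_const 1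
  simpa [Function.comp_def, jacobiTheta_eq_jacobiTheta₂, theta3] using h3

lemma theta3_ne_zero {τ : ℂ} (hτ : 0 < τ.im) : theta3 τ ≠ 0 := by
  intro h
  have key : ∀ n : ℕ, theta4 (2 ^ (n + 1) * τ) = 0 := by
    intro n
    induction n with
    | zero =>
      have := theta3_mul_theta4 hτ
      rw [h, zero_mul] at this
      simpa using this.symm
    | succ n ih =>
      have h1 : 0 < ((2 : ℂ) ^ (n + 1) * τ).im := by
        have : ((2 : ℂ) ^ (n + 1)) = ((2 ^ (n + 1) : ℝ) : ℂ) := by push_cast; rfl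
        rw [this, Complex.im_ofReal_mul]; positivity
      have := theta3_mul_theta4 h1
      rw [ih, mul_zero] at this
      rw [pow_succ', mul_assoc]
      simpa using this.symm
  have h2 : Tendsto (fun n : ℕ => theta3 (2 ^ (n + 1) * τ + 1)) atTop (𝓝 1) := by
    apply tendsto_theta3
    have h3 : ∀ n : ℕ, ((2 : ℂ) ^ (n + 1) * τ + 1).im = 2 ^ (n + 1) * τ.im := by
      intro n
      have : ((2 : ℂ) ^ (n + 1)) = ((2 ^ (n + 1) : ℝ) : ℂ) := by push_cast; rfl
      rw [this, Complex.add_im, Complex.im_ofReal_mul]; simp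
    simp_rw [h3]
    refine Tendsto.atTop_mul_const hτ ?_
    exact (tendsto_pow_atTop_atTop_of_one_lt (by norm_num : (1 : ℝ) < 2)).comp
      (tendsto_add_atTop_nat 1)
  simp_rw [theta3_add_one, key] at h2
  exact zero_ne_one (tendsto_nhds_unique tendsto_const_nhds h2)

lemma theta4_ne_zero {τ : ℂ} (hτ : 0 < τ.im) : theta4 τ ≠ 0 := by
  rw [← theta3_add_one]; exact theta3_ne_zero (by simpa using hτ)

lemma theta2_ne_zero {τ : ℂ} (hτ : 0 < τ.im) : theta2 τ ≠ 0 := by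
  intro h
  have := theta4_neg_inv hτ
  rw [h, mul_zero] at this
  exact theta4_ne_zero (neg_inv_im_pos hτ) this

lemma differentiableAt_theta3 {τ : ℂ} (hτ : 0 < τ.im) : DifferentiableAt ℂ theta3 τ :=
  differentiableAt_jacobiTheta₂_snd 0 hτ

lemma differentiableAt_theta2 {τ : ℂ} (hτ : 0 < τ.im) : DifferentiableAt ℂ theta2 τ := by
  have h1 : DifferentiableAt ℂ (fun t : ℂ => jacobiTheta₂ (t / 2) t) τ := by
    have h := (hasFDerivAt_jacobiTheta₂ (τ / 2) hτ).differentiableAt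
    have h2 : DifferentiableAt ℂ (fun t : ℂ => ((t / 2, t) : ℂ × ℂ)) τ := by fun_prop
    exact DifferentiableAt.comp (f := fun t : ℂ => ((t / 2, t) : ℂ × ℂ))
      (g := fun p : ℂ × ℂ => jacobiTheta₂ p.1 p.2) τ h h2
  unfold theta2
  fun_prop

/-- The elliptic modulus `k = θ₂² / θ₃²`. -/
noncomputable def kmod (τ : ℂ) : ℂ := theta2 τ ^ 2 / theta3 τ ^ 2

/-- The complementary modulus `k' = θ₄² / θ₃²`. -/
noncomputable def kcomp (τ : ℂ) : ℂ := theta4 τ ^ 2 / theta3 τ ^ 2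

lemma kmod_ne_zero {τ : ℂ} (hτ : 0 < τ.im) : kmod τ ≠ 0 :=
  div_ne_zero (pow_ne_zero _ (theta2_ne_zero hτ)) (pow_ne_zero _ (theta3_ne_zero hτ))

lemma kcomp_ne_zero {τ : ℂ} (hτ : 0 < τ.im) : kcomp τ ≠ 0 :=
  div_ne_zero (pow_ne_zero _ (theta4_ne_zero hτ)) (pow_ne_zero _ (theta3_ne_zero hτ))

lemma kmod_sq_add_kcomp_sq {τ : ℂ} (hτ : 0 < τ.im) : kmod τ ^ 2 + kcomp τ ^ 2 = 1 := by
  have := theta3_ne_zero hτ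
  rw [kmod, kcomp]; field_simp; rw [theta3_pow_four hτ]

lemma differentiableAt_kmod {τ : ℂ} (hτ : 0 < τ.im) : DifferentiableAt ℂ kmod τ := by
  unfold kmod
  exact ((differentiableAt_theta2 hτ).pow 2).div ((differentiableAt_theta3 hτ).pow 2)
    (pow_ne_zero _ (theta3_ne_zero hτ))

lemma kmod_neg_inv {τ : ℂ} (hτ : 0 < τ.im) : kmod (-1 / τ) = kcomp τ := by
  have h := neg_I_mul_cpow_ne_zero hτ
  have := theta3_ne_zero hτ
  rw [kmod, kcomp, theta2_neg_inv hτ, theta3_neg_inv hτ]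
  generalize (-I * τ) ^ (1 / 2 : ℂ) = c at *
  field_simp

lemma kcomp_neg_inv {τ : ℂ} (hτ : 0 < τ.im) : kcomp (-1 / τ) = kmod τ := by
  have h := neg_I_mul_cpow_ne_zero hτ
  have := theta3_ne_zero hτ
  rw [kmod, kcomp, theta4_neg_inv hτ, theta3_neg_inv hτ]
  generalize (-I * τ) ^ (1 / 2 : ℂ) = c at *
  field_simp

lemma kmod_add_one (τ : ℂ) : kmod (τ + 1) = I * theta2 τ ^ 2 / theta4 τ ^ 2 := by
  rw [kmod, theta2_sq_add_one, theta3_add_one]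

lemma kcomp_add_one (τ : ℂ) : kcomp (τ + 1) = (kcomp τ)⁻¹ := by
  rw [kcomp, kcomp, theta4_add_one, theta3_add_one, inv_div]

lemma kmod_add_two (τ : ℂ) : kmod (τ + 2) = -kmod τ := by
  rw [show τ + 2 = τ + 1 + 1 by ring, kmod_add_one, theta2_sq_add_one, theta4_add_one, kmod,
    ← mul_assoc, I_mul_I]; ring

lemma kcomp_add_two (τ : ℂ) : kcomp (τ + 2) = kcomp τ := by
  rw [show τ + 2 = τ + 1 + 1 by ring, kcomp_add_one, kcomp_add_one, inv_inv]

lemma theta3_add_two (τ : ℂ) : theta3 (τ + 2) = theta3 τ := by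
  rw [show τ + 2 = τ + 1 + 1 by ring, theta3_add_one, theta4_add_one]

lemma theta3_neg_inv_pow_four {τ : ℂ} (hτ : 0 < τ.im) :
    theta3 (-1 / τ) ^ 4 = -τ ^ 2 * theta3 τ ^ 4 := by
  rw [theta3_neg_inv hτ, mul_pow, show 4 = 2 * 2 by norm_num, pow_mul, cpow_half_sq]
  linear_combination τ ^ 2 * (theta3 τ ^ (2 * 2)) * I_sq

/-- The law for the generator `τ ↦ τ / (2τ + 1)`, in the form `σ ↦ -1 / (-1/σ - 2)`. -/
lemma kmod_div_two_mul_add_one {τ : ℂ} (hτ : 0 < τ.im) {e : ℂ} (he : e = 2 ∨ e = -2) :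
    kmod (τ / (e * τ + 1)) = kmod τ ∧
      theta3 (τ / (e * τ + 1)) ^ 4 = (e * τ + 1) ^ 2 * theta3 τ ^ 4 := by
  have h0 : τ ≠ 0 := by rintro rfl; simp at hτ
  have h1 := neg_inv_im_pos hτ
  have him : e.im = 0 := by rcases he with rfl | rfl <;> simp
  have h2 : 0 < (-1 / τ - e).im := by simpa [him] using h1
  have h3 : -1 / τ - e ≠ 0 := by intro h; rw [h] at h2; simp at h2
  have h5 : e * τ + 1 ≠ 0 := by
    intro h; apply h3; field_simp; linear_combination -h
  have h4 : τ / (e * τ + 1) = -1 / (-1 / τ - e) := by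
    have : -1 / τ - e = -(e * τ + 1) / τ := by field_simp; ring
    rw [this]; field_simp
  have kc : kcomp (-1 / τ - e) = kcomp (-1 / τ) := by
    rcases he with rfl | rfl
    · rw [← kcomp_add_two (-1 / τ - 2)]; ring_nf
    · rw [← kcomp_add_two (-1 / τ)]; ring_nf
  have tc : theta3 (-1 / τ - e) = theta3 (-1 / τ) := by
    rcases he with rfl | rfl
    · rw [← theta3_add_two (-1 / τ - 2)]; ring_nf
    · rw [← theta3_add_two (-1 / τ)]; ring_nf
  constructor
  · rw [h4, kmod_neg_inv h2, kc, kcomp_neg_inv hτ]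
  · rw [h4, theta3_neg_inv_pow_four h2, tc, theta3_neg_inv_pow_four hτ]
    field_simp; ring

lemma mobius_im {a b c d : ℤ} {τ : ℂ} :
    ((a * τ + b) / (c * τ + d)).im = (a * d - b * c) * τ.im / normSq (c * τ + d) := by
  rw [Complex.div_im]; simp [normSq_apply]; ring

lemma mobius_den_ne_zero {a b c d : ℤ} (h : 0 < a * d - b * c) {τ : ℂ} (hτ : 0 < τ.im) :
    (c * τ + d : ℂ) ≠ 0 := by
  intro h0
  have h1 := congrArg im h0
  have h2 := congrArg re h0
  simp at h1 h2
  rcases h1 with h1 | h1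
  · subst h1; simp at h2; subst h2; simp at h
  · exact hτ.ne' h1

lemma mobius_im_pos {a b c d : ℤ} (h : 0 < a * d - b * c) {τ : ℂ} (hτ : 0 < τ.im) :
    0 < ((a * τ + b) / (c * τ + d)).im := by
  rw [mobius_im]
  have := normSq_pos.mpr (mobius_den_ne_zero h hτ)
  have : (0 : ℝ) < a * d - b * c := by exact_mod_cast h
  positivity

lemma kmod_add_two_mul (m : ℤ) : ∀ τ : ℂ, kmod (τ + 2 * m) = (m.negOnePow : ℤ) * kmod τ := by
  induction m using Int.induction_on with
  | zero => simp
  | succ n ih =>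
    intro τ
    rw [Int.negOnePow_succ, show τ + 2 * ((n + 1 : ℤ) : ℂ) = (τ + 2 * (n : ℤ)) + 2 by
      push_cast; ring, kmod_add_two, ih]
    simp
  | pred n ih =>
    intro τ
    have := ih (τ - 2)
    have h2 := kmod_add_two (τ - 2)
    rw [sub_add_cancel] at h2
    rw [show τ + 2 * ((-n - 1 : ℤ) : ℂ) = (τ - 2) + 2 * ((-n : ℤ) : ℂ) by
      push_cast; ring, this, h2, Int.negOnePow_sub]
    simp

lemma theta3_add_two_mul (m : ℤ) : ∀ τ : ℂ, theta3 (τ + 2 * m) = theta3 τ := by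
  induction m using Int.induction_on with
  | zero => simp
  | succ n ih =>
    intro τ
    rw [show τ + 2 * ((n + 1 : ℤ) : ℂ) = (τ + 2 * (n : ℤ)) + 2 by
      push_cast; ring, theta3_add_two, ih]
  | pred n ih =>
    intro τ
    have h2 := theta3_add_two (τ - 2)
    rw [sub_add_cancel] at h2
    rw [show τ + 2 * ((-n - 1 : ℤ) : ℂ) = (τ - 2) + 2 * ((-n : ℤ) : ℂ) by
      push_cast; ring, ih, h2]

lemma exists_natAbs_sub_lt {a c : ℤ} (hc : c ≠ 0) (h : c.natAbs < a.natAbs) :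
    ∃ e : ℤ, (e = 1 ∨ e = -1) ∧ (a - 2 * e * c).natAbs < a.natAbs := by
  by_cases hs : (0 < a ∧ 0 < c) ∨ (a < 0 ∧ c < 0)
  · exact ⟨1, Or.inl rfl, by omega⟩
  · exact ⟨-1, Or.inr rfl, by omega⟩

lemma gamma_two_law (n : ℕ) : ∀ a b c d : ℤ, a.natAbs + c.natAbs ≤ n → a * d - b * c = 1 →
    Even b → Even c → Odd a → ∀ τ : ℂ, 0 < τ.im →
    kmod ((a * τ + b) / (c * τ + d)) = ((b / 2).negOnePow : ℤ) * kmod τ ∧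
    theta3 ((a * τ + b) / (c * τ + d)) ^ 4 = (c * τ + d) ^ 2 * theta3 τ ^ 4 := by
  induction n with
  | zero =>
    intro a b c d h _ _ _ ha
    have : a = 0 := by omega
    subst this; simp at ha
  | succ n ih =>
    intro a b c d hn hdet hb hc ha τ hτ
    have hd : Odd d := by
      have : Odd (a * d) := by
        rw [show a * d = 1 + b * c by linarith]
        exact (odd_one).add_even (hc.mul_left b)
      exact (Int.odd_mul.mp this).2
    have hden := mobius_den_ne_zero (a := a) (b := b) (c := c) (d := d) (by omega) hτ
    have him := mobius_im_pos (a := a) (b := b) (c := c) (d := d) (by omega) hτ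
    obtain ⟨b', rfl⟩ := even_iff_two_dvd.mp hb
    rcases Nat.lt_or_ge c.natAbs a.natAbs with hlt | hge
    · rcases eq_or_ne c 0 with rfl | hc0
      · have had : a * d = 1 := by simpa using hdet
        have key : ((a : ℂ) * τ + (2 * b' : ℤ)) / ((0 : ℤ) * τ + d) = τ + 2 * ((a * b' : ℤ) : ℂ) ∧
            (d : ℂ) ^ 2 = 1 ∧ (a * b').negOnePow = b'.negOnePow := by
          rcases Int.eq_one_or_neg_one_of_mul_eq_one had with rfl | rfl
          · obtain rfl : d = 1 := by omega
            simp
          · obtain rfl : d = -1 := by omega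
            refine ⟨?_, by simp, by simp⟩
            push_cast; field_simp; ring
        rw [key.1, kmod_add_two_mul, theta3_add_two_mul, key.2.2]
        simp [key.2.1]
      · obtain ⟨e, he, hlt2⟩ := exists_natAbs_sub_lt hc0 hlt
        obtain ⟨h1, h2⟩ := ih (a - 2 * e * c) (2 * (b' - e * d)) c d (by omega)
          (by linear_combination hdet) (even_two_mul _) hc
          (by rw [mul_assoc]; exact ha.sub_even (even_two_mul _)) τ hτ
        have hσ : (((a - 2 * e * c : ℤ) : ℂ) * τ + (2 * (b' - e * d) : ℤ)) / (c * τ + d) =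
            (a * τ + (2 * b' : ℤ)) / (c * τ + d) + 2 * ((-e : ℤ) : ℂ) := by
          rw [div_add' _ _ _ hden]; congr 1; push_cast; ring
        rw [hσ, kmod_add_two_mul] at h1
        rw [hσ, theta3_add_two_mul] at h2
        refine ⟨?_, h2⟩
        rw [Int.mul_ediv_cancel_left _ two_ne_zero, Int.negOnePow_sub] at h1
        rw [Int.mul_ediv_cancel_left _ two_ne_zero]
        have h3 : (-e).negOnePow = -1 := by
          rcases he with rfl | rfl <;> simp
        have h4 : (e * d).negOnePow = -1 := by
          rcases he with rfl | rfl <;> simp [Int.negOnePow_odd _ hd]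
        rw [h3, h4] at h1
        simpa using h1
    · have hne : a.natAbs < c.natAbs := by
        obtain ⟨u, rfl⟩ := ha
        obtain ⟨v, rfl⟩ := hc
        omega
      have ha0 : a ≠ 0 := by rintro rfl; simp at ha
      obtain ⟨e, he, hlt2⟩ := exists_natAbs_sub_lt ha0 hne
      obtain ⟨h1, h2⟩ := ih a (2 * b') (c - 2 * e * a) (d - 2 * e * (2 * b')) (by omega)
        (by linear_combination hdet) hb (by rw [mul_assoc]; exact hc.sub (even_two_mul _)) ha τ hτ
      have hden' := mobius_den_ne_zero (a := a) (b := 2 * b') (c := c - 2 * e * a)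
        (d := d - 2 * e * (2 * b')) (lt_of_lt_of_eq one_pos (by linear_combination -hdet)) hτ
      have hσ2 : (-2 * e : ℂ) * ((a * τ + (2 * b' : ℤ)) / (c * τ + d)) + 1 =
          (((c - 2 * e * a : ℤ) : ℂ) * τ + ((d - 2 * e * (2 * b') : ℤ) : ℂ)) / (c * τ + d) := by
        rw [← mul_div_assoc, div_add' _ _ _ hden]; congr 1; push_cast; ring
      have hσ : (a * τ + (2 * b' : ℤ)) / (((c - 2 * e * a : ℤ) : ℂ) * τ +
          ((d - 2 * e * (2 * b') : ℤ) : ℂ)) = (a * τ + (2 * b' : ℤ)) / (c * τ + d) /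
            ((-2 * e : ℂ) * ((a * τ + (2 * b' : ℤ)) / (c * τ + d)) + 1) := by
        rw [hσ2, div_div_div_cancel_right₀ hden]
      obtain ⟨h3, h4⟩ := kmod_div_two_mul_add_one him (e := -2 * e)
        (by rcases he with rfl | rfl <;> simp)
      rw [hσ, h3] at h1
      rw [hσ, h4, hσ2] at h2
      refine ⟨h1, ?_⟩
      generalize theta3 ((a * τ + (2 * b' : ℤ)) / (c * τ + d)) ^ 4 = X at *
      generalize (((c - 2 * e * a : ℤ) : ℂ) * τ + ((d - 2 * e * (2 * b') : ℤ) : ℂ)) = Y at *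
      have : Y ^ 2 * X = Y ^ 2 * ((c * τ + d) ^ 2 * theta3 τ ^ 4) := by
        field_simp at h2 ⊢
        linear_combination h2
      exact mul_left_cancel₀ (pow_ne_zero 2 hden') this

end Modulus

section HasExp

open PowerSeries Filter Topology

/-- The power series `A` converges to `F` on the open unit disc. -/
def HasExp (A : PowerSeries ℂ) (F : ℂ → ℂ) : Prop :=
  ∀ s : ℂ, ‖s‖ < 1 → HasSum (fun n => A.coeff n * s ^ n) (F s)

namespace HasExp

variable {A B : PowerSeries ℂ} {F G : ℂ → ℂ}

lemma hasFPowerSeriesOnBall (h : HasExp A F) :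
    HasFPowerSeriesOnBall F (FormalMultilinearSeries.ofScalars ℂ (fun n => A.coeff n)) 0 1 := by
  refine ⟨?_, one_pos, ?_⟩
  · refine ENNReal.le_of_forall_nnreal_lt fun r hr => ?_
    apply FormalMultilinearSeries.le_radius_of_summable
    have h1 := (h (r : ℂ) (by simpa using hr)).summable.norm
    simpa [FormalMultilinearSeries.ofScalars_norm] using h1
  · intro y hy
    have h1 := h y (by
      rw [Metric.mem_eball, edist_zero_right, ← ofReal_norm, ENNReal.ofReal_lt_one] at hy; exact hy)
    simpa [FormalMultilinearSeries.ofScalars_apply_eq, mul_comm] using h1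

lemma differentiableOn (h : HasExp A F) : DifferentiableOn ℂ F (Metric.ball 0 1) := by
  have := h.hasFPowerSeriesOnBall.differentiableOn
  rwa [← ENNReal.ofReal_one, Metric.eball_ofReal] at this

lemma continuousAt_zero (h : HasExp A F) : ContinuousAt F 0 :=
  (h.differentiableOn.differentiableAt (Metric.ball_mem_nhds 0 one_pos)).continuousAt

lemma apply_zero (h : HasExp A F) : F 0 = constantCoeff A := by
  have h1 := h 0 (by simp)
  have h2 : HasSum (fun n => A.coeff n * (0 : ℂ) ^ n) (A.coeff 0 * 0 ^ 0) :=
    hasSum_single 0 (fun n hn => by simp [hn])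
  simpa using h1.unique h2

lemma unique (hA : HasExp A F) (hB : HasExp B G) (h : ∀ s : ℂ, s ≠ 0 → ‖s‖ < 1 → F s = G s) :
    A = B := by
  have e0 : F =ᶠ[𝓝[≠] 0] G := by
    rw [Filter.EventuallyEq, eventually_nhdsWithin_iff]
    filter_upwards [Metric.ball_mem_nhds (0 : ℂ) one_pos] with s hs hs0
    exact h s hs0 (by simpa using hs)
  have h1 := hA.hasFPowerSeriesOnBall.hasFPowerSeriesAt
  have h2 := hB.hasFPowerSeriesOnBall.hasFPowerSeriesAt
  have e1 := (h1.analyticAt.frequently_eq_iff_eventually_eq h2.analyticAt).mp e0.frequently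
  have e2 := (h1.congr e1).eq_formalMultilinearSeries h2
  have e3 := (FormalMultilinearSeries.ofScalars_series_injective ℂ ℂ) e2
  ext n
  exact congrFun e3 n

lemma congr (hA : HasExp A F) (h : ∀ s : ℂ, ‖s‖ < 1 → G s = F s) : HasExp A G := by
  intro s hs; rw [h s hs]; exact hA s hs

lemma add (hA : HasExp A F) (hB : HasExp B G) : HasExp (A + B) (fun s => F s + G s) := by
  intro s hs
  simpa [add_mul] using (hA s hs).add (hB s hs)

lemma sub (hA : HasExp A F) (hB : HasExp B G) : HasExp (A - B) (fun s => F s - G s) := by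
  intro s hs
  simpa [sub_mul] using (hA s hs).sub (hB s hs)

lemma C (c : ℂ) : HasExp (PowerSeries.C c) (fun _ => c) := by
  intro s _
  have h2 : HasSum (fun n => (PowerSeries.C c).coeff n * s ^ n)
      ((PowerSeries.C c).coeff 0 * s ^ 0) :=
    hasSum_single 0 (fun n hn => by simp [PowerSeries.coeff_C, hn])
  simpa using h2

lemma X : HasExp (PowerSeries.X) (fun s => s) := by
  intro s _
  have h2 : HasSum (fun n => (PowerSeries.X : PowerSeries ℂ).coeff n * s ^ n)
      ((PowerSeries.X : PowerSeries ℂ).coeff 1 * s ^ 1) :=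
    hasSum_single 1 (fun n hn => by simp [PowerSeries.coeff_X, hn])
  simpa using h2

lemma mul (hA : HasExp A F) (hB : HasExp B G) : HasExp (A * B) (fun s => F s * G s) := by
  intro s hs
  have h1 := (hA s hs).summable.norm
  have h2 := (hB s hs).summable.norm
  have e : (fun n => (A * B).coeff n * s ^ n) = fun n => ∑ kl ∈ antidiagonal n,
      (A.coeff kl.1 * s ^ kl.1) * (B.coeff kl.2 * s ^ kl.2) := by
    funext n
    rw [PowerSeries.coeff_mul, Finset.sum_mul]
    refine Finset.sum_congr rfl fun kl hkl => ?_
    rw [← mem_antidiagonal.mp hkl, pow_add]; ring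
  simp only
  rw [e, ← (hA s hs).tsum_eq, ← (hB s hs).tsum_eq,
    tsum_mul_tsum_eq_tsum_sum_antidiagonal_of_summable_norm h1 h2]
  exact (summable_norm_sum_mul_antidiagonal_of_summable_norm h1 h2).of_norm.hasSum

lemma one : HasExp 1 (fun _ => 1) := by simpa using HasExp.C 1

lemma pow (hA : HasExp A F) (n : ℕ) : HasExp (A ^ n) (fun s => F s ^ n) := by
  induction n with
  | zero => simpa using one
  | succ n ih => simpa [pow_succ] using ih.mul hA

lemma prod {ι : Type*} (t : Finset ι) {A : ι → PowerSeries ℂ} {F : ι → ℂ → ℂ}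
    (h : ∀ i ∈ t, HasExp (A i) (F i)) : HasExp (∏ i ∈ t, A i) (fun s => ∏ i ∈ t, F i s) := by
  classical
  induction t using Finset.induction_on with
  | empty => simpa using one
  | insert a t ha ih =>
    simp_rw [Finset.prod_insert ha]
    exact (h a (mem_insert_self _ _)).mul (ih fun i hi => h i (mem_insert_of_mem hi))

lemma sum {ι : Type*} (t : Finset ι) {A : ι → PowerSeries ℂ} {F : ι → ℂ → ℂ}
    (h : ∀ i ∈ t, HasExp (A i) (F i)) : HasExp (∑ i ∈ t, A i) (fun s => ∑ i ∈ t, F i s) := by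
  intro s hs
  simpa [Finset.sum_mul] using hasSum_sum fun i hi => h i hi s hs

lemma aeval (hA : HasExp A F) (R : Polynomial ℂ) :
    HasExp (Polynomial.aeval A R) (fun s => R.eval (F s)) := by
  have := HasExp.sum (range (R.natDegree + 1)) (A := fun i => PowerSeries.C (R.coeff i) * A ^ i)
    (F := fun i s => R.coeff i * F s ^ i) fun i _ => (HasExp.C _).mul (hA.pow i)
  rw [Polynomial.aeval_eq_sum_range]
  simp_rw [Polynomial.eval_eq_sum_range, PowerSeries.smul_eq_C_mul]
  exact this

lemma expand (hA : HasExp A F) (m : ℕ) (hm : m ≠ 0) :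
    HasExp (A.expand m hm) (fun s => F (s ^ m)) := by
  intro s hs
  have h1 := hA (s ^ m) (by rw [norm_pow]; exact pow_lt_one₀ (norm_nonneg _) hs hm)
  have hi : Function.Injective (fun n : ℕ => m * n) := fun a b h => by simpa [hm] using h
  rw [← hi.hasSum_iff]
  · simpa [Function.comp_def, PowerSeries.coeff_expand_mul, pow_mul] using h1
  · intro n hn
    rw [PowerSeries.coeff_expand_of_not_dvd, zero_mul]
    rintro ⟨c, rfl⟩
    exact hn ⟨c, rfl⟩

lemma rescale (hA : HasExp A F) (z : ℂ) (hz : ‖z‖ = 1) :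
    HasExp (PowerSeries.rescale z A) (fun s => F (z * s)) := by
  intro s hs
  have := hA (z * s) (by simpa [hz] using hs)
  simpa [PowerSeries.coeff_rescale, mul_pow, mul_assoc, mul_left_comm] using this

lemma exists_of_differentiableOn (h : DifferentiableOn ℂ F (Metric.ball 0 1)) :
    ∃ A, HasExp A F := by
  refine ⟨PowerSeries.mk fun n => (n.factorial : ℂ)⁻¹ * iteratedDeriv n F 0, fun s hs => ?_⟩
  have := Complex.hasSum_taylorSeries_on_ball (r := 1) (c := 0) (f := F) (z := s)
    (by simpa using h) (by simpa [Metric.mem_eball] using hs)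
  simpa [mul_assoc, mul_comm, mul_left_comm] using this

lemma inv (hA : HasExp A F) (h : ∀ s : ℂ, ‖s‖ < 1 → F s ≠ 0) (hAB : A * B = 1) :
    HasExp B (fun s => (F s)⁻¹) := by
  obtain ⟨D, hD⟩ := exists_of_differentiableOn (F := fun s => (F s)⁻¹)
    (hA.differentiableOn.inv fun s hs => h s (by simpa using hs))
  have h1 : A * D = 1 := (hA.mul hD).unique one fun s _ hs => mul_inv_cancel₀ (h s hs)
  have : D = B := by
    calc D = (A * B) * D := by rw [hAB, one_mul]
      _ = B * (A * D) := by ring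
      _ = B := by rw [h1, mul_one]
  exact this ▸ hD

end HasExp

end HasExp

section QSeries

open Complex Filter Topology

/-- The power series `∑ X ^ e m`. -/
noncomputable def gapSeries (e : ℕ → ℕ) : PowerSeries ℤ :=
  open scoped Classical in PowerSeries.mk fun n => if n ∈ Set.range e then 1 else 0

/-- The coefficientwise embedding of integral power series. -/
noncomputable abbrev toComplexSeries : PowerSeries ℤ →+* PowerSeries ℂ :=
  PowerSeries.map (Int.castRingHom ℂ)

lemma hasExp_gapSeries {e : ℕ → ℕ} (he : Function.Injective e) :
    HasExp (toComplexSeries (gapSeries e)) (fun s => ∑' m, s ^ e m) := by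
  intro s hs
  have h1 : HasSum (fun m => s ^ e m) (∑' m, s ^ e m) :=
    ((summable_geometric_of_norm_lt_one hs).comp_injective he).hasSum
  rw [← he.hasSum_iff]
  · simpa [Function.comp_def, gapSeries] using h1
  · intro n hn
    simp [gapSeries, hn]

/-- `θ₃` as a power series in `q = e^{πiτ}`. -/
noncomputable def theta3Series : PowerSeries ℤ := 1 + 2 * gapSeries fun m => (m + 1) ^ 2

/-- `θ₂ / (2q^{1/4})` as a power series in `q = e^{πiτ}`. -/
noncomputable def psiSeries : PowerSeries ℤ := gapSeries fun m => m * (m + 1)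

lemma constantCoeff_toComplexSeries (A : PowerSeries ℤ) :
    PowerSeries.constantCoeff (toComplexSeries A) = (PowerSeries.constantCoeff A : ℤ) := by
  rw [← PowerSeries.coeff_zero_eq_constantCoeff_apply, PowerSeries.coeff_map,
    PowerSeries.coeff_zero_eq_constantCoeff_apply]; rfl

lemma constantCoeff_psiSeries : PowerSeries.constantCoeff psiSeries = 1 := by
  rw [← PowerSeries.coeff_zero_eq_constantCoeff_apply, psiSeries, gapSeries, PowerSeries.coeff_mk,
    if_pos ⟨0, rfl⟩]

lemma constantCoeff_theta3Series : PowerSeries.constantCoeff theta3Series = 1 := by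
  rw [theta3Series, map_add, map_one, map_mul, ← PowerSeries.coeff_zero_eq_constantCoeff_apply,
    ← PowerSeries.coeff_zero_eq_constantCoeff_apply (gapSeries _), gapSeries, PowerSeries.coeff_mk,
    if_neg (by simp), mul_zero, add_zero]

/-- The sum of `theta3Series`. -/
noncomputable def theta3Fun (s : ℂ) : ℂ := 1 + 2 * ∑' m : ℕ, s ^ (m + 1) ^ 2

/-- The sum of `psiSeries`. -/
noncomputable def psiFun (s : ℂ) : ℂ := ∑' m : ℕ, s ^ (m * (m + 1))

lemma hasExp_psi : HasExp (toComplexSeries psiSeries) psiFun :=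
  hasExp_gapSeries (StrictMono.injective fun a b h => by
    show _ < _
    nlinarith)

lemma hasExp_theta3 : HasExp (toComplexSeries theta3Series) theta3Fun := by
  have h1 := hasExp_gapSeries (e := fun m => (m + 1) ^ 2) (StrictMono.injective fun a b h => by
    show _ < _
    nlinarith)
  have h2 := HasExp.one.add ((HasExp.C 2).mul h1)
  have : toComplexSeries theta3Series = 1 + PowerSeries.C 2 *
      toComplexSeries (gapSeries fun m => (m + 1) ^ 2) := by
    rw [theta3Series, map_add, map_mul, map_one, map_ofNat, map_ofNat]
  rw [this]; exact h2

lemma norm_exp_pi_lt_one {τ : ℂ} (hτ : 0 < τ.im) {c : ℝ} (hc : 0 < c) :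
    ‖cexp (Real.pi * I * τ * c)‖ < 1 := by
  rw [Complex.norm_exp]
  simp
  have := Real.pi_pos
  positivity

lemma theta3_eq_fun {τ : ℂ} (hτ : 0 < τ.im) : theta3 τ = theta3Fun (cexp (Real.pi * I * τ)) := by
  have h := (hasSum_nat_jacobiTheta hτ).tsum_eq
  have e : ∀ n : ℕ, cexp (Real.pi * I * (n + 1) ^ 2 * τ) = cexp (Real.pi * I * τ) ^ (n + 1) ^ 2 := by
    intro n; rw [← Complex.exp_nat_mul]; congr 1; push_cast; ring
  simp_rw [e] at h
  rw [theta3Fun, h, theta3, ← jacobiTheta_eq_jacobiTheta₂]; ring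

lemma theta2_eq_fun {τ : ℂ} (hτ : 0 < τ.im) :
    theta2 τ = 2 * cexp (Real.pi * I * τ / 4) * psiFun (cexp (Real.pi * I * τ)) := by
  have h := HasSum.nat_add_neg_add_one (f := fun n => jacobiTheta₂_term n (τ / 2) τ)
    (hasSum_jacobiTheta₂_term (τ / 2) hτ)
  have e : ∀ n : ℕ, jacobiTheta₂_term n (τ / 2) τ + jacobiTheta₂_term (-(n + 1 : ℤ)) (τ / 2) τ =
      2 * cexp (Real.pi * I * τ) ^ (n * (n + 1)) := by
    intro n
    rw [jacobiTheta₂_term, jacobiTheta₂_term, ← Complex.exp_nat_mul, two_mul (cexp _)]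
    refine congrArg₂ (· + ·) (congrArg cexp ?_) (congrArg cexp ?_)
    · push_cast; ring
    · push_cast; ring
  simp_rw [e] at h
  rw [theta2, psiFun, ← h.tsum_eq, tsum_mul_left]; ring

lemma exists_exp_eq {s : ℂ} (h0 : s ≠ 0) (h1 : ‖s‖ < 1) {c : ℝ} (hc : 0 < c) :
    ∃ τ : ℂ, 0 < τ.im ∧ cexp (Real.pi * I * τ * c) = s := by
  have hp : (Real.pi : ℂ) ≠ 0 := by exact_mod_cast Real.pi_ne_zero
  have hc' : (c : ℂ) ≠ 0 := by exact_mod_cast hc.ne'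
  refine ⟨((1 / (Real.pi * c) : ℝ) : ℂ) * (-I * Complex.log s), ?_, ?_⟩
  · rw [Complex.im_ofReal_mul]
    have : Real.log ‖s‖ < 0 := Real.log_neg (norm_pos_iff.mpr h0) h1
    have h2 : (-I * Complex.log s).im = -Real.log ‖s‖ := by simp [Complex.log_re]
    rw [h2]
    have := Real.pi_pos
    exact mul_pos (by positivity) (by linarith)
  · have : Real.pi * I * (((1 / (Real.pi * c) : ℝ) : ℂ) * (-I * Complex.log s)) * c =
        Complex.log s := by
      push_cast; field_simp; linear_combination (-Complex.log s) * I_sq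
    rw [this, Complex.exp_log h0]

lemma theta3Fun_ne_zero {s : ℂ} (h1 : ‖s‖ < 1) : theta3Fun s ≠ 0 := by
  rcases eq_or_ne s 0 with rfl | h0
  · simp [theta3Fun]
  · obtain ⟨τ, hτ, rfl⟩ := exists_exp_eq h0 h1 one_pos
    rw [ofReal_one, mul_one, ← theta3_eq_fun hτ]
    exact theta3_ne_zero hτ

/-- The inverse of `theta3Series`. -/
noncomputable def theta3SeriesInv : PowerSeries ℤ := theta3Series.invOfUnit 1

lemma theta3Series_mul_inv : theta3Series * theta3SeriesInv = 1 :=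
  PowerSeries.mul_invOfUnit _ _ (by simp [constantCoeff_theta3Series])

lemma constantCoeff_theta3SeriesInv : PowerSeries.constantCoeff theta3SeriesInv = 1 := by
  simpa [constantCoeff_theta3Series] using congrArg PowerSeries.constantCoeff theta3Series_mul_inv

lemma hasExp_theta3_inv :
    HasExp (toComplexSeries theta3SeriesInv) (fun s => (theta3Fun s)⁻¹) :=
  hasExp_theta3.inv (fun _ hs => theta3Fun_ne_zero hs) (by
    rw [← map_mul, theta3Series_mul_inv, map_one])

/-- `(4s)⁻¹ k`, where `s = e^{πiτ/2}`, as a power series in `s`. -/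
noncomputable def kUnitSeries : PowerSeries ℤ :=
  (psiSeries.expand 2 two_ne_zero) ^ 2 * (theta3SeriesInv.expand 2 two_ne_zero) ^ 2

lemma constantCoeff_kUnitSeries : PowerSeries.constantCoeff kUnitSeries = 1 := by
  rw [kUnitSeries, map_mul, map_pow, map_pow, PowerSeries.constantCoeff_expand,
    PowerSeries.constantCoeff_expand, constantCoeff_theta3SeriesInv, constantCoeff_psiSeries]
  norm_num

/-- The elliptic modulus as a power series in `s = e^{πiτ/2}`. -/
noncomputable def kSeries : PowerSeries ℤ := 4 * PowerSeries.X * kUnitSeries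

/-- The sum of `kUnitSeries`. -/
noncomputable def kUnitFun (s : ℂ) : ℂ := psiFun (s ^ 2) ^ 2 * (theta3Fun (s ^ 2))⁻¹ ^ 2

/-- The sum of `kSeries`. -/
noncomputable def kFun (s : ℂ) : ℂ := 4 * s * kUnitFun s

lemma hasExp_kUnit : HasExp (toComplexSeries kUnitSeries) kUnitFun := by
  have h := ((hasExp_psi.expand 2 two_ne_zero).pow 2).mul
    ((hasExp_theta3_inv.expand 2 two_ne_zero).pow 2)
  rw [kUnitSeries, map_mul, map_pow, map_pow, toComplexSeries, PowerSeries.map_expand,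
    PowerSeries.map_expand]
  exact h

lemma hasExp_k : HasExp (toComplexSeries kSeries) kFun := by
  have h := ((HasExp.C 4).mul HasExp.X).mul hasExp_kUnit
  have e : toComplexSeries kSeries = PowerSeries.C 4 * PowerSeries.X * toComplexSeries kUnitSeries := by
    rw [kSeries, map_mul, map_mul, map_ofNat, map_ofNat, PowerSeries.map_X]
  rw [e]; exact h

lemma kmod_eq_fun {τ : ℂ} (hτ : 0 < τ.im) : kmod τ = kFun (cexp (Real.pi * I * τ / 2)) := by
  rw [kmod, theta2_eq_fun hτ, theta3_eq_fun hτ, kFun, kUnitFun]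
  have h1 : cexp (Real.pi * I * τ / 2) ^ 2 = cexp (Real.pi * I * τ) := by
    rw [← Complex.exp_nat_mul]; congr 1; push_cast; ring
  have h2 : cexp (Real.pi * I * τ / 4) ^ 2 = cexp (Real.pi * I * τ / 2) := by
    rw [← Complex.exp_nat_mul]; congr 1; push_cast; ring
  rw [h1, div_eq_mul_inv, inv_pow, mul_pow, mul_pow, h2]; ring

/-- The filter of points whose imaginary part tends to infinity. -/
def imInfty : Filter ℂ := comap im atTop

lemma eventually_im_pos : ∀ᶠ τ in imInfty, 0 < τ.im :=
  tendsto_comap.eventually (eventually_gt_atTop 0)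

lemma tendsto_exp_imInfty {c : ℝ} (hc : 0 < c) :
    Tendsto (fun τ : ℂ => cexp (Real.pi * I * τ * c)) imInfty (𝓝 0) := by
  rw [tendsto_zero_iff_norm_tendsto_zero]
  simp_rw [Complex.norm_exp]
  refine Real.tendsto_exp_atBot.comp ?_
  have : (fun τ : ℂ => (Real.pi * I * τ * c).re) = fun τ : ℂ => -(Real.pi * c) * τ.im := by
    funext τ; simp; ring
  rw [this]
  exact tendsto_comap.const_mul_atTop_of_neg (by have := Real.pi_pos; nlinarith)

lemma tendsto_theta3_imInfty : Tendsto theta3 imInfty (𝓝 1) := by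
  have h1 := hasExp_theta3.continuousAt_zero.tendsto.comp (tendsto_exp_imInfty one_pos)
  have h0 : theta3Fun 0 = 1 := by simp [theta3Fun]
  rw [h0] at h1
  refine h1.congr' ?_
  filter_upwards [eventually_im_pos] with τ hτ
  simp [theta3_eq_fun hτ]

lemma tendsto_add_one_imInfty : Tendsto (fun τ : ℂ => τ + 1) imInfty imInfty := by
  rw [imInfty, tendsto_comap_iff]
  simpa [Function.comp_def] using tendsto_comap

lemma tendsto_theta4_imInfty : Tendsto theta4 imInfty (𝓝 1) := by
  have := tendsto_theta3_imInfty.comp tendsto_add_one_imInfty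
  simpa [Function.comp_def, theta3_add_one] using this

lemma tendsto_kcomp_imInfty : Tendsto kcomp imInfty (𝓝 1) := by
  have := (tendsto_theta4_imInfty.pow 2).div (tendsto_theta3_imInfty.pow 2) (by simp)
  simpa [kcomp] using! this

lemma tendsto_kmod_div_exp : Tendsto (fun τ => kmod τ / cexp (Real.pi * I * τ / 2))
    imInfty (𝓝 4) := by
  have h1 := hasExp_kUnit.continuousAt_zero.tendsto.comp
    (tendsto_exp_imInfty (c := 1 / 2) (by norm_num))
  have h0 : kUnitFun 0 = 1 := by
    rw [hasExp_kUnit.apply_zero, constantCoeff_toComplexSeries, constantCoeff_kUnitSeries,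
      Int.cast_one]
  rw [h0] at h1
  have h2 := h1.const_mul 4
  rw [mul_one] at h2
  refine h2.congr' ?_
  filter_upwards [eventually_im_pos] with τ hτ
  have e : Real.pi * I * τ * ((1 / 2 : ℝ) : ℂ) = Real.pi * I * τ / 2 := by push_cast; ring
  rw [kmod_eq_fun hτ, kFun, Function.comp_apply, e]
  have := Complex.exp_ne_zero (Real.pi * I * τ / 2)
  field_simp

end QSeries

section Cosets

open Complex Matrix

/-- The Möbius action of an integral matrix. -/
noncomputable def mob (M : Matrix (Fin 2) (Fin 2) ℤ) (τ : ℂ) : ℂ :=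
  (M 0 0 * τ + M 0 1) / (M 1 0 * τ + M 1 1)

/-- The automorphy factor of an integral matrix. -/
noncomputable def den (M : Matrix (Fin 2) (Fin 2) ℤ) (τ : ℂ) : ℂ := M 1 0 * τ + M 1 1

lemma den_ne_zero {M : Matrix (Fin 2) (Fin 2) ℤ} (hM : 0 < M.det) {τ : ℂ} (hτ : 0 < τ.im) :
    den M τ ≠ 0 := by
  rw [det_fin_two] at hM; exact mobius_den_ne_zero hM hτ

lemma mob_im_pos {M : Matrix (Fin 2) (Fin 2) ℤ} (hM : 0 < M.det) {τ : ℂ} (hτ : 0 < τ.im) :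
    0 < (mob M τ).im := by
  rw [det_fin_two] at hM; exact mobius_im_pos hM hτ

lemma den_mul (M : Matrix (Fin 2) (Fin 2) ℤ) {N : Matrix (Fin 2) (Fin 2) ℤ} (hN : 0 < N.det)
    {τ : ℂ} (hτ : 0 < τ.im) : den (M * N) τ = den M (mob N τ) * den N τ := by
  have h := den_ne_zero hN hτ
  rw [den] at h
  simp only [den, mob, Matrix.mul_apply, Fin.sum_univ_two]
  rw [add_mul, mul_assoc, div_mul_cancel₀ _ h]
  push_cast; ring

lemma mob_mul (M : Matrix (Fin 2) (Fin 2) ℤ) {N : Matrix (Fin 2) (Fin 2) ℤ} (hN : 0 < N.det)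
    {τ : ℂ} (hτ : 0 < τ.im) : mob (M * N) τ = mob M (mob N τ) := by
  have h := den_ne_zero hN hτ
  have key : (M * N) 0 0 * τ + (M * N) 0 1 = (M 0 0 * mob N τ + M 0 1) * den N τ := by
    rw [den] at h ⊢
    rw [add_mul, mob, mul_assoc, div_mul_cancel₀ _ h]
    simp only [Matrix.mul_apply, Fin.sum_univ_two]
    push_cast; ring
  have e : mob (M * N) τ = ((M * N) 0 0 * τ + (M * N) 0 1) / den (M * N) τ := rfl
  rw [e, key, den_mul M hN hτ, mul_div_mul_right _ _ h]
  rfl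

/-- Integral matrices congruent to the identity modulo `2`. -/
def IsOneModTwo (M : Matrix (Fin 2) (Fin 2) ℤ) : Prop :=
  ∃ N : Matrix (Fin 2) (Fin 2) ℤ, M = 1 + (2 : ℤ) • N

lemma isOneModTwo_iff {M : Matrix (Fin 2) (Fin 2) ℤ} :
    IsOneModTwo M ↔ Odd (M 0 0) ∧ Even (M 0 1) ∧ Even (M 1 0) ∧ Odd (M 1 1) := by
  constructor
  · rintro ⟨N, rfl⟩
    refine ⟨⟨N 0 0, ?_⟩, ⟨N 0 1, ?_⟩, ⟨N 1 0, ?_⟩, ⟨N 1 1, ?_⟩⟩ <;>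
      simp [Matrix.add_apply, Matrix.smul_apply, -zsmul_eq_mul] <;> ring
  · rintro ⟨⟨a, ha⟩, ⟨b, hb⟩, ⟨c, hc⟩, ⟨d, hd⟩⟩
    refine ⟨!![a, b; c, d], ?_⟩
    ext i j; fin_cases i <;> fin_cases j <;> simp [ha, hb, hc, hd] <;> ring

lemma IsOneModTwo.mul {M N : Matrix (Fin 2) (Fin 2) ℤ} (hM : IsOneModTwo M) (hN : IsOneModTwo N) :
    IsOneModTwo (M * N) := by
  obtain ⟨A, rfl⟩ := hM
  obtain ⟨B, rfl⟩ := hN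
  refine ⟨A + B + (2 : ℤ) • (A * B), ?_⟩
  simp only [mul_add, add_mul, smul_mul_assoc, mul_smul_comm, one_mul, mul_one, smul_add]
  abel

lemma IsOneModTwo.adjugate {M : Matrix (Fin 2) (Fin 2) ℤ} (hM : IsOneModTwo M) :
    IsOneModTwo M.adjugate := by
  rw [isOneModTwo_iff] at *
  rw [adjugate_fin_two]
  simpa using ⟨hM.2.2.2, hM.2.1, hM.2.2.1, hM.1⟩

lemma IsOneModTwo.conj {M σ ρ : Matrix (Fin 2) (Fin 2) ℤ} (hM : IsOneModTwo M) (h : ρ * σ = 1) :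
    IsOneModTwo (ρ * M * σ) := by
  obtain ⟨A, rfl⟩ := hM
  refine ⟨ρ * A * σ, ?_⟩
  simp only [mul_add, add_mul, smul_mul_assoc, mul_smul_comm, mul_one, h]

/-- The character `(-1)^{b/2}`. -/
def upperSign (M : Matrix (Fin 2) (Fin 2) ℤ) : ℤˣ := (M 0 1 / 2).negOnePow

lemma upperSign_mul {M N : Matrix (Fin 2) (Fin 2) ℤ} (hM : IsOneModTwo M) (hN : IsOneModTwo N) :
    upperSign (M * N) = upperSign M * upperSign N := by
  obtain ⟨A, rfl⟩ := hM
  obtain ⟨B, rfl⟩ := hN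
  simp only [upperSign, Matrix.mul_apply, Fin.sum_univ_two, Matrix.add_apply, Matrix.smul_apply,
    smul_eq_mul, Matrix.one_apply, zero_ne_one, if_false, zero_add, if_true]
  have e : (1 + 2 * A 0 0) * (2 * B 0 1) + 2 * A 0 1 * (1 + 2 * B 1 1) =
      2 * (A 0 1 + B 0 1 + 2 * (A 0 0 * B 0 1 + A 0 1 * B 1 1)) := by ring
  rw [e, Int.mul_ediv_cancel_left _ two_ne_zero, Int.mul_ediv_cancel_left _ two_ne_zero,
    Int.mul_ediv_cancel_left _ two_ne_zero, Int.negOnePow_add, Int.negOnePow_add,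
    Int.negOnePow_two_mul, mul_one]

lemma kmod_mob {γ : Matrix (Fin 2) (Fin 2) ℤ} (h2 : IsOneModTwo γ) (h1 : γ.det = 1) {τ : ℂ}
    (hτ : 0 < τ.im) : kmod (mob γ τ) = (upperSign γ : ℤ) * kmod τ := by
  rw [isOneModTwo_iff] at h2
  rw [det_fin_two] at h1
  exact (gamma_two_law _ _ _ _ _ le_rfl h1 h2.2.1 h2.2.2.1 h2.1 τ hτ).1

lemma theta3_mob {γ : Matrix (Fin 2) (Fin 2) ℤ} (h2 : IsOneModTwo γ) (h1 : γ.det = 1) {τ : ℂ}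
    (hτ : 0 < τ.im) : theta3 (mob γ τ) ^ 4 = den γ τ ^ 2 * theta3 τ ^ 4 := by
  rw [isOneModTwo_iff] at h2
  rw [det_fin_two] at h1
  exact (gamma_two_law _ _ _ _ _ le_rfl h1 h2.2.1 h2.2.2.1 h2.1 τ hτ).2

/-- Representatives for `Γ(2) \ {M ≡ 1 mod 2, det M = p}`. -/
def heckeRep (p : ℕ) : Option (ZMod p) → Matrix (Fin 2) (Fin 2) ℤ
  | none => !![(p : ℤ), 0; 0, 1]
  | some j => !![1, 4 * (j.val : ℤ); 0, p]

variable {p : ℕ} [hp : Fact p.Prime]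

lemma det_heckeRep (j : Option (ZMod p)) : (heckeRep p j).det = p := by
  cases j <;> simp [heckeRep, det_fin_two]

lemma isOneModTwo_heckeRep (hp2 : p ≠ 2) (j : Option (ZMod p)) : IsOneModTwo (heckeRep p j) := by
  have hodd : Odd (p : ℤ) := by exact_mod_cast hp.out.odd_of_ne_two hp2
  rw [isOneModTwo_iff]
  cases j with
  | none => simpa [heckeRep] using hodd
  | some j => simpa [heckeRep, hodd, Int.even_mul] using Or.inl (by decide)

omit hp in
lemma upperSign_heckeRep (j : Option (ZMod p)) : upperSign (heckeRep p j) = 1 := by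
  cases j with
  | none => simp [heckeRep, upperSign]
  | some j =>
    simp only [heckeRep, upperSign, of_apply, cons_val', cons_val_one, cons_val_zero, cons_val_fin_one]
    rw [show 4 * (j.val : ℤ) = 2 * (2 * j.val) by ring, Int.mul_ediv_cancel_left _ two_ne_zero,
      Int.negOnePow_two_mul]

lemma exists_heckeRep (hp2 : p ≠ 2) {M : Matrix (Fin 2) (Fin 2) ℤ} (h2 : IsOneModTwo M)
    (hM : M.det = p) : ∃ j γ, IsOneModTwo γ ∧ γ.det = 1 ∧ M = γ * heckeRep p j := by
  have hodd : Odd (p : ℤ) := by exact_mod_cast hp.out.odd_of_ne_two hp2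
  have hp0 : (p : ℤ) ≠ 0 := by exact_mod_cast hp.out.ne_zero
  suffices h : ∃ j γ, M = γ * heckeRep p j by
    obtain ⟨j, γ, hγ⟩ := h
    have hdet : γ.det = 1 := by
      have := congrArg det hγ
      rw [det_mul, det_heckeRep, hM] at this
      exact mul_right_cancel₀ hp0 (by rw [← this, one_mul])
    refine ⟨j, γ, ?_, hdet, hγ⟩
    have e : M * (heckeRep p j).adjugate = (p : ℤ) • γ := by
      rw [hγ, mul_assoc, mul_adjugate, det_heckeRep, Matrix.mul_smul, mul_one]
    have h3 := h2.mul (isOneModTwo_heckeRep hp2 j).adjugate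
    rw [e, isOneModTwo_iff] at h3
    rw [isOneModTwo_iff]
    simpa [Int.odd_mul, Int.even_mul, hodd, Int.not_even_iff_odd.mpr hodd] using h3
  rw [det_fin_two] at hM
  by_cases hc : (p : ℤ) ∣ M 0 0 ∧ (p : ℤ) ∣ M 1 0
  · obtain ⟨⟨a, ha⟩, ⟨c, hc⟩⟩ := hc
    refine ⟨none, !![a, M 0 1; c, M 1 1], ?_⟩
    ext i j; fin_cases i <;> fin_cases j <;>
      simp [heckeRep, Matrix.mul_apply, Fin.sum_univ_two, ha, hc, mul_comm]
  · have h4 : (4 : ZMod p) ≠ 0 := by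
      have h2 : (2 : ZMod p) ≠ 0 := by
        intro h
        have := (ZMod.natCast_eq_zero_iff 2 p).mp (by exact_mod_cast h)
        exact hp2 ((Nat.prime_dvd_prime_iff_eq hp.out Nat.prime_two).mp this)
      rw [show (4 : ZMod p) = 2 * 2 by norm_num]; exact mul_ne_zero h2 h2
    have hdet : (M 0 0 : ZMod p) * M 1 1 - M 0 1 * M 1 0 = 0 := by
      have := congrArg (Int.cast : ℤ → ZMod p) hM
      push_cast at this; simpa using this
    obtain ⟨j, hj1, hj2⟩ : ∃ j : ZMod p, (M 0 1 : ZMod p) - 4 * j * M 0 0 = 0 ∧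
        (M 1 1 : ZMod p) - 4 * j * M 1 0 = 0 := by
      rcases not_and_or.mp hc with h | h
      · have h0 : (M 0 0 : ZMod p) ≠ 0 := by rwa [Ne, ZMod.intCast_zmod_eq_zero_iff_dvd]
        refine ⟨M 0 1 / (4 * M 0 0), by field_simp; ring, ?_⟩
        field_simp; linear_combination hdet
      · have h0 : (M 1 0 : ZMod p) ≠ 0 := by rwa [Ne, ZMod.intCast_zmod_eq_zero_iff_dvd]
        refine ⟨M 1 1 / (4 * M 1 0), ?_, by field_simp; ring⟩
        field_simp; linear_combination -hdet
    have hd : ∀ x y : ℤ, (x : ZMod p) - 4 * j * y = 0 → ∃ z, x = p * z + 4 * j.val * y := by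
      intro x y h
      have : ((x - 4 * j.val * y : ℤ) : ZMod p) = 0 := by push_cast; simpa using h
      obtain ⟨z, hz⟩ := (ZMod.intCast_zmod_eq_zero_iff_dvd _ _).mp this
      exact ⟨z, by linarith⟩
    obtain ⟨b, hb⟩ := hd _ _ hj1
    obtain ⟨d, hd⟩ := hd _ _ hj2
    refine ⟨some j, !![M 0 0, b; M 1 0, d], ?_⟩
    ext i j; fin_cases i <;> fin_cases j <;>
      simp [heckeRep, Matrix.mul_apply, Fin.sum_univ_two, hb, hd] <;> ring

lemma heckeRep_unique (hp2 : p ≠ 2) {γ : Matrix (Fin 2) (Fin 2) ℤ} {i j : Option (ZMod p)}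
    (h : heckeRep p i = γ * heckeRep p j) : i = j := by
  have hp1 : ¬ (p : ℤ) ∣ 1 := by
    intro h; exact hp.out.one_lt.ne' (by exact_mod_cast Int.eq_one_of_dvd_one (by positivity) h)
  have e00 := congrFun (congrFun h 0) 0
  have e01 := congrFun (congrFun h 0) 1
  have e10 := congrFun (congrFun h 1) 0
  have e11 := congrFun (congrFun h 1) 1
  cases i with
  | none =>
    cases j with
    | none => rfl
    | some j =>
      simp [heckeRep, Matrix.mul_apply, Fin.sum_univ_two] at e00 e01 e10 e11
      exfalso; apply hp1
      exact ⟨γ 1 1, by rw [← e10] at e11; linarith⟩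
  | some i =>
    cases j with
    | none =>
      simp [heckeRep, Matrix.mul_apply, Fin.sum_univ_two] at e00 e01 e10 e11
      exfalso; apply hp1
      exact ⟨γ 0 0, by linarith⟩
    | some j =>
      simp [heckeRep, Matrix.mul_apply, Fin.sum_univ_two, -ZMod.natCast_val] at e00 e01 e10 e11
      congr 1
      have h1 : ((4 * i.val : ℤ) : ZMod p) = ((4 * j.val + γ 0 1 * p : ℤ) : ZMod p) := by
        rw [e01, ← e00]; push_cast; ring
      push_cast [ZMod.natCast_zmod_val] at h1
      have h4 : (4 : ZMod p) ≠ 0 := by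
        have h2 : (2 : ZMod p) ≠ 0 := by
          intro h
          have := (ZMod.natCast_eq_zero_iff 2 p).mp (by exact_mod_cast h)
          exact hp2 ((Nat.prime_dvd_prime_iff_eq hp.out Nat.prime_two).mp this)
        rw [show (4 : ZMod p) = 2 * 2 by norm_num]; exact mul_ne_zero h2 h2
      simpa [h4] using h1

lemma exists_perm_heckeRep (hp2 : p ≠ 2) {σ : Matrix (Fin 2) (Fin 2) ℤ} (hσ : σ.det = 1) :
    ∃ (π : Equiv.Perm (Option (ZMod p))) (γ : Option (ZMod p) → Matrix (Fin 2) (Fin 2) ℤ), ∀ j,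
      IsOneModTwo (γ j) ∧ (γ j).det = 1 ∧ heckeRep p j * σ = γ j * σ * heckeRep p (π j) := by
  have h1 : σ.adjugate * σ = 1 := by rw [adjugate_mul, hσ, one_smul]
  have h1' : σ * σ.adjugate = 1 := by rw [mul_adjugate, hσ, one_smul]
  have hdet : σ.adjugate.det = 1 := by
    have := congrArg det h1
    rwa [det_mul, hσ, mul_one, det_one] at this
  have hex : ∀ j : Option (ZMod p), ∃ i γ, IsOneModTwo γ ∧ γ.det = 1 ∧
      σ.adjugate * heckeRep p j * σ = γ * heckeRep p i := fun j =>
    exists_heckeRep hp2 ((isOneModTwo_heckeRep hp2 j).conj h1) (by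
      rw [det_mul, det_mul, hσ, hdet, det_heckeRep]; ring)
  choose π γ hγ2 hγ1 hγ using hex
  have hinj : Function.Injective π := by
    intro j j' hjj
    have e1 := hγ j
    have e2 := hγ j'
    rw [← hjj] at e2
    have e3 : heckeRep p (π j) = (γ j').adjugate * (σ.adjugate * heckeRep p j' * σ) := by
      rw [e2, ← mul_assoc, adjugate_mul, hγ1, one_smul, one_mul]
    apply heckeRep_unique hp2 (γ := σ * γ j * (γ j').adjugate * σ.adjugate)
    calc heckeRep p j = (σ * σ.adjugate) * heckeRep p j * (σ * σ.adjugate) := by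
          rw [h1', one_mul, mul_one]
      _ = σ * (σ.adjugate * heckeRep p j * σ) * σ.adjugate := by simp only [mul_assoc]
      _ = σ * (γ j * ((γ j').adjugate * (σ.adjugate * heckeRep p j' * σ))) * σ.adjugate := by
          rw [e1, e3]
      _ = σ * γ j * (γ j').adjugate * σ.adjugate * heckeRep p j' * (σ * σ.adjugate) := by
          simp only [mul_assoc]
      _ = _ := by rw [h1', mul_one]
  refine ⟨Equiv.ofBijective π (Finite.injective_iff_bijective.mp hinj),
    fun j => σ * γ j * σ.adjugate, fun j => ⟨(hγ2 j).conj h1', ?_, ?_⟩⟩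
  · simp [det_mul, hσ, hdet, hγ1]
  · have : heckeRep p j * σ = σ * (σ.adjugate * heckeRep p j * σ) := by
      simp only [← mul_assoc, h1', one_mul]
    rw [this, hγ j]
    simp only [Equiv.ofBijective_apply, mul_assoc]
    rw [← mul_assoc σ.adjugate, h1, one_mul]

end Cosets

section LevelTwo

open Complex Matrix Asymptotics Filter

/-- The matrix `τ ↦ -1/τ`. -/
def matS : Matrix (Fin 2) (Fin 2) ℤ := !![0, -1; 1, 0]

/-- The matrix `τ ↦ 1 - 1/τ`. -/
def matTS : Matrix (Fin 2) (Fin 2) ℤ := !![1, -1; 1, 0]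

lemma det_matS : matS.det = 1 := by simp [matS, det_fin_two]

lemma det_matTS : matTS.det = 1 := by simp [matTS, det_fin_two]

lemma mob_matS (τ : ℂ) : mob matS τ = -1 / τ := by simp [mob, matS]

lemma mob_matTS {τ : ℂ} (hτ : 0 < τ.im) : mob matTS τ = -1 / τ + 1 := by
  have h : τ ≠ 0 := by rintro rfl; simp at hτ
  simp only [mob, matTS, of_apply, cons_val', cons_val_zero, cons_val_one, cons_val_fin_one]
  push_cast
  rw [div_add_one h]
  congr 1 <;> ring

/-- Invariance under the principal congruence subgroup of level two. -/
def IsGammaTwoInvariant (F : ℂ → ℂ) : Prop :=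
  ∀ γ : Matrix (Fin 2) (Fin 2) ℤ, IsOneModTwo γ → γ.det = 1 → ∀ τ : ℂ, 0 < τ.im →
    F (mob γ τ) = F τ

lemma IsGammaTwoInvariant.isBigO_mob {F : ℂ → ℂ} (hinv : IsGammaTwoInvariant F)
    (hinf : F =O[imInfty] (1 : ℂ → ℂ)) (h0 : (fun τ => F (mob matS τ)) =O[imInfty] (1 : ℂ → ℂ))
    (h1 : (fun τ => F (mob matTS τ)) =O[imInfty] (1 : ℂ → ℂ))
    {M : Matrix (Fin 2) (Fin 2) ℤ} (hM : M.det = 1) :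
    (fun τ => F (mob M τ)) =O[imInfty] (1 : ℂ → ℂ) := by
  have key : ∀ ρ : Matrix (Fin 2) (Fin 2) ℤ, ρ.det = 1 → IsOneModTwo (M * ρ.adjugate) →
      (fun τ => F (mob ρ τ)) =O[imInfty] (1 : ℂ → ℂ) →
      (fun τ => F (mob M τ)) =O[imInfty] (1 : ℂ → ℂ) := by
    intro ρ hρ h2 hb
    refine hb.congr' ?_ EventuallyEq.rfl
    filter_upwards [eventually_im_pos] with τ hτ
    have hd : (M * ρ.adjugate).det = 1 := by
      have := congrArg det (mul_adjugate ρ)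
      rw [hρ, one_smul, det_mul, hρ, one_mul, det_one] at this
      rw [det_mul, hM, this, one_mul]
    have e : M = M * ρ.adjugate * ρ := by rw [mul_assoc, adjugate_mul, hρ, one_smul, mul_one]
    rw [e, mob_mul _ (by rw [hρ]; norm_num) hτ,
      hinv _ h2 hd _ (mob_im_pos (by rw [hρ]; norm_num) hτ)]
  have hT : ∀ ρ : Matrix (Fin 2) (Fin 2) ℤ, (fun τ => F (mob ρ τ)) =O[imInfty] (1 : ℂ → ℂ) →
      (fun τ => F (mob (ρ * !![1, 1; 0, 1]) τ)) =O[imInfty] (1 : ℂ → ℂ) := by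
    intro ρ hb
    refine (hb.comp_tendsto tendsto_add_one_imInfty).congr' ?_ EventuallyEq.rfl
    filter_upwards [eventually_im_pos] with τ hτ
    have e : mob !![1, 1; 0, 1] τ = τ + 1 := by simp [mob]
    rw [mob_mul _ (by simp [det_fin_two]) hτ, e]; rfl
  have h1' : (fun τ => F (mob 1 τ)) =O[imInfty] (1 : ℂ → ℂ) := by
    simpa [mob] using hinf
  have hdet := hM
  rw [det_fin_two] at hdet
  have hpar : Odd (M 0 0 * M 1 1 - M 0 1 * M 1 0) := by rw [hdet]; exact odd_one
  simp only [Int.odd_sub, Int.odd_mul, Int.even_mul] at hpar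
  simp only [isOneModTwo_iff, adjugate_fin_two, Matrix.mul_apply, Fin.sum_univ_two] at key
  rcases Int.even_or_odd (M 1 0) with hc | hc
  · rcases Int.even_or_odd (M 0 1) with hb | hb
    · refine key 1 (by simp) ?_ h1'
      simp [parity_simps, hb, hc] at hpar ⊢
      tauto
    · refine key (1 * !![1, 1; 0, 1]) (by simp [det_fin_two]) ?_ (hT _ h1')
      simp [parity_simps, hc] at hpar ⊢
      grind
  · rcases Int.even_or_odd (M 0 0) with ha | ha <;> rcases Int.even_or_odd (M 1 1) with hd | hd
    · refine key matS det_matS ?_ h0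
      simp [matS, parity_simps, ha, hc, hd] at hpar ⊢
      grind
    · refine key (matS * !![1, 1; 0, 1]) (by simp [matS, det_fin_two]) ?_ (hT _ h0)
      simp [matS, parity_simps, ha, hc, hd] at hpar ⊢
      grind
    · refine key matTS det_matTS ?_ h1
      simp [matTS, parity_simps, ha, hc, hd] at hpar ⊢
      grind
    · refine key (matTS * !![1, 1; 0, 1]) (by simp [matTS, det_fin_two]) ?_ (hT _ h1)
      simp [matTS, parity_simps, ha, hd] at hpar ⊢
      grind

open UpperHalfPlane ModularForm MatrixGroups CongruenceSubgroup in
lemma IsGammaTwoInvariant.eq_const {F : ℂ → ℂ} (hinv : IsGammaTwoInvariant F)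
    (hF : DifferentiableOn ℂ F {τ | 0 < τ.im})
    (hinf : F =O[imInfty] (1 : ℂ → ℂ)) (h0 : (fun τ => F (mob matS τ)) =O[imInfty] (1 : ℂ → ℂ))
    (h1 : (fun τ => F (mob matTS τ)) =O[imInfty] (1 : ℂ → ℂ)) :
    ∃ c, ∀ τ : ℂ, 0 < τ.im → F τ = c := by
  have hmob : ∀ (γ : SL(2, ℤ)) (τ : ℍ), ((γ • τ : ℍ) : ℂ) = mob γ.1 τ := by
    intro γ τ
    rw [UpperHalfPlane.coe_specialLinearGroup_apply]
    simp [mob]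
  have hslash : ∀ (γ : SL(2, ℤ)) (τ : ℍ), ((fun τ : ℍ => F τ) ∣[(0 : ℤ)] γ) τ = F (mob γ.1 τ) := by
    intro γ τ
    rw [ModularForm.SL_slash_apply, hmob]
    simp
  let f : ModularForm ((Gamma 2 : Subgroup SL(2, ℤ)) : Subgroup (GL (Fin 2) ℝ)) 0 :=
    { toFun := fun τ : ℍ => F τ
      slash_action_eq' := by
        rintro _ ⟨γ, hγ, rfl⟩
        ext τ
        rw [SetLike.mem_coe, Gamma_mem] at hγ
        have := hslash γ τ
        refine this.trans (hinv _ ?_ γ.2 _ τ.im_pos)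
        rw [isOneModTwo_iff]
        obtain ⟨ha, hb, hc, hd⟩ := hγ
        refine ⟨(ZMod.intCast_eq_one_iff_odd).mp ha, ?_, ?_, ?_⟩
        · exact even_iff_two_dvd.mpr ((ZMod.intCast_zmod_eq_zero_iff_dvd _ 2).mp hb)
        · exact even_iff_two_dvd.mpr ((ZMod.intCast_zmod_eq_zero_iff_dvd _ 2).mp hc)
        · exact (ZMod.intCast_eq_one_iff_odd).mp hd
      holo' := by
        rw [UpperHalfPlane.mdifferentiable_iff]
        refine hF.congr fun τ hτ => ?_
        change F (UpperHalfPlane.ofComplex τ) = F τ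
        rw [UpperHalfPlane.ofComplex_apply_of_im_pos hτ]
      bdd_at_cusps' := by
        intro c hc
        have hc' : IsCusp c 𝒮ℒ := hc.mono (by rintro _ ⟨γ, -, rfl⟩; exact ⟨γ, rfl⟩)
        rw [OnePoint.isBoundedAt_iff_forall_SL2Z hc']
        intro γ _
        have := (hinv.isBigO_mob hinf h0 h1 γ.2)
        have h2 : Tendsto (fun τ : ℍ => (τ : ℂ)) atImInfty imInfty := by
          rw [imInfty, tendsto_comap_iff]
          exact tendsto_comap
        have h3 := this.comp_tendsto h2
        rw [IsBoundedAtImInfty, BoundedAtFilter]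
        exact (h3.congr_left fun τ => (hslash γ τ).symm).trans
          (isBigO_of_le _ fun _ => by simp) }
  obtain ⟨c, hc⟩ := ModularForm.eq_const_of_weight_zero f
  exact ⟨c, fun τ hτ => congrFun hc ⟨τ, hτ⟩⟩

end LevelTwo

section Hauptmodul

open Complex Matrix Asymptotics Filter

lemma kmod_sq_invariant : IsGammaTwoInvariant fun τ => kmod τ ^ 2 := by
  intro γ h2 h1 τ hτ
  simp only [kmod_mob h2 h1 hτ, mul_pow]
  rcases Int.units_eq_one_or (upperSign γ) with h | h <;> simp [h]

lemma kmod_matS {τ : ℂ} (hτ : 0 < τ.im) : kmod (mob matS τ) = kcomp τ := by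
  rw [mob_matS, kmod_neg_inv hτ]

lemma kmod_matTS {τ : ℂ} (hτ : 0 < τ.im) :
    kmod (mob matTS τ) = I * kcomp τ / kmod τ := by
  rw [mob_matTS hτ, kmod_add_one, theta2_neg_inv hτ, theta4_neg_inv hτ, kcomp, kmod]
  have h := neg_I_mul_cpow_ne_zero hτ
  have h3 := theta3_ne_zero hτ
  have h2 := theta2_ne_zero hτ
  generalize (-I * τ) ^ (1 / 2 : ℂ) = c at *
  field_simp

lemma differentiableOn_kmod : DifferentiableOn ℂ kmod {τ | 0 < τ.im} :=
  fun _ hτ => (differentiableAt_kmod hτ).differentiableWithinAt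

lemma exp_isBigO_kmod :
    (fun τ : ℂ => cexp (Real.pi * I * τ / 2)) =O[imInfty] kmod := by
  have h := tendsto_kmod_div_exp.inv₀ (by norm_num)
  have h1 : (fun τ : ℂ => (kmod τ / cexp (Real.pi * I * τ / 2))⁻¹ * kmod τ) =O[imInfty] kmod := by
    simpa using (h.isBigO_one ℂ).mul (isBigO_refl kmod imInfty)
  refine h1.congr' ?_ EventuallyEq.rfl
  filter_upwards [eventually_im_pos] with τ hτ
  have := kmod_ne_zero hτ
  field_simp

lemma kmod_isBigO_one : kmod =O[imInfty] (1 : ℂ → ℂ) := by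
  have h1 : (fun τ : ℂ => cexp (Real.pi * I * τ / 2)) =O[imInfty] (1 : ℂ → ℂ) := by
    refine IsBigO.of_bound 1 ?_
    filter_upwards [eventually_im_pos] with τ hτ
    simpa [div_eq_mul_inv] using (norm_exp_pi_lt_one hτ (c := 1/2) (by norm_num)).le
  have h := (tendsto_kmod_div_exp.isBigO_one ℂ).mul h1
  refine h.congr' (Eventually.of_forall fun τ => ?_) (by simp [EventuallyEq])
  simp

lemma IsGammaTwoInvariant.exists_sub_isBigO {F : ℂ → ℂ} (hinv : IsGammaTwoInvariant F)
    (hF : DifferentiableOn ℂ F {τ | 0 < τ.im}) (hinf : F =O[imInfty] (1 : ℂ → ℂ)) :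
    ∃ c, (fun τ => F τ - c) =O[imInfty] fun τ => kmod τ ^ 2 := by
  classical
  let f : ℂ → ℂ := fun τ => if 0 < τ.im then F τ else 0
  have hfF : f =ᶠ[imInfty] F := by
    filter_upwards [eventually_im_pos] with τ hτ using if_pos hτ
  have hper : Function.Periodic f (2 : ℝ) := by
    intro τ
    have him : (τ + (2 : ℝ)).im = τ.im := by simp
    simp only [f, him]
    split_ifs with hτ
    · have := hinv !![1, 2; 0, 1] (by rw [isOneModTwo_iff]; simp) (by simp [det_fin_two]) τ hτ
      rw [← this]; congr 1; simp [mob]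
    · rfl
  have hd : ∀ᶠ z in imInfty, DifferentiableAt ℂ f z := by
    filter_upwards [eventually_im_pos] with τ hτ
    have ho : {τ : ℂ | 0 < τ.im} ∈ nhds τ :=
      (isOpen_lt continuous_const Complex.continuous_im).mem_nhds hτ
    refine (hF.differentiableAt ho).congr_of_eventuallyEq ?_
    filter_upwards [ho] with z hz using if_pos hz
  have hb : BoundedAtFilter imInfty f :=
    (hinf.congr' hfF.symm EventuallyEq.rfl).trans (isBigO_of_le _ fun _ => by simp)
  refine ⟨Function.Periodic.cuspFunction (2 : ℝ) f 0, ?_⟩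
  have h := Function.Periodic.exp_decay_sub_of_bounded_at_inf (by norm_num) hper hd hb
  have h2 := (h.congr' (hfF.sub EventuallyEq.rfl) EventuallyEq.rfl)
  have h3 : (fun τ : ℂ => Real.exp (-2 * Real.pi * τ.im / 2)) =O[imInfty] fun τ => kmod τ ^ 2 := by
    refine IsBigO.trans (isBigO_of_le _ fun τ => ?_) (exp_isBigO_kmod.pow 2)
    rw [← Complex.exp_nat_mul, Complex.norm_exp, Real.norm_of_nonneg (Real.exp_pos _).le]
    apply le_of_eq; congr 1
    simp
    ring
  exact h2.trans h3

/-- A `Γ(2)`-invariant function whose only pole is at the cusp `1` is a polynomial in `k²`. -/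
lemma IsGammaTwoInvariant.exists_polynomial {N : ℕ} : ∀ {F : ℂ → ℂ}, IsGammaTwoInvariant F →
    DifferentiableOn ℂ F {τ | 0 < τ.im} → F =O[imInfty] (1 : ℂ → ℂ) →
    (fun τ => F (mob matS τ)) =O[imInfty] (1 : ℂ → ℂ) →
    (fun τ => F (mob matTS τ) * kmod τ ^ (2 * N)) =O[imInfty] (1 : ℂ → ℂ) →
    ∃ R : Polynomial ℂ, R.natDegree ≤ N ∧ ∀ τ : ℂ, 0 < τ.im → F τ = R.eval (kmod τ ^ 2) := by
  induction N with
  | zero =>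
    intro F hinv hF hinf h0 h1
    obtain ⟨c, hc⟩ := hinv.eq_const hF hinf h0 (by simpa using h1)
    exact ⟨Polynomial.C c, by simp, by simpa using hc⟩
  | succ N ih =>
    intro F hinv hF hinf h0 h1
    obtain ⟨c, hc⟩ := hinv.exists_sub_isBigO hF hinf
    have hone : ∀ c : ℂ, (fun _ : ℂ => c) =O[imInfty] (1 : ℂ → ℂ) := fun c =>
      isBigO_const_const c one_ne_zero _
    have hkc : (fun τ => (kcomp τ ^ 2)⁻¹) =O[imInfty] (1 : ℂ → ℂ) := by
      have := (tendsto_kcomp_imInfty.pow 2).inv₀ (by norm_num)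
      exact this.isBigO_one ℂ
    have a1 : IsGammaTwoInvariant fun τ => (F τ - c) / kmod τ ^ 2 := by
      intro γ h2 h1 τ hτ
      have := kmod_sq_invariant γ h2 h1 τ hτ
      simp only at this
      simp only [this, hinv γ h2 h1 τ hτ]
    have a2 : DifferentiableOn ℂ (fun τ => (F τ - c) / kmod τ ^ 2) {τ | 0 < τ.im} := by
      exact (hF.sub (differentiableOn_const c)).div (differentiableOn_kmod.pow 2)
        fun τ hτ => pow_ne_zero 2 (kmod_ne_zero hτ)
    have a3 : (fun τ => (F τ - c) / kmod τ ^ 2) =O[imInfty] (1 : ℂ → ℂ) := by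
      have := hc.mul (isBigO_refl (fun τ => (kmod τ ^ 2)⁻¹) imInfty)
      simp only [← div_eq_mul_inv] at this
      refine this.trans (isBigO_of_le _ fun τ => ?_)
      by_cases h : kmod τ = 0 <;> simp [h]
    have a4 : (fun τ => (F (mob matS τ) - c) / kmod (mob matS τ) ^ 2) =O[imInfty] (1 : ℂ → ℂ) := by
      have := (h0.sub (hone c)).mul hkc
      refine this.congr' ?_ (by simp [EventuallyEq])
      filter_upwards [eventually_im_pos] with τ hτ
      rw [kmod_matS hτ, div_eq_mul_inv]
    have a5 : (fun τ => (F (mob matTS τ) - c) / kmod (mob matTS τ) ^ 2 * kmod τ ^ (2 * N)) =O[imInfty]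
        (1 : ℂ → ℂ) := by
      have hck : (fun τ => c * kmod τ ^ (2 * (N + 1))) =O[imInfty] (1 : ℂ → ℂ) := by
        simpa [Pi.one_def] using (hone c).mul (kmod_isBigO_one.pow (2 * (N + 1)))
      have := ((h1.sub hck).mul hkc).neg_left
      refine (this.congr' ?_ EventuallyEq.rfl).trans (isBigO_of_le _ fun _ => by simp)
      filter_upwards [eventually_im_pos] with τ hτ
      have hk := kmod_ne_zero hτ
      have hk' := kcomp_ne_zero hτ
      rw [kmod_matTS hτ, div_pow, mul_pow, I_sq]
      field_simp
      ring
    obtain ⟨R, hR, hFR⟩ := ih a1 a2 a3 a4 a5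
    refine ⟨Polynomial.C c + Polynomial.X * R, ?_, fun τ hτ => ?_⟩
    · refine (Polynomial.natDegree_add_le _ _).trans (max_le (by simp) ?_)
      refine Polynomial.natDegree_mul_le.trans ?_
      have := Polynomial.natDegree_X_le (R := ℂ)
      omega
    · have := hFR τ hτ
      rw [div_eq_iff (pow_ne_zero 2 (kmod_ne_zero hτ))] at this
      simp only [Polynomial.eval_add, Polynomial.eval_C, Polynomial.eval_mul, Polynomial.eval_X]
      linear_combination this

end Hauptmodul

section Integrality

open PowerSeries

lemma PowerSeries.aeval_injective {K : Type*} [Field K] {L : PowerSeries K}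
    (h0 : constantCoeff L = 0) (hL : L ≠ 0) {R : Polynomial K}
    (h : Polynomial.aeval L R = 0) : R = 0 := by
  by_contra hR
  obtain ⟨Q, hQ, hQ0⟩ := Polynomial.exists_eq_pow_rootMultiplicity_mul_and_not_dvd R hR 0
  rw [hQ] at h
  simp only [map_zero, sub_zero, map_mul, map_pow, Polynomial.aeval_X, mul_eq_zero] at h
  rcases h with h | h
  · exact hL (eq_zero_of_pow_eq_zero h)
  · apply hQ0
    rw [Polynomial.dvd_iff_isRoot, Polynomial.IsRoot]
    have := congrArg (constantCoeff (R := K)) h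
    rw [Polynomial.aeval_def, Polynomial.hom_eval₂, h0, map_zero] at this
    rw [← this, Polynomial.eval]
    congr 1

lemma PowerSeries.map_aeval {A B : Type*} [CommRing A] [CommRing B] (f : A →+* B)
    (L : PowerSeries A) (R : Polynomial A) :
    PowerSeries.map f (Polynomial.aeval L R) =
      Polynomial.aeval (PowerSeries.map f L) (R.map f) := by
  rw [Polynomial.aeval_def, Polynomial.hom_eval₂, Polynomial.aeval_def, Polynomial.eval₂_map]
  congr 1
  ext a : 1
  simp

lemma PowerSeries.map_injective' {A B : Type*} [CommRing A] [CommRing B] {f : A →+* B}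
    (hf : Function.Injective f) : Function.Injective (PowerSeries.map f) := by
  intro x y h
  ext n
  apply hf
  simpa using congrArg (PowerSeries.coeff n) h

/-- If a polynomial in an integral power series with nonzero reduction is integral, then the
polynomial itself is integral. -/
lemma ValuationSubring.exists_lift {F : Type*} [Field F] (A : ValuationSubring F)
    {L C : PowerSeries A}
    (h0 : constantCoeff (PowerSeries.map (IsLocalRing.residue A) L) = 0)
    (hL : PowerSeries.map (IsLocalRing.residue A) L ≠ 0) {R : Polynomial F}
    (h : Polynomial.aeval (PowerSeries.map A.subtype L) R = PowerSeries.map A.subtype C) :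
    ∃ Q : Polynomial A, Q.map A.subtype = R ∧ Polynomial.aeval L Q = C := by
  suffices hinteg : ∀ n, R.coeff n ∈ A by
    obtain ⟨Q, hQ⟩ := (Polynomial.mem_lifts _).mp
      ((Polynomial.lifts_iff_coeff_lifts R (f := A.subtype)).mpr fun n => ⟨⟨_, hinteg n⟩, rfl⟩)
    refine ⟨Q, hQ, PowerSeries.map_injective' (f := A.subtype) Subtype.val_injective ?_⟩
    rw [PowerSeries.map_aeval, hQ, h]
  by_contra hcon
  push Not at hcon
  obtain ⟨n, hn⟩ := hcon
  have hn0 : R.coeff n ≠ 0 := fun h => hn (h ▸ A.zero_mem)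
  obtain ⟨i, hi, hmax⟩ := Finset.exists_max_image R.support (fun i => A.valuation (R.coeff i))
    ⟨n, Polynomial.mem_support_iff.mpr hn0⟩
  have hi0 : R.coeff i ≠ 0 := Polynomial.mem_support_iff.mp hi
  have hci : 1 < A.valuation (R.coeff i) := by
    refine lt_of_lt_of_le ?_ (hmax n (Polynomial.mem_support_iff.mpr hn0))
    rwa [← not_le, A.valuation_le_one_iff]
  have hinv : A.valuation (R.coeff i)⁻¹ < 1 := by
    rw [map_inv₀]; exact inv_lt_one_of_one_lt₀ hci
  let c : A := ⟨(R.coeff i)⁻¹, (A.valuation_le_one_iff _).mp hinv.le⟩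
  have hc : IsLocalRing.residue A c = 0 := by
    rw [IsLocalRing.residue_eq_zero_iff, A.valuation_lt_one_iff]; exact hinv
  have hlift : ∀ m, (Polynomial.C (R.coeff i)⁻¹ * R).coeff m ∈ A := by
    intro m
    rw [Polynomial.coeff_C_mul]
    by_cases hm : R.coeff m = 0
    · rw [hm, mul_zero]; exact A.zero_mem
    · rw [← A.valuation_le_one_iff, map_mul, map_inv₀]
      have h1 := hmax m (Polynomial.mem_support_iff.mpr hm)
      have h2 : A.valuation (R.coeff i) ≠ 0 := (Valuation.ne_zero_iff _).mpr hi0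
      calc _ ≤ (A.valuation (R.coeff i))⁻¹ * A.valuation (R.coeff i) := by gcongr
        _ = 1 := inv_mul_cancel₀ h2
  obtain ⟨Q, hQ⟩ : ∃ Q : Polynomial A, Q.map A.subtype = Polynomial.C (R.coeff i)⁻¹ * R :=
    (Polynomial.mem_lifts _).mp ((Polynomial.lifts_iff_coeff_lifts _ (f := A.subtype)).mpr fun n => ⟨⟨_, hlift n⟩, rfl⟩)
  have hQL : Polynomial.aeval L Q = PowerSeries.C c * C := by
    apply PowerSeries.map_injective' (f := A.subtype) Subtype.val_injective
    rw [PowerSeries.map_aeval, hQ, map_mul, map_mul, h, Polynomial.aeval_C, PowerSeries.map_C]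
    rfl
  have hQ0 := PowerSeries.aeval_injective h0 hL (R := Q.map (IsLocalRing.residue A)) (by
    rw [← PowerSeries.map_aeval, hQL, map_mul, PowerSeries.map_C, hc, map_zero, zero_mul])
  have hQi : Q.coeff i = 1 := by
    apply Subtype.val_injective
    have := congrArg (fun P => Polynomial.coeff P i) hQ
    simp only [Polynomial.coeff_map, Polynomial.coeff_C_mul] at this
    rw [inv_mul_cancel₀ hi0] at this
    exact this
  have := congrArg (fun P => Polynomial.coeff P i) hQ0
  simp [Polynomial.coeff_map, hQi] at this

end Integrality

section Reduction

variable (p : ℕ) [hp : Fact p.Prime]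

lemma ValuationSubring.exists_charP : ∃ A : ValuationSubring ℂ,
    CharP (IsLocalRing.ResidueField A) p := by
  let Z : Subring ℂ := (Int.castRingHom ℂ).range
  let x : Z := ⟨(p : ℂ), ⟨p, by simp⟩⟩
  have hI : Ideal.span {x} ≠ ⊤ := by
    rw [Ne, Ideal.eq_top_iff_one, Ideal.mem_span_singleton]
    rintro ⟨⟨_, y, rfl⟩, hy⟩
    have h1 : (1 : ℂ) = p * y := congrArg Subtype.val hy
    have h2 : (1 : ℤ) = p * y := by exact_mod_cast h1
    exact hp.out.one_lt.ne' (by exact_mod_cast Int.eq_one_of_dvd_one (by positivity) ⟨y, h2⟩)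
  obtain ⟨A, -, hA⟩ := Ideal.image_subset_nonunits_valuationSubring (Ideal.span {x}) hI
  refine ⟨A, (CharP.charP_iff_prime_eq_zero hp.out).mpr ?_⟩
  have h := hA ⟨x, Ideal.subset_span rfl, rfl⟩
  have h2 : A.valuation ((p : A) : ℂ) < 1 := by
    have := (A.mem_nonunits_iff).mp h
    simpa using this
  rw [← A.valuation_lt_one_iff, ← IsLocalRing.residue_eq_zero_iff, map_natCast] at h2
  exact h2

variable {p}

lemma ValuationSubring.exists_residue_eq_one (A : ValuationSubring ℂ)
    [CharP (IsLocalRing.ResidueField A) p] {ζ : ℂ} (hζ : ζ ^ p = 1) :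
    ∃ z : A, (z : ℂ) = ζ ∧ IsLocalRing.residue A z = 1 := by
  have hA : ζ ∈ A := by
    rw [← A.valuation_le_one_iff]
    have : A.valuation ζ ^ p = 1 := by rw [← map_pow, hζ, map_one]
    exact le_of_not_gt fun h => (one_lt_pow₀ h hp.out.ne_zero).ne' this
  refine ⟨⟨ζ, hA⟩, rfl, ?_⟩
  have h1 : (⟨ζ, hA⟩ : A) ^ p = 1 := Subtype.ext hζ
  have h2 : (IsLocalRing.residue A ⟨ζ, hA⟩ - 1) ^ p = 0 := by
    rw [sub_pow_char, ← map_pow, h1, map_one, one_pow, sub_self]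
  exact sub_eq_zero.mp (eq_zero_of_pow_eq_zero h2)

lemma PowerSeries.map_int_expand {κ : Type*} [CommRing κ] [CharP κ p] (K : PowerSeries ℤ) :
    PowerSeries.map (Int.castRingHom κ) (K.expand p hp.out.ne_zero) =
      PowerSeries.map (Int.castRingHom κ) K ^ p := by
  have e : Int.castRingHom κ = (ZMod.castHom dvd_rfl κ).comp (Int.castRingHom (ZMod p)) :=
    RingHom.ext_int _ _
  have h : PowerSeries.map (Int.castRingHom (ZMod p)) (K.expand p hp.out.ne_zero) =
      PowerSeries.map (Int.castRingHom (ZMod p)) K ^ p := by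
    have h1 : frobenius (ZMod p) p = RingHom.id _ := by
      ext x; rw [frobenius_def, ZMod.pow_card, RingHom.id_apply]
    have h2 := MvPowerSeries.map_frobenius_expand (R := ZMod p) p hp.out.ne_zero
      (f := PowerSeries.map (Int.castRingHom (ZMod p)) K)
    rw [h1, MvPowerSeries.map_id, RingHom.id_apply] at h2
    rw [PowerSeries.map_expand]
    exact h2
  rw [e, PowerSeries.map_comp, RingHom.comp_apply, RingHom.comp_apply, h, map_pow]

lemma PowerSeries.map_subtype_int (A : ValuationSubring ℂ) (K : PowerSeries ℤ) :
    PowerSeries.map A.subtype (PowerSeries.map (Int.castRingHom A) K) = toComplexSeries K := by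
  rw [← RingHom.comp_apply, ← PowerSeries.map_comp]
  congr 2

lemma PowerSeries.map_residue_int (A : ValuationSubring ℂ) (K : PowerSeries ℤ) :
    PowerSeries.map (IsLocalRing.residue A) (PowerSeries.map (Int.castRingHom A) K) =
      PowerSeries.map (Int.castRingHom _) K := by
  rw [← RingHom.comp_apply, ← PowerSeries.map_comp]
  congr 2

lemma map_kSeries_ne_zero (hp2 : p ≠ 2) (κ : Type*) [Field κ] [CharP κ p] :
    PowerSeries.map (Int.castRingHom κ) kSeries ≠ 0 := by
  intro h
  have h1 := congrArg (PowerSeries.coeff 1) h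
  rw [PowerSeries.coeff_map, kSeries, mul_comm (4 : PowerSeries ℤ), mul_assoc,
    PowerSeries.coeff_succ_X_mul, PowerSeries.coeff_zero_eq_constantCoeff_apply, map_mul,
    constantCoeff_kUnitSeries, map_ofNat, mul_one, map_zero] at h1
  have h1 : ((4 : ℤ) : κ) = 0 := h1
  have h2 : ((2 : ℕ) : κ) ^ 2 = 0 := by
    push_cast at h1 ⊢; linear_combination h1
  have h3 := (CharP.cast_eq_zero_iff κ p 2).mp (eq_zero_of_pow_eq_zero h2)
  exact hp2 ((Nat.prime_dvd_prime_iff_eq hp.out Nat.prime_two).mp h3)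

lemma constantCoeff_kSeries : PowerSeries.constantCoeff kSeries = 0 := by
  simp [kSeries]

end Reduction

section ModularCorrespondence

open Complex Matrix Asymptotics Filter

variable {p : ℕ} [hp : Fact p.Prime]

lemma det_heckeRep_pos (j : Option (ZMod p)) : 0 < (heckeRep p j).det := by
  rw [det_heckeRep]; exact_mod_cast hp.out.pos

lemma kmod_heckeRep_mob (hp2 : p ≠ 2) {σ : Matrix (Fin 2) (Fin 2) ℤ} (hσ : σ.det = 1) :
    ∃ (π : Equiv.Perm (Option (ZMod p))) (s : Option (ZMod p) → ℤˣ),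
      (IsOneModTwo σ → ∀ j, s j = 1) ∧ ∀ j τ, 0 < τ.im →
        kmod (mob (heckeRep p j) (mob σ τ)) =
          (s j : ℤ) * kmod (mob σ (mob (heckeRep p (π j)) τ)) := by
  obtain ⟨π, γ, h⟩ := exists_perm_heckeRep hp2 hσ
  refine ⟨π, fun j => upperSign (γ j), fun h2 j => ?_, fun j τ hτ => ?_⟩
  · obtain ⟨h3, -, h4⟩ := h j
    have h5 := congrArg upperSign h4
    rw [upperSign_mul (isOneModTwo_heckeRep hp2 j) h2,
      upperSign_mul (h3.mul h2) (isOneModTwo_heckeRep hp2 _), upperSign_mul h3 h2,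
      upperSign_heckeRep, upperSign_heckeRep, one_mul, mul_one] at h5
    exact (mul_eq_right.mp h5.symm)
  · obtain ⟨h3, h1, h4⟩ := h j
    have hσ' : 0 < σ.det := by rw [hσ]; norm_num
    have hU := mob_im_pos (det_heckeRep_pos (π j)) hτ
    rw [← mob_mul _ hσ' hτ, h4, mob_mul _ (det_heckeRep_pos _) hτ, mob_mul _ hσ' hU,
      kmod_mob h3 h1 (mob_im_pos hσ' hU)]

/-- The product over the Hecke correspondence of `k (k - ε k ∘ U)`. -/
noncomputable def heckeCorr (p : ℕ) [Fact p.Prime] (ε : ℤˣ) (τ : ℂ) : ℂ :=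
  ∏ j : Option (ZMod p), (kmod τ ^ 2 - (ε : ℤ) * kmod τ * kmod (mob (heckeRep p j) τ))

lemma heckeCorr_invariant (hp2 : p ≠ 2) (ε : ℤˣ) : IsGammaTwoInvariant (heckeCorr p ε) := by
  intro γ h2 h1 τ hτ
  obtain ⟨π, s, hs, h⟩ := kmod_heckeRep_mob hp2 h1
  rw [heckeCorr, heckeCorr]
  refine Eq.trans (prod_congr rfl fun j _ => ?_) (Equiv.prod_comp π _)
  rw [h j τ hτ, hs h2, kmod_mob h2 h1 hτ, kmod_mob h2 h1 (mob_im_pos (det_heckeRep_pos _) hτ)]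
  have e : (((upperSign γ : ℤ) : ℂ)) ^ 2 = 1 := by
    rcases Int.units_eq_one_or (upperSign γ) with h | h <;> simp [h]
  push_cast
  linear_combination (kmod τ ^ 2 - (ε : ℤ) * kmod τ * kmod (mob (heckeRep p (π j)) τ)) * e

lemma differentiableAt_mob {M : Matrix (Fin 2) (Fin 2) ℤ} (hM : 0 < M.det) {τ : ℂ}
    (hτ : 0 < τ.im) : DifferentiableAt ℂ (mob M) τ :=
  ((differentiableAt_id.const_mul _).add_const _).div
    ((differentiableAt_id.const_mul _).add_const _) (den_ne_zero hM hτ)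

lemma differentiableAt_kmod_mob {M : Matrix (Fin 2) (Fin 2) ℤ} (hM : 0 < M.det) {τ : ℂ}
    (hτ : 0 < τ.im) : DifferentiableAt ℂ (fun τ => kmod (mob M τ)) τ :=
  DifferentiableAt.comp τ (differentiableAt_kmod (mob_im_pos hM hτ)) (differentiableAt_mob hM hτ)

lemma differentiableOn_heckeCorr (ε : ℤˣ) :
    DifferentiableOn ℂ (heckeCorr p ε) {τ | 0 < τ.im} := by
  intro τ hτ
  refine DifferentiableAt.differentiableWithinAt ?_
  unfold heckeCorr
  refine DifferentiableAt.fun_finsetProd fun j _ => ?_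
  exact ((differentiableAt_kmod hτ).pow 2).sub (((differentiableAt_kmod hτ).const_mul _).mul
    (differentiableAt_kmod_mob (det_heckeRep_pos j) hτ))

omit hp in
lemma mob_heckeRep_none (τ : ℂ) : mob (heckeRep p none) τ = p * τ := by
  simp [mob, heckeRep]

omit hp in
lemma mob_heckeRep_some (j : ZMod p) (τ : ℂ) :
    mob (heckeRep p (some j)) τ = (τ + 4 * j.val) / p := by
  simp [mob, heckeRep, -ZMod.natCast_val]

omit hp in
lemma im_mob_heckeRep_none (τ : ℂ) : (mob (heckeRep p none) τ).im = p * τ.im := by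
  rw [mob_heckeRep_none]; simp

omit hp in
lemma im_mob_heckeRep_some (j : ZMod p) (τ : ℂ) :
    (mob (heckeRep p (some j)) τ).im = τ.im / p := by
  rw [mob_heckeRep_some, Complex.div_natCast_im]; simp [-ZMod.natCast_val]

lemma tendsto_mob_heckeRep (j : Option (ZMod p)) :
    Tendsto (mob (heckeRep p j)) imInfty imInfty := by
  have hp0 : (0 : ℝ) < p := by exact_mod_cast hp.out.pos
  rw [imInfty, tendsto_comap_iff]
  cases j with
  | none =>
    have := (tendsto_comap (f := im) (x := atTop)).const_mul_atTop hp0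
    exact this.congr fun τ => (im_mob_heckeRep_none τ).symm
  | some j =>
    have := (tendsto_comap (f := im) (x := atTop)).atTop_div_const hp0
    exact this.congr fun τ => (im_mob_heckeRep_some j τ).symm

lemma kmod_isBigO_exp :
    kmod =O[imInfty] (fun τ : ℂ => cexp (Real.pi * I * τ / 2)) := by
  have h1 := (tendsto_kmod_div_exp.isBigO_one ℂ).mul
    (isBigO_refl (fun τ : ℂ => cexp (Real.pi * I * τ / 2)) imInfty)
  simpa using h1

/-- The order of growth of a factor of `heckeCorr` at the cusp `1`. -/
def cuspWeight (p : ℕ) : Option (ZMod p) → ℕ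
  | none => p
  | some _ => 1

lemma kmod_pow_div_isBigO (j : Option (ZMod p)) :
    (fun τ => kmod τ ^ cuspWeight p j / kmod (mob (heckeRep p j) τ)) =O[imInfty] (1 : ℂ → ℂ) := by
  have hp1 : (1 : ℝ) ≤ p := by exact_mod_cast hp.out.one_le
  have h1 := exp_isBigO_kmod.comp_tendsto (tendsto_mob_heckeRep j)
  have h2 := kmod_isBigO_exp.pow (cuspWeight p j)
  have h3 : (fun τ : ℂ => cexp (Real.pi * I * τ / 2) ^ cuspWeight p j) =O[imInfty]
      ((fun τ : ℂ => cexp (Real.pi * I * τ / 2)) ∘ mob (heckeRep p j)) := by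
    refine IsBigO.of_bound 1 ?_
    filter_upwards [eventually_im_pos] with τ hτ
    rw [Function.comp_apply, ← Complex.exp_nat_mul, Complex.norm_exp, Complex.norm_exp, one_mul,
      Real.exp_le_exp]
    have e : ∀ z : ℂ, (Real.pi * I * z / 2).re = -(Real.pi * z.im / 2) := by
      intro z
      rw [show Real.pi * I * z / 2 = ((Real.pi / 2 : ℝ) : ℂ) * (I * z) by push_cast; ring,
        Complex.re_ofReal_mul]
      simp; ring
    rw [show ((cuspWeight p j : ℕ) : ℂ) * (Real.pi * I * τ / 2) =
      ((cuspWeight p j : ℝ) : ℂ) * (Real.pi * I * τ / 2) by push_cast; ring,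
      Complex.re_ofReal_mul, e, e]
    cases j with
    | none => rw [im_mob_heckeRep_none, cuspWeight]; apply le_of_eq; ring
    | some j =>
      rw [im_mob_heckeRep_some, cuspWeight, Nat.cast_one, one_mul, neg_le_neg_iff]
      have : τ.im / p ≤ τ.im := div_le_self hτ.le hp1
      have := Real.pi_pos
      gcongr
  have h4 := (h2.trans (h3.trans h1)).mul
    (isBigO_refl (fun τ => (kmod (mob (heckeRep p j) τ))⁻¹) imInfty)
  simp only [← div_eq_mul_inv, Function.comp_def] at h4
  refine h4.trans (isBigO_of_le _ fun τ => ?_)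
  by_cases h : kmod (mob (heckeRep p j) τ) = 0 <;> simp [h]

lemma kcomp_isBigO_one : kcomp =O[imInfty] (1 : ℂ → ℂ) := tendsto_kcomp_imInfty.isBigO_one ℂ

omit hp in
lemma isBigO_prod_one {ι : Type*} (t : Finset ι) {f : ι → ℂ → ℂ}
    (h : ∀ i ∈ t, f i =O[imInfty] (1 : ℂ → ℂ)) :
    (fun τ => ∏ i ∈ t, f i τ) =O[imInfty] (1 : ℂ → ℂ) := by
  exact (IsBigO.finsetProd h).trans (isBigO_of_le _ fun _ => by simp)

lemma sum_cuspWeight : ∑ j : Option (ZMod p), (cuspWeight p j + 1) = 3 * p + 1 := by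
  simp [Fintype.sum_option, cuspWeight, ZMod.card]; ring

lemma heckeCorr_isBigO_infty (ε : ℤˣ) : heckeCorr p ε =O[imInfty] (1 : ℂ → ℂ) := by
  refine isBigO_prod_one _ fun j _ => ?_
  have h1 : (fun τ => kmod τ ^ 2) =O[imInfty] (1 : ℂ → ℂ) := by
    simpa [Pi.one_def] using kmod_isBigO_one.pow 2
  have h2 : (fun τ => (ε : ℤ) * kmod τ * kmod (mob (heckeRep p j) τ)) =O[imInfty] (1 : ℂ → ℂ) := by
    simpa [Pi.one_def, Function.comp_def] using (kmod_isBigO_one.const_mul_left ((ε : ℤ) : ℂ)).mul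
      (kmod_isBigO_one.comp_tendsto (tendsto_mob_heckeRep j))
  exact h1.sub h2

lemma heckeCorr_isBigO_matS (hp2 : p ≠ 2) (ε : ℤˣ) :
    (fun τ => heckeCorr p ε (mob matS τ)) =O[imInfty] (1 : ℂ → ℂ) := by
  obtain ⟨π, s, -, h⟩ := kmod_heckeRep_mob hp2 det_matS
  refine isBigO_prod_one _ fun j _ => ?_
  have h1 : (fun τ => kcomp τ ^ 2) =O[imInfty] (1 : ℂ → ℂ) := by
    simpa [Pi.one_def] using kcomp_isBigO_one.pow 2
  have h2 : (fun τ => ((ε : ℤ) * (s j : ℤ)) * kcomp τ * kcomp (mob (heckeRep p (π j)) τ))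
      =O[imInfty] (1 : ℂ → ℂ) := by
    simpa [Pi.one_def, Function.comp_def] using
      (kcomp_isBigO_one.const_mul_left (((ε : ℤ) : ℂ) * (s j : ℤ))).mul
      (kcomp_isBigO_one.comp_tendsto (tendsto_mob_heckeRep (π j)))
  refine (h1.sub h2).congr' ?_ EventuallyEq.rfl
  filter_upwards [eventually_im_pos] with τ hτ
  rw [h j τ hτ, kmod_matS hτ, kmod_matS (mob_im_pos (det_heckeRep_pos _) hτ)]
  ring

lemma heckeCorr_isBigO_matTS (hp2 : p ≠ 2) (ε : ℤˣ) :
    (fun τ => heckeCorr p ε (mob matTS τ) * kmod τ ^ (3 * p + 1)) =O[imInfty] (1 : ℂ → ℂ) := by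
  obtain ⟨π, s, -, h⟩ := kmod_heckeRep_mob hp2 det_matTS
  rw [← sum_cuspWeight, ← Equiv.sum_comp π]
  simp only [← prod_pow_eq_pow_sum, heckeCorr, ← prod_mul_distrib]
  refine isBigO_prod_one _ fun j _ => ?_
  have hw : 1 ≤ cuspWeight p (π j) := by
    cases π j with
    | none => exact hp.out.one_le
    | some _ => exact le_rfl
  obtain ⟨w, hw⟩ := Nat.exists_eq_add_of_le' hw
  have hk := kmod_pow_div_isBigO (π j)
  rw [hw] at hk ⊢
  have h1 : (fun τ => - (kcomp τ ^ 2 * kmod τ ^ w)) =O[imInfty] (1 : ℂ → ℂ) := by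
    simpa [Pi.one_def] using ((kcomp_isBigO_one.pow 2).mul (kmod_isBigO_one.pow w)).neg_left
  have h2 : (fun τ => ((ε : ℤ) * (s j : ℤ)) * kcomp τ * kcomp (mob (heckeRep p (π j)) τ) *
      (kmod τ ^ (w + 1) / kmod (mob (heckeRep p (π j)) τ))) =O[imInfty] (1 : ℂ → ℂ) := by
    simpa [Pi.one_def, Function.comp_def] using
      ((kcomp_isBigO_one.const_mul_left (((ε : ℤ) : ℂ) * (s j : ℤ))).mul
      (kcomp_isBigO_one.comp_tendsto (tendsto_mob_heckeRep (π j)))).mul hk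
  refine (h1.add h2).congr' ?_ EventuallyEq.rfl
  filter_upwards [eventually_im_pos] with τ hτ
  have hU := mob_im_pos (det_heckeRep_pos (π j)) hτ
  have hk0 := kmod_ne_zero hτ
  have hk1 := kmod_ne_zero hU
  rw [h j τ hτ, kmod_matTS hτ, kmod_matTS hU]
  generalize mob (heckeRep p (π j)) τ = z at *
  have hI : I ^ 2 = -1 := I_sq
  field_simp
  linear_combination kmod τ ^ (w + 2) *
    (- kcomp τ ^ 2 * kmod z + ε * kmod τ * s j * kcomp τ * kcomp z) * hI

lemma heckeCorr_eq_polynomial (hp2 : p ≠ 2) (ε : ℤˣ) :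
    ∃ R : Polynomial ℂ, R.natDegree ≤ (3 * p + 1) / 2 ∧
      ∀ τ : ℂ, 0 < τ.im → heckeCorr p ε τ = R.eval (kmod τ ^ 2) := by
  have e : 2 * ((3 * p + 1) / 2) = 3 * p + 1 := by
    have := hp.out.eq_two_or_odd; omega
  exact (heckeCorr_invariant hp2 ε).exists_polynomial (differentiableOn_heckeCorr ε)
    (heckeCorr_isBigO_infty ε) (heckeCorr_isBigO_matS hp2 ε)
    (by rw [e]; exact heckeCorr_isBigO_matTS hp2 ε)

end ModularCorrespondence

section Reduction

open Complex

variable {p : ℕ} [hp : Fact p.Prime]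

lemma kmod_eq_kFun_pow {τ : ℂ} (hτ : 0 < τ.im) :
    kmod τ = kFun (cexp (Real.pi * I * τ * ((1 / (2 * p) : ℝ) : ℂ)) ^ p) := by
  have hp0 : (p : ℂ) ≠ 0 := by exact_mod_cast hp.out.ne_zero
  rw [kmod_eq_fun hτ, ← Complex.exp_nat_mul]
  congr 2
  push_cast
  field_simp

/-- If a polynomial in `k ^ 2` has a `p`-integral expansion, then it has `p`-integral coefficients,
and the relation persists after reduction. -/
lemma exists_polynomial_lift (hp2 : p ≠ 2) (A : ValuationSubring ℂ)
    [CharP (IsLocalRing.ResidueField A) p] {R : Polynomial ℂ} {G : PowerSeries A} {g : ℂ → ℂ}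
    (hG : HasExp (PowerSeries.map A.subtype G) g)
    (h : ∀ τ : ℂ, 0 < τ.im →
      g (cexp (Real.pi * I * τ * ((1 / (2 * p) : ℝ) : ℂ))) = R.eval (kmod τ ^ 2)) :
    ∃ Q : Polynomial A, Q.map A.subtype = R ∧
      Polynomial.aeval (PowerSeries.map (Int.castRingHom (IsLocalRing.ResidueField A))
        kSeries ^ (2 * p)) (Q.map (IsLocalRing.residue A)) =
          PowerSeries.map (IsLocalRing.residue A) G := by
  set L : PowerSeries A :=
    PowerSeries.map (Int.castRingHom A) ((kSeries.expand p hp.out.ne_zero) ^ 2) with hL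
  have hLr : PowerSeries.map (IsLocalRing.residue A) L =
      PowerSeries.map (Int.castRingHom (IsLocalRing.ResidueField A)) kSeries ^ (2 * p) := by
    rw [hL, PowerSeries.map_residue_int, map_pow, PowerSeries.map_int_expand, ← pow_mul, mul_comm]
  have hLc : HasExp (PowerSeries.map A.subtype L) (fun s => kFun (s ^ p) ^ 2) := by
    rw [hL, PowerSeries.map_subtype_int, map_pow, toComplexSeries, PowerSeries.map_expand]
    exact (hasExp_k.expand p hp.out.ne_zero).pow 2
  have hc : (0 : ℝ) < 1 / (2 * p) := by
    have : (0 : ℝ) < p := by exact_mod_cast hp.out.pos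
    positivity
  have e : Polynomial.aeval (PowerSeries.map A.subtype L) R = PowerSeries.map A.subtype G := by
    refine (hLc.aeval R).unique hG fun s hs0 hs1 => ?_
    obtain ⟨τ, hτ, rfl⟩ := exists_exp_eq hs0 hs1 hc
    rw [h τ hτ, kmod_eq_kFun_pow (p := p) hτ]
  obtain ⟨Q, hQ, hQ2⟩ := A.exists_lift (L := L) (C := G)
    (by rw [hLr, map_pow]
        have : PowerSeries.constantCoeff (PowerSeries.map
          (Int.castRingHom (IsLocalRing.ResidueField A)) kSeries) = 0 := by
          rw [← PowerSeries.coeff_zero_eq_constantCoeff_apply, PowerSeries.coeff_map,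
            PowerSeries.coeff_zero_eq_constantCoeff_apply, constantCoeff_kSeries, map_zero]
        rw [this, zero_pow (mul_ne_zero two_ne_zero hp.out.ne_zero)])
    (by rw [hLr]; exact pow_ne_zero _ (map_kSeries_ne_zero hp2 _)) e
  refine ⟨Q, hQ, ?_⟩
  rw [← hLr, ← PowerSeries.map_aeval, hQ2]

lemma aeval_kSeries_injective (hp2 : p ≠ 2) {κ : Type*} [Field κ] [CharP κ p] {P Q : Polynomial κ}
    {m : ℕ} (hm : m ≠ 0)
    (h : Polynomial.aeval (PowerSeries.map (Int.castRingHom κ) kSeries ^ m) P =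
      Polynomial.aeval (PowerSeries.map (Int.castRingHom κ) kSeries ^ m) Q) : P = Q := by
  rw [← sub_eq_zero]
  refine PowerSeries.aeval_injective (L := PowerSeries.map (Int.castRingHom κ) kSeries ^ m) ?_
    (pow_ne_zero _ (map_kSeries_ne_zero hp2 κ)) ?_
  · rw [map_pow, ← PowerSeries.coeff_zero_eq_constantCoeff_apply, PowerSeries.coeff_map,
      PowerSeries.coeff_zero_eq_constantCoeff_apply, constantCoeff_kSeries, map_zero, zero_pow hm]
  · rw [map_sub, h, sub_self]

/-- The expansion variable of `mob (heckeRep p j) τ`. -/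
lemma exp_mob_heckeRep_some (j : ZMod p) (τ : ℂ) :
    cexp (Real.pi * I * mob (heckeRep p (some j)) τ / 2) =
      cexp (2 * Real.pi * I / p) ^ j.val * cexp (Real.pi * I * τ * ((1 / (2 * p) : ℝ) : ℂ)) := by
  have hp0 : (p : ℂ) ≠ 0 := by exact_mod_cast hp.out.ne_zero
  rw [mob_heckeRep_some, ← Complex.exp_nat_mul, ← Complex.exp_add]
  congr 1
  push_cast
  field_simp
  ring

lemma exp_mob_heckeRep_none (τ : ℂ) :
    cexp (Real.pi * I * mob (heckeRep p none) τ / 2) =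
      cexp (Real.pi * I * τ * ((1 / (2 * p) : ℝ) : ℂ)) ^ (p * p) := by
  have hp0 : (p : ℂ) ≠ 0 := by exact_mod_cast hp.out.ne_zero
  rw [mob_heckeRep_none, ← Complex.exp_nat_mul]
  congr 1
  push_cast
  field_simp

lemma exists_residue_root (A : ValuationSubring ℂ) [CharP (IsLocalRing.ResidueField A) p] :
    ∃ z : A, (z : ℂ) = cexp (2 * Real.pi * I / p) ∧ IsLocalRing.residue A z = 1 := by
  have hp0 : (p : ℂ) ≠ 0 := by exact_mod_cast hp.out.ne_zero
  apply A.exists_residue_eq_one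
  rw [← Complex.exp_nat_mul, show (p : ℂ) * (2 * Real.pi * I / p) = 2 * Real.pi * I by field_simp,
    Complex.exp_two_pi_mul_I]

lemma PowerSeries.map_rescale' {A B : Type*} [CommRing A] [CommRing B] (f : A →+* B) (z : A)
    (K : PowerSeries A) : PowerSeries.map f (PowerSeries.rescale z K) =
      PowerSeries.rescale (f z) (PowerSeries.map f K) := by
  ext n
  simp [PowerSeries.coeff_rescale]

/-- The expansion of `K` at `mob (heckeRep p j) τ`. -/
noncomputable def heckeSeries {A : Type*} [CommRing A] (z : A) (K : PowerSeries ℤ) :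
    Option (ZMod p) → PowerSeries A
  | none => PowerSeries.map (Int.castRingHom A)
      (K.expand (p * p) (mul_ne_zero hp.out.ne_zero hp.out.ne_zero))
  | some j => PowerSeries.rescale (z ^ j.val) (PowerSeries.map (Int.castRingHom A) K)

lemma hasExp_heckeSeries (A : ValuationSubring ℂ) {z : A}
    (hz : (z : ℂ) = cexp (2 * Real.pi * I / p)) {K : PowerSeries ℤ} {F f : ℂ → ℂ}
    (hK : HasExp (toComplexSeries K) F)
    (hf : ∀ τ : ℂ, 0 < τ.im → f τ = F (cexp (Real.pi * I * τ / 2))) (j : Option (ZMod p)) :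
    ∃ g, HasExp (PowerSeries.map A.subtype (heckeSeries z K j)) g ∧ ∀ τ : ℂ, 0 < τ.im →
      g (cexp (Real.pi * I * τ * ((1 / (2 * p) : ℝ) : ℂ))) = f (mob (heckeRep p j) τ) := by
  have hp0 : (p : ℂ) ≠ 0 := by exact_mod_cast hp.out.ne_zero
  cases j with
  | none =>
    refine ⟨fun s => F (s ^ (p * p)), ?_, fun τ hτ => ?_⟩
    · rw [heckeSeries, PowerSeries.map_subtype_int, toComplexSeries, PowerSeries.map_expand]
      exact hK.expand _ _
    · rw [hf _ (mob_im_pos (det_heckeRep_pos _) hτ), exp_mob_heckeRep_none]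
  | some j =>
    refine ⟨fun s => F (cexp (2 * Real.pi * I / p) ^ j.val * s), ?_, fun τ hτ => ?_⟩
    · rw [heckeSeries, PowerSeries.map_rescale', PowerSeries.map_subtype_int]
      have : A.subtype (z ^ j.val) = cexp (2 * Real.pi * I / p) ^ j.val := by
        rw [map_pow]; exact congrArg (· ^ j.val) hz
      rw [this]
      refine hK.rescale _ ?_
      rw [norm_pow, Complex.norm_exp]
      simp [Complex.div_natCast_re]
    · rw [hf _ (mob_im_pos (det_heckeRep_pos _) hτ), exp_mob_heckeRep_some]

lemma map_heckeSeries_none (A : ValuationSubring ℂ) [CharP (IsLocalRing.ResidueField A) p] (z : A)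
    (K : PowerSeries ℤ) :
    PowerSeries.map (IsLocalRing.residue A) (heckeSeries (p := p) z K none) =
      PowerSeries.map (Int.castRingHom (IsLocalRing.ResidueField A)) K ^ (p * p) := by
  rw [heckeSeries, PowerSeries.map_residue_int,
    PowerSeries.expand_mul (hp := hp.out.ne_zero) (hq := hp.out.ne_zero),
    PowerSeries.map_int_expand, PowerSeries.map_int_expand, pow_mul]

lemma map_heckeSeries_some (A : ValuationSubring ℂ) {z : A}
    (hz : IsLocalRing.residue A z = 1)
    (K : PowerSeries ℤ) (j : ZMod p) :
    PowerSeries.map (IsLocalRing.residue A) (heckeSeries (p := p) z K (some j)) =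
      PowerSeries.map (Int.castRingHom (IsLocalRing.ResidueField A)) K := by
  rw [heckeSeries, PowerSeries.map_rescale', PowerSeries.map_residue_int, map_pow, hz, one_pow,
    PowerSeries.rescale_one, RingHom.id_apply]

open Polynomial in
/-- Kronecker's congruence for the elliptic modulus. -/
theorem exists_heckeCorr_polynomial (hp2 : p ≠ 2) (A : ValuationSubring ℂ)
    [CharP (IsLocalRing.ResidueField A) p] (ε : ℤˣ) :
    ∃ Q : A[X], (∀ τ : ℂ, 0 < τ.im → heckeCorr p ε τ = (Q.map A.subtype).eval (kmod τ ^ 2)) ∧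
      Q.map (IsLocalRing.residue A) =
        - ((ε : ℤ) : (IsLocalRing.ResidueField A)[X]) * X ^ ((p + 3) / 2) *
          (1 - ((ε : ℤ) : (IsLocalRing.ResidueField A)[X]) * X ^ (p / 2)) ^ 2 ∧
      Q.natDegree ≤ (3 * p + 1) / 2 := by
  obtain ⟨R, hRdeg, hR⟩ := heckeCorr_eq_polynomial hp2 ε
  obtain ⟨z, hz, hz1⟩ := exists_residue_root (p := p) A
  choose g hg hg' using hasExp_heckeSeries (p := p) A hz hasExp_k (fun τ hτ => kmod_eq_fun hτ)
  set κ := IsLocalRing.ResidueField A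
  set E : PowerSeries A := PowerSeries.map (Int.castRingHom A) (kSeries.expand p hp.out.ne_zero)
    with hE
  set G : PowerSeries A := ∏ j : Option (ZMod p), (E ^ 2 - ((ε : ℤ) : PowerSeries A) * E * heckeSeries z kSeries j)
    with hG
  have hEc : HasExp (PowerSeries.map A.subtype E) (fun s => kFun (s ^ p)) := by
    rw [hE, PowerSeries.map_subtype_int, toComplexSeries, PowerSeries.map_expand]
    exact hasExp_k.expand p hp.out.ne_zero
  have hGc : HasExp (PowerSeries.map A.subtype G)
      (fun s => ∏ j : Option (ZMod p), (kFun (s ^ p) ^ 2 - ((ε : ℤ) : ℂ) * kFun (s ^ p) * g j s)) := by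
    rw [hG, map_prod]
    refine HasExp.prod _ fun j _ => ?_
    rw [map_sub, map_mul, map_mul, map_pow, map_intCast]
    have := HasExp.C ((ε : ℤ) : ℂ)
    rw [map_intCast] at this
    exact (hEc.pow 2).sub ((this.mul hEc).mul (hg j))
  obtain ⟨Q, hQ, hQ2⟩ := exists_polynomial_lift hp2 A hGc (R := R) fun τ hτ => by
    rw [← hR τ hτ, heckeCorr]
    refine prod_congr rfl fun j _ => ?_
    rw [hg' j τ hτ, ← kmod_eq_kFun_pow hτ]
  refine ⟨Q, fun τ hτ => by rw [hR τ hτ, hQ], ?_, ?_⟩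
  · apply aeval_kSeries_injective hp2 (m := 2 * p) (mul_ne_zero two_ne_zero hp.out.ne_zero)
    rw [hQ2, hG, map_prod]
    set K := PowerSeries.map (Int.castRingHom κ) kSeries with hK
    have hEr : PowerSeries.map (IsLocalRing.residue A) E = K ^ p := by
      rw [hE, PowerSeries.map_residue_int, PowerSeries.map_int_expand]
    have hε : ∀ B : Type _, [CommRing B] → (((ε : ℤ) : B)) ^ p = (ε : ℤ) := by
      intro B _
      have hodd : Odd p := hp.out.odd_of_ne_two hp2
      rcases Int.units_eq_one_or ε with h | h <;> simp [h, hodd.neg_one_pow]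
    have hε2 : (((ε : ℤ) : PowerSeries κ)) ^ 2 = 1 := by
      rcases Int.units_eq_one_or ε with h | h <;> simp [h]
    simp only [map_sub, map_mul, map_pow, map_intCast, hEr, Fintype.prod_option,
      map_heckeSeries_none, map_heckeSeries_some A hz1, prod_const, card_univ, ZMod.card,
      aeval_X, map_neg, map_one]
    have : CharP (PowerSeries κ) p := charP_of_injective_algebraMap
      (algebraMap κ (PowerSeries κ)).injective p
    have e1 : ((K ^ p) ^ 2 - ((ε : ℤ) : PowerSeries κ) * K ^ p * K) ^ p =
        K ^ (p * p) * (K ^ (p * p) - (ε : ℤ) * K ^ p) := by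
      rw [sub_pow_char, mul_pow, mul_pow, hε]
      ring
    rw [e1]
    obtain ⟨n, hn⟩ : ∃ n, p = 2 * n + 1 := (hp.out.odd_of_ne_two hp2)
    have h1 : (p + 3) / 2 = n + 2 := by omega
    have h2 : p / 2 = n := by omega
    rw [h1, h2, ← pow_mul, ← pow_mul]
    have h3 : 2 * p * (n + 2) = p * p + 3 * p := by subst hn; ring
    have h4 : K ^ (p * p) = K ^ (2 * p * n) * K ^ p := by
      rw [← pow_add]; congr 1; conv_lhs => rw [hn]
      conv_rhs => rw [hn]
      ring
    rw [h3, pow_add, h4]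
    linear_combination (- K ^ (p * 4) * K ^ (p * n * 4) +
      K ^ (p * 4) * K ^ (p * n * 6) * ((ε : ℤ) : PowerSeries κ)) * hε2
  · rw [← natDegree_map_eq_of_injective (f := A.subtype) Subtype.val_injective, hQ]
    exact hRdeg

end Reduction

section HasseInvariant

open Complex

/-- `θ₃` as a power series in `s = e^{πiτ/2}`. -/
noncomputable def thetaSeries : PowerSeries ℤ := theta3Series.expand 2 two_ne_zero

/-- `θ₃⁻¹` as a power series in `s = e^{πiτ/2}`. -/
noncomputable def thetaSeriesInv : PowerSeries ℤ := theta3SeriesInv.expand 2 two_ne_zero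

lemma thetaSeries_mul_inv : thetaSeries * thetaSeriesInv = 1 := by
  rw [thetaSeries, thetaSeriesInv, ← map_mul, theta3Series_mul_inv, map_one]

lemma hasExp_thetaSeries : HasExp (toComplexSeries thetaSeries) (fun s => theta3Fun (s ^ 2)) := by
  rw [thetaSeries, toComplexSeries, PowerSeries.map_expand]
  exact hasExp_theta3.expand 2 two_ne_zero

lemma hasExp_thetaSeriesInv :
    HasExp (toComplexSeries thetaSeriesInv) (fun s => (theta3Fun (s ^ 2))⁻¹) := by
  rw [thetaSeriesInv, toComplexSeries, PowerSeries.map_expand]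
  exact hasExp_theta3_inv.expand 2 two_ne_zero

lemma theta3_eq_fun_sq {τ : ℂ} (hτ : 0 < τ.im) :
    theta3 τ = theta3Fun (cexp (Real.pi * I * τ / 2) ^ 2) := by
  rw [theta3_eq_fun hτ, ← Complex.exp_nat_mul]
  congr 2; push_cast; ring

lemma exp_half_sq (τ : ℂ) :
    cexp (Real.pi * I * τ / 2) ^ 2 = cexp (Real.pi * I * (2 * τ) / 2) := by
  rw [← Complex.exp_nat_mul]; congr 1; push_cast; ring

lemma toComplexSeries_injective : Function.Injective toComplexSeries :=
  PowerSeries.map_injective' Int.cast_injective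

lemma HasExp.int_unique {A B : PowerSeries ℤ} {F G : ℂ → ℂ} (hA : HasExp (toComplexSeries A) F)
    (hB : HasExp (toComplexSeries B) G)
    (h : ∀ τ : ℂ, 0 < τ.im → F (cexp (Real.pi * I * τ / 2)) = G (cexp (Real.pi * I * τ / 2))) :
    A = B := by
  refine toComplexSeries_injective (hA.unique hB fun s h0 h1 => ?_)
  obtain ⟨τ, hτ, rfl⟩ := exists_exp_eq h0 h1 (c := 1 / 2) (by norm_num)
  convert h τ hτ using 2 <;> · congr 1; push_cast; ring

lemma theta3_sq_eq_kmod {τ : ℂ} (hτ : 0 < τ.im) :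
    theta3 τ ^ 2 = theta3 (2 * τ) ^ 2 * (1 + kmod (2 * τ)) := by
  have h2 : 0 < (2 * τ).im := by simpa using hτ
  have := theta3_ne_zero h2
  rw [theta3_sq hτ, kmod]; field_simp

lemma kmod_landen {τ : ℂ} (hτ : 0 < τ.im) :
    kmod τ ^ 2 * (1 + kmod (2 * τ)) ^ 2 = 4 * kmod (2 * τ) := by
  have h2 : 0 < (2 * τ).im := by simpa using hτ
  have h3 := theta3_ne_zero h2
  have h4 := theta3_ne_zero hτ
  have h5 := theta3_sq hτ
  rw [kmod, kmod, theta2_sq hτ, h5]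
  rw [← pow_ne_zero_iff two_ne_zero, h5] at h4
  field_simp
  ring

lemma thetaSeries_sq : thetaSeries ^ 2 =
    (thetaSeries.expand 2 two_ne_zero) ^ 2 * (1 + kSeries.expand 2 two_ne_zero) := by
  have h1 := hasExp_thetaSeries.expand 2 two_ne_zero
  have h2 := hasExp_k.expand 2 two_ne_zero
  rw [toComplexSeries, ← PowerSeries.map_expand] at h1 h2
  refine HasExp.int_unique (by rw [map_pow]; exact hasExp_thetaSeries.pow 2)
    (by rw [map_mul, map_pow, map_add, map_one]; exact (h1.pow 2).mul (HasExp.one.add h2))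
    fun τ hτ => ?_
  have hτ2 : 0 < (2 * τ).im := by simpa using hτ
  rw [← theta3_eq_fun_sq hτ, exp_half_sq τ, ← theta3_eq_fun_sq hτ2, ← kmod_eq_fun hτ2,
    theta3_sq_eq_kmod hτ]

lemma kSeries_landen : kSeries ^ 2 * (1 + kSeries.expand 2 two_ne_zero) ^ 2 =
    4 * kSeries.expand 2 two_ne_zero := by
  have h2 := hasExp_k.expand 2 two_ne_zero
  rw [toComplexSeries, ← PowerSeries.map_expand] at h2
  have h4 := HasExp.C 4
  rw [map_ofNat] at h4
  refine HasExp.int_unique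
    (by rw [map_mul, map_pow, map_pow, map_add, map_one]
        exact (hasExp_k.pow 2).mul ((HasExp.one.add h2).pow 2))
    (by rw [map_mul, map_ofNat]; exact h4.mul h2)
    fun τ hτ => ?_
  have hτ2 : 0 < (2 * τ).im := by simpa using hτ
  rw [exp_half_sq τ, ← kmod_eq_fun hτ2, ← kmod_eq_fun hτ, kmod_landen hτ]

lemma PowerSeries.eq_C_of_expand_two_eq {R : Type*} [CommRing R] {y : PowerSeries R}
    (h : y.expand 2 two_ne_zero = y) : y = PowerSeries.C (PowerSeries.constantCoeff y) := by
  have key : ∀ n, 0 < n → PowerSeries.coeff n y = 0 := by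
    intro n
    induction n using Nat.strong_induction_on with
    | _ n ih =>
      intro hn
      rw [← h, PowerSeries.coeff_expand]
      split_ifs with h2
      · exact ih _ (by omega) (by omega)
      · rfl
  ext n
  rcases Nat.eq_zero_or_pos n with rfl | hn
  · simp
  · rw [key n hn, PowerSeries.coeff_C, if_neg hn.ne']

variable {p : ℕ} [hp : Fact p.Prime]

omit hp in
lemma aeval_map_hassePoly {κ R : Type*} [CommRing κ] [CommRing R] [Algebra κ R] (p : ℕ) (x : R) :
    Polynomial.aeval x ((hassePoly p).map (Int.castRingHom κ)) =
      ∑ i ∈ range (p / 2 + 1), ((p / 2).choose i : R) ^ 2 * x ^ i := by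
  simp [hassePoly, Polynomial.map_sum]

/-- The Hasse invariant is the reduction of `θ₃^{-2(p-1)}`. -/
lemma thetaSeries_pow_mul_hassePoly (hp2 : p ≠ 2) (κ : Type*) [Field κ] [CharP κ p] :
    PowerSeries.map (Int.castRingHom κ) thetaSeries ^ (4 * (p / 2)) *
      Polynomial.aeval (PowerSeries.map (Int.castRingHom κ) kSeries ^ 2)
        ((hassePoly p).map (Int.castRingHom κ)) = 1 := by
  have : CharP (PowerSeries κ) p := charP_of_injective_algebraMap
      (algebraMap κ (PowerSeries κ)).injective p
  set f := PowerSeries.map (Int.castRingHom κ)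
  set y := f thetaSeries ^ (4 * (p / 2)) * Polynomial.aeval (f kSeries ^ 2)
    ((hassePoly p).map (Int.castRingHom κ)) with hy
  have h1 := congrArg f thetaSeries_sq
  have h2 := congrArg f kSeries_landen
  simp only [map_mul, map_pow, map_add, map_one, map_ofNat, f, PowerSeries.map_expand] at h1 h2
  change f thetaSeries ^ 2 = ((f thetaSeries).expand 2 two_ne_zero) ^ 2 *
    (1 + (f kSeries).expand 2 two_ne_zero) at h1
  change f kSeries ^ 2 * (1 + (f kSeries).expand 2 two_ne_zero) ^ 2 =
    4 * (f kSeries).expand 2 two_ne_zero at h2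
  have hexp : y.expand 2 two_ne_zero = y := by
    have h5 := hassePoly_landen hp2 ((f kSeries).expand 2 two_ne_zero)
    rw [aeval_hassePoly] at h5
    rw [hy, aeval_map_hassePoly, map_mul, map_pow, map_sum]
    simp only [map_mul, map_pow, map_natCast]
    have e0 : f thetaSeries ^ (4 * (p / 2)) =
        (f thetaSeries).expand 2 two_ne_zero ^ (4 * (p / 2)) *
          ((1 + (f kSeries).expand 2 two_ne_zero) ^ 2) ^ (p / 2) := by
      rw [pow_mul, show f thetaSeries ^ 4 = (f thetaSeries ^ 2) ^ 2 by ring, h1, pow_mul _ 4,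
        ← mul_pow]
      congr 1; ring
    rw [← h5, e0, ← h2, mul_assoc]
    congr 1
    rw [mul_sum]
    refine sum_congr rfl fun i hi => ?_
    have hi : i ≤ p / 2 := by simpa [Nat.lt_succ_iff] using hi
    obtain ⟨d, hd⟩ := Nat.exists_eq_add_of_le hi
    have : p / 2 - i = d := by omega
    rw [this, hd, mul_pow]
    ring
  have h3 := PowerSeries.eq_C_of_expand_two_eq hexp
  have hf : ∀ K : PowerSeries ℤ, PowerSeries.constantCoeff (f K) =
      ((PowerSeries.constantCoeff K : ℤ) : κ) := by
    intro K
    rw [← PowerSeries.coeff_zero_eq_constantCoeff_apply, PowerSeries.coeff_map,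
      PowerSeries.coeff_zero_eq_constantCoeff_apply]; rfl
  have h4 : PowerSeries.constantCoeff y = 1 := by
    rw [hy, map_mul, map_pow, hf, thetaSeries, PowerSeries.constantCoeff_expand,
      constantCoeff_theta3Series, aeval_map_hassePoly, map_sum, sum_eq_single 0]
    · simp
    · intro i _ hi
      rw [map_mul, map_pow, map_pow, map_pow, hf, constantCoeff_kSeries]
      simp [hi]
    · simp
  rw [h3, h4, map_one]

end HasseInvariant

section WeightCorrespondence

open Complex Matrix Asymptotics Filter Topology

variable {p : ℕ} [hp : Fact p.Prime]

/-- The weight `2` slash action on `θ₃ ^ 4`. -/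
noncomputable def thetaSlash (σ : Matrix (Fin 2) (Fin 2) ℤ) (τ : ℂ) : ℂ :=
  theta3 (mob σ τ) ^ 4 / den σ τ ^ 2

/-- The ratio of `θ₃ ^ 4` and its weight `2` transform under `heckeRep p j`. -/
noncomputable def heckeWeight (p : ℕ) (j : Option (ZMod p)) (τ : ℂ) : ℂ :=
  den (heckeRep p j) τ ^ 2 * (theta3 τ ^ 4 / theta3 (mob (heckeRep p j) τ) ^ 4)

lemma heckeWeight_mob (hp2 : p ≠ 2) {σ : Matrix (Fin 2) (Fin 2) ℤ} (hσ : σ.det = 1) :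
    ∃ π : Equiv.Perm (Option (ZMod p)), ∀ j τ, 0 < τ.im →
      heckeWeight p j (mob σ τ) = den (heckeRep p (π j)) τ ^ 2 *
        (thetaSlash σ τ / thetaSlash σ (mob (heckeRep p (π j)) τ)) := by
  obtain ⟨π, γ, h⟩ := exists_perm_heckeRep hp2 hσ
  refine ⟨π, fun j τ hτ => ?_⟩
  obtain ⟨h3, h1, h4⟩ := h j
  have hσ' : 0 < σ.det := by rw [hσ]; norm_num
  have hγ' : 0 < (γ j).det := by rw [h1]; norm_num
  have hU := mob_im_pos (det_heckeRep_pos (π j)) hτ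
  have hσU := mob_im_pos hσ' hU
  have e1 : den (heckeRep p j) (mob σ τ) * den σ τ =
      den (γ j) (mob σ (mob (heckeRep p (π j)) τ)) * den σ (mob (heckeRep p (π j)) τ) *
        den (heckeRep p (π j)) τ := by
    rw [← den_mul _ hσ' hτ, h4, den_mul _ (det_heckeRep_pos _) hτ, den_mul _ hσ' hU]
  have e2 : theta3 (mob (heckeRep p j) (mob σ τ)) ^ 4 =
      den (γ j) (mob σ (mob (heckeRep p (π j)) τ)) ^ 2 *
        theta3 (mob σ (mob (heckeRep p (π j)) τ)) ^ 4 := by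
    rw [← mob_mul _ hσ' hτ, h4, mob_mul _ (det_heckeRep_pos _) hτ, mob_mul _ hσ' hU,
      theta3_mob h3 h1 hσU]
  have n1 := den_ne_zero hσ' hτ
  have n2 := den_ne_zero hγ' hσU
  have n3 := den_ne_zero hσ' hU
  have n4 := theta3_ne_zero hσU
  rw [heckeWeight, e2, eq_div_of_mul_eq n1 e1, thetaSlash, thetaSlash]
  field_simp

lemma thetaSlash_gammaTwo {γ : Matrix (Fin 2) (Fin 2) ℤ} (h2 : IsOneModTwo γ) (h1 : γ.det = 1)
    {τ : ℂ} (hτ : 0 < τ.im) : thetaSlash γ τ = theta3 τ ^ 4 := by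
  have := den_ne_zero (M := γ) (by rw [h1]; norm_num) hτ
  rw [thetaSlash, theta3_mob h2 h1 hτ]; field_simp

lemma thetaSlash_matS {τ : ℂ} (hτ : 0 < τ.im) : thetaSlash matS τ = - theta3 τ ^ 4 := by
  have h0 : τ ≠ 0 := by rintro rfl; simp at hτ
  have e : den matS τ = τ := by simp [den, matS]
  rw [thetaSlash, e, mob_matS, theta3_neg_inv_pow_four hτ]; field_simp

lemma thetaSlash_matTS {τ : ℂ} (hτ : 0 < τ.im) : thetaSlash matTS τ = - theta2 τ ^ 4 := by
  have h0 : τ ≠ 0 := by rintro rfl; simp at hτ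
  have e : den matTS τ = τ := by simp [den, matTS]
  have e2 : (((-I * τ) ^ (1 / 2 : ℂ)) ^ 2) ^ 2 = - τ ^ 2 := by
    rw [cpow_half_sq, mul_pow, neg_sq, I_sq]; ring
  rw [thetaSlash, e, mob_matTS hτ, theta3_add_one, theta4_neg_inv hτ, mul_pow,
    show ((-I * τ) ^ (1 / 2 : ℂ)) ^ 4 = (((-I * τ) ^ (1 / 2 : ℂ)) ^ 2) ^ 2 by ring, e2]
  field_simp

/-- The characteristic polynomial, at `e`, of the weights of the Hecke correspondence. -/
noncomputable def etaCorr (p : ℕ) [Fact p.Prime] (e τ : ℂ) : ℂ :=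
  ∏ j : Option (ZMod p), (e - heckeWeight p j τ)

lemma etaCorr_mob (hp2 : p ≠ 2) {σ : Matrix (Fin 2) (Fin 2) ℤ} (hσ : σ.det = 1) (e : ℂ) {τ : ℂ}
    (hτ : 0 < τ.im) : etaCorr p e (mob σ τ) = ∏ j : Option (ZMod p),
      (e - den (heckeRep p j) τ ^ 2 *
        (thetaSlash σ τ / thetaSlash σ (mob (heckeRep p j) τ))) := by
  obtain ⟨π, h⟩ := heckeWeight_mob hp2 hσ
  refine Eq.trans (prod_congr rfl fun j _ => ?_) (Equiv.prod_comp π _)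
  rw [h j τ hτ]

lemma etaCorr_invariant (hp2 : p ≠ 2) (e : ℂ) : IsGammaTwoInvariant (etaCorr p e) := by
  intro γ h2 h1 τ hτ
  rw [etaCorr_mob hp2 h1 e hτ, etaCorr]
  refine prod_congr rfl fun j _ => ?_
  rw [thetaSlash_gammaTwo h2 h1 hτ,
    thetaSlash_gammaTwo h2 h1 (mob_im_pos (det_heckeRep_pos _) hτ), heckeWeight]

lemma etaCorr_matS (hp2 : p ≠ 2) (e : ℂ) {τ : ℂ} (hτ : 0 < τ.im) :
    etaCorr p e (mob matS τ) = etaCorr p e τ := by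
  rw [etaCorr_mob hp2 det_matS e hτ, etaCorr]
  refine prod_congr rfl fun j _ => ?_
  rw [thetaSlash_matS hτ, thetaSlash_matS (mob_im_pos (det_heckeRep_pos _) hτ), neg_div_neg_eq,
    heckeWeight]

lemma differentiableOn_etaCorr (e : ℂ) : DifferentiableOn ℂ (etaCorr p e) {τ | 0 < τ.im} := by
  intro τ hτ
  refine DifferentiableAt.differentiableWithinAt ?_
  unfold etaCorr
  refine DifferentiableAt.fun_finsetProd fun j _ => ?_
  have hU := mob_im_pos (det_heckeRep_pos j) hτ
  have h1 : DifferentiableAt ℂ (fun τ => theta3 (mob (heckeRep p j) τ)) τ :=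
    DifferentiableAt.comp τ (differentiableAt_theta3 hU) (differentiableAt_mob (det_heckeRep_pos j) hτ)
  refine DifferentiableAt.const_sub (DifferentiableAt.mul ?_ ?_) _
  · exact ((differentiableAt_id.const_mul _).add_const _).pow 2
  · exact ((differentiableAt_theta3 hτ).pow 4).div (h1.pow 4) (pow_ne_zero _ (theta3_ne_zero hU))

lemma isBigO_den_heckeRep (j : Option (ZMod p)) :
    (fun τ => den (heckeRep p j) τ ^ 2) =O[imInfty] (1 : ℂ → ℂ) := by
  cases j with
  | none => simpa [den, heckeRep, Pi.one_def] using! isBigO_refl (fun _ : ℂ => (1 : ℂ)) imInfty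
  | some j =>
    have := isBigO_const_const ((p : ℂ) ^ 2) (one_ne_zero (α := ℂ)) imInfty
    simpa [den, heckeRep, Pi.one_def] using! this

lemma theta_ratio_isBigO (j : Option (ZMod p)) :
    (fun τ => theta3 τ ^ 4 / theta3 (mob (heckeRep p j) τ) ^ 4) =O[imInfty] (1 : ℂ → ℂ) := by
  have h1 := (tendsto_theta3_imInfty.pow 4).div
    ((tendsto_theta3_imInfty.comp (tendsto_mob_heckeRep (p := p) j)).pow 4) (by simp)
  exact h1.isBigO_one ℂ

lemma etaCorr_isBigO_infty (e : ℂ) : etaCorr p e =O[imInfty] (1 : ℂ → ℂ) := by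
  refine isBigO_prod_one _ fun j _ => ?_
  have h1 : (fun _ : ℂ => e) =O[imInfty] (1 : ℂ → ℂ) := isBigO_const_const e one_ne_zero imInfty
  have h2 := (isBigO_den_heckeRep j).mul (theta_ratio_isBigO j)
  simp only [Pi.one_apply, mul_one] at h2
  exact h1.sub h2

/-- The order of growth of a factor of `etaCorr` at the cusp `1`. -/
def etaWeight (p : ℕ) : Option (ZMod p) → ℕ
  | none => 2 * (p - 1)
  | some _ => 0

lemma sum_etaWeight : ∑ j : Option (ZMod p), etaWeight p j = 2 * (p - 1) := by
  simp [Fintype.sum_option, etaWeight]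

lemma etaCorr_isBigO_matTS (hp2 : p ≠ 2) (e : ℂ) :
    (fun τ => etaCorr p e (mob matTS τ) * kmod τ ^ (2 * (p - 1))) =O[imInfty] (1 : ℂ → ℂ) := by
  have key : (fun τ => ∏ j : Option (ZMod p), (e * kmod τ ^ etaWeight p j -
      den (heckeRep p j) τ ^ 2 * ((theta3 τ ^ 4 / theta3 (mob (heckeRep p j) τ) ^ 4) *
      (kmod τ ^ cuspWeight p j / kmod (mob (heckeRep p j) τ)) ^ 2))) =O[imInfty] (1 : ℂ → ℂ) := by
    refine isBigO_prod_one _ fun j _ => ?_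
    have h1 := (kmod_isBigO_one.pow (etaWeight p j)).const_mul_left e
    have h2 := (isBigO_den_heckeRep j).mul ((theta_ratio_isBigO j).mul
      ((kmod_pow_div_isBigO j).pow 2))
    simp only [Pi.one_apply, mul_one, one_pow] at h1 h2
    exact h1.sub h2
  refine key.congr' ?_ EventuallyEq.rfl
  filter_upwards [eventually_im_pos] with τ hτ
  rw [etaCorr_mob hp2 det_matTS e hτ, ← sum_etaWeight, ← prod_pow_eq_pow_sum, ← prod_mul_distrib]
  refine prod_congr rfl fun j _ => ?_
  have hU := mob_im_pos (det_heckeRep_pos j) hτ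
  rw [thetaSlash_matTS hτ, thetaSlash_matTS hU, neg_div_neg_eq]
  have e1 : kmod τ ^ (2 * cuspWeight p j) = kmod τ ^ 2 * kmod τ ^ etaWeight p j := by
    rw [← pow_add]
    congr 1
    cases j with
    | none => have := hp.out.one_le; simp only [cuspWeight, etaWeight]; omega
    | some j => simp [cuspWeight, etaWeight]
  have h3 := theta3_ne_zero hU
  have h4 := theta2_ne_zero hU
  have h5 := theta3_ne_zero hτ
  have e2 : theta2 τ ^ 4 / theta2 (mob (heckeRep p j) τ) ^ 4 =
      (theta3 τ ^ 4 / theta3 (mob (heckeRep p j) τ) ^ 4) *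
        (kmod τ ^ 2 / kmod (mob (heckeRep p j) τ) ^ 2) := by
    rw [kmod, kmod]; field_simp
  rw [e2, div_pow, ← pow_mul, mul_comm (cuspWeight p j), e1]
  ring

lemma etaCorr_eq_polynomial (hp2 : p ≠ 2) (e : ℂ) :
    ∃ R : Polynomial ℂ, ∀ τ : ℂ, 0 < τ.im → etaCorr p e τ = R.eval (kmod τ ^ 2) := by
  obtain ⟨R, -, h⟩ := (etaCorr_invariant hp2 e).exists_polynomial (differentiableOn_etaCorr e)
    (etaCorr_isBigO_infty e) ((etaCorr_isBigO_infty e).congr' (by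
      filter_upwards [eventually_im_pos] with τ hτ
      exact (etaCorr_matS hp2 e hτ).symm) EventuallyEq.rfl)
    (etaCorr_isBigO_matTS hp2 e)
  exact ⟨R, h⟩

/-- The value of `den (heckeRep p j)`. -/
def heckeDen (p : ℕ) : Option (ZMod p) → ℕ
  | none => 1
  | some _ => p

omit hp in
lemma den_heckeRep (j : Option (ZMod p)) (τ : ℂ) : den (heckeRep p j) τ = heckeDen p j := by
  cases j <;> simp [den, heckeRep, heckeDen]

open Polynomial in
/-- Kronecker's congruence for the weights of the Hecke correspondence. -/
theorem exists_etaCorr_polynomial (hp2 : p ≠ 2) (A : ValuationSubring ℂ)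
    [CharP (IsLocalRing.ResidueField A) p] (e : A) :
    ∃ Q : A[X], (∀ τ : ℂ, 0 < τ.im → etaCorr p e τ = (Q.map A.subtype).eval (kmod τ ^ 2)) ∧
      Q.map (IsLocalRing.residue A) = C (IsLocalRing.residue A e) ^ p *
        (C (IsLocalRing.residue A e) - ((hassePoly p).map (Int.castRingHom _)) ^ 2) := by
  obtain ⟨R, hR⟩ := etaCorr_eq_polynomial hp2 (e : ℂ)
  obtain ⟨z, hz, hz1⟩ := exists_residue_root (p := p) A
  choose g hg hg' using hasExp_heckeSeries (p := p) A hz hasExp_thetaSeriesInv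
    (f := fun τ => (theta3 τ)⁻¹) (fun τ hτ => by rw [theta3_eq_fun_sq hτ])
  set κ := IsLocalRing.ResidueField A
  set E : PowerSeries A := PowerSeries.map (Int.castRingHom A)
    (thetaSeries.expand p hp.out.ne_zero) with hE
  set G : PowerSeries A := ∏ j : Option (ZMod p), (PowerSeries.C e - (heckeDen p j : PowerSeries A) ^ 2 *
    (E ^ 4 * heckeSeries z thetaSeriesInv j ^ 4)) with hG
  have hEc : HasExp (PowerSeries.map A.subtype E) (fun s => theta3Fun ((s ^ p) ^ 2)) := by
    rw [hE, PowerSeries.map_subtype_int, toComplexSeries, PowerSeries.map_expand]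
    exact hasExp_thetaSeries.expand p hp.out.ne_zero
  have hEc' : ∀ τ : ℂ, 0 < τ.im →
      theta3 τ = theta3Fun ((cexp (Real.pi * I * τ * ((1 / (2 * p) : ℝ) : ℂ)) ^ p) ^ 2) := by
    intro τ hτ
    have hp0 : (p : ℂ) ≠ 0 := by exact_mod_cast hp.out.ne_zero
    rw [theta3_eq_fun_sq hτ, ← Complex.exp_nat_mul _ p]
    congr 3
    push_cast
    field_simp
  have hGc : HasExp (PowerSeries.map A.subtype G)
      (fun s => ∏ j : Option (ZMod p), ((e : ℂ) - (heckeDen p j : ℂ) ^ 2 *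
        (theta3Fun ((s ^ p) ^ 2) ^ 4 * g j s ^ 4))) := by
    rw [hG, map_prod]
    refine HasExp.prod _ fun j _ => ?_
    rw [map_sub, map_mul, map_mul, map_pow, map_pow, map_pow, map_natCast, PowerSeries.map_C]
    have := HasExp.C (heckeDen p j : ℂ)
    rw [map_natCast] at this
    exact (HasExp.C _).sub ((this.pow 2).mul ((hEc.pow 4).mul ((hg j).pow 4)))
  obtain ⟨Q, hQ, hQ2⟩ := exists_polynomial_lift hp2 A hGc (R := R) fun τ hτ => by
    rw [← hR τ hτ, etaCorr]
    refine prod_congr rfl fun j _ => ?_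
    rw [hg' j τ hτ, ← hEc' τ hτ, heckeWeight, den_heckeRep, inv_pow, ← div_eq_mul_inv]
  refine ⟨Q, fun τ hτ => by rw [hR τ hτ, hQ], ?_⟩
  apply aeval_kSeries_injective hp2 (m := 2 * p) (mul_ne_zero two_ne_zero hp.out.ne_zero)
  rw [hQ2, hG, map_prod]
  set K := PowerSeries.map (Int.castRingHom κ) kSeries with hK
  set T := PowerSeries.map (Int.castRingHom κ) thetaSeries with hT
  set V := PowerSeries.map (Int.castRingHom κ) thetaSeriesInv with hV
  have : CharP (PowerSeries κ) p := charP_of_injective_algebraMap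
    (algebraMap κ (PowerSeries κ)).injective p
  have hTV : T * V = 1 := by rw [hT, hV, ← map_mul, thetaSeries_mul_inv, map_one]
  have hEr : PowerSeries.map (IsLocalRing.residue A) E = T ^ p := by
    rw [hE, PowerSeries.map_residue_int, PowerSeries.map_int_expand]
  have hH := thetaSeries_pow_mul_hassePoly hp2 κ
  rw [aeval_map_hassePoly, ← hT, ← hK] at hH
  have hHp : T ^ (4 * (p / 2) * p) *
      ∑ i ∈ range (p / 2 + 1), ((p / 2).choose i : PowerSeries κ) ^ 2 * (K ^ (2 * p)) ^ i = 1 := by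
    have h1 := congrArg (frobenius (PowerSeries κ) p) hH
    rw [map_mul, map_sum, map_one, frobenius_def, ← pow_mul] at h1
    rw [← h1]
    congr 1
    refine sum_congr rfl fun i _ => ?_
    rw [map_mul, map_pow, map_natCast, frobenius_def]
    ring
  simp only [map_sub, map_mul, map_pow, map_natCast, hEr, Fintype.prod_option,
    map_heckeSeries_none, map_heckeSeries_some A hz1, prod_const, card_univ, ZMod.card,
    PowerSeries.map_C, heckeDen, Nat.cast_one, one_pow, one_mul, aeval_map_hassePoly]
  rw [CharP.cast_eq_zero, zero_pow two_ne_zero, zero_mul, sub_zero, aeval_C, mul_comm]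
  congr 1
  congr 1
  generalize (∑ i ∈ range (p / 2 + 1),
    ((p / 2).choose i : PowerSeries κ) ^ 2 * (K ^ (2 * p)) ^ i) = H at *
  obtain ⟨n, hn⟩ : ∃ n, p = 2 * n + 1 := (hp.out.odd_of_ne_two hp2)
  have h2 : p / 2 = n := by omega
  rw [h2] at hHp
  have e1 : 4 * n * p * 2 + p * 4 = p * p * 4 := by
    have : p * p = (2 * n + 1) * p := by rw [← hn]
    rw [this]; ring
  have h3 : T ^ (p * p * 4) * V ^ (p * p * 4) = 1 := by rw [← mul_pow, hTV, one_pow]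
  rw [← e1, pow_add, pow_mul, pow_mul T p 4] at h3
  rw [e1] at h3
  rw [← pow_mul V]
  linear_combination (H ^ 2) * h3 - ((T ^ p) ^ 4 * V ^ (p * p * 4)) *
    (T ^ (4 * n * p) * H + 1) * hHp

end WeightCorrespondence

section ThetaInequality

open Complex Filter Topology

lemma abs_im_pow_le (s : ℂ) (n : ℕ) : |(s ^ (n + 1)).im| ≤ (n + 1) * ‖s‖ ^ n * |s.im| := by
  induction n with
  | zero => simp
  | succ n ih =>
    rw [pow_succ, Complex.mul_im]
    have h1 : |(s ^ (n + 1)).re| ≤ ‖s‖ ^ (n + 1) := by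
      rw [← norm_pow]; exact Complex.abs_re_le_norm _
    have h2 := Complex.abs_re_le_norm s
    calc |(s ^ (n + 1)).re * s.im + (s ^ (n + 1)).im * s.re|
        ≤ |(s ^ (n + 1)).re| * |s.im| + |(s ^ (n + 1)).im| * |s.re| := by
          rw [← abs_mul, ← abs_mul]; exact abs_add_le _ _
      _ ≤ ‖s‖ ^ (n + 1) * |s.im| + ((n + 1) * ‖s‖ ^ n * |s.im|) * ‖s‖ := by gcongr
      _ = _ := by push_cast; ring

lemma HasExp.norm_sub_one_le {A : PowerSeries ℤ} {F : ℂ → ℂ} (h : HasExp (toComplexSeries A) F)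
    (h1 : A.constantCoeff = 1) (h2 : ∀ n, |A.coeff n| ≤ 2) {s : ℂ} (hs : ‖s‖ ≤ 1 / 50) :
    ‖F s - 1‖ ≤ 1 / 24 ∧ |(F s).im| ≤ 21 / 10 * |s.im| := by
  have hF := h s (by linarith)
  rw [← hasSum_nat_add_iff' 1] at hF
  simp only [range_one, sum_singleton, pow_zero, mul_one, PowerSeries.coeff_map,
    PowerSeries.coeff_zero_eq_constantCoeff_apply, h1, map_one] at hF
  have hc : ∀ n, ‖((A.coeff n : ℤ) : ℂ)‖ ≤ 2 := fun n => by
    rw [Complex.norm_intCast]; exact_mod_cast h2 n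
  have hr0 := norm_nonneg s
  constructor
  · refine (hF.norm_le_of_bounded (((hasSum_geometric_of_lt_one hr0
      (by linarith)).mul_left (2 * ‖s‖))) fun n => ?_).trans ?_
    · rw [norm_mul, norm_pow, pow_succ]
      calc _ ≤ 2 * (‖s‖ ^ n * ‖s‖) := by gcongr; exact hc _
        _ = _ := by ring
    · rw [← div_eq_mul_inv, div_le_iff₀ (by linarith)]; linarith
  · have hI := (Complex.hasSum_im hF)
    rw [Complex.sub_im, Complex.one_im, sub_zero] at hI
    refine (hI.norm_le_of_bounded (((hasSum_geometric_of_lt_one (r := 2 * ‖s‖)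
      (by linarith) (by linarith)).mul_left (2 * |s.im|))) fun n => ?_).trans ?_
    · rw [show ((Int.castRingHom ℂ) (A.coeff (n + 1)) : ℂ) =
        (((A.coeff (n + 1) : ℤ) : ℝ) : ℂ) by simp, Complex.im_ofReal_mul, norm_mul,
        Real.norm_eq_abs, Real.norm_eq_abs]
      have h3 : |((A.coeff (n + 1) : ℤ) : ℝ)| ≤ 2 := by exact_mod_cast h2 _
      have h4 : ((n : ℝ) + 1) ≤ 2 ^ n := by exact_mod_cast n.lt_two_pow_self
      calc _ ≤ 2 * ((n + 1) * ‖s‖ ^ n * |s.im|) := by gcongr; exact abs_im_pow_le s n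
        _ ≤ 2 * (2 ^ n * ‖s‖ ^ n * |s.im|) := by gcongr
        _ = _ := by rw [mul_pow]; ring
    · rw [mul_assoc, mul_comm, mul_assoc, ← div_eq_inv_mul, ← mul_div_assoc,
        div_le_iff₀ (by linarith)]
      nlinarith [abs_nonneg s.im]

lemma abs_coeff_gapSeries_le (e : ℕ → ℕ) (n : ℕ) : |(gapSeries e).coeff n| ≤ 1 := by
  rw [gapSeries, PowerSeries.coeff_mk]; split_ifs <;> simp

lemma abs_coeff_theta3Series_le (n : ℕ) : |theta3Series.coeff n| ≤ 2 := by
  have h1 := abs_coeff_gapSeries_le (fun m => (m + 1) ^ 2) n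
  have h2 : PowerSeries.coeff n theta3Series = (if n = 0 then 1 else 0) +
      2 * PowerSeries.coeff n (gapSeries fun m => (m + 1) ^ 2) := by
    rw [theta3Series, map_add, PowerSeries.coeff_one,
      show (2 : PowerSeries ℤ) = PowerSeries.C 2 by simp, PowerSeries.coeff_C_mul]
  rcases Nat.eq_zero_or_pos n with rfl | hn
  · rw [PowerSeries.coeff_zero_eq_constantCoeff_apply, constantCoeff_theta3Series]; simp
  · rw [h2, if_neg hn.ne', zero_add, abs_mul]; simpa using h1

lemma theta3Fun_near {s : ℂ} (hs : ‖s‖ ≤ 1 / 50) :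
    ‖theta3Fun s - 1‖ ≤ 1 / 24 ∧ |(theta3Fun s).im| ≤ 21 / 10 * |s.im| :=
  hasExp_theta3.norm_sub_one_le constantCoeff_theta3Series abs_coeff_theta3Series_le hs

lemma psiFun_near {s : ℂ} (hs : ‖s‖ ≤ 1 / 50) :
    ‖psiFun s - 1‖ ≤ 1 / 24 ∧ |(psiFun s).im| ≤ 21 / 10 * |s.im| :=
  hasExp_psi.norm_sub_one_le constantCoeff_psiSeries
    (fun n => (abs_coeff_gapSeries_le _ n).trans (by norm_num)) hs

lemma one_div_fifty_le {x : ℝ} (hx : 4 ≤ x) : Real.exp (-x) ≤ 1 / 50 := by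
  rw [Real.exp_neg, ← one_div]
  apply one_div_le_one_div_of_le (by norm_num)
  calc (50 : ℝ) ≤ 2.7 ^ 4 := by norm_num
    _ ≤ Real.exp 1 ^ 4 := by gcongr; linarith [Real.exp_one_gt_d9]
    _ = Real.exp 4 := by rw [← Real.exp_nat_mul]; norm_num
    _ ≤ _ := Real.exp_le_exp.mpr hx

lemma re_pos_aux {q A C : ℂ} (hq : 0 < q.re) (hr : ‖q ^ 4‖ ≤ 1 / 50)
    (hA : ‖A - 1‖ ≤ 1 / 24 ∧ |A.im| ≤ 21 / 10 * |(q ^ 4).im|)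
    (hC : ‖C - 1‖ ≤ 1 / 24 ∧ |C.im| ≤ 21 / 10 * |(q ^ 4).im|) :
    0 < (A * (starRingEnd ℂ) (q * C)).re := by
  have hq4 : |(q ^ 4).im| ≤ 4 * ‖q‖ ^ 3 * q.re := by
    have e : (q ^ 4).im = 4 * (q ^ 2).re * q.im * q.re := by
      rw [show q ^ 4 = q ^ 2 * q ^ 2 by ring, Complex.mul_im, sq q, Complex.mul_im]; ring
    have h1 : |(q ^ 2).re| ≤ ‖q‖ ^ 2 := by rw [← norm_pow]; exact Complex.abs_re_le_norm _
    rw [e, abs_mul, abs_mul, abs_mul, abs_of_pos hq]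
    have h2 := Complex.abs_im_le_norm q
    calc _ ≤ |(4 : ℝ)| * ‖q‖ ^ 2 * ‖q‖ * q.re := by gcongr
      _ = _ := by rw [abs_of_pos (by norm_num)]; ring
  have bnd : ∀ {B : ℂ}, ‖B - 1‖ ≤ 1 / 24 → 23 / 24 ≤ B.re ∧ B.re ≤ 25 / 24 ∧ |B.im| ≤ 1 / 24 := by
    intro B hB
    have h1 := (Complex.abs_re_le_norm (B - 1)).trans hB
    have h2 := (Complex.abs_im_le_norm (B - 1)).trans hB
    rw [Complex.sub_re, Complex.one_re, abs_le] at h1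
    rw [Complex.sub_im, Complex.one_im, sub_zero] at h2
    exact ⟨by linarith, by linarith, h2⟩
  obtain ⟨a1, a2, a3⟩ := bnd hA.1
  obtain ⟨c1, c2, c3⟩ := bnd hC.1
  have e : (A * (starRingEnd ℂ) (q * C)).re = q.re * (A.re * C.re + A.im * C.im) +
      q.im * (A.im * C.re - A.re * C.im) := by
    simp; ring
  rw [e]
  have h1 : 4 / 5 ≤ A.re * C.re + A.im * C.im := by
    have : |A.im * C.im| ≤ 1 / 24 * (1 / 24) := by rw [abs_mul]; gcongr
    have := (abs_le.mp this).1
    nlinarith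
  have h3 : |q.im * (A.im * C.re - A.re * C.im)| ≤ 2 / 5 * q.re := by
    rw [norm_pow] at hr
    have ha := hA.2.trans (mul_le_mul_of_nonneg_left hq4 (by norm_num))
    have hc := hC.2.trans (mul_le_mul_of_nonneg_left hq4 (by norm_num))
    have h4 : |A.im * C.re - A.re * C.im| ≤ 2 * (25 / 24 * (21 / 10 * (4 * ‖q‖ ^ 3 * q.re))) := by
      refine (abs_sub _ _).trans ?_
      rw [abs_mul, abs_mul, abs_of_pos (a := C.re) (by linarith),
        abs_of_pos (a := A.re) (by linarith)]
      have := mul_le_mul ha c2 (by linarith) (by positivity)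
      have := mul_le_mul a2 hc (by positivity) (by norm_num)
      linarith
    rw [abs_mul]
    calc _ ≤ ‖q‖ * (2 * (25 / 24 * (21 / 10 * (4 * ‖q‖ ^ 3 * q.re)))) := by
          gcongr; exact Complex.abs_im_le_norm q
      _ = 35 / 2 * ‖q‖ ^ 4 * q.re := by ring
      _ ≤ 35 / 2 * (1 / 50) * q.re := by gcongr
      _ ≤ _ := by linarith
  have := (abs_le.mp h3).1
  nlinarith

lemma norm_sub_lt_norm_add {a b : ℂ} (h : 0 < (a * (starRingEnd ℂ) b).re) :
    ‖a - b‖ < ‖a + b‖ := by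
  apply lt_of_pow_lt_pow_left₀ 2 (norm_nonneg _)
  rw [← Complex.normSq_eq_norm_sq, ← Complex.normSq_eq_norm_sq, Complex.normSq_sub,
    Complex.normSq_add]
  linarith

/-- On the strip `|Re τ| < 1/2`, `θ₄` is smaller than `θ₃`. -/
lemma norm_theta4_lt_norm_theta3 {τ : ℂ} (h1 : |τ.re| < 1 / 2) (h2 : 1 ≤ Real.pi * τ.im) :
    ‖theta4 τ‖ < ‖theta3 τ‖ := by
  have hτ : 0 < τ.im := pos_of_mul_pos_right (by linarith) Real.pi_pos.le
  have h4 : 0 < (4 * τ).im := by simpa using hτ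
  rw [theta3_eq hτ, theta4_eq hτ, theta3_eq_fun h4, theta2_eq_fun h4]
  have e1 : Real.pi * I * (4 * τ) = (4 : ℕ) * (Real.pi * I * τ) := by push_cast; ring
  have e2 : Real.pi * I * (4 * τ) / 4 = Real.pi * I * τ := by ring
  rw [e2, e1, Complex.exp_nat_mul]
  set q := cexp (Real.pi * I * τ) with hq
  have hre : 0 < q.re := by
    rw [hq, Complex.exp_re]
    refine mul_pos (Real.exp_pos _) (Real.cos_pos_of_mem_Ioo ?_)
    rw [abs_lt] at h1
    have := Real.pi_pos
    simp only [mul_im, mul_re, ofReal_re, ofReal_im, I_re, I_im]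
    constructor <;> nlinarith
  have hr : ‖q ^ 4‖ ≤ 1 / 50 := by
    rw [hq, ← Complex.exp_nat_mul, Complex.norm_exp]
    refine le_trans (le_of_eq ?_) (one_div_fifty_le (x := 4 * (Real.pi * τ.im)) (by linarith))
    congr 1; simp
  apply norm_sub_lt_norm_add
  have := re_pos_aux hre hr (theta3Fun_near hr) (psiFun_near hr)
  rw [mul_assoc, map_mul, mul_left_comm, map_ofNat, show (2 : ℂ) = ((2 : ℝ) : ℂ) by norm_num,
    Complex.re_ofReal_mul]
  linarith

lemma norm_theta2_lt_norm_theta3_of_im {τ : ℂ} (h : 4 ≤ Real.pi * τ.im) :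
    ‖theta2 τ‖ < ‖theta3 τ‖ := by
  have hτ : 0 < τ.im := pos_of_mul_pos_right (by linarith) Real.pi_pos.le
  rw [theta3_eq_fun hτ, theta2_eq_fun hτ]
  have e1 : Real.pi * I * τ = (4 : ℕ) * (Real.pi * I * τ / 4) := by push_cast; ring
  have hr : ‖cexp (Real.pi * I * τ)‖ ≤ 1 / 50 := by
    rw [Complex.norm_exp]
    refine le_trans (le_of_eq ?_) (one_div_fifty_le h)
    congr 1; simp
  have a := (psiFun_near hr).1
  have b := (theta3Fun_near hr).1
  have hr' : ‖cexp (Real.pi * I * τ / 4)‖ ≤ 2 / 5 := by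
    apply le_of_pow_le_pow_left₀ (n := 4) (by norm_num) (by norm_num)
    rw [← norm_pow, ← Complex.exp_nat_mul, ← e1]
    exact hr.trans (by norm_num)
  have a' : ‖psiFun (cexp (Real.pi * I * τ))‖ ≤ 25 / 24 := by
    have := norm_le_norm_sub_add (psiFun (cexp (Real.pi * I * τ))) 1
    rw [norm_one] at this; linarith
  have b' : 23 / 24 ≤ ‖theta3Fun (cexp (Real.pi * I * τ))‖ := by
    have := norm_le_norm_sub_add 1 (theta3Fun (cexp (Real.pi * I * τ)))
    rw [norm_one, norm_sub_rev] at this; linarith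
  rw [norm_mul, norm_mul, Complex.norm_ofNat]
  calc _ ≤ 2 * (2 / 5) * (25 / 24 : ℝ) := by gcongr
    _ < 23 / 24 := by norm_num
    _ ≤ _ := b'

end ThetaInequality

section LambdaInjective

open Complex Filter Topology

/-- The points of the upper half-plane at distance more than `1` from all odd integers. -/
def FarFromOdd (w : ℂ) : Prop := 0 < w.im ∧ ∀ m : ℤ, Odd m → 1 < ‖w - m‖

lemma FarFromOdd.two_mul {w : ℂ} (h : FarFromOdd w) : FarFromOdd (2 * w) := by
  refine ⟨two_mul_im_pos h.1, fun m hm => ?_⟩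
  by_contra hc
  push Not at hc
  obtain ⟨j, rfl⟩ := hm
  have h1 : ‖w - ((2 * j + 1 : ℤ) : ℂ) / 2‖ ≤ 1 / 2 := by
    have e : (2 * w - ((2 * j + 1 : ℤ) : ℂ)) = 2 * (w - ((2 * j + 1 : ℤ) : ℂ) / 2) := by ring
    rw [e, norm_mul, Complex.norm_ofNat] at hc
    linarith
  have key : ∀ (o : ℤ) (s : ℂ), Odd o → ‖s‖ ≤ 1 / 2 → ((2 * j + 1 : ℤ) : ℂ) / 2 - o = s →
      False := by
    intro o s ho hs he
    have := h.2 o ho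
    have e : w - o = (w - ((2 * j + 1 : ℤ) : ℂ) / 2) + s := by rw [← he]; ring
    rw [e] at this
    linarith [norm_add_le (w - ((2 * j + 1 : ℤ) : ℂ) / 2) s]
  rcases Int.even_or_odd j with hj | hj
  · exact key (j + 1) (-(1 / 2)) hj.add_one (by norm_num) (by push_cast; ring)
  · exact key j (1 / 2) hj (by norm_num) (by push_cast; ring)

lemma FarFromOdd.add_two_mul {w : ℂ} (h : FarFromOdd w) (n : ℤ) : FarFromOdd (w + 2 * n) := by
  refine ⟨by simpa using h.1, fun m hm => ?_⟩
  have := h.2 (m - 2 * n) (hm.sub_even (even_two_mul n))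
  rwa [show w + 2 * n - m = w - ((m - 2 * n : ℤ) : ℂ) by push_cast; ring]

lemma norm_theta2_add_two_mul (w : ℂ) (n : ℤ) : ‖theta2 (w + 2 * n)‖ = ‖theta2 w‖ := by
  have h1 : ∀ w : ℂ, ‖theta2 (w + 1)‖ = ‖theta2 w‖ := fun w => by
    rw [theta2_add_one, norm_mul, Complex.norm_exp]; simp
  have h2 : ∀ w : ℂ, ‖theta2 (w + 2)‖ = ‖theta2 w‖ := fun w => by
    rw [show w + 2 = w + 1 + 1 by ring, h1, h1]
  induction n with
  | zero => simp
  | succ i hi => rw [← hi, ← h2 (w + 2 * (i : ℤ))]; congr 2; push_cast; ring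
  | pred i hi => rw [← hi, ← h2 (w + 2 * (-(i : ℤ) - 1 : ℤ))]; congr 2; push_cast; ring

lemma re_im_of_norm_gt {w : ℂ} {r : ℝ} (h : 1 < ‖w - r‖) :
    1 < (w.re - r) ^ 2 + w.im ^ 2 := by
  have h1 : 1 < ‖w - r‖ ^ 2 := by nlinarith
  rw [← Complex.normSq_eq_norm_sq, Complex.normSq_apply] at h1
  simp at h1
  nlinarith

lemma FarFromOdd.norm_theta2_lt {w : ℂ} (h : FarFromOdd w) : ‖theta2 w‖ < ‖theta3 w‖ := by
  wlog hw : |w.re| ≤ 1 generalizing w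
  · have := this (h.add_two_mul (-round (w.re / 2))) (by
      have h1 := abs_sub_round (w.re / 2)
      have e : (w + 2 * ((-round (w.re / 2) : ℤ) : ℂ)).re = 2 * (w.re / 2 - round (w.re / 2)) := by
        simp; ring
      rw [e, abs_mul, abs_two]; linarith)
    rwa [norm_theta2_add_two_mul, theta3_add_two_mul] at this
  have hτ := h.1
  rcases le_or_gt 4 (Real.pi * w.im) with h4 | h4
  · exact norm_theta2_lt_norm_theta3_of_im h4
  have hp := re_im_of_norm_gt (r := 1) (by simpa using h.2 1 odd_one)
  have hm := re_im_of_norm_gt (r := -1) (by simpa using h.2 (-1) (by decide))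
  have hn : 0 < normSq w := normSq_pos.mpr (by rintro rfl; simp at hτ)
  have hn' : normSq w = w.re ^ 2 + w.im ^ 2 := by rw [normSq_apply]; ring
  have key := norm_theta4_lt_norm_theta3 (τ := -1 / w) (by
    rw [neg_div, one_div, Complex.neg_re, Complex.inv_re, abs_neg, abs_div, abs_of_pos hn,
      div_lt_iff₀ hn, hn']
    rw [abs_lt]
    constructor <;> nlinarith) (by
    rw [neg_div, one_div, Complex.neg_im, Complex.inv_im, neg_div, neg_neg, mul_div_assoc',
      le_div_iff₀ hn, one_mul, hn']
    have hpi := Real.pi_gt_three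
    have hv : w.im < 4 / 3 := by nlinarith
    refine le_trans ?_ (mul_le_mul_of_nonneg_right hpi.le hτ.le)
    rw [abs_le] at hw
    have hu2 : w.re ^ 2 ≤ 1 := by nlinarith
    rcases le_or_gt (1 / 2) w.im with h5 | h5
    · nlinarith
    · have h6 : w.re ^ 2 ≤ w.im ^ 2 := by
        rcases le_total 0 w.re with h7 | h7
        · nlinarith
        · nlinarith
      nlinarith)
  rw [theta3_neg_inv hτ, theta4_neg_inv hτ, norm_mul, norm_mul] at key
  exact lt_of_mul_lt_mul_left key (norm_nonneg _)

lemma re_sub_div_add_pos {a b : ℂ} (h : ‖b‖ < ‖a‖) : 0 < ((a - b) / (a + b)).re := by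
  have h0 : a + b ≠ 0 := by
    intro h0
    rw [eq_neg_of_add_eq_zero_left h0, norm_neg] at h
    exact lt_irrefl _ h
  have h1 : 0 < normSq (a + b) := normSq_pos.mpr h0
  have h2 : normSq b < normSq a := by
    rw [normSq_eq_norm_sq, normSq_eq_norm_sq]; gcongr
  have e : ((a - b) / (a + b)).re = (normSq a - normSq b) / normSq (a + b) := by
    rw [Complex.div_re, ← add_div]; congr 1; simp [normSq_apply]; ring
  rw [e]
  exact div_pos (by linarith) h1

/-- A fundamental domain for `Γ(2)`, without its boundary. -/
def lambdaDomain : Set ℂ := {τ | 0 < τ.im ∧ |τ.re| < 1 ∧ 1 < ‖2 * τ - 1‖ ∧ 1 < ‖2 * τ + 1‖}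

lemma isOpen_lambdaDomain : IsOpen lambdaDomain := by
  have h1 : Continuous fun τ : ℂ => |τ.re| := Complex.continuous_re.abs
  have h2 : Continuous fun τ : ℂ => ‖2 * τ - 1‖ := by fun_prop
  have h3 : Continuous fun τ : ℂ => ‖2 * τ + 1‖ := by fun_prop
  exact (isOpen_lt continuous_const Complex.continuous_im).inter
    ((isOpen_lt h1 continuous_const).inter
    ((isOpen_lt continuous_const h2).inter (isOpen_lt continuous_const h3)))

lemma farFromOdd_of_mem {τ : ℂ} (h : τ ∈ lambdaDomain) : FarFromOdd (2 * τ) := by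
  obtain ⟨h0, h1, h2, h3⟩ := h
  refine ⟨two_mul_im_pos h0, fun m hm => ?_⟩
  rw [abs_lt] at h1
  obtain ⟨j, rfl⟩ := hm
  have hre : ∀ x : ℝ, x ≤ |(2 * τ - ((2 * j + 1 : ℤ) : ℂ)).re| →
      x ≤ ‖2 * τ - ((2 * j + 1 : ℤ) : ℂ)‖ := fun x hx => hx.trans (Complex.abs_re_le_norm _)
  have him : (2 * τ - ((2 * j + 1 : ℤ) : ℂ)).re = 2 * τ.re - (2 * j + 1) := by
    simp
  rcases lt_trichotomy j 0 with hj | rfl | hj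
  · rcases eq_or_lt_of_le (show j ≤ -1 by omega) with rfl | hj
    · simpa using h3
    · have : (j : ℝ) ≤ -2 := by exact_mod_cast (show j ≤ -2 by omega)
      refine lt_of_lt_of_le ?_ (Complex.abs_re_le_norm _)
      rw [him, lt_abs]; left; linarith
  · simpa using h2
  · have : (1 : ℝ) ≤ j := by exact_mod_cast hj
    refine lt_of_lt_of_le ?_ (Complex.abs_re_le_norm _)
    rw [him, lt_abs]; right; linarith

lemma re_theta4_div_theta3_pos {τ : ℂ} (hτ : 0 < τ.im) (h : FarFromOdd (4 * τ)) :
    0 < (theta4 τ / theta3 τ).re := by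
  rw [theta4_eq hτ, theta3_eq hτ]
  exact re_sub_div_add_pos h.norm_theta2_lt

lemma re_kcomp_pos {τ : ℂ} (hτ : 0 < τ.im) (h : FarFromOdd (2 * τ)) : 0 < (kcomp τ).re := by
  rw [kcomp, theta4_sq hτ, theta3_sq hτ]
  refine re_sub_div_add_pos ?_
  rw [norm_pow, norm_pow]
  have := h.norm_theta2_lt
  gcongr

lemma eq_of_sq_eq_of_re_pos {z w : ℂ} (hz : 0 < z.re) (hw : 0 < w.re) (h : z ^ 2 = w ^ 2) :
    z = w := by
  rcases sq_eq_sq_iff_eq_or_eq_neg.mp h with h | h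
  · exact h
  · rw [h, Complex.neg_re] at hz; linarith

lemma kcomp_two_mul {τ : ℂ} (hτ : 0 < τ.im) :
    kcomp (2 * τ) = 2 * (theta4 τ / theta3 τ) / (1 + (theta4 τ / theta3 τ) ^ 2) := by
  have h0 := theta3_ne_zero hτ
  have h1 : theta3 (2 * τ) ^ 2 = (theta3 τ ^ 2 + theta4 τ ^ 2) / 2 := by
    rw [theta3_sq hτ, theta4_sq hτ]; ring
  have h2 : theta3 (2 * τ) ^ 2 ≠ 0 := pow_ne_zero _ (theta3_ne_zero (two_mul_im_pos hτ))
  rw [kcomp, ← theta3_mul_theta4 hτ]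
  rw [h1] at h2 ⊢
  have h3 : theta3 τ ^ 2 + theta4 τ ^ 2 ≠ 0 := fun h => h2 (by rw [h]; simp)
  field_simp

lemma kcomp_two_pow_mul_eq {τ τ' : ℂ} (h : FarFromOdd (2 * τ)) (h' : FarFromOdd (2 * τ'))
    (hk : kmod τ ^ 2 = kmod τ' ^ 2) (n : ℕ) : kcomp (2 ^ n * τ) = kcomp (2 ^ n * τ') := by
  have pos : ∀ {τ : ℂ}, FarFromOdd (2 * τ) → 0 < τ.im := fun h => by simpa using h.1
  have far : ∀ {τ : ℂ}, FarFromOdd (2 * τ) → ∀ n : ℕ, FarFromOdd (2 * (2 ^ n * τ)) := by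
    intro τ h n
    induction n with
    | zero => simpa using h
    | succ n ih => have := ih.two_mul; rwa [show (2 : ℂ) ^ (n + 1) * τ = 2 * (2 ^ n * τ) by ring]
  induction n with
  | zero =>
    rw [pow_zero, one_mul, one_mul]
    refine eq_of_sq_eq_of_re_pos (re_kcomp_pos (pos h) h) (re_kcomp_pos (pos h') h') ?_
    linear_combination kmod_sq_add_kcomp_sq (pos h) - kmod_sq_add_kcomp_sq (pos h') - hk
  | succ n ih =>
    have hf := far h n
    have hf' := far h' n
    have e : theta4 (2 ^ n * τ) / theta3 (2 ^ n * τ) =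
        theta4 (2 ^ n * τ') / theta3 (2 ^ n * τ') := by
      have f4 := hf.two_mul
      have f4' := hf'.two_mul
      rw [show 2 * (2 * (2 ^ n * τ)) = 4 * (2 ^ n * τ) by ring] at f4
      rw [show 2 * (2 * (2 ^ n * τ')) = 4 * (2 ^ n * τ') by ring] at f4'
      refine eq_of_sq_eq_of_re_pos (re_theta4_div_theta3_pos (pos hf) f4)
        (re_theta4_div_theta3_pos (pos hf') f4') ?_
      rw [div_pow, div_pow]; exact ih
    rw [pow_succ', mul_assoc, mul_assoc, kcomp_two_mul (pos hf), kcomp_two_mul (pos hf'), e]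

lemma exists_eq_one_of_tendsto {u : ℕ → ℂ} (hu : ∀ n, u (n + 1) = u n ^ 2)
    (h : Tendsto u atTop (𝓝 1)) : ∃ n, u n = 1 := by
  have h1 : ∀ᶠ n in atTop, ‖u n - 1‖ < 1 / 2 := by
    have := (tendsto_iff_norm_sub_tendsto_zero.mp h)
    exact this.eventually_lt_const (by norm_num)
  obtain ⟨N, hN⟩ := eventually_atTop.mp h1
  refine ⟨N, ?_⟩
  have h2 : ∀ k, (3 / 2) ^ k * ‖u N - 1‖ ≤ ‖u (N + k) - 1‖ := by
    intro k
    induction k with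
    | zero => simp
    | succ k ih =>
      have e : u (N + (k + 1)) - 1 = (u (N + k) + 1) * (u (N + k) - 1) := by
        rw [← add_assoc, hu]; ring
      have h3 := hN (N + k) (by omega)
      have h4 : 3 / 2 ≤ ‖u (N + k) + 1‖ := by
        have h5 := norm_sub_le (u (N + k) + 1) (u (N + k) - 1)
        rw [show u (N + k) + 1 - (u (N + k) - 1) = 2 by ring, Complex.norm_ofNat] at h5
        linarith
      rw [e, norm_mul, pow_succ']
      calc _ = 3 / 2 * ((3 / 2) ^ k * ‖u N - 1‖) := by ring
        _ ≤ _ := by gcongr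
  by_contra hne
  have h0 : 0 < ‖u N - 1‖ := norm_pos_iff.mpr (sub_ne_zero.mpr hne)
  obtain ⟨k, hk⟩ := pow_unbounded_of_one_lt (1 / ‖u N - 1‖) (by norm_num : (1 : ℝ) < 3 / 2)
  rw [div_lt_iff₀ h0] at hk
  linarith [h2 k, hN (N + k) (by omega)]

lemma kcomp_add_odd (τ : ℂ) (m : ℤ) : kcomp (τ + (2 * m + 1)) = (kcomp τ)⁻¹ := by
  induction m generalizing τ with
  | zero => simpa using kcomp_add_one τ
  | succ i hi => 
    rw [← hi τ, ← kcomp_add_two (τ + (2 * ((i : ℤ) : ℂ) + 1))]; congr 1; push_cast; ring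
  | pred i hi => 
    rw [← hi τ, ← kcomp_add_two (τ + (2 * ((-(i : ℤ) - 1 : ℤ) : ℂ) + 1))]; congr 1; push_cast; ring

theorem kmod_sq_injOn : Set.InjOn (fun τ => kmod τ ^ 2) lambdaDomain := by
  intro τ h τ' h' hk
  have hτ := h.1
  have hτ' := h'.1
  have key := kcomp_two_pow_mul_eq (farFromOdd_of_mem h) (farFromOdd_of_mem h') hk
  have pos : ∀ {τ : ℂ}, 0 < τ.im → ∀ n : ℕ, 0 < (2 ^ n * τ).im := by
    intro τ hτ n
    have : (2 ^ n : ℂ) = ((2 ^ n : ℝ) : ℂ) := by push_cast; rfl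
    rw [this, Complex.im_ofReal_mul]; positivity
  have tend : ∀ {τ : ℂ}, 0 < τ.im → Tendsto (fun n : ℕ => (2 : ℂ) ^ n * τ) atTop imInfty := by
    intro τ hτ
    rw [imInfty, tendsto_comap_iff]
    have e : Complex.im ∘ (fun n : ℕ => (2 : ℂ) ^ n * τ) = fun n : ℕ => (2 : ℝ) ^ n * τ.im := by
      ext n
      have : (2 ^ n : ℂ) = ((2 ^ n : ℝ) : ℂ) := by push_cast; rfl
      rw [Function.comp, this, Complex.im_ofReal_mul]
    rw [e]
    exact (tendsto_pow_atTop_atTop_of_one_lt one_lt_two).atTop_mul_const hτ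
  have keyk : ∀ n : ℕ, kmod (2 ^ n * τ) ^ 2 = kmod (2 ^ n * τ') ^ 2 := fun n => by
    linear_combination kmod_sq_add_kcomp_sq (pos hτ n) - kmod_sq_add_kcomp_sq (pos hτ' n) -
      (kcomp (2 ^ n * τ) + kcomp (2 ^ n * τ')) * key n
  set u : ℕ → ℂ := fun n => cexp (Real.pi * I * (2 ^ n * (τ - τ'))) with hu
  have hlim : Tendsto u atTop (𝓝 1) := by
    have h1 := ((tendsto_kmod_div_exp.comp (tend hτ')).pow 2).div
      ((tendsto_kmod_div_exp.comp (tend hτ)).pow 2) (by norm_num)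
    rw [div_self (by norm_num)] at h1
    refine h1.congr fun n => ?_
    simp only [Function.comp_apply, Pi.div_apply, div_pow]
    rw [keyk n, ← Complex.exp_nat_mul, ← Complex.exp_nat_mul, hu]
    have hne : kmod (2 ^ n * τ') ^ 2 ≠ 0 := pow_ne_zero _ (kmod_ne_zero (pos hτ' n))
    rw [div_div_div_cancel_left' _ _ hne, ← Complex.exp_sub]
    congr 1; push_cast; ring
  obtain ⟨n, hn⟩ := exists_eq_one_of_tendsto (fun n => by
    rw [hu]; dsimp only; rw [← Complex.exp_nat_mul]; congr 1; push_cast; ring) hlim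
  classical
  have hex : ∃ n, u n = 1 := ⟨n, hn⟩
  rcases Nat.eq_zero_or_pos (Nat.find hex) with h0 | h0
  · have h1 := Nat.find_spec hex
    rw [h0, hu] at h1
    simp only [pow_zero, one_mul] at h1
    obtain ⟨m, hm⟩ := Complex.exp_eq_one_iff.mp h1
    have hpi : (Real.pi : ℂ) * I ≠ 0 := by simp [Real.pi_ne_zero]
    have h2 : τ - τ' = 2 * m := mul_left_cancel₀ hpi (by rw [hm]; ring)
    have h3 := congrArg Complex.re h2
    simp at h3
    have h4 := abs_lt.mp h.2.1
    have h5 := abs_lt.mp h'.2.1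
    have h6 : |(m : ℝ)| < 1 := by rw [abs_lt]; constructor <;> linarith
    have h7 : m = 0 := by rw [← Int.cast_abs] at h6; exact Int.abs_lt_one_iff.mp (by exact_mod_cast h6)
    rw [h7] at h2; simpa [sub_eq_zero] using h2
  · obtain ⟨l, hl⟩ : ∃ l, Nat.find hex = l + 1 := ⟨Nat.find hex - 1, by omega⟩
    have h1 := Nat.find_spec hex
    have h2 : u l ≠ 1 := Nat.find_min hex (by omega)
    have h3 : u l = -1 := by
      rw [hl, hu] at h1
      have : u l ^ 2 = 1 := by
        rw [← h1, hu]; dsimp only; rw [← Complex.exp_nat_mul]; congr 1; push_cast; ring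
      exact (sq_eq_one_iff.mp this).resolve_left h2
    have h4 : cexp (Real.pi * I * (2 ^ l * (τ - τ') - 1)) = 1 := by
      rw [mul_sub, Complex.exp_sub, mul_one, Complex.exp_pi_mul_I]
      have : cexp (Real.pi * I * (2 ^ l * (τ - τ'))) = -1 := h3
      rw [this]; norm_num
    obtain ⟨m, hm⟩ := Complex.exp_eq_one_iff.mp h4
    have hpi : (Real.pi : ℂ) * I ≠ 0 := by simp [Real.pi_ne_zero]
    have h5 : 2 ^ l * τ = 2 ^ l * τ' + (2 * m + 1) := by
      have : 2 ^ l * (τ - τ') - 1 = 2 * m := mul_left_cancel₀ hpi (by rw [hm]; ring)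
      linear_combination this
    have h6 := key l
    rw [h5, kcomp_add_odd] at h6
    have h7 := kcomp_ne_zero (pos hτ' l)
    have h8 : kcomp (2 ^ l * τ') ^ 2 = 1 := by
      rw [sq]; nth_rewrite 1 [← h6]; exact inv_mul_cancel₀ h7
    have h9 := kmod_sq_add_kcomp_sq (pos hτ' l)
    rw [h8] at h9
    exact absurd (add_eq_right.mp h9) (pow_ne_zero _ (kmod_ne_zero (pos hτ' l)))

end LambdaInjective

section InjectiveDeriv

open Complex Filter Topology

/-- An injective holomorphic function has nonvanishing derivative. -/
theorem AnalyticAt.deriv_ne_zero_of_injOn {f : ℂ → ℂ} {z₀ : ℂ} (hf : AnalyticAt ℂ f z₀)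
    {s : Set ℂ} (hs : s ∈ 𝓝 z₀) (hinj : Set.InjOn f s) : deriv f z₀ ≠ 0 := by
  have hnc : ∀ z ∈ interior s, ¬ ∀ᶠ w in 𝓝 z, f w = f z := by
    intro z hz h
    have h1 : ∀ᶠ w in 𝓝 z, w = z := by
      filter_upwards [h, mem_interior_iff_mem_nhds.mp hz] with w hw hws
      exact hinj hws (interior_subset hz) hw
    exact (NormedField.nhdsNE_neBot z).ne
      (by rw [nhdsWithin, inf_principal_eq_bot, compl_compl]; exact h1)
  have hd : ∀ᶠ z in 𝓝[≠] z₀, deriv f z ≠ 0 := by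
    refine hf.deriv.eventually_eq_zero_or_eventually_ne_zero.resolve_left fun h => ?_
    obtain ⟨r, hr, hball⟩ := Metric.eventually_nhds_iff_ball.mp (h.and hf.eventually_analyticAt)
    refine hnc z₀ (mem_interior_iff_mem_nhds.mpr hs) ?_
    filter_upwards [Metric.ball_mem_nhds z₀ hr] with w hw
    exact Metric.isOpen_ball.is_const_of_deriv_eq_zero (convex_ball z₀ r).isPreconnected
      (fun z hz => (hball z hz).2.differentiableAt.differentiableWithinAt)
      (fun z hz => (hball z hz).1) hw (Metric.mem_ball_self hr)
  obtain ⟨V, hV, hVo, hzV⟩ := eventually_nhds_iff.mp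
    ((eventually_nhdsWithin_iff.mp hd).and (hf.eventually_analyticAt.and
      (mem_interior_iff_mem_nhds.mpr hs |> isOpen_interior.mem_nhds)))
  have hVinj : Set.InjOn f V := hinj.mono fun z hz => interior_subset (hV z hz).2.2
  set g := Function.invFunOn f V with hg
  have hgf : ∀ z ∈ V, g (f z) = z := fun z hz => hVinj.leftInvOn_invFunOn hz
  have hmap : ∀ z ∈ V, 𝓝 (f z) ≤ map f (𝓝 z) := fun z hz =>
    (hV z hz).2.1.eventually_constant_or_nhds_le_map_nhds.resolve_left (hnc z (hV z hz).2.2)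
  have hgc : ∀ z ∈ V, ContinuousAt g (f z) := by
    intro z hz
    rw [ContinuousAt, hgf z hz]
    refine (tendsto_map'_iff.mpr ?_).mono_left (hmap z hz)
    refine tendsto_id.congr' ?_
    filter_upwards [hVo.mem_nhds hz] with w hw using (hgf w hw).symm
  have hfg : ∀ z ∈ V, ∀ᶠ w in 𝓝 (f z), f (g w) = w := by
    intro z hz
    refine hmap z hz (mem_map.mpr ?_)
    filter_upwards [hVo.mem_nhds hz] with w hw
    simp only [Set.mem_preimage, Set.mem_ofPred_eq]; rw [hgf w hw]
  have hgd : ∀ z ∈ V, z ≠ z₀ → DifferentiableAt ℂ g (f z) := by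
    intro z hz hne
    refine (HasDerivAt.of_local_left_inverse (f := f) (f' := deriv f z) (hgc z hz) ?_
      ((hV z hz).1 hne) (hfg z hz)).differentiableAt
    rw [hgf z hz]
    exact (hV z hz).2.1.differentiableAt.hasDerivAt
  have hga : AnalyticAt ℂ g (f z₀) := by
    refine analyticAt_of_differentiable_on_punctured_nhds_of_continuousAt ?_ (hgc z₀ hzV)
    rw [eventually_nhdsWithin_iff]
    refine hmap z₀ hzV (mem_map.mpr ?_)
    filter_upwards [hVo.mem_nhds hzV] with w hw hne
    exact hgd w hw fun h => hne (by rw [h]; rfl)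
  intro h0
  have h1 : HasDerivAt (g ∘ f) (deriv g (f z₀) * deriv f z₀) z₀ :=
    HasDerivAt.comp z₀ hga.differentiableAt.hasDerivAt hf.differentiableAt.hasDerivAt
  have h2 : HasDerivAt (g ∘ f) 1 z₀ := by
    refine (hasDerivAt_id z₀).congr_of_eventuallyEq ?_
    filter_upwards [hVo.mem_nhds hzV] with w hw using hgf w hw
  have := h1.unique h2
  rw [h0, mul_zero] at this
  exact zero_ne_one this

lemma differentiableAt_kmod_sq {τ : ℂ} (hτ : 0 < τ.im) :
    DifferentiableAt ℂ (fun τ => kmod τ ^ 2) τ := (differentiableAt_kmod hτ).pow 2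

lemma analyticAt_of_differentiableAt_im_pos {f : ℂ → ℂ}
    (hf : ∀ τ : ℂ, 0 < τ.im → DifferentiableAt ℂ f τ) {τ : ℂ} (hτ : 0 < τ.im) :
    AnalyticAt ℂ f τ :=
  DifferentiableOn.analyticAt (s := {τ : ℂ | 0 < τ.im})
    (fun z hz => (hf z hz).differentiableWithinAt)
    ((isOpen_lt continuous_const Complex.continuous_im).mem_nhds hτ)

lemma analyticOrderAt_kmod_sq {τ : ℂ} (hτ : τ ∈ lambdaDomain) :
    analyticOrderAt (fun z => kmod z ^ 2 - kmod τ ^ 2) τ = 1 :=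
  have ha := analyticAt_of_differentiableAt_im_pos (fun _ => differentiableAt_kmod_sq) hτ.1
  ha.analyticOrderAt_sub_eq_one_of_deriv_ne_zero
    (ha.deriv_ne_zero_of_injOn (isOpen_lambdaDomain.mem_nhds hτ) kmod_sq_injOn)

lemma analyticOrderAt_eval_kmod_sq {τ : ℂ} (hτ : τ ∈ lambdaDomain) {R : Polynomial ℂ}
    (hR : R ≠ 0) : analyticOrderAt (fun z => R.eval (kmod z ^ 2)) τ =
      R.rootMultiplicity (kmod τ ^ 2) := by
  obtain ⟨S, hS, hS'⟩ := Polynomial.exists_eq_pow_rootMultiplicity_mul_and_not_dvd R hR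
    (kmod τ ^ 2)
  have ha := analyticAt_of_differentiableAt_im_pos (fun _ => differentiableAt_kmod_sq) hτ.1
  have hSa : AnalyticAt ℂ (fun z => S.eval (kmod z ^ 2)) τ := by
    have := ha.aeval_polynomial S
    simpa using this
  have hsub : AnalyticAt ℂ (fun z => kmod z ^ 2 - kmod τ ^ 2) τ := ha.sub analyticAt_const
  have e : (fun z => R.eval (kmod z ^ 2)) = (fun z => kmod z ^ 2 - kmod τ ^ 2) ^
      R.rootMultiplicity (kmod τ ^ 2) * fun z => S.eval (kmod z ^ 2) := by
    ext z; nth_rewrite 1 [hS]; simp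
  have h0 : analyticOrderAt (fun z => S.eval (kmod z ^ 2)) τ = 0 := by
    rw [hSa.analyticOrderAt_eq_zero]
    rwa [Polynomial.dvd_iff_isRoot] at hS'
  rw [e, analyticOrderAt_mul (hsub.pow _) hSa, analyticOrderAt_pow hsub,
    analyticOrderAt_kmod_sq hτ, h0]
  simp

lemma card_le_analyticOrderAt_prod {ι : Type*} [Fintype ι] (s : Finset ι) {f : ι → ℂ → ℂ} {z : ℂ}
    (hf : ∀ i, AnalyticAt ℂ (f i) z) (h0 : ∀ i ∈ s, f i z = 0) :
    (s.card : ℕ∞) ≤ analyticOrderAt (fun w => ∏ i, f i w) z := by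
  classical
  have ha : ∀ t : Finset ι, AnalyticAt ℂ (fun w => ∏ i ∈ t, f i w) z := fun t =>
    Finset.analyticAt_fun_prod t fun i _ => hf i
  have key : ∀ t : Finset ι, t ⊆ s → (t.card : ℕ∞) ≤ analyticOrderAt (fun w => ∏ i ∈ t, f i w) z := by
    intro t
    induction t using Finset.induction_on with
    | empty => simp
    | insert i t hi ih =>
      intro hts
      have e : (fun w => ∏ j ∈ insert i t, f j w) = f i * fun w => ∏ j ∈ t, f j w := by
        ext w; simp [prod_insert hi]
      rw [e, analyticOrderAt_mul (hf i) (ha t), card_insert_of_notMem hi, add_comm]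
      push_cast
      refine add_le_add ?_ (ih (insert_subset_iff.mp hts).2)
      rw [Order.one_le_iff_ne_zero]
      exact (hf i).analyticOrderAt_ne_zero.mpr (h0 i (hts (mem_insert_self i t)))
  have e : (fun w => ∏ i, f i w) = (fun w => ∏ i ∈ s, f i w) * fun w => ∏ i ∈ sᶜ, f i w := by
    ext w; exact (prod_mul_prod_compl s _).symm
  rw [e, analyticOrderAt_mul (ha s) (ha sᶜ)]
  exact (key s subset_rfl).trans le_self_add

end InjectiveDeriv

section FixedPoints

open Matrix

variable {p : ℕ} [hp : Fact p.Prime]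

omit hp in
lemma eq_one_or_neg_one_of_fixed {γ : Matrix (Fin 2) (Fin 2) ℤ} (h2 : IsOneModTwo γ)
    (h1 : γ.det = 1) {τ : ℂ} (hτ : 0 < τ.im) (hf : mob γ τ = τ) : γ = 1 ∨ γ = -1 := by
  have h3 := theta3_mob h2 h1 hτ
  rw [hf] at h3
  have h4 : den γ τ ^ 2 = 1 :=
    (mul_right_cancel₀ (pow_ne_zero 4 (theta3_ne_zero hτ)) (by rw [one_mul]; exact h3)).symm
  have hden : den γ τ = 1 ∨ den γ τ = -1 := sq_eq_one_iff.mp h4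
  have hc : γ 1 0 = 0 := by
    have : (den γ τ).im = 0 := by rcases hden with h | h <;> simp [h]
    simp only [den, Complex.add_im, Complex.mul_im, Complex.intCast_im, Complex.intCast_re,
      zero_mul, add_zero] at this
    exact_mod_cast (mul_eq_zero.mp this).resolve_right hτ.ne'
  rw [det_fin_two, hc, mul_zero, sub_zero] at h1
  have hd : (γ 0 0 = 1 ∧ γ 1 1 = 1) ∨ (γ 0 0 = -1 ∧ γ 1 1 = -1) := Int.mul_eq_one_iff_eq_one_or_neg_one.mp h1
  have hb : γ 0 1 = 0 := by
    have h5 : mob γ τ = τ + (γ 0 1 : ℂ) * (γ 1 1 : ℂ) := by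
      rw [mob, hc]
      rcases hd with ⟨h, h'⟩ | ⟨h, h'⟩ <;> (rw [h, h']; simp; try ring)
    rw [h5, add_eq_left] at hf
    rcases mul_eq_zero.mp hf with h | h
    · exact_mod_cast h
    · rcases hd with ⟨_, h'⟩ | ⟨_, h'⟩ <;> rw [h'] at h <;> simp at h
  rcases hd with ⟨h, h'⟩ | ⟨h, h'⟩
  · left; ext i j; fin_cases i <;> fin_cases j <;> simp [h, h', hb, hc]
  · right; ext i j; fin_cases i <;> fin_cases j <;> simp [h, h', hb, hc]

lemma eq_of_fixed_of_heckeRep {γ γ' : Matrix (Fin 2) (Fin 2) ℤ} {j : Option (ZMod p)}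
    (h2 : IsOneModTwo γ) (h1 : γ.det = 1) (h2' : IsOneModTwo γ') (h1' : γ'.det = 1) {τ : ℂ}
    (hτ : 0 < τ.im) (hf : mob (γ * heckeRep p j) τ = τ) (hf' : mob (γ' * heckeRep p j) τ = τ)
    (hc : 0 < (γ * heckeRep p j) 1 0) (hc' : 0 < (γ' * heckeRep p j) 1 0) : γ = γ' := by
  have hdet : 0 < (heckeRep p j).det := det_heckeRep_pos j
  set w := mob (heckeRep p j) τ with hw
  have hwp : 0 < w.im := mob_im_pos hdet hτ
  rw [mob_mul _ hdet hτ] at hf hf'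
  have hdet' : 0 < γ.det := by rw [h1]; exact one_pos
  have hadj : γ.adjugate * γ = 1 := by rw [adjugate_mul, h1, one_smul]
  have hdadj : γ.adjugate.det = 1 := by
    have := congrArg det hadj
    rwa [det_mul, h1, mul_one, det_one] at this
  have h3 : mob (γ.adjugate * γ') w = w := by
    rw [mob_mul _ (by rw [h1']; exact one_pos) hwp, hf']
    nth_rewrite 1 [← hf]
    rw [← mob_mul _ hdet' hwp, hadj]
    simp [mob]
  have h4 := eq_one_or_neg_one_of_fixed (h2.adjugate.mul h2') (by rw [det_mul, hdadj, h1', one_mul])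
    hwp h3
  have e : γ' = γ * (γ.adjugate * γ') := by
    rw [← Matrix.mul_assoc, mul_adjugate, h1, one_smul, Matrix.one_mul]
  rcases h4 with h4 | h4
  · rw [e, h4, Matrix.mul_one]
  · rw [e, h4] at hc'
    rw [mul_neg, Matrix.mul_one, neg_mul, Matrix.neg_apply] at hc'
    linarith

lemma heckeCorr_factor_eq_zero {ε : ℤˣ} {γ : Matrix (Fin 2) (Fin 2) ℤ} {j : Option (ZMod p)}
    (hp2 : p ≠ 2) (h2 : IsOneModTwo γ) (h1 : γ.det = 1) {τ : ℂ} (hτ : 0 < τ.im)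
    (hf : mob (γ * heckeRep p j) τ = τ) (hs : upperSign (γ * heckeRep p j) = ε) :
    kmod τ ^ 2 - (ε : ℤ) * kmod τ * kmod (mob (heckeRep p j) τ) = 0 := by
  have hdet : 0 < (heckeRep p j).det := det_heckeRep_pos j
  rw [mob_mul _ hdet hτ] at hf
  rw [upperSign_mul h2 (isOneModTwo_heckeRep hp2 j), upperSign_heckeRep, mul_one] at hs
  have h := kmod_mob h2 h1 (mob_im_pos hdet hτ)
  rw [hf, hs] at h
  linear_combination kmod τ * h

lemma etaCorr_eq_zero (hp2 : p ≠ 2) {M : Matrix (Fin 2) (Fin 2) ℤ} (h2 : IsOneModTwo M)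
    (hM : M.det = p) {τ : ℂ} (hτ : 0 < τ.im) (hf : mob M τ = τ) :
    etaCorr p (den M τ ^ 2) τ = 0 := by
  obtain ⟨j, γ, h2', h1', rfl⟩ := exists_heckeRep hp2 h2 hM
  have hdet : 0 < (heckeRep p j).det := det_heckeRep_pos j
  refine prod_eq_zero (mem_univ j) ?_
  have hw := mob_im_pos hdet hτ
  have h := theta3_mob h2' h1' hw
  rw [← mob_mul _ hdet hτ, hf] at h
  rw [heckeWeight, den_mul _ hdet hτ, h, mul_div_cancel_right₀ _ (pow_ne_zero 4 (theta3_ne_zero hw))]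
  ring

omit hp in
lemma den_quadratic {M : Matrix (Fin 2) (Fin 2) ℤ} {τ : ℂ} (hM : 0 < M.det) (hτ : 0 < τ.im)
    (hf : mob M τ = τ) : den M τ * den M.adjugate τ = M.det ∧
      den M τ + den M.adjugate τ = ((M 0 0 + M 1 1 : ℤ) : ℂ) := by
  have h := den_ne_zero hM hτ
  have h1 : (M 0 0 : ℂ) * τ + M 0 1 = τ * den M τ := by
    have h' := h
    rw [den] at h'
    rw [mob, div_eq_iff h'] at hf
    exact hf
  rw [den] at h1
  rw [adjugate_fin_two, det_fin_two]
  simp only [den, of_apply, cons_val', cons_val_zero, cons_val_one, cons_val_fin_one]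
  push_cast
  constructor
  · linear_combination (M 1 0 : ℂ) * h1
  · ring

omit hp in
lemma mob_adjugate {M : Matrix (Fin 2) (Fin 2) ℤ} {τ : ℂ} (hM : 0 < M.det) (hτ : 0 < τ.im)
    (hf : mob M τ = τ) : mob M.adjugate τ = τ := by
  nth_rewrite 1 [← hf]
  rw [← mob_mul _ hM hτ, adjugate_mul, mob]
  have : (M.det : ℂ) ≠ 0 := by exact_mod_cast hM.ne'
  simp [this]

open Polynomial in
/-- The trace of an integral matrix fixing `τ` is, modulo `p`, `± a_p(λ(τ))` or zero. -/
lemma trace_sq_of_fixed (hp2 : p ≠ 2) (A : ValuationSubring ℂ)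
    [CharP (IsLocalRing.ResidueField A) p] {M : Matrix (Fin 2) (Fin 2) ℤ} (h2 : IsOneModTwo M)
    (hM : M.det = p) {τ : ℂ} (hτ : 0 < τ.im) (hf : mob M τ = τ) (ξ : A) (hξ : ξ = kmod τ ^ 2)
    (x : ZMod p) (hx : IsLocalRing.residue A ξ = ZMod.castHom dvd_rfl _ x) :
    (p : ℤ) ∣ (M 0 0 + M 1 1) ^ 2 ∨ (p : ℤ) ∣ (M 0 0 + M 1 1) ^ 2 - ap p x ^ 2 := by
  have hdet : 0 < M.det := by rw [hM]; exact_mod_cast hp.out.pos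
  obtain ⟨hprod, hsum⟩ := den_quadratic hdet hτ hf
  have hmemgen : ∀ u v : ℂ, u * v = M.det → u + v = ((M 0 0 + M 1 1 : ℤ) : ℂ) → u ∈ A := by
    intro u v huv hadd
    have hinteg : IsIntegral A u := by
      refine ⟨X ^ 2 - C (((M 0 0 + M 1 1 : ℤ)) : A) * X + C ((M.det : ℤ) : A), ?_, ?_⟩
      · monicity!
      · rw [eval₂_add, eval₂_sub, eval₂_mul, eval₂_pow, eval₂_X, eval₂_C, eval₂_C, map_intCast,
          map_intCast]
        rw [← huv, ← hadd]; ring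
    obtain ⟨y, hy⟩ := (IsIntegrallyClosed.isIntegral_iff (R := A) (K := ℂ)).mp hinteg
    rw [← hy]; exact y.2
  have hu := hmemgen _ _ hprod hsum
  have hv := hmemgen _ _ (by rw [mul_comm]; exact hprod) (by rw [add_comm]; exact hsum)
  set u : A := ⟨_, hu⟩ with hu'
  set v : A := ⟨_, hv⟩ with hv'
  have huv : u * v = ((p : ℤ) : A) := by
    apply Subtype.ext; push_cast; rw [hu', hv']; simp only; rw [hprod, hM]; simp
  have hadd : u + v = ((M 0 0 + M 1 1 : ℤ) : A) := by
    apply Subtype.ext; push_cast; rw [hu', hv']; simp only; rw [hsum]; push_cast; rfl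
  have hap : (aeval x (hassePoly p) : ZMod p) ^ 2 = (ap p x : ZMod p) ^ 2 := (ap_sq_cast hp2 x).symm
  have key : ∀ (N : Matrix (Fin 2) (Fin 2) ℤ) (w : A), (w : ℂ) = den N τ → IsOneModTwo N →
      N.det = p → mob N τ = τ → IsLocalRing.residue A w ^ 2 = 0 ∨
      IsLocalRing.residue A w ^ 2 = ((ap p x ^ 2 : ℤ) : IsLocalRing.ResidueField A) := by
    intro N w hw h2 hN hf
    obtain ⟨Q, hQ, hQ'⟩ := exists_etaCorr_polynomial hp2 A (w ^ 2)
    have h0 : Q.eval ξ = 0 := by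
      apply Subtype.ext
      have := etaCorr_eq_zero hp2 h2 hN hτ hf
      rw [← hw] at this
      have h1 := hQ τ hτ
      rw [show ((w ^ 2 : A) : ℂ) = (w : ℂ) ^ 2 from rfl] at h1
      rw [this, ← hξ] at h1
      have h2 := Polynomial.eval₂_at_apply (p := Q) A.subtype ξ
      rw [← Polynomial.eval_map] at h2
      exact (h2.symm.trans h1.symm)
    have h1 : (Q.map (IsLocalRing.residue A)).eval (IsLocalRing.residue A ξ) = 0 := by
      rw [Polynomial.eval_map, Polynomial.eval₂_hom, h0, map_zero]
    rw [hQ', hx] at h1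
    have h3 : ((hassePoly p).map (Int.castRingHom (IsLocalRing.ResidueField A))).eval
        (ZMod.castHom dvd_rfl _ x) = ZMod.castHom dvd_rfl _ (aeval x (hassePoly p)) := by
      rw [aeval_def, ← Polynomial.eval_map, ← Polynomial.eval₂_hom, ← Polynomial.eval_map,
        Polynomial.map_map]
      congr 2
      exact RingHom.ext_int _ _
    have h4 := congrArg (· ^ 2) h3
    rw [← map_pow (ZMod.castHom _ _), hap] at h4
    rw [eval_mul, eval_pow, eval_sub, eval_pow, eval_C, h4] at h1
    rcases mul_eq_zero.mp h1 with h1 | h1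
    · left; simpa using eq_zero_of_pow_eq_zero h1
    · right; rw [map_pow] at h1; rw [sub_eq_zero.mp h1]; simp
  have hadjdet : M.adjugate.det = p := by
    rw [det_adjugate, hM]; simp
  have k1 := key M u rfl h2 hM hf
  have k2 := key M.adjugate v rfl h2.adjugate hadjdet (mob_adjugate hdet hτ hf)
  have hz : IsLocalRing.residue A u * IsLocalRing.residue A v = 0 := by
    rw [← map_mul, huv, map_intCast]; simp
  have ht : IsLocalRing.residue A u + IsLocalRing.residue A v =
      ((M 0 0 + M 1 1 : ℤ) : IsLocalRing.ResidueField A) := by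
    rw [← map_add, hadd, map_intCast]
  have hsq : (((M 0 0 + M 1 1) ^ 2 : ℤ) : IsLocalRing.ResidueField A) =
      IsLocalRing.residue A u ^ 2 + IsLocalRing.residue A v ^ 2 := by
    rw [Int.cast_pow, ← ht]; linear_combination 2 * hz
  have hfin : (((M 0 0 + M 1 1) ^ 2 : ℤ) : IsLocalRing.ResidueField A) = 0 ∨
      (((M 0 0 + M 1 1) ^ 2 : ℤ) : IsLocalRing.ResidueField A) = ((ap p x ^ 2 : ℤ) : _) := by
    rw [hsq]
    rcases mul_eq_zero.mp hz with h | h <;> rw [h, zero_pow two_ne_zero]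
    · simpa using k2
    · simpa using k1
  rw [← CharP.intCast_eq_zero_iff (IsLocalRing.ResidueField A) p,
    ← CharP.intCast_eq_zero_iff (IsLocalRing.ResidueField A) p]
  refine hfin.imp id fun h => ?_
  rw [Int.cast_sub, h, sub_self]

omit hp in
lemma sq_le_of_dvd_sub {t a : ℤ} {p : ℕ} (hp : p.Prime) (h16 : 16 < p) (ht : t ^ 2 < 4 * p)
    (h : (p : ℤ) ∣ t ^ 2 ∨ (p : ℤ) ∣ t ^ 2 - a ^ 2) : t ^ 2 ≤ a ^ 2 := by
  have hpI : Prime (p : ℤ) := Nat.prime_iff_prime_int.mp hp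
  have hlt : 2 * |t| < p := by
    apply lt_of_pow_lt_pow_left₀ 2 (by positivity)
    rw [mul_pow, sq_abs]
    have : (16 : ℤ) < p := by exact_mod_cast h16
    nlinarith
  have key : ∀ s : ℤ, (s = a ∨ s = -a) → (p : ℤ) ∣ t - s → t ^ 2 ≤ a ^ 2 := by
    intro s hs hd
    by_contra hc
    push Not at hc
    have habs : |a| < |t| := sq_lt_sq.mp hc
    have hsa : |s| = |a| := by rcases hs with rfl | rfl <;> simp
    have h0 : t - s = 0 := Int.eq_zero_of_abs_lt_dvd hd (by
      have := abs_sub t s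
      omega)
    rw [sub_eq_zero.mp h0] at habs
    omega
  rcases h with h | h
  · have h0 : t = 0 := Int.eq_zero_of_abs_lt_dvd (hpI.dvd_of_dvd_pow h) (by
      have := abs_nonneg t; omega)
    rw [h0, zero_pow two_ne_zero]; positivity
  · rw [sq_sub_sq] at h
    rcases hpI.dvd_or_dvd h with h | h
    · exact key (-a) (Or.inr rfl) (by rwa [sub_neg_eq_add])
    · exact key a (Or.inl rfl) h

end FixedPoints

section Matching

variable {p : ℕ} [hp : Fact p.Prime]

open Polynomial

omit hp in
lemma ValuationSubring.splits_of_natDegree_map_residue (A : ValuationSubring ℂ) {Q : A[X]}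
    (hQ : Q.map (IsLocalRing.residue A) ≠ 0)
    (hdeg : Q.natDegree ≤ (Q.map (IsLocalRing.residue A)).natDegree) : Q.Splits := by
  have hd : (Q.map (IsLocalRing.residue A)).natDegree = Q.natDegree :=
    le_antisymm natDegree_map_le hdeg
  have hlead : IsUnit Q.leadingCoeff := by
    rw [← IsLocalRing.residue_ne_zero_iff_isUnit, leadingCoeff, ← hd, ← coeff_map]
    exact leadingCoeff_ne_zero.mpr hQ
  have hinj : Function.Injective A.subtype := Subtype.val_injective
  refine Splits.of_splits_map_of_injective hinj (IsAlgClosed.splits _) fun a ha => ?_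
  have hroot : (Q.map A.subtype).eval a = 0 := (mem_roots'.mp ha).2
  obtain ⟨u, hu⟩ := hlead
  have hinteg : IsIntegral A a := by
    refine ⟨C (↑u⁻¹ : A) * Q, ?_, ?_⟩
    · rw [Monic, leadingCoeff_mul, leadingCoeff_C, ← hu, Units.inv_mul]
    · rw [eval₂_mul]
      rw [eval_map] at hroot
      exact mul_eq_zero_of_right _ hroot
  obtain ⟨y, hy⟩ := (IsIntegrallyClosed.isIntegral_iff (R := A) (K := ℂ)).mp hinteg
  exact ⟨y, hy⟩

lemma units_pow_card_div_two_mem (K : Type*) [Field K] [CharP K p] (hp2 : p ≠ 2) {ε : ℤˣ} {y : K}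
    (hy : y ^ (p / 2) = ((ε : ℤ) : K)) :
    ∃ x : ZMod p, phi p x = ε ∧ ZMod.castHom dvd_rfl K x = y := by
  have hodd : p = p / 2 + p / 2 + 1 := by
    have := Nat.odd_iff.mp (hp.out.odd_of_ne_two hp2); omega
  have hε : ((ε : ℤ) : K) * ((ε : ℤ) : K) = 1 := by
    rw [← Int.cast_mul, Int.units_coe_mul_self, Int.cast_one]
  have hyp : y ^ p = y := by
    rw [hodd, pow_succ, pow_add, hy, hε, one_mul]
  rw [← Subfield.mem_bot_iff_pow_eq_self, ← ZMod.fieldRange_castHom_eq_bot p] at hyp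
  obtain ⟨x, rfl⟩ := hyp
  refine ⟨x, ?_, rfl⟩
  have h1 : (phi p x : ZMod p) = ((ε : ℤ) : ZMod p) := by
    rw [phi_cast hp2]
    apply (ZMod.castHom dvd_rfl K).injective
    rw [map_pow, hy, map_intCast]
  have h2 : (p : ℤ) ∣ phi p x - (ε : ℤ) := by
    rw [← ZMod.intCast_zmod_eq_zero_iff_dvd, Int.cast_sub, h1, sub_self]
  have h3 : |phi p x| ≤ 1 := by
    have := phi_sq_le_one (p := p) x
    exact (sq_le_one_iff_abs_le_one _).mp this
  have h4 : |(ε : ℤ)| = 1 := Int.isUnit_iff_abs_eq.mp ε.isUnit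
  have h5 : (3 : ℤ) ≤ p := by
    have := hp.out.two_le
    omega
  refine sub_eq_zero.mp (Int.eq_zero_of_abs_lt_dvd h2 ?_)
  have := abs_sub (phi p x) (ε : ℤ)
  omega

/-- The sum of a function supported on the prime field over the roots of the reduction of the
Hecke correspondence polynomial. -/
lemma sum_roots_le (K : Type*) [Field K] [CharP K p] (hp2 : p ≠ 2) (ε : ℤˣ) (f : ZMod p → ℤ)
    (hf : ∀ x, 0 ≤ f x) :
    ((C (-((ε : ℤ) : K)) * X ^ (p / 2 + 2) * (X ^ (p / 2) - C ((ε : ℤ) : K)) ^ 2).roots.map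
      (Function.extend (ZMod.castHom dvd_rfl K) f 0)).sum ≤
    (p / 2 + 2 : ℕ) * f 0 + 2 * ∑ x with phi p x = ε, f x := by
  classical
  set c := ZMod.castHom (n := p) dvd_rfl K with hc
  set F : K → ℤ := Function.extend c f 0 with hF
  have hε : ((ε : ℤ) : K) ≠ 0 := by
    intro h
    have : ((ε : ℤ) : K) * ((ε : ℤ) : K) = 1 := by
      rw [← Int.cast_mul, Int.units_coe_mul_self, Int.cast_one]
    rw [h, zero_mul] at this
    exact zero_ne_one this
  have hn : 0 < p / 2 := Nat.div_pos hp.out.two_le two_pos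
  have hX : (X ^ (p / 2) - C ((ε : ℤ) : K)) ≠ 0 := X_pow_sub_C_ne_zero hn _
  have hX0 : (X ^ (p / 2 + 2) : K[X]) ≠ 0 := pow_ne_zero _ X_ne_zero
  have hFapp : ∀ x, F (c x) = f x := fun x => c.injective.extend_apply _ _ _
  have hF0 : ∀ y, 0 ≤ F y := by
    intro y
    by_cases h : ∃ x, c x = y
    · obtain ⟨x, rfl⟩ := h; rw [hFapp]; exact hf x
    · rw [hF, Function.extend_apply' _ _ _ h]; rfl
  have hsep : (X ^ (p / 2) - C ((ε : ℤ) : K)).Separable := by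
    refine separable_X_pow_sub_C' p _ _ (fun h => ?_) hε
    have := Nat.le_of_dvd hn h
    have := hp.out.two_le
    omega
  rw [mul_assoc, roots_C_mul _ (neg_ne_zero.mpr hε), roots_mul (mul_ne_zero hX0 (pow_ne_zero 2 hX)),
    roots_pow, roots_pow, roots_X, Multiset.map_add, Multiset.sum_add, Multiset.map_nsmul,
    Multiset.map_nsmul, Multiset.sum_nsmul, Multiset.sum_nsmul, Multiset.map_singleton,
    Multiset.sum_singleton, show F 0 = f 0 by rw [← hFapp, map_zero], nsmul_eq_mul, nsmul_eq_mul]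
  have h1 : ((X ^ (p / 2) - C ((ε : ℤ) : K)).roots.map F).sum ≤ ∑ x with phi p x = ε, f x := by
    have hnd := nodup_roots hsep
    have h2 : ((X ^ (p / 2) - C ((ε : ℤ) : K)).roots.map F).sum =
        ∑ y ∈ (X ^ (p / 2) - C ((ε : ℤ) : K)).roots.toFinset, F y := by
      rw [sum_eq_multiset_sum, Multiset.toFinset_val, hnd.dedup]
    have h3 : ∑ x with phi p x = ε, f x =
        ∑ y ∈ (univ.filter fun x => phi p x = ε).image c, F y := by
      rw [sum_image (fun a _ b _ h => c.injective h)]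
      exact sum_congr rfl fun x _ => (hFapp x).symm
    rw [h2, h3]
    refine sum_le_sum_of_subset_of_nonneg (fun y hy => ?_) fun y _ _ => hF0 y
    rw [Multiset.mem_toFinset, mem_roots hX, IsRoot, eval_sub, eval_pow, eval_X, eval_C,
      sub_eq_zero] at hy
    obtain ⟨x, hx, rfl⟩ := units_pow_card_div_two_mem K hp2 hy
    exact mem_image_of_mem _ (by simpa using hx)
  push_cast
  linarith

/-- Matrices with a common fixed point contribute to the multiplicity of a root. -/
lemma card_le_rootMultiplicity (hp2 : p ≠ 2) (ε : ℤˣ) {R : ℂ[X]} (hR : R ≠ 0)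
    (hRτ : ∀ τ : ℂ, 0 < τ.im → heckeCorr p ε τ = R.eval (kmod τ ^ 2))
    (S : Finset (Matrix (Fin 2) (Fin 2) ℤ)) {τ : ℂ} (hτ : τ ∈ lambdaDomain)
    (hfix : ∀ M ∈ S, mob M τ = τ) (h2 : ∀ M ∈ S, IsOneModTwo M) (hdet : ∀ M ∈ S, M.det = p)
    (hpos : ∀ M ∈ S, 0 < M 1 0) (hs : ∀ M ∈ S, upperSign M = ε) :
    S.card ≤ R.rootMultiplicity (kmod τ ^ 2) := by
  classical
  have hτ0 := hτ.1
  have hex : ∀ M : Matrix (Fin 2) (Fin 2) ℤ, ∃ (j : Option (ZMod p))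
      (γ : Matrix (Fin 2) (Fin 2) ℤ), M ∈ S → IsOneModTwo γ ∧ γ.det = 1 ∧ M = γ * heckeRep p j := by
    intro M
    by_cases h : M ∈ S
    · obtain ⟨j, γ, h⟩ := exists_heckeRep hp2 (h2 M h) (hdet M h)
      exact ⟨j, γ, fun _ => h⟩
    · exact ⟨none, 0, fun h' => absurd h' h⟩
  choose j γ hjγ using hex
  have hinj : Set.InjOn j S := by
    intro M hM M' hM' hj
    obtain ⟨a, b, e⟩ := hjγ M hM
    obtain ⟨a', b', e'⟩ := hjγ M' hM'
    rw [← hj] at e'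
    have := eq_of_fixed_of_heckeRep a b a' b' hτ0 (by rw [← e]; exact hfix M hM)
      (by rw [← e']; exact hfix M' hM') (by rw [← e]; exact hpos M hM)
      (by rw [← e']; exact hpos M' hM')
    rw [e, e', this]
  rw [← card_image_of_injOn hinj, ← Nat.cast_le (α := ℕ∞), ← analyticOrderAt_eval_kmod_sq hτ hR]
  have hcongr : (fun z => R.eval (kmod z ^ 2)) =ᶠ[nhds τ] (fun w => ∏ i : Option (ZMod p),
      (kmod w ^ 2 - (ε : ℤ) * kmod w * kmod (mob (heckeRep p i) w))) := by
    filter_upwards [(isOpen_lt continuous_const Complex.continuous_im).mem_nhds hτ0] with w hw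
    rw [← hRτ w hw, heckeCorr]
  rw [analyticOrderAt_congr hcongr]
  refine card_le_analyticOrderAt_prod (f := fun (i : Option (ZMod p)) w =>
    kmod w ^ 2 - (ε : ℤ) * kmod w * kmod (mob (heckeRep p i) w)) _ (fun i => ?_) ?_
  · refine analyticAt_of_differentiableAt_im_pos (fun w hw => ?_) hτ0
    have h1 := differentiableAt_kmod hw
    have h2 := differentiableAt_kmod_mob (det_heckeRep_pos i) hw
    exact (h1.pow 2).sub (((differentiableAt_const _).mul h1).mul h2)
  · intro i hi
    obtain ⟨M, hM, rfl⟩ := mem_image.mp hi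
    obtain ⟨a, b, e⟩ := hjγ M hM
    exact heckeCorr_factor_eq_zero hp2 a b hτ0 (by rw [← e]; exact hfix M hM)
      (by rw [← e]; exact hs M hM)

/-- Squared traces of elliptic matrices of determinant `p` are dominated by squared traces of
Frobenius in the Legendre family. -/
theorem sum_trace_sq_le (hp16 : 16 < p) (ε : ℤˣ) (S : Finset (Matrix (Fin 2) (Fin 2) ℤ))
    (τ : Matrix (Fin 2) (Fin 2) ℤ → ℂ) (hτ : ∀ M ∈ S, τ M ∈ lambdaDomain)
    (hfix : ∀ M ∈ S, mob M (τ M) = τ M) (h2 : ∀ M ∈ S, IsOneModTwo M) (hdet : ∀ M ∈ S, M.det = p)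
    (hpos : ∀ M ∈ S, 0 < M 1 0) (hs : ∀ M ∈ S, upperSign M = ε)
    (htr : ∀ M ∈ S, (M 0 0 + M 1 1) ^ 2 < 4 * (p : ℤ)) :
    ∑ M ∈ S, (M 0 0 + M 1 1) ^ 2 ≤
      2 * ∑ x with phi p x = ε ∧ x ≠ 1 ∧ x ≠ -1, ap p x ^ 2 + 20 * (p : ℤ) := by
  classical
  have hp2 : p ≠ 2 := by omega
  have hodd := Nat.odd_iff.mp (hp.out.odd_of_ne_two hp2)
  obtain ⟨A, hA⟩ := ValuationSubring.exists_charP (p := p)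
  obtain ⟨Q, hQ, hQ', hdeg⟩ := exists_heckeCorr_polynomial hp2 A ε
  set K := IsLocalRing.ResidueField A with hK
  set f : ZMod p → ℤ := fun x => min (ap p x ^ 2) (4 * p) with hf
  have hf0 : ∀ x, 0 ≤ f x := fun x => le_min (sq_nonneg _) (by positivity)
  set F : K → ℤ := Function.extend (ZMod.castHom (n := p) dvd_rfl K) f 0 with hF
  have hεε : ((ε : ℤ) : K[X]) * ((ε : ℤ) : K[X]) = 1 := by
    rw [← Int.cast_mul, Int.units_coe_mul_self, Int.cast_one]
  have hε0 : ((ε : ℤ) : K) ≠ 0 := by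
    intro h
    have : ((ε : ℤ) : K) * ((ε : ℤ) : K) = 1 := by
      rw [← Int.cast_mul, Int.units_coe_mul_self, Int.cast_one]
    rw [h, zero_mul] at this
    exact zero_ne_one this
  have hQ2 : Q.map (IsLocalRing.residue A) =
      C (-((ε : ℤ) : K)) * X ^ (p / 2 + 2) * (X ^ (p / 2) - C ((ε : ℤ) : K)) ^ 2 := by
    rw [hQ', show (p + 3) / 2 = p / 2 + 2 by omega, C_neg, Polynomial.C_eq_intCast]
    linear_combination (-((ε : ℤ) : K[X])) * X ^ (p / 2 + 2) *
      ((X ^ (p / 2)) ^ 2 - 1) * hεε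
  have hn : 0 < p / 2 := by omega
  have hX : (X ^ (p / 2) - C ((ε : ℤ) : K)) ≠ 0 := X_pow_sub_C_ne_zero hn _
  have hCX : C (-((ε : ℤ) : K)) * X ^ (p / 2 + 2) ≠ 0 :=
    mul_ne_zero (C_ne_zero.mpr (neg_ne_zero.mpr hε0)) (pow_ne_zero _ X_ne_zero)
  have hQ0 : Q.map (IsLocalRing.residue A) ≠ 0 := by
    rw [hQ2]; exact mul_ne_zero hCX (pow_ne_zero 2 hX)
  have hQd : Q.natDegree ≤ (Q.map (IsLocalRing.residue A)).natDegree := by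
    rw [hQ2, natDegree_mul hCX (pow_ne_zero 2 hX), natDegree_C_mul_X_pow _ _ (neg_ne_zero.mpr hε0),
      natDegree_pow, natDegree_X_pow_sub_C]
    omega
  have hsplit := A.splits_of_natDegree_map_residue hQ0 hQd
  have hinj : Function.Injective A.subtype := Subtype.val_injective
  have hQne : Q ≠ 0 := fun h => hQ0 (by rw [h, Polynomial.map_zero])
  have hR : Q.map A.subtype ≠ 0 := (Polynomial.map_ne_zero_iff hinj).mpr hQne
  have hrootsC := hsplit.roots_map_of_ne_zero hR
  have hrootsK := hsplit.roots_map_of_ne_zero hQ0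
  have hcount : ∀ r : A, (Q.map A.subtype).rootMultiplicity (r : ℂ) = Q.roots.count r := by
    intro r
    rw [← count_roots, hrootsC]
    exact Multiset.count_map_eq_count' A.subtype Q.roots hinj r
  have hfiber : ∀ (r : A) (T : Finset (Matrix (Fin 2) (Fin 2) ℤ)), T ⊆ S →
      (∀ M ∈ T, kmod (τ M) ^ 2 = r) → T.card ≤ Q.roots.count r := by
    intro r T hT hr
    rcases T.eq_empty_or_nonempty with rfl | ⟨M₀, hM₀⟩
    · simp
    have heq : ∀ M ∈ T, τ M = τ M₀ := fun M hM =>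
      kmod_sq_injOn (hτ M (hT hM)) (hτ M₀ (hT hM₀)) ((hr M hM).trans (hr M₀ hM₀).symm)
    rw [← hcount, ← hr M₀ hM₀]
    exact card_le_rootMultiplicity hp2 ε hR hQ T (hτ M₀ (hT hM₀))
      (fun M hM => by rw [← heq M hM]; exact hfix M (hT hM)) (fun M hM => h2 M (hT hM))
      (fun M hM => hdet M (hT hM)) (fun M hM => hpos M (hT hM)) (fun M hM => hs M (hT hM))
  have hrex : ∀ M : Matrix (Fin 2) (Fin 2) ℤ, ∃ r : A, M ∈ S → r ∈ Q.roots ∧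
      kmod (τ M) ^ 2 = r := by
    intro M
    by_cases h : M ∈ S
    · have h1 : 1 ≤ (Q.map A.subtype).rootMultiplicity (kmod (τ M) ^ 2) := by
        refine card_le_rootMultiplicity hp2 ε hR hQ {M} (hτ M h) ?_ ?_ ?_ ?_ ?_ <;>
          simp only [mem_singleton, forall_eq]
        · exact hfix M h
        · exact h2 M h
        · exact hdet M h
        · exact hpos M h
        · exact hs M h
      have h3 : kmod (τ M) ^ 2 ∈ (Q.map A.subtype).roots := by
        rw [← Multiset.one_le_count_iff_mem, count_roots]; exact h1
      rw [hrootsC, Multiset.mem_map] at h3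
      obtain ⟨r, hr, hr'⟩ := h3
      exact ⟨r, fun _ => ⟨hr, hr'.symm⟩⟩
    · exact ⟨0, fun h' => absurd h' h⟩
  choose r hr using hrex
  have hle : ∀ M ∈ S, (M 0 0 + M 1 1) ^ 2 ≤ F (IsLocalRing.residue A (r M)) := by
    intro M hM
    obtain ⟨hrM, hrk⟩ := hr M hM
    have h4 : IsLocalRing.residue A (r M) ∈ (Q.map (IsLocalRing.residue A)).roots := by
      rw [hrootsK]; exact Multiset.mem_map_of_mem _ hrM
    obtain ⟨x, hx⟩ : ∃ x : ZMod p, ZMod.castHom dvd_rfl K x = IsLocalRing.residue A (r M) := by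
      rw [hQ2, mem_roots', IsRoot, eval_mul, eval_mul, eval_C, eval_pow, eval_pow, eval_X, eval_sub,
        eval_pow, eval_X, eval_C] at h4
      rcases mul_eq_zero.mp h4.2 with h5 | h5
      · rcases mul_eq_zero.mp h5 with h6 | h6
        · exact absurd h6 (neg_ne_zero.mpr hε0)
        · exact ⟨0, by rw [map_zero, eq_zero_of_pow_eq_zero h6]⟩
      · obtain ⟨x, -, hx⟩ := units_pow_card_div_two_mem K hp2
          (sub_eq_zero.mp (eq_zero_of_pow_eq_zero h5))
        exact ⟨x, hx⟩
    rw [← hx, hF, (ZMod.castHom dvd_rfl K).injective.extend_apply]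
    refine le_min ?_ (htr M hM).le
    exact sq_le_of_dvd_sub hp.out hp16 (htr M hM)
      (trace_sq_of_fixed hp2 A (h2 M hM) (hdet M hM) (hτ M hM).1 (hfix M hM) (r M) hrk.symm x
        hx.symm)
  have hF0 : ∀ y, 0 ≤ F y := by
    intro y
    by_cases h : ∃ x, ZMod.castHom (n := p) dvd_rfl K x = y
    · obtain ⟨x, rfl⟩ := h
      rw [hF, (ZMod.castHom dvd_rfl K).injective.extend_apply]; exact hf0 x
    · rw [hF, Function.extend_apply' _ _ _ h]; rfl
  have hsum1 : ∑ M ∈ S, (M 0 0 + M 1 1) ^ 2 ≤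
      ((Q.map (IsLocalRing.residue A)).roots.map F).sum := by
    calc ∑ M ∈ S, (M 0 0 + M 1 1) ^ 2 ≤ ∑ M ∈ S, F (IsLocalRing.residue A (r M)) :=
          sum_le_sum hle
      _ = ∑ s ∈ Q.roots.toFinset, ∑ M ∈ S with r M = s, F (IsLocalRing.residue A (r M)) :=
          (sum_fiberwise_of_maps_to (fun M hM => Multiset.mem_toFinset.mpr (hr M hM).1) _).symm
      _ ≤ ∑ s ∈ Q.roots.toFinset, Q.roots.count s • F (IsLocalRing.residue A s) := by
          refine sum_le_sum fun s _ => ?_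
          rw [sum_congr rfl (g := fun _ => F (IsLocalRing.residue A s))
            (fun M hM => by rw [(mem_filter.mp hM).2]), sum_const]
          refine nsmul_le_nsmul_left (hF0 _) (hfiber s _ (filter_subset _ _) fun M hM => ?_)
          rw [mem_filter] at hM
          rw [(hr M hM.1).2, hM.2]
      _ = ((Q.map (IsLocalRing.residue A)).roots.map F).sum := by
          rw [hrootsK, Multiset.map_map, Finset.sum_multiset_map_count]
          rfl
  refine hsum1.trans ?_
  rw [hQ2]
  refine (sum_roots_le K hp2 ε f hf0).trans ?_
  have h0 : f 0 ≤ 1 := (min_le_left _ _).trans (ap_zero_sq hp2)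
  have hsplit3 : ∑ x with phi p x = ε, f x ≤
      ∑ x with phi p x = ε ∧ x ≠ 1 ∧ x ≠ -1, ap p x ^ 2 + 8 * p := by
    have h5 : (univ.filter fun x : ZMod p => phi p x = ε) ⊆
        (univ.filter fun x : ZMod p => phi p x = ε ∧ x ≠ 1 ∧ x ≠ -1) ∪ {1, -1} := by
      intro x hx
      simp only [mem_union, mem_filter, mem_univ, true_and, mem_insert, mem_singleton] at hx ⊢
      tauto
    have h6 := sum_le_sum_of_subset_of_nonneg h5 (f := f) fun x _ _ => hf0 x
    have h7 := sum_union_inter (s₁ := univ.filter fun x : ZMod p => phi p x = ε ∧ x ≠ 1 ∧ x ≠ -1)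
      (s₂ := {1, -1}) (f := f)
    have h8 : 0 ≤ ∑ x ∈ (univ.filter fun x : ZMod p => phi p x = ε ∧ x ≠ 1 ∧ x ≠ -1) ∩ {1, -1},
      f x := sum_nonneg fun x _ => hf0 x
    have h9 : ∑ x ∈ ({1, -1} : Finset (ZMod p)), f x ≤ 8 * p := by
      have h10 := sum_le_card_nsmul ({1, -1} : Finset (ZMod p)) f (4 * p) fun x _ => min_le_right _ _
      have h11 : ({1, -1} : Finset (ZMod p)).card ≤ 2 := card_le_two
      rw [nsmul_eq_mul] at h10
      have : ((({1, -1} : Finset (ZMod p)).card : ℕ) : ℤ) ≤ 2 := by exact_mod_cast h11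
      nlinarith
    have h10 : ∑ x with phi p x = ε ∧ x ≠ 1 ∧ x ≠ -1, f x ≤
        ∑ x with phi p x = ε ∧ x ≠ 1 ∧ x ≠ -1, ap p x ^ 2 := sum_le_sum fun x _ => min_le_left _ _
    linarith
  have h12 : ((p / 2 + 2 : ℕ) : ℤ) * f 0 ≤ 4 * p := by
    have h13 : ((p / 2 + 2 : ℕ) : ℤ) ≤ 4 * p := by omega
    nlinarith [hf0 0]
  linarith

end Matching

section Kloosterman

variable {F : Type*} [Field F] [Fintype F] [DecidableEq F]

/-- Kloosterman sums over a finite field. -/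
noncomputable def kloosterman (ψ : AddChar F ℂ) (a b : F) : ℂ :=
  ∑ w : Fˣ, ψ (a * w + b * (w⁻¹ : Fˣ))

lemma card_kloosterman_energy :
    (univ.filter fun z : (Fˣ × Fˣ) × (Fˣ × Fˣ) =>
      (z.1.1 : F) + z.1.2 = z.2.1 + z.2.2 ∧
      ((z.1.1⁻¹ : Fˣ) : F) + (z.1.2⁻¹ : Fˣ) = (z.2.1⁻¹ : Fˣ) + (z.2.2⁻¹ : Fˣ)).card ≤
    3 * Fintype.card Fˣ ^ 2 := by
  set f1 : Fˣ × Fˣ → (Fˣ × Fˣ) × (Fˣ × Fˣ) := fun w => ((w.1, w.2), (w.1, w.2))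
  set f2 : Fˣ × Fˣ → (Fˣ × Fˣ) × (Fˣ × Fˣ) := fun w => ((w.1, w.2), (w.2, w.1))
  set f3 : Fˣ × Fˣ → (Fˣ × Fˣ) × (Fˣ × Fˣ) := fun w => ((w.1, -w.1), (w.2, -w.2))
  have hsub : (univ.filter fun z : (Fˣ × Fˣ) × (Fˣ × Fˣ) =>
      (z.1.1 : F) + z.1.2 = z.2.1 + z.2.2 ∧
      ((z.1.1⁻¹ : Fˣ) : F) + (z.1.2⁻¹ : Fˣ) = (z.2.1⁻¹ : Fˣ) + (z.2.2⁻¹ : Fˣ)) ⊆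
      univ.image f1 ∪ univ.image f2 ∪ univ.image f3 := by
    rintro ⟨⟨x, y⟩, ⟨z, w⟩⟩ h
    simp only [mem_filter, mem_univ, true_and, Units.val_inv_eq_inv_val] at h
    obtain ⟨h1, h2⟩ := h
    simp only [mem_union, mem_image, mem_univ, true_and, Prod.exists]
    by_cases h0 : (x : F) + y = 0
    · right
      refine ⟨x, z, ?_⟩
      have hy : -x = y := by apply Units.ext; push_cast; linear_combination -h0
      have hw : -z = w := by apply Units.ext; push_cast; linear_combination -h0 + h1
      simp only [f3, hy, hw]
    · left
      have hx := x.ne_zero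
      have hy := y.ne_zero
      have hz := z.ne_zero
      have hw := w.ne_zero
      have h3 : (z : F) * w = x * y := by
        field_simp at h2
        have h4 : ((x : F) + y) * (z * w - x * y) = 0 := by
          linear_combination h2 - x * y * h1
        rcases mul_eq_zero.mp h4 with h | h
        · exact absurd h h0
        · exact sub_eq_zero.mp h
      have h4 : ((z : F) - x) * (z - y) = 0 := by linear_combination (-(z : F)) * h1 - h3
      rcases mul_eq_zero.mp h4 with h | h
      · left
        have e1 : x = z := Units.ext (sub_eq_zero.mp h).symm
        have e2 : y = w := by apply Units.ext; rw [e1] at h1; exact add_left_cancel h1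
        exact ⟨x, y, by simp only [f1, e1, e2]⟩
      · right
        have e1 : y = z := Units.ext (sub_eq_zero.mp h).symm
        have e2 : x = w := by
          apply Units.ext; rw [e1, add_comm] at h1; exact add_left_cancel h1
        exact ⟨x, y, by simp only [f2, e1, e2]⟩
  refine (card_le_card hsub).trans ((card_union_le _ _).trans ?_)
  have hc : ∀ f : Fˣ × Fˣ → (Fˣ × Fˣ) × (Fˣ × Fˣ),
      (univ.image f).card ≤ Fintype.card Fˣ ^ 2 := fun f =>
    card_image_le.trans (by rw [card_univ, Fintype.card_prod, sq])
  have := card_union_le (univ.image f1) (univ.image f2)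
  have := hc f1
  have := hc f2
  have := hc f3
  omega

lemma sum_norm_kloosterman_pow_four_le {ψ : AddChar F ℂ} (hψ : ψ ≠ 1) :
    ∑ z : F × F, ‖kloosterman ψ z.1 z.2‖ ^ 4 ≤
      3 * (Fintype.card F : ℝ) ^ 2 * (Fintype.card Fˣ : ℝ) ^ 2 := by
  have hprim : ψ.IsPrimitive := AddChar.IsPrimitive.of_ne_one hψ
  have hsq : ∀ a b : F, kloosterman ψ a b ^ 2 = ∑ w : Fˣ × Fˣ,
      ψ (a * ((w.1 : F) + w.2) + b * (((w.1⁻¹ : Fˣ) : F) + (w.2⁻¹ : Fˣ))) := by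
    intro a b
    rw [sq, kloosterman, sum_mul_sum, Fintype.sum_prod_type]
    refine sum_congr rfl fun x _ => sum_congr rfl fun y _ => ?_
    rw [← AddChar.map_add_eq_mul]; congr 1; ring
  have hfour : ∀ a b : F, ((‖kloosterman ψ a b‖ ^ 4 : ℝ) : ℂ) =
      ∑ z : (Fˣ × Fˣ) × (Fˣ × Fˣ),
        ψ (a * (((z.1.1 : F) + z.1.2) - (z.2.1 + z.2.2))) *
        ψ (b * ((((z.1.1⁻¹ : Fˣ) : F) + (z.1.2⁻¹ : Fˣ)) -
          ((z.2.1⁻¹ : Fˣ) + (z.2.2⁻¹ : Fˣ)))) := by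
    intro a b
    have h1 : ((‖kloosterman ψ a b‖ ^ 4 : ℝ) : ℂ) =
        kloosterman ψ a b ^ 2 * (starRingEnd ℂ) (kloosterman ψ a b ^ 2) := by
      rw [Complex.mul_conj', norm_pow]; push_cast; ring
    rw [h1, hsq, map_sum, sum_mul_sum, Fintype.sum_prod_type (α₁ := Fˣ × Fˣ)]
    refine sum_congr rfl fun x _ => sum_congr rfl fun y _ => ?_
    simp only [← ψ.map_neg_eq_conj, ← ψ.map_add_eq_mul]
    congr 1
    ring
  have hC : ((∑ z : F × F, ‖kloosterman ψ z.1 z.2‖ ^ 4 : ℝ) : ℂ) =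
      ((Fintype.card F ^ 2 * (univ.filter fun z : (Fˣ × Fˣ) × (Fˣ × Fˣ) =>
      (z.1.1 : F) + z.1.2 = z.2.1 + z.2.2 ∧
      ((z.1.1⁻¹ : Fˣ) : F) + (z.1.2⁻¹ : Fˣ) = (z.2.1⁻¹ : Fˣ) + (z.2.2⁻¹ : Fˣ)).card : ℝ) : ℂ) := by
    rw [Complex.ofReal_sum]
    simp_rw [hfour]
    rw [sum_comm, card_filter]
    push_cast
    rw [mul_sum]
    refine sum_congr rfl fun z _ => ?_
    rw [Fintype.sum_prod_type]
    simp only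
    rw [← sum_mul_sum, AddChar.sum_mulShift _ hprim, AddChar.sum_mulShift _ hprim]
    simp only [sub_eq_zero]
    split_ifs <;> simp_all [sq]
  have hR := Complex.ofReal_injective hC
  rw [hR]
  have h := card_kloosterman_energy (F := F)
  have h' : (((univ.filter fun z : (Fˣ × Fˣ) × (Fˣ × Fˣ) =>
      (z.1.1 : F) + z.1.2 = z.2.1 + z.2.2 ∧
      ((z.1.1⁻¹ : Fˣ) : F) + (z.1.2⁻¹ : Fˣ) = (z.2.1⁻¹ : Fˣ) + (z.2.2⁻¹ : Fˣ)).card : ℕ) : ℝ) ≤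
      3 * (Fintype.card Fˣ : ℝ) ^ 2 := by exact_mod_cast h
  nlinarith [sq_nonneg (Fintype.card F : ℝ)]

/-- Kloosterman's bound. -/
theorem norm_kloosterman_pow_four_le {ψ : AddChar F ℂ} (hψ : ψ ≠ 1) {a b : F}
    (hab : a ≠ 0 ∨ b ≠ 0) :
    ‖kloosterman ψ a b‖ ^ 4 ≤ 3 * (Fintype.card F : ℝ) ^ 2 * (Fintype.card Fˣ : ℝ) := by
  have hinv : ∀ t : Fˣ, kloosterman ψ (a * t) (b * (t⁻¹ : Fˣ)) = kloosterman ψ a b := by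
    intro t
    rw [kloosterman, kloosterman]
    refine Fintype.sum_equiv (Equiv.mulLeft t) _ _ fun w => ?_
    congr 1
    simp only [Equiv.coe_mulLeft, mul_inv, Units.val_mul]
    ring
  have hinj : Function.Injective fun t : Fˣ => ((a * t, b * (t⁻¹ : Fˣ)) : F × F) := by
    intro t t' h
    simp only [Prod.mk.injEq] at h
    rcases hab with h0 | h0
    · exact Units.ext (mul_left_cancel₀ h0 h.1)
    · exact inv_injective (Units.ext (mul_left_cancel₀ h0 h.2))
  have h1 : ∑ t : Fˣ, ‖kloosterman ψ a b‖ ^ 4 ≤ ∑ z : F × F, ‖kloosterman ψ z.1 z.2‖ ^ 4 := by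
    calc ∑ t : Fˣ, ‖kloosterman ψ a b‖ ^ 4
        = ∑ z ∈ univ.image fun t : Fˣ => ((a * t, b * (t⁻¹ : Fˣ)) : F × F),
          ‖kloosterman ψ z.1 z.2‖ ^ 4 := by
          rw [sum_image fun x _ y _ h => hinj h]
          exact sum_congr rfl fun t _ => by rw [hinv]
      _ ≤ _ := sum_le_sum_of_subset_of_nonneg (subset_univ _) fun z _ _ => by positivity
  rw [sum_const, card_univ, nsmul_eq_mul] at h1
  have h2 := h1.trans (sum_norm_kloosterman_pow_four_le hψ)
  have h3 : (0 : ℝ) < Fintype.card Fˣ := by exact_mod_cast Fintype.card_pos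
  refine le_of_mul_le_mul_left (h2.trans (le_of_eq ?_)) h3
  ring

end Kloosterman

/-- Cancellation in complete Kloosterman sums to a modulus exactly divisible by a prime `q`. -/
lemma norm_sum_units_stdAddChar_pow_four_le {q b : ℕ} [Fact q.Prime] [NeZero b] [NeZero (q * b)]
    (hqb : q.Coprime b) (A B : ZMod (q * b))
    (hAB : ZMod.castHom (dvd_mul_right q b) (ZMod q) A ≠ 0 ∨
      ZMod.castHom (dvd_mul_right q b) (ZMod q) B ≠ 0) :
    ‖∑ u : (ZMod (q * b))ˣ, ZMod.stdAddChar (A * (u : ZMod (q * b)) + B * ((u⁻¹ : (ZMod (q * b))ˣ) : ZMod (q * b)))‖ ^ 4 ≤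
      (Fintype.card (ZMod (q * b))ˣ : ℝ) ^ 4 * (12 / ((q : ℝ) - 1)) := by
  have hq : q.Prime := Fact.out
  have hq2 : (2 : ℝ) ≤ q := by exact_mod_cast hq.two_le
  set e := ZMod.chineseRemainder hqb with he
  set ψ : AddChar (ZMod (q * b)) ℂ := ZMod.stdAddChar with hψ
  set ψ₁ : AddChar (ZMod q) ℂ := (ψ.compAddMonoidHom (e.symm : _ →+ _)).compAddMonoidHom
    (AddMonoidHom.inl (ZMod q) (ZMod b)) with hψ₁
  set ψ₂ : AddChar (ZMod b) ℂ := (ψ.compAddMonoidHom (e.symm : _ →+ _)).compAddMonoidHom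
    (AddMonoidHom.inr (ZMod q) (ZMod b)) with hψ₂
  have hsplit : ∀ z, ψ z = ψ₁ (e z).1 * ψ₂ (e z).2 := by
    intro z
    have h : z = e.symm ((e z).1, 0) + e.symm (0, (e z).2) := by
      rw [← map_add]; simp
    conv_lhs => rw [h, ψ.map_add_eq_mul]
    simp [hψ₁, hψ₂]
  have h₁ : ψ₁ ≠ 1 := by
    intro h
    have h1 : ψ (e.symm (1, 0)) = 1 := by
      have : ψ₁ 1 = 1 := by rw [h]; rfl
      simpa [hψ₁] using this
    rw [← ψ.map_zero_eq_one] at h1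
    have h2 := ZMod.injective_stdAddChar h1
    rw [map_eq_zero_iff _ e.symm.injective] at h2
    have h3 := congrArg Prod.fst h2
    exact one_ne_zero h3
  have hfst : ∀ z, (e z).1 = ZMod.castHom (dvd_mul_right q b) (ZMod q) z := fun z =>
    congrArg (fun f : ZMod (q * b) →+* ZMod q => f z)
      (Subsingleton.elim ((RingHom.fst _ _).comp e.toRingHom) _)
  have hK := norm_kloosterman_pow_four_le (F := ZMod q) h₁ (a := (e A).1) (b := (e B).1)
    (by rwa [hfst, hfst])
  have hprod : ∑ u : (ZMod (q * b))ˣ, ψ (A * u + B * (u⁻¹ : (ZMod (q * b))ˣ)) =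
      kloosterman ψ₁ (e A).1 (e B).1 *
        ∑ t : (ZMod b)ˣ, ψ₂ ((e A).2 * t + (e B).2 * (t⁻¹ : (ZMod b)ˣ)) := by
    rw [kloosterman, sum_mul_sum, ← Fintype.sum_prod_type']
    refine Fintype.sum_equiv ((Units.mapEquiv e.toMulEquiv).trans MulEquiv.prodUnits).toEquiv
      _ _ fun u => ?_
    rw [hsplit]
    congr 1
    · rw [map_add, map_mul, map_mul]
      rfl
    · rw [map_add, map_mul, map_mul]
      rfl
  have hnorm : ‖∑ t : (ZMod b)ˣ, ψ₂ ((e A).2 * t + (e B).2 * (t⁻¹ : (ZMod b)ˣ))‖ ≤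
      Fintype.card (ZMod b)ˣ := by
    refine (norm_sum_le _ _).trans ?_
    simp [AddChar.norm_apply]
  have hcard : (Fintype.card (ZMod (q * b))ˣ : ℝ) =
      Fintype.card (ZMod q)ˣ * Fintype.card (ZMod b)ˣ := by
    rw [ZMod.card_units_eq_totient, ZMod.card_units_eq_totient, ZMod.card_units_eq_totient,
      Nat.totient_mul hqb]
    push_cast; rfl
  have hcq : (Fintype.card (ZMod q)ˣ : ℝ) = q - 1 := by
    rw [ZMod.card_units q, Nat.cast_sub hq.one_le]; norm_num
  rw [hprod, norm_mul, mul_pow, hcard, hcq]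
  rw [hcq, ZMod.card q] at hK
  have h4 := pow_le_pow_left₀ (norm_nonneg _) hnorm 4
  have hpos : (0 : ℝ) < q - 1 := by linarith
  calc _ ≤ (3 * (q : ℝ) ^ 2 * (q - 1)) * (Fintype.card (ZMod b)ˣ : ℝ) ^ 4 :=
        mul_le_mul hK h4 (by positivity) (by positivity)
    _ ≤ (12 * (q - 1 : ℝ) ^ 3) * (Fintype.card (ZMod b)ˣ : ℝ) ^ 4 := by
        refine mul_le_mul_of_nonneg_right ?_ (by positivity)
        have : (q : ℝ) ^ 2 ≤ 4 * (q - 1) ^ 2 := by nlinarith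
        nlinarith
    _ = _ := by field_simp

section Equidistribution

open Filter Topology MeasureTheory

/-- A modulus `q * b` exactly divisible by the prime `q`, and a unit residue class. -/
structure KloostermanDatum where
  q : ℕ
  b : ℕ
  hq : q.Prime
  hb : b ≠ 0
  hqb : q.Coprime b
  a : (ZMod (q * b))ˣ

namespace KloostermanDatum

/-- The filter along which the distinguished prime grows. -/
def primeAtTop : Filter KloostermanDatum := comap KloostermanDatum.q atTop

instance (d : KloostermanDatum) : Fact d.q.Prime := ⟨d.hq⟩
instance (d : KloostermanDatum) : NeZero d.b := ⟨d.hb⟩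
instance (d : KloostermanDatum) : NeZero (d.q * d.b) := ⟨mul_ne_zero d.hq.ne_zero d.hb⟩

/-- The average of `f ⊗ g` over the points `(u / c, a u⁻¹ / c)`. -/
noncomputable def average (d : KloostermanDatum) (f g : C(UnitAddCircle, ℂ)) : ℂ :=
  (Fintype.card (ZMod (d.q * d.b))ˣ : ℂ)⁻¹ * ∑ u : (ZMod (d.q * d.b))ˣ,
    f (ZMod.toAddCircle (u : ZMod (d.q * d.b))) *
      g (ZMod.toAddCircle ((d.a * u⁻¹ : (ZMod (d.q * d.b))ˣ) : ZMod (d.q * d.b)))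

lemma card_units_pos (d : KloostermanDatum) : (0 : ℝ) < Fintype.card (ZMod (d.q * d.b))ˣ := by
  exact_mod_cast Fintype.card_pos

lemma average_symm (d : KloostermanDatum) (f g : C(UnitAddCircle, ℂ)) :
    d.average f g = d.average g f := by
  rw [average, average]
  congr 1
  refine Fintype.sum_equiv ((Equiv.inv _).trans (Equiv.mulLeft d.a)) _ _ fun u => ?_
  simp [mul_comm]

lemma norm_average_le (d : KloostermanDatum) (f g : C(UnitAddCircle, ℂ)) :
    ‖d.average f g‖ ≤ ‖g‖ * ‖f‖ := by
  rw [average, norm_mul, norm_inv, Complex.norm_natCast, inv_mul_le_iff₀ d.card_units_pos]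
  refine (norm_sum_le _ _).trans ?_
  refine (sum_le_sum (g := fun _ => ‖g‖ * ‖f‖) fun u _ => ?_).trans (by simp)
  rw [norm_mul, mul_comm]
  exact mul_le_mul (g.norm_coe_le_norm _) (f.norm_coe_le_norm _) (norm_nonneg _) (norm_nonneg _)

/-- Deviation of the average from the product of the integrals, as a linear functional. -/
noncomputable def deviation (d : KloostermanDatum) (g : C(UnitAddCircle, ℂ)) :
    C(UnitAddCircle, ℂ) →ₗ[ℂ] ℂ where
  toFun f := d.average f g - (∫ x, f x) * ∫ x, g x
  map_add' f₁ f₂ := by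
    have h : ∀ f : C(UnitAddCircle, ℂ), Integrable (fun x => f x) := fun f =>
      f.continuous.integrable_of_hasCompactSupport (HasCompactSupport.of_compactSpace f)
    simp only [average, ContinuousMap.add_apply, add_mul, sum_add_distrib, mul_add]
    rw [integral_add (h f₁) (h f₂)]
    ring
  map_smul' r f := by
    simp only [average, ContinuousMap.smul_apply, smul_eq_mul, mul_assoc, ← mul_sum,
      integral_const_mul, RingHom.id_apply]
    ring

lemma volume_real_univ : (volume : Measure UnitAddCircle).real Set.univ = 1 := by
  rw [measureReal_def, UnitAddCircle.measure_univ]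
  rfl

lemma norm_integral_le (f : C(UnitAddCircle, ℂ)) : ‖∫ x, f x‖ ≤ ‖f‖ := by
  have := norm_integral_le_of_norm_le_const (μ := (volume : Measure UnitAddCircle))
    (f := f) (C := ‖f‖) (Eventually.of_forall fun x => f.norm_coe_le_norm x)
  simpa [volume_real_univ] using this

lemma norm_deviation_le (d : KloostermanDatum) (f g : C(UnitAddCircle, ℂ)) :
    ‖d.deviation g f‖ ≤ 2 * ‖g‖ * ‖f‖ := by
  refine (norm_sub_le _ _).trans ?_
  have h1 := d.norm_average_le f g
  rw [norm_mul]
  have h2 := mul_le_mul (norm_integral_le f) (norm_integral_le g) (norm_nonneg _) (norm_nonneg _)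
  linarith

lemma tendsto_zero_of_dense {ι E : Type*} [NormedAddCommGroup E] [NormedSpace ℂ E] {L : Filter ι}
    (D : ι → E →ₗ[ℂ] ℂ) {C : ℝ} (hC : ∀ i f, ‖D i f‖ ≤ C * ‖f‖) {s : Set E}
    (hs : (Submodule.span ℂ s).topologicalClosure = ⊤)
    (h : ∀ f ∈ s, Tendsto (fun i => D i f) L (𝓝 0)) (f : E) :
    Tendsto (fun i => D i f) L (𝓝 0) := by
  have hspan : ∀ f ∈ Submodule.span ℂ s, Tendsto (fun i => D i f) L (𝓝 0) := by
    intro f hf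
    induction hf using Submodule.span_induction with
    | mem x hx => exact h x hx
    | zero => simpa using tendsto_const_nhds
    | add x y _ _ hx hy => simpa using hx.add hy
    | smul r x _ hx => simpa using hx.const_mul r
  rw [Metric.tendsto_nhds]
  intro ε hε
  have hf : f ∈ closure (Submodule.span ℂ s : Set E) := by
    rw [← Submodule.topologicalClosure_coe, hs]; trivial
  obtain ⟨g, hg, hfg⟩ := Metric.mem_closure_iff.mp hf (ε / (2 * (|C| + 1))) (by positivity)
  have h1 := Metric.tendsto_nhds.mp (hspan g hg) (ε / 2) (by positivity)
  filter_upwards [h1] with i hi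
  rw [dist_zero_right] at hi ⊢
  have h2 : D i f = D i (f - g) + D i g := by rw [← map_add, sub_add_cancel]
  have h3 : ‖D i (f - g)‖ ≤ ε / 2 := by
    refine (hC i _).trans ?_
    rw [← dist_eq_norm]
    have h5 : 0 < |C| + 1 := by positivity
    calc C * dist f g ≤ (|C| + 1) * (ε / (2 * (|C| + 1))) :=
          mul_le_mul (by linarith [le_abs_self C]) hfg.le dist_nonneg h5.le
      _ = ε / 2 := by field_simp
  rw [h2]
  exact (norm_add_le _ _).trans_lt (by linarith)

lemma integral_fourier (n : ℤ) :
    ∫ x : UnitAddCircle, (fourier n x : ℂ) = if n = 0 then 1 else 0 := by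
  split_ifs with h
  · simp [h, volume_real_univ]
  · have h1 : (volume : Measure UnitAddCircle) = AddCircle.haarAddCircle := by
      rw [AddCircle.volume_eq_smul_haarAddCircle]; simp
    have h2 := congrFun (fourierCoeff_fourier (T := 1) n) 0
    rw [Pi.single_apply, if_neg (Ne.symm h), fourierCoeff] at h2
    rw [h1]
    simpa using h2

lemma average_fourier (d : KloostermanDatum) (h l : ℤ) :
    d.average (fourier h) (fourier l) = (Fintype.card (ZMod (d.q * d.b))ˣ : ℂ)⁻¹ *
      ∑ u : (ZMod (d.q * d.b))ˣ, ZMod.stdAddChar ((h : ZMod (d.q * d.b)) *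
        (u : ZMod (d.q * d.b)) + ((l : ZMod (d.q * d.b)) * (d.a : ZMod (d.q * d.b))) *
          ((u⁻¹ : (ZMod (d.q * d.b))ˣ) : ZMod (d.q * d.b))) := by
  rw [average]
  congr 1
  refine sum_congr rfl fun u _ => ?_
  have hf : ∀ (n : ℤ) (z : ZMod (d.q * d.b)), (fourier n (ZMod.toAddCircle z) : ℂ) =
      ZMod.stdAddChar ((n : ZMod (d.q * d.b)) * z) := by
    intro n z
    rw [fourier_apply, ZMod.stdAddChar_apply, ← zsmul_eq_mul, ← map_zsmul]
    rfl
  rw [hf, hf, ← AddChar.map_add_eq_mul, Units.val_mul]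
  congr 1
  ring

lemma tendsto_deviation_fourier (h l : ℤ) :
    Tendsto (fun d : KloostermanDatum => d.deviation (fourier l) (fourier h)) primeAtTop
      (𝓝 0) := by
  by_cases h0 : h = 0 ∧ l = 0
  · obtain ⟨rfl, rfl⟩ := h0
    refine tendsto_const_nhds.congr fun d => ?_
    simp [deviation, average, volume_real_univ]
  have hI : (∫ x : UnitAddCircle, (fourier h x : ℂ)) * ∫ x : UnitAddCircle, (fourier l x : ℂ) = 0 := by
    rw [integral_fourier, integral_fourier]
    by_cases h1 : h = 0
    · have h2 : l ≠ 0 := fun h2 => h0 ⟨h1, h2⟩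
      simp [h2]
    · simp [h1]
  have hq : Tendsto (fun d : KloostermanDatum => (d.q : ℝ)) primeAtTop atTop :=
    tendsto_natCast_atTop_atTop.comp tendsto_comap
  have hlim : Tendsto (fun d : KloostermanDatum => 12 / ((d.q : ℝ) - 1)) primeAtTop (𝓝 0) :=
    tendsto_const_nhds.div_atTop (tendsto_atTop_add_const_right _ (-1) hq)
  have h4 : Tendsto (fun d : KloostermanDatum => ‖d.deviation (fourier l) (fourier h)‖ ^ 4)
      primeAtTop (𝓝 0) := by
    refine squeeze_zero' (Eventually.of_forall fun d => by positivity) ?_ hlim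
    filter_upwards [hq.eventually_gt_atTop ((|h| + |l| : ℤ) : ℝ)] with d hd
    have hd' : |h| + |l| < (d.q : ℤ) := by exact_mod_cast hd
    have key := norm_sum_units_stdAddChar_pow_four_le d.hqb (h : ZMod (d.q * d.b)) (l * (d.a : ZMod (d.q * d.b))) (by
      have hz : ∀ n : ℤ, |n| < d.q → n ≠ 0 → (n : ZMod d.q) ≠ 0 := fun n hn hn0 hz =>
        hn0 (Int.eq_zero_of_abs_lt_dvd ((ZMod.intCast_zmod_eq_zero_iff_dvd n d.q).mp hz) hn)
      by_cases h1 : h = 0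
      · right
        rw [map_mul, map_intCast]
        have hu : IsUnit (ZMod.castHom (dvd_mul_right d.q d.b) (ZMod d.q)
          (d.a : ZMod (d.q * d.b))) := d.a.isUnit.map _
        refine mul_ne_zero (hz l ?_ fun h2 => h0 ⟨h1, h2⟩) hu.ne_zero
        linarith [abs_nonneg h]
      · left
        rw [map_intCast]
        exact hz h (by linarith [abs_nonneg l]) h1)
    have hdev : d.deviation (fourier l) (fourier h) = d.average (fourier h) (fourier l) := by
      change d.average (fourier h) (fourier l) - _ = _
      rw [hI, sub_zero]
    rw [hdev, average_fourier, norm_mul, norm_inv, Complex.norm_natCast, mul_pow, inv_pow,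
      inv_mul_le_iff₀ (by have := d.card_units_pos; positivity)]
    exact key
  rw [tendsto_zero_iff_norm_tendsto_zero]
  have := h4.rpow_const (p := 1 / 4) (Or.inr (by norm_num))
  rw [Real.zero_rpow (by norm_num)] at this
  refine this.congr fun d => ?_
  rw [← Real.rpow_natCast, ← Real.rpow_mul (norm_nonneg _)]
  norm_num

/-- Equidistribution of modular hyperbolas, tested against continuous functions. -/
theorem tendsto_deviation (f g : C(UnitAddCircle, ℂ)) :
    Tendsto (fun d : KloostermanDatum => d.deviation g f) primeAtTop (𝓝 0) := by
  have hsymm : ∀ (d : KloostermanDatum) (f g : C(UnitAddCircle, ℂ)),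
      d.deviation g f = d.deviation f g := fun d f g => by
    change d.average f g - _ = d.average g f - _
    rw [average_symm, mul_comm (∫ x, f x)]
  refine tendsto_zero_of_dense (fun d : KloostermanDatum => d.deviation g)
    (fun d f => d.norm_deviation_le f g)
    span_fourier_closure_eq_top ?_ f
  rintro _ ⟨h, rfl⟩
  simp_rw [hsymm _ (fourier h) g]
  refine tendsto_zero_of_dense (fun d : KloostermanDatum => d.deviation (fourier h))
    (fun d f => d.norm_deviation_le f (fourier h)) span_fourier_closure_eq_top ?_ g
  rintro _ ⟨l, rfl⟩
  exact tendsto_deviation_fourier l h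

end KloostermanDatum

end Equidistribution

section Cells

open Filter Topology MeasureTheory

namespace KloostermanDatum

/-- A continuous minorant of the indicator function of an open ball in the circle. -/
noncomputable def bump (z : UnitAddCircle) (r s : ℝ) (x : UnitAddCircle) : ℝ :=
  max 0 (min 1 ((r - ‖x - z‖) / s))

lemma bump_nonneg (z : UnitAddCircle) (r s : ℝ) (x : UnitAddCircle) : 0 ≤ bump z r s x :=
  le_max_left _ _

lemma bump_le_one (z : UnitAddCircle) (r s : ℝ) (x : UnitAddCircle) : bump z r s x ≤ 1 :=
  max_le zero_le_one (min_le_left _ _)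

lemma continuous_bump (z : UnitAddCircle) (r s : ℝ) : Continuous (bump z r s) := by
  unfold bump; fun_prop

lemma bump_eq_zero {z : UnitAddCircle} {r s : ℝ} (hs : 0 < s) {x : UnitAddCircle}
    (h : ¬ ‖x - z‖ < r) : bump z r s x = 0 :=
  max_eq_left ((min_le_right _ _).trans
    (div_nonpos_of_nonpos_of_nonneg (by linarith [not_lt.mp h]) hs.le))

lemma le_integral_bump (z : UnitAddCircle) {r s : ℝ} (hs : 0 < s) (hr : r ≤ 1 / 2) :
    2 * (r - s) ≤ ∫ x, bump z r s x := by
  have hinteg : Integrable (bump z r s) (volume : Measure UnitAddCircle) :=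
    (continuous_bump z r s).integrable_of_hasCompactSupport (HasCompactSupport.of_compactSpace _)
  have h1 : ∀ x, (Metric.closedBall z (r - s)).indicator (fun _ => (1 : ℝ)) x ≤ bump z r s x := by
    intro x
    by_cases hx : x ∈ Metric.closedBall z (r - s)
    · rw [Set.indicator_of_mem hx]
      rw [Metric.mem_closedBall, dist_eq_norm] at hx
      refine le_max_of_le_right (le_min le_rfl ?_)
      rw [le_div_iff₀ hs]; linarith
    · rw [Set.indicator_of_notMem hx]; exact bump_nonneg _ _ _ _
  have h2 := integral_mono ((integrable_const (1 : ℝ)).indicator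
    (Metric.isClosed_closedBall (x := z) (ε := r - s)).measurableSet) hinteg h1
  rw [integral_indicator_const _ Metric.isClosed_closedBall.measurableSet, measureReal_def,
    AddCircle.volume_closedBall, min_eq_right (by linarith), smul_eq_mul, mul_one,
    ENNReal.toReal_ofReal'] at h2
  exact (le_max_left _ _).trans h2

/-- The centre of the `i`-th of `k` equal arcs. -/
noncomputable def arcCenter (k : ℕ) (i : ℤ) : ℝ := (i + 1 / 2) / k

lemma arcCenter_emod {k : ℕ} (hk : 0 < k) (i : ℤ) :
    (arcCenter k (i % k) : UnitAddCircle) = (arcCenter k i : UnitAddCircle) := by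
  have hk' : (k : ℝ) ≠ 0 := by positivity
  have h : arcCenter k i = arcCenter k (i % k) + (i / k : ℤ) := by
    have := Int.emod_add_mul_ediv i k
    have h' : (i : ℝ) = (i % k : ℤ) + k * (i / k : ℤ) := by exact_mod_cast this.symm
    unfold arcCenter
    field_simp
    rw [h']; ring
  rw [h, AddCircle.coe_add]
  have : ((i / k : ℤ) : ℝ) = (i / k : ℤ) • (1 : ℝ) := by simp
  rw [this, AddCircle.coe_zsmul, AddCircle.coe_period, smul_zero, add_zero]

/-- The units whose point on the modular hyperbola lies in a given cell. -/
noncomputable def cell (d : KloostermanDatum) (k : ℕ) (i j : ℤ) :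
    Finset (ZMod (d.q * d.b))ˣ :=
  univ.filter fun u =>
    ‖ZMod.toAddCircle (u : ZMod (d.q * d.b)) - (arcCenter k i : UnitAddCircle)‖ < 1 / (2 * k) ∧
    ‖ZMod.toAddCircle ((d.a * u⁻¹ : (ZMod (d.q * d.b))ˣ) : ZMod (d.q * d.b)) -
      (arcCenter k j : UnitAddCircle)‖ < 1 / (2 * k)

theorem eventually_le_card_cell {k : ℕ} (hk : 0 < k) {η : ℝ} (hη : 0 < η) :
    ∀ᶠ d : KloostermanDatum in primeAtTop, ∀ i j : ℤ,
      (1 / (k : ℝ) ^ 2 - η) * Fintype.card (ZMod (d.q * d.b))ˣ ≤ (d.cell k i j).card := by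
  have hk1 : (1 : ℝ) ≤ k := by exact_mod_cast hk
  suffices h : ∀ᶠ d : KloostermanDatum in primeAtTop,
      ∀ ij ∈ Finset.Ico (0 : ℤ) k ×ˢ Finset.Ico (0 : ℤ) k,
      (1 / (k : ℝ) ^ 2 - η) * Fintype.card (ZMod (d.q * d.b))ˣ ≤ (d.cell k ij.1 ij.2).card by
    filter_upwards [h] with d hd i j
    have hk0 : (k : ℤ) ≠ 0 := by positivity
    have := hd (i % k, j % k) (by
      simp [Int.emod_nonneg _ hk0, Int.emod_lt_of_pos _ (by positivity : (0 : ℤ) < k)])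
    simpa only [cell, arcCenter_emod hk] using this
  rw [Filter.eventually_all_finset]
  rintro ⟨i, j⟩ -
  set r : ℝ := 1 / (2 * k) with hr
  obtain ⟨s, hs, hs1, hs2⟩ : ∃ s : ℝ, 0 < s ∧ s ≤ η / 8 ∧ s ≤ r :=
    ⟨min (η / 8) r, by positivity, min_le_left _ _, min_le_right _ _⟩
  set f : ℤ → C(UnitAddCircle, ℂ) := fun i =>
    ⟨fun x => (bump (arcCenter k i : UnitAddCircle) r s x : ℂ),
      Complex.continuous_ofReal.comp (continuous_bump _ _ _)⟩ with hf
  have hlim := Metric.tendsto_nhds.mp (tendsto_deviation (f i) (f j)) (η / 2) (by positivity)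
  filter_upwards [hlim] with d hd
  set I : ℤ → ℝ := fun i => ∫ x, bump (arcCenter k i : UnitAddCircle) r s x with hI
  have hIf : ∀ i, ∫ x, f i x = (I i : ℂ) := fun i => integral_ofReal
  have hIl : ∀ i, 1 / (k : ℝ) - 2 * s ≤ I i := fun i => by
    have := le_integral_bump (arcCenter k i : UnitAddCircle) hs (r := r) (by
      rw [hr, div_le_div_iff₀ (by positivity) (by norm_num)]; linarith)
    refine le_trans (le_of_eq ?_) this
    rw [hr]; field_simp
  set A : ℝ := (Fintype.card (ZMod (d.q * d.b))ˣ : ℝ)⁻¹ * ∑ u : (ZMod (d.q * d.b))ˣ,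
    bump (arcCenter k i : UnitAddCircle) r s (ZMod.toAddCircle (u : ZMod (d.q * d.b))) *
    bump (arcCenter k j : UnitAddCircle) r s
      (ZMod.toAddCircle ((d.a * u⁻¹ : (ZMod (d.q * d.b))ˣ) : ZMod (d.q * d.b))) with hA
  have hav : d.average (f i) (f j) = (A : ℂ) := by
    rw [average, hA]; push_cast; rfl
  have hdev : d.deviation (f j) (f i) = ((A - I i * I j : ℝ) : ℂ) := by
    change d.average (f i) (f j) - (∫ x, f i x) * ∫ x, f j x = _
    rw [hav, hIf, hIf]; push_cast; rfl
  rw [hdev, dist_zero_right, Complex.norm_real, Real.norm_eq_abs] at hd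
  have hA1 : 1 / (k : ℝ) ^ 2 - η ≤ A := by
    have h1 := (abs_lt.mp hd).1
    have h0 : 0 ≤ 1 / (k : ℝ) - 2 * s := by
      have : 2 * r = 1 / k := by rw [hr]; field_simp
      linarith
    have h2 := mul_le_mul (hIl i) (hIl j) h0 (h0.trans (hIl i))
    have h3 : 1 / (k : ℝ) ≤ 1 := by rw [div_le_one (by positivity)]; exact hk1
    have h4 : (1 / (k : ℝ) - 2 * s) * (1 / k - 2 * s) ≥ 1 / (k : ℝ) ^ 2 - 4 * s := by
      rw [← one_div_pow]
      nlinarith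
    linarith
  have hpos := d.card_units_pos
  have hA2 : A * Fintype.card (ZMod (d.q * d.b))ˣ ≤ (d.cell k i j).card := by
    rw [hA, mul_comm, mul_inv_cancel_left₀ hpos.ne', cell, card_filter]
    push_cast
    refine sum_le_sum fun u _ => ?_
    split_ifs with h
    · exact mul_le_one₀ (bump_le_one _ _ _ _) (bump_nonneg _ _ _ _) (bump_le_one _ _ _ _)
    · rw [not_and_or] at h
      rcases h with h | h
      · rw [bump_eq_zero hs h, zero_mul]
      · rw [bump_eq_zero hs h, mul_zero]
  exact (mul_le_mul_of_nonneg_right hA1 hpos.le).trans hA2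

lemma exists_lift {c : ℕ} [NeZero c] (u : ZMod c) (z r : ℝ)
    (h : ‖ZMod.toAddCircle u - (z : UnitAddCircle)‖ < r) :
    ∃ x : ℤ, (x : ZMod c) = u ∧ |(x : ℝ) / c - z| < r := by
  have hc : (c : ℝ) ≠ 0 := by exact_mod_cast NeZero.ne c
  rw [ZMod.toAddCircle_apply, ← AddCircle.coe_sub, UnitAddCircle.norm_eq] at h
  refine ⟨u.val - c * round ((u.val : ℝ) / c - z), by simp, ?_⟩
  convert h using 2
  push_cast
  field_simp
  ring

/-- A lower bound for the number of points of a modular hyperbola in a box. -/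
lemma le_card_box (d : KloostermanDatum) {k : ℕ} (hk : 0 < k) {η : ℝ} (hη : η ≤ 1 / (k : ℝ) ^ 2)
    (hcell : ∀ i j : ℤ,
      (1 / (k : ℝ) ^ 2 - η) * Fintype.card (ZMod (d.q * d.b))ˣ ≤ (d.cell k i j).card)
    {X₁ X₂ Y₁ Y₂ : ℝ} (hY : 2 ≤ k * (Y₂ - Y₁)) {P : Finset (ℤ × ℤ)}
    (hP : ∀ x y : ℤ, X₁ ≤ x / (d.q * d.b : ℕ) → x / (d.q * d.b : ℕ) ≤ X₂ →
      Y₁ ≤ y / (d.q * d.b : ℕ) → y / (d.q * d.b : ℕ) ≤ Y₂ →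
      ((x * y : ℤ) : ZMod (d.q * d.b)) = d.a → (x, y) ∈ P) :
    (k * (X₂ - X₁) - 2) * (k * (Y₂ - Y₁) - 2) *
      ((1 / (k : ℝ) ^ 2 - η) * Fintype.card (ZMod (d.q * d.b))ˣ) ≤ P.card := by
  have hk' : (0 : ℝ) < k := by exact_mod_cast hk
  set c := d.q * d.b
  set J : ℝ → ℝ → Finset ℤ := fun A B => Finset.Icc ⌈k * A⌉ (⌊k * B⌋ - 1) with hJ
  have hJcard : ∀ A B, k * (B - A) - 2 ≤ ((J A B).card : ℝ) := fun A B => by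
    rw [hJ]
    simp only [Int.card_Icc]
    have h1 : ((⌊k * B⌋ - 1 + 1 - ⌈k * A⌉ : ℤ) : ℝ) ≤
        ((⌊k * B⌋ - 1 + 1 - ⌈k * A⌉).toNat : ℝ) := by
      exact_mod_cast Int.self_le_toNat _
    push_cast at h1
    have := Int.sub_one_lt_floor (k * B)
    have := Int.ceil_lt_add_one (k * A)
    linarith
  have hmem : ∀ A B, ∀ i ∈ J A B, ∀ t : ℝ, |t - arcCenter k i| < 1 / (2 * k) → A ≤ t ∧ t ≤ B := by
    intro A B i hi t ht
    simp only [hJ, Finset.mem_Icc, Int.ceil_le, Int.le_sub_one_iff, Int.lt_floor_iff] at hi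
    have h2 : (i : ℝ) + 1 ≤ k * B := by simpa using hi.2
    have h3 : arcCenter k i = i / k + 1 / (2 * k) := by unfold arcCenter; field_simp
    have h4 : (i : ℝ) / k + 1 / (2 * k) + 1 / (2 * k) = (i + 1) / k := by field_simp; ring
    have h5 : A ≤ i / k := by rw [le_div_iff₀ hk']; linarith [hi.1]
    have h6 : ((i : ℝ) + 1) / k ≤ B := by rw [div_le_iff₀ hk']; linarith
    rw [abs_lt] at ht
    constructor <;> linarith
  have hinj : ∀ i i' : ℤ, ∀ t : ℝ, |t - arcCenter k i| < 1 / (2 * k) →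
      |t - arcCenter k i'| < 1 / (2 * k) → i = i' := by
    intro i i' t h h'
    have h3 : |((i : ℝ) - i') / k| < 1 / k := by
      have : ((i : ℝ) - i') / k = (t - arcCenter k i') - (t - arcCenter k i) := by
        unfold arcCenter; field_simp; ring
      rw [this]
      refine (abs_sub _ _).trans_lt ?_
      have : 1 / (k : ℝ) = 1 / (2 * k) + 1 / (2 * k) := by field_simp; norm_num
      linarith
    rw [abs_div, abs_of_pos hk', div_lt_div_iff_of_pos_right hk'] at h3
    have h4 : |i - i'| < 1 := by exact_mod_cast h3
    linarith [Int.abs_lt_one_iff.mp h4]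
  have hlift : ∀ (i : ℤ) (u : ZMod c), ∃ x : ℤ,
      ‖ZMod.toAddCircle u - (arcCenter k i : UnitAddCircle)‖ < 1 / (2 * k) →
      (x : ZMod c) = u ∧ |(x : ℝ) / c - arcCenter k i| < 1 / (2 * k) := by
    intro i u
    by_cases h : ‖ZMod.toAddCircle u - (arcCenter k i : UnitAddCircle)‖ < 1 / (2 * k)
    · obtain ⟨x, hx⟩ := exists_lift u _ _ h
      exact ⟨x, fun _ => hx⟩
    · exact ⟨0, fun h' => absurd h' h⟩
  choose x hx using hlift
  have hcount : ∑ ij ∈ J X₁ X₂ ×ˢ J Y₁ Y₂, (d.cell k ij.1 ij.2).card ≤ P.card := by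
    rw [← card_sigma]
    refine card_le_card_of_injOn
      (fun s => (x s.1.1 s.2, x s.1.2 ((d.a * s.2⁻¹ : (ZMod c)ˣ) : ZMod c))) ?_ ?_
    · rintro ⟨⟨i, j⟩, u⟩ hs
      simp only [coe_sigma, Set.mem_sigma_iff, SetLike.mem_coe, mem_product, cell, mem_filter,
        mem_univ, true_and] at hs
      obtain ⟨⟨hi, hj⟩, hu1, hu2⟩ := hs
      obtain ⟨e1, l1⟩ := hx _ _ hu1
      obtain ⟨e2, l2⟩ := hx _ _ hu2
      obtain ⟨a1, a2⟩ := hmem _ _ _ hi _ l1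
      obtain ⟨a3, a4⟩ := hmem _ _ _ hj _ l2
      refine hP _ _ a1 a2 a3 a4 ?_
      rw [Int.cast_mul, e1, e2, ← Units.val_mul]
      simp
    · rintro ⟨⟨i, j⟩, u⟩ hs ⟨⟨i', j'⟩, u'⟩ hs' he
      simp only [coe_sigma, Set.mem_sigma_iff, SetLike.mem_coe, mem_product, cell, mem_filter,
        mem_univ, true_and] at hs hs'
      simp only [Prod.mk.injEq] at he
      obtain ⟨⟨hi, hj⟩, hu1, hu2⟩ := hs
      obtain ⟨⟨hi', hj'⟩, hu1', hu2'⟩ := hs'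
      obtain ⟨e1, l1⟩ := hx _ _ hu1
      obtain ⟨e2, l2⟩ := hx _ _ hu2
      obtain ⟨e1', l1'⟩ := hx _ _ hu1'
      obtain ⟨e2', l2'⟩ := hx _ _ hu2'
      have hu : u = u' := Units.ext (by rw [← e1, ← e1', he.1])
      rw [he.1] at l1
      rw [he.2] at l2
      rw [hinj _ _ _ l1 l1', hinj _ _ _ l2 l2', hu]
  have hsum : ((J X₁ X₂ ×ˢ J Y₁ Y₂).card : ℝ) *
      ((1 / (k : ℝ) ^ 2 - η) * Fintype.card (ZMod c)ˣ) ≤ P.card := by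
    rw [← nsmul_eq_mul]
    refine (card_nsmul_le_sum _ (fun ij => ((d.cell k ij.1 ij.2).card : ℝ)) _
      fun ij _ => hcell _ _).trans ?_
    exact_mod_cast hcount
  refine le_trans (mul_le_mul_of_nonneg_right ?_ ?_) hsum
  · rw [card_product]; push_cast
    exact mul_le_mul (hJcard _ _) (hJcard _ _) (by linarith) (by positivity)
  · exact mul_nonneg (by linarith) d.card_units_pos.le

end KloostermanDatum

end Cells

section TotientMean

open Filter Topology ArithmeticFunction

/-- The summand in the Möbius expansion of `2 * φ (8 * m) / (8 * m)`. -/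
noncomputable def oddMoebius (d : ℕ) : ℝ := if Odd d then (ArithmeticFunction.moebius d : ℝ) / d else 0

lemma totient_div_eq_sum_moebius {n : ℕ} (hn : 0 < n) :
    (n.totient : ℝ) / n = ∑ d ∈ n.divisors, (ArithmeticFunction.moebius d : ℝ) / d := by
  have h := (ArithmeticFunction.sum_eq_iff_sum_mul_moebius_eq (R := ℝ)
    (f := fun n => (n.totient : ℝ)) (g := fun n => (n : ℝ))).mp
    (fun n _ => by exact_mod_cast Nat.sum_totient n) n hn
  rw [Nat.sum_divisorsAntidiagonal
    (f := fun a b => ((ArithmeticFunction.moebius a : ℤ) : ℝ) * (b : ℝ))] at h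
  rw [← h, sum_div]
  refine sum_congr rfl fun d hd => ?_
  have hd' := Nat.dvd_of_mem_divisors hd
  have h0 : (d : ℝ) ≠ 0 := by exact_mod_cast (Nat.pos_of_mem_divisors hd).ne'
  have h1 : (n : ℝ) ≠ 0 := by exact_mod_cast hn.ne'
  rw [Nat.cast_div hd' h0]
  field_simp

lemma totient_eight_mul {m : ℕ} (hm : 0 < m) :
    ((8 * m).totient : ℝ) / (8 * m) = 1 / 2 * ∑ d ∈ m.divisors, oddMoebius d := by
  obtain ⟨k, r, hr, rfl⟩ := Nat.exists_eq_two_pow_mul_odd hm.ne'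
  have hr0 : 0 < r := hr.pos
  have hdiv : (2 ^ k * r).divisors.filter Odd = r.divisors := by
    ext d
    simp only [mem_filter, Nat.mem_divisors]
    constructor
    · rintro ⟨⟨h1, -⟩, h2⟩
      exact ⟨(Nat.Coprime.pow_right k (Nat.coprime_two_right.mpr h2)).dvd_of_dvd_mul_left h1,
        hr0.ne'⟩
    · rintro ⟨h1, -⟩
      exact ⟨⟨h1.mul_left _, hm.ne'⟩, hr.of_dvd_nat h1⟩
  have hs : ∑ d ∈ (2 ^ k * r).divisors, oddMoebius d = (r.totient : ℝ) / r := by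
    rw [totient_div_eq_sum_moebius hr0, ← hdiv, sum_filter]
    rfl
  have ht : (8 * (2 ^ k * r)).totient = 2 ^ (k + 2) * r.totient := by
    rw [show 8 * (2 ^ k * r) = 2 ^ (k + 3) * r by ring,
      Nat.totient_mul (Nat.Coprime.pow_left _ (Nat.coprime_two_left.mpr hr)),
      Nat.totient_prime_pow_succ Nat.prime_two]
    simp
  have h1 : (r : ℝ) ≠ 0 := by exact_mod_cast hr0.ne'
  rw [hs, ht]
  push_cast
  field_simp
  ring

lemma sum_totient_eight_mul (N : ℕ) :
    ∑ m ∈ Ioc 0 N, ((8 * m).totient : ℝ) / (8 * m) =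
      1 / 2 * ∑' d : ℕ, oddMoebius d * (N / d : ℕ) := by
  have h1 : ∀ m ∈ Ioc 0 N, ((8 * m).totient : ℝ) / (8 * m) =
      1 / 2 * ∑ d ∈ Ioc 0 N, if d ∣ m then oddMoebius d else 0 := by
    intro m hm
    rw [mem_Ioc] at hm
    rw [totient_eight_mul hm.1, ← sum_filter]
    congr 1
    refine sum_congr ?_ fun _ _ => rfl
    ext d
    simp only [Nat.mem_divisors, mem_filter, mem_Ioc]
    constructor
    · rintro ⟨h, -⟩
      exact ⟨⟨Nat.pos_of_dvd_of_pos h hm.1, (Nat.le_of_dvd hm.1 h).trans hm.2⟩, h⟩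
    · rintro ⟨-, h⟩
      exact ⟨h, hm.1.ne'⟩
  rw [sum_congr rfl h1, ← mul_sum, sum_comm, tsum_eq_sum (s := Ioc 0 N)]
  · congr 1
    refine sum_congr rfl fun d _ => ?_
    rw [← sum_filter, sum_const, Nat.Ioc_filter_dvd_card_eq_div, nsmul_eq_mul, mul_comm]
  · intro d hd
    rw [mem_Ioc, not_and_or, not_lt, Nat.le_zero, not_le] at hd
    rcases hd with rfl | hd
    · simp
    · simp [Nat.div_eq_of_lt hd]

lemma summable_moebius_div_sq :
    Summable fun n : ℕ => (ArithmeticFunction.moebius n : ℝ) / (n : ℝ) ^ 2 := by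
  refine Summable.of_norm_bounded (Real.summable_one_div_nat_pow.mpr one_lt_two) fun n => ?_
  rw [norm_div, norm_pow, Real.norm_natCast]
  refine div_le_div_of_nonneg_right ?_ (by positivity)
  rw [Real.norm_eq_abs]
  exact_mod_cast ArithmeticFunction.abs_moebius_le_one

lemma tsum_moebius_div_sq :
    ∑' n : ℕ, (ArithmeticFunction.moebius n : ℝ) / (n : ℝ) ^ 2 = 6 / Real.pi ^ 2 := by
  have h2 : (1 : ℝ) < (2 : ℂ).re := by norm_num
  have h := LSeries_zeta_mul_Lseries_moebius h2
  rw [LSeries_zeta_eq_riemannZeta h2, riemannZeta_two] at h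
  have h3 : LSeries (fun n => ((ArithmeticFunction.moebius n : ℤ) : ℂ)) 2 =
      ((∑' n : ℕ, (ArithmeticFunction.moebius n : ℝ) / (n : ℝ) ^ 2 : ℝ) : ℂ) := by
    rw [LSeries, Complex.ofReal_tsum]
    refine tsum_congr fun n => ?_
    rcases eq_or_ne n 0 with rfl | hn
    · simp
    · rw [LSeries.term_of_ne_zero hn]
      push_cast
      norm_num
  have h4 : ((Real.pi ^ 2 / 6 *
      ∑' n : ℕ, (ArithmeticFunction.moebius n : ℝ) / (n : ℝ) ^ 2 : ℝ) : ℂ) = (1 : ℝ) := by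
    rw [Complex.ofReal_mul, ← h3]
    simpa using h
  have h5 := Complex.ofReal_injective h4
  have := Real.pi_pos
  field_simp at h5 ⊢
  linarith

lemma tsum_oddMoebius_div : ∑' d : ℕ, oddMoebius d / d = 8 / Real.pi ^ 2 := by
  set g : ℕ → ℝ := fun n => (ArithmeticFunction.moebius n : ℝ) / (n : ℝ) ^ 2 with hg
  have hodd : ∀ k : ℕ, oddMoebius (2 * k + 1) / (2 * k + 1 : ℕ) = g (2 * k + 1) := fun k => by
    rw [oddMoebius, if_pos (by simp), hg, div_div, ← sq]
  have heven : ∀ k : ℕ, oddMoebius (2 * k) / (2 * k : ℕ) = 0 := fun k => by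
    rw [oddMoebius, if_neg (by simp), zero_div]
  have hgeven : ∀ k : ℕ, g (2 * k) = -(1 / 4) * (oddMoebius k / k) := fun k => by
    rw [hg, oddMoebius]
    simp only
    split_ifs with h
    · rw [ArithmeticFunction.isMultiplicative_moebius.map_mul_of_coprime
        (Nat.coprime_two_left.mpr h), ArithmeticFunction.moebius_apply_prime Nat.prime_two]
      push_cast
      rcases eq_or_ne (k : ℝ) 0 with h0 | h0
      · simp [h0]
      · field_simp; norm_num
    · rw [Nat.not_odd_iff_even] at h
      obtain ⟨j, rfl⟩ := h
      rw [ArithmeticFunction.moebius_eq_zero_of_not_squarefree]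
      · simp
      · intro hs
        have := hs 2 ⟨j, by ring⟩
        simp at this
  have hsum := summable_moebius_div_sq
  have hse : Summable fun k => g (2 * k) :=
    hsum.comp_injective (mul_right_injective₀ two_ne_zero)
  have hso : Summable fun k => g (2 * k + 1) :=
    hsum.comp_injective ((add_left_injective 1).comp (mul_right_injective₀ two_ne_zero))
  have h1 := tsum_even_add_odd hse hso
  have h2 := tsum_even_add_odd (f := fun d : ℕ => oddMoebius d / d)
    (by simp_rw [heven]; exact summable_zero) (by simp_rw [hodd]; exact hso)
  simp_rw [heven, hodd, tsum_zero, zero_add] at h2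
  simp_rw [hgeven, tsum_mul_left] at h1
  rw [h2, hg, tsum_moebius_div_sq] at h1
  have := Real.pi_pos
  linear_combination (4 / 3) * h1

/-- The mean value of `φ (8 m) / (8 m)`. -/
theorem tendsto_mean_totient_eight_mul :
    Tendsto (fun N : ℕ => (∑ m ∈ Ioc 0 N, ((8 * m).totient : ℝ) / (8 * m)) / N) atTop
      (𝓝 (4 / Real.pi ^ 2)) := by
  have habs : ∀ d, |oddMoebius d| ≤ 1 / d := fun d => by
    rw [oddMoebius]
    split_ifs
    · rw [abs_div, Nat.abs_cast]
      refine div_le_div_of_nonneg_right ?_ (by positivity)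
      exact_mod_cast ArithmeticFunction.abs_moebius_le_one
    · simp
  have hlim := tendsto_tsum_of_dominated_convergence (𝓕 := (atTop : Filter ℕ))
    (f := fun (N : ℕ) (d : ℕ) => oddMoebius d * ((N / d : ℕ) / (N : ℝ)))
    (g := fun d => oddMoebius d * (1 / d : ℝ)) (bound := fun d : ℕ => 1 / (d : ℝ) ^ 2)
    (Real.summable_one_div_nat_pow.mpr one_lt_two) (fun d => by
      refine tendsto_const_nhds.mul ?_
      have := (tendsto_nat_floor_mul_div_atTop (R := ℝ) (a := 1 / d) (by positivity)).comp
        tendsto_natCast_atTop_atTop (α := ℕ)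
      refine this.congr fun N => ?_
      simp only [Function.comp]
      rw [one_div_mul_eq_div, Nat.floor_div_eq_div])
    (Eventually.of_forall fun N d => by
      rw [norm_mul, Real.norm_eq_abs, Real.norm_of_nonneg (by positivity), sq, ← one_div_mul_one_div]
      refine mul_le_mul (habs d) ?_ (by positivity) (by positivity)
      rcases Nat.eq_zero_or_pos N with rfl | hN
      · simp
      · rw [div_le_iff₀ (by positivity), one_div_mul_eq_div]
        exact Nat.cast_div_le)
  have h2 : ∑' d : ℕ, oddMoebius d * (1 / d : ℝ) = 8 / Real.pi ^ 2 := by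
    rw [← tsum_oddMoebius_div]
    exact tsum_congr fun d => by ring
  rw [h2] at hlim
  have := hlim.const_mul (1 / 2 : ℝ)
  convert this using 1
  · ext N
    rw [sum_totient_eight_mul, mul_div_assoc, div_eq_mul_inv _ (N : ℝ), ← tsum_mul_right]
    congr 1
    exact tsum_congr fun d => by ring
  · congr 1; ring

end TotientMean

section IsolatedPrimes

open Filter Topology

/-- `m` is exactly divisible by some prime exceeding `K`. -/
def HasIsolatedPrime (K m : ℕ) : Prop := ∃ q : ℕ, q.Prime ∧ K < q ∧ q ∣ m ∧ ¬ q ^ 2 ∣ m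

open scoped Classical in
lemma eventually_card_not_hasIsolatedPrime_le {K : ℕ} (hK : 0 < K) :
    ∀ᶠ N : ℕ in atTop,
      (((Ioc 0 N).filter fun m => ¬ HasIsolatedPrime K m).card : ℝ) ≤ 2 * N / K := by
  set A := 2 ^ (Nat.primesBelow (K + 1)).card * K with hA
  filter_upwards [eventually_ge_atTop (max K (A ^ 2))] with N hN
  have hKN : K ≤ N := (le_max_left _ _).trans hN
  have hAN : A ≤ N.sqrt := Nat.le_sqrt'.mpr ((le_max_right _ _).trans hN)
  have hsub : ((Ioc 0 N).filter fun m => ¬ HasIsolatedPrime K m) ⊆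
      Nat.smoothNumbersUpTo N (K + 1) ∪
        (Ioc K N).biUnion fun j => (Ioc 0 N).filter fun m => j ^ 2 ∣ m := by
    intro m hm
    rw [mem_filter, mem_Ioc] at hm
    rw [mem_union, Nat.mem_smoothNumbersUpTo]
    by_cases hs : m ∈ Nat.smoothNumbers (K + 1)
    · exact Or.inl ⟨hm.1.2, hs⟩
    · right
      rw [Nat.mem_smoothNumbers'] at hs
      push Not at hs
      obtain ⟨q, hq, hqm, hqK⟩ := hs
      rw [mem_biUnion]
      refine ⟨q, mem_Ioc.mpr ⟨by omega, (Nat.le_of_dvd hm.1.1 hqm).trans hm.1.2⟩,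
        mem_filter.mpr ⟨mem_Ioc.mpr hm.1, ?_⟩⟩
      by_contra h
      exact hm.2 ⟨q, hq, by omega, hqm, h⟩
  have h1 : ((Nat.smoothNumbersUpTo N (K + 1)).card : ℝ) ≤ N / K := by
    rw [le_div_iff₀ (by positivity)]
    have h2 := Nat.smoothNumbersUpTo_card_le N (K + 1)
    have h3 := Nat.sqrt_le' N
    have h4 : (Nat.smoothNumbersUpTo N (K + 1)).card * K ≤ N := by
      calc _ ≤ (2 ^ (Nat.primesBelow (K + 1)).card * N.sqrt) * K := Nat.mul_le_mul_right _ h2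
        _ = A * N.sqrt := by rw [hA]; ring
        _ ≤ N.sqrt * N.sqrt := Nat.mul_le_mul_right _ hAN
        _ ≤ N := Nat.sqrt_le N
    exact_mod_cast h4
  have h2 : ((((Ioc K N).biUnion fun j => (Ioc 0 N).filter fun m => j ^ 2 ∣ m).card : ℕ) : ℝ) ≤
      N / K := by
    have h3 : ((((Ioc K N).biUnion fun j => (Ioc 0 N).filter fun m => j ^ 2 ∣ m).card : ℕ) : ℝ) ≤
        ∑ j ∈ Ioc K N, N * ((j : ℝ) ^ 2)⁻¹ := by
      have h := card_biUnion_le (s := Ioc K N) (t := fun j => (Ioc 0 N).filter fun m => j ^ 2 ∣ m)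
      refine (Nat.cast_le.mpr h).trans ?_
      push_cast
      refine sum_le_sum fun j hj => ?_
      rw [Nat.Ioc_filter_dvd_card_eq_div]
      refine Nat.cast_div_le.trans ?_
      push_cast
      rw [div_eq_mul_inv]
    rw [← mul_sum] at h3
    have h4 := sum_Ioc_inv_sq_le_sub (α := ℝ) hK.ne' hKN
    have h5 : (0 : ℝ) ≤ (N : ℝ)⁻¹ := by positivity
    refine h3.trans ?_
    rw [div_eq_mul_inv]
    exact mul_le_mul_of_nonneg_left (by linarith) (by positivity)
  have h3 : ((((Ioc 0 N).filter fun m => ¬ HasIsolatedPrime K m).card : ℕ) : ℝ) ≤ _ :=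
    Nat.cast_le.mpr ((card_le_card hsub).trans (card_union_le _ _))
  push_cast at h3
  calc _ ≤ _ := h3
    _ ≤ (N : ℝ) / K + N / K := add_le_add h1 h2
    _ = _ := by ring

open scoped Classical in
/-- The mean of `φ (8 m) / (8 m)` is carried by integers with an isolated large prime factor. -/
theorem exists_le_sum_totient_hasIsolatedPrime {a b ε : ℝ} (ha : 0 < a) (hab : a < b)
    (hε : 0 < ε) :
    ∃ K₀ : ℕ, ∀ K, K₀ ≤ K → ∀ᶠ t : ℝ in atTop, t * ((b - a) * (4 / Real.pi ^ 2) - ε) ≤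
      ∑ m ∈ (Ioc ⌊a * t⌋₊ ⌊b * t⌋₊).filter (HasIsolatedPrime K),
        ((8 * m).totient : ℝ) / (8 * m) := by
  have hb : 0 < b := ha.trans hab
  set L : ℝ := 4 / Real.pi ^ 2
  set S : ℕ → ℝ := fun N => ∑ m ∈ Ioc 0 N, ((8 * m).totient : ℝ) / (8 * m) with hS
  have hfloor : ∀ c : ℝ, 0 < c → Tendsto (fun t : ℝ => ⌊c * t⌋₊) atTop atTop := fun c hc =>
    tendsto_nat_floor_atTop.comp (tendsto_id.const_mul_atTop hc)
  have hlim : ∀ c : ℝ, 0 < c → Tendsto (fun t : ℝ => S ⌊c * t⌋₊ / t) atTop (𝓝 (L * c)) := by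
    intro c hc
    have h1 := (tendsto_mean_totient_eight_mul.comp (hfloor c hc)).mul
      (tendsto_nat_floor_mul_div_atTop (R := ℝ) hc.le)
    refine h1.congr' ?_
    filter_upwards [(hfloor c hc).eventually_gt_atTop 0] with t ht
    have h2 : ((⌊c * t⌋₊ : ℕ) : ℝ) ≠ 0 := by exact_mod_cast ht.ne'
    simp only [Function.comp, hS]
    rw [div_mul_div_cancel₀ h2]
  have hdiff := (hlim b hb).sub (hlim a ha)
  obtain ⟨K₀, hK₀⟩ := exists_nat_gt (4 * b / ε)
  refine ⟨K₀, fun K hK => ?_⟩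
  have hK1 : 4 * b / ε < K := hK₀.trans_le (by exact_mod_cast hK)
  have hKpos : (0 : ℝ) < K := lt_trans (by positivity) hK1
  have hbad := (hfloor b hb).eventually
    (eventually_card_not_hasIsolatedPrime_le (K := K) (by exact_mod_cast hKpos))
  filter_upwards [hbad, eventually_gt_atTop 0,
    hdiff.eventually_const_lt (show (b - a) * L - ε / 2 < L * b - L * a by linarith)]
    with t h1 ht h2
  rw [← sub_div, lt_div_iff₀ ht] at h2
  have hle : ⌊a * t⌋₊ ≤ ⌊b * t⌋₊ := Nat.floor_le_floor (by gcongr)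
  have hsplit : S ⌊b * t⌋₊ - S ⌊a * t⌋₊ =
      ∑ m ∈ Ioc ⌊a * t⌋₊ ⌊b * t⌋₊, ((8 * m).totient : ℝ) / (8 * m) := by
    simp only [hS]
    rw [← sum_Ioc_consecutive _ (Nat.zero_le _) hle]; ring
  rw [hsplit, ← sum_filter_add_sum_filter_not _ (HasIsolatedPrime K)] at h2
  have hbadsum : ∑ m ∈ (Ioc ⌊a * t⌋₊ ⌊b * t⌋₊).filter (fun m => ¬ HasIsolatedPrime K m),
      ((8 * m).totient : ℝ) / (8 * m) ≤ ε / 2 * t := by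
    have hone : ∀ m : ℕ, ((8 * m).totient : ℝ) / (8 * m) ≤ 1 := fun m =>
      div_le_one_of_le₀ (by exact_mod_cast Nat.totient_le (8 * m)) (by positivity)
    refine (sum_le_card_nsmul _ _ 1 fun m _ => hone m).trans ?_
    rw [nsmul_eq_mul, mul_one]
    have hsub : (Ioc ⌊a * t⌋₊ ⌊b * t⌋₊).filter (fun m => ¬ HasIsolatedPrime K m) ⊆
        (Ioc 0 ⌊b * t⌋₊).filter (fun m => ¬ HasIsolatedPrime K m) :=
      filter_subset_filter _ (Ioc_subset_Ioc_left (Nat.zero_le _))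
    have h3 : (((Ioc ⌊a * t⌋₊ ⌊b * t⌋₊).filter (fun m => ¬ HasIsolatedPrime K m)).card : ℝ) ≤
        ((Ioc 0 ⌊b * t⌋₊).filter (fun m => ¬ HasIsolatedPrime K m)).card := by
      exact_mod_cast card_le_card hsub
    refine h3.trans (h1.trans ?_)
    rw [div_le_iff₀ hKpos]
    rw [div_lt_iff₀ hε] at hK1
    have h4 := Nat.floor_le (show 0 ≤ b * t by positivity)
    nlinarith
  linarith

end IsolatedPrimes

section BoxCount

open Filter Topology

open KloostermanDatum in
lemma exists_le_card_slice {k : ℕ} (hk : 0 < k) {η : ℝ} (hη : 0 < η) (hηk : η ≤ 1 / (k : ℝ) ^ 2) :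
    ∃ K₁ : ℕ, ∀ K, K₁ ≤ K → ∀ m p : ℕ, HasIsolatedPrime K m → p.Prime → p ≠ 2 → 0 < m → m < p →
      ∀ (δ : ℤ) {X₁ X₂ Y₁ Y₂ : ℝ}, 2 ≤ k * (Y₂ - Y₁) → ∀ P : Finset (ℤ × ℤ),
      (∀ x y : ℤ, X₁ ≤ x / (8 * m) → x / (8 * m) ≤ X₂ → Y₁ ≤ y / (8 * m) → y / (8 * m) ≤ Y₂ →
        (8 * m : ℤ) ∣ x * y - (p + 4 * m * δ) → (x, y) ∈ P) →
      (k * (X₂ - X₁) - 2) * (k * (Y₂ - Y₁) - 2) *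
        ((1 / (k : ℝ) ^ 2 - η) * (8 * m).totient) ≤ P.card := by
  have h := eventually_le_card_cell hk hη
  rw [primeAtTop, eventually_comap] at h
  obtain ⟨K₁, hK₁⟩ := eventually_atTop.mp h
  refine ⟨max K₁ 2, fun K hK m p hm hp hp2 hm0 hmp δ X₁ X₂ Y₁ Y₂ hY P hP => ?_⟩
  obtain ⟨q, hq, hKq, ⟨n, rfl⟩, hq2⟩ := hm
  have hn0 : n ≠ 0 := by rintro rfl; simp at hm0
  have hqn : q.Coprime (8 * n) := by
    rw [Nat.Prime.coprime_iff_not_dvd hq]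
    intro hd
    rcases (Nat.Prime.dvd_mul hq).mp hd with h8 | hn
    · have : q ∣ 2 ^ 3 := by norm_num; exact h8
      have := Nat.le_of_dvd (by norm_num) (hq.dvd_of_dvd_pow this)
      have := le_max_right K₁ 2
      omega
    · obtain ⟨j, rfl⟩ := hn
      exact hq2 ⟨j, by ring⟩
  have hmul : q * (8 * n) = 8 * (q * n) := by ring
  have hcop : IsCoprime ((p : ℤ) + 4 * (q * n : ℕ) * δ) ((q * (8 * n) : ℕ) : ℤ) := by
    have hpm : IsCoprime (p : ℤ) ((q * n : ℕ) : ℤ) := by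
      rw [Nat.isCoprime_iff_coprime]
      exact (Nat.Prime.coprime_iff_not_dvd hp).mpr fun hd => by
        have := Nat.le_of_dvd hm0 hd; omega
    have hp2' : IsCoprime (p : ℤ) (2 : ℤ) := by
      have : p.Coprime 2 := (Nat.coprime_primes hp Nat.prime_two).mpr hp2
      exact_mod_cast Nat.isCoprime_iff_coprime.mpr this
    have h1 : IsCoprime ((p : ℤ) + 4 * (q * n : ℕ) * δ) ((q * n : ℕ) : ℤ) := by
      rw [show (p : ℤ) + 4 * (q * n : ℕ) * δ = p + (q * n : ℕ) * (4 * δ) by ring]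
      exact hpm.add_mul_left_left _
    have h2 : IsCoprime ((p : ℤ) + 4 * (q * n : ℕ) * δ) (2 : ℤ) := by
      rw [show (p : ℤ) + 4 * (q * n : ℕ) * δ = p + 2 * (2 * (q * n : ℕ) * δ) by ring]
      exact hp2'.add_mul_left_left _
    have h3 := (IsCoprime.pow_right (n := 3) h2).mul_right h1
    convert h3 using 1
    push_cast; ring
  have hunit : IsUnit ((((p : ℤ) + 4 * (q * n : ℕ) * δ : ℤ)) : ZMod (q * (8 * n))) := by
    obtain ⟨u, v, huv⟩ := hcop
    have := congrArg (Int.cast : ℤ → ZMod (q * (8 * n))) huv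
    rw [Int.cast_add, Int.cast_mul, Int.cast_mul, Int.cast_natCast (q * (8 * n)),
      ZMod.natCast_self, mul_zero, add_zero, Int.cast_one] at this
    exact IsUnit.of_mul_eq_one_right _ this
  obtain ⟨a, ha⟩ := hunit
  obtain ⟨d, hdq, hdc, hda⟩ : ∃ d : KloostermanDatum, d.q = q ∧ d.q * d.b = 8 * (q * n) ∧
      ((p + 4 * (q * n : ℕ) * δ : ℤ) : ZMod (d.q * d.b)) = d.a :=
    ⟨⟨q, 8 * n, hq, by omega, hqn, a⟩, rfl, hmul, ha.symm⟩
  have hd := hK₁ q (by have := le_max_left K₁ 2; omega) d hdq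
  have hc : ((d.q * d.b : ℕ) : ℝ) = 8 * (q * n : ℕ) := by
    rw [hdc]; push_cast; ring
  have := d.le_card_box hk hηk hd hY (P := P) (X₁ := X₁) (X₂ := X₂) (fun x y h1 h2 h3 h4 h5 => by
    rw [hc] at h1 h2 h3 h4
    refine hP x y h1 h2 h3 h4 ?_
    have h6 : ((x * y - (p + 4 * (q * n : ℕ) * δ) : ℤ) : ZMod (d.q * d.b)) = 0 := by
      rw [Int.cast_sub, hda]
      exact sub_eq_zero.mpr h5
    have h7 := (ZMod.intCast_zmod_eq_zero_iff_dvd _ _).mp h6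
    rw [hdc] at h7
    exact_mod_cast h7)
  rwa [ZMod.card_units_eq_totient, hdc] at this

/-- A lower bound for the number of solutions of `x y ≡ p + 4 m δ` modulo `8 m` with
`(x, y, m)` in a box of size proportional to `√p`. -/
theorem exists_le_card_box {X₁ X₂ Y₁ Y₂ μ₁ μ₂ ℓ : ℝ} (hℓ : 0 < ℓ) (hX : X₂ - X₁ = ℓ)
    (hY : Y₂ - Y₁ = ℓ) (hμ₁ : 0 < μ₁) (hμ : μ₁ < μ₂) (δ : ℤ) {η : ℝ} (hη : 0 < η) :
    ∃ N : ℕ, ∀ p : ℕ, p.Prime → N < p → ∀ P : Finset (ℤ × ℤ × ℤ),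
      (∀ x y m : ℤ, X₁ ≤ x / √p → x / √p ≤ X₂ → Y₁ ≤ y / √p → y / √p ≤ Y₂ →
        μ₁ ≤ m / √p → m / √p ≤ μ₂ → 8 * m ∣ x * y - (p + 4 * m * δ) → (x, y, m) ∈ P) →
      p * (ℓ ^ 2 * (μ₂ - μ₁) * μ₁ / μ₂ ^ 2 / (2 * Real.pi ^ 2) - η) ≤ P.card := by
  classical
  have hμ₂ : 0 < μ₂ := hμ₁.trans hμ
  set A := ℓ / (8 * μ₂) with hA
  have hA0 : 0 < A := by positivity
  set G : ℝ → ℝ := fun u => (A - 2 * u) ^ 2 * (1 - u) * (8 * μ₁) *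
    ((μ₂ - μ₁) * (4 / Real.pi ^ 2) - u) with hG
  have hG0 : G 0 = ℓ ^ 2 * (μ₂ - μ₁) * μ₁ / μ₂ ^ 2 / (2 * Real.pi ^ 2) := by
    have := Real.pi_pos.ne'
    simp only [hG, hA]; field_simp; ring
  have hlim : Tendsto (fun k : ℕ => G (1 / (k : ℝ))) atTop (𝓝 (G 0)) := by
    have hc : Continuous G := by simp only [hG]; fun_prop
    exact (hc.tendsto 0).comp tendsto_one_div_atTop_nhds_zero_nat
  have hkA : Tendsto (fun k : ℕ => (k : ℝ) * A) atTop atTop :=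
    tendsto_natCast_atTop_atTop.atTop_mul_const hA0
  obtain ⟨k, hk1, hk2, hk3⟩ := ((hlim.eventually (lt_mem_nhds (sub_lt_self _ hη))).and
    ((hkA.eventually_ge_atTop 2).and (eventually_ge_atTop 1))).exists
  have hk0 : (0 : ℝ) < k := by exact_mod_cast hk3
  have hk1' : (1 : ℝ) ≤ k := by exact_mod_cast hk3
  obtain ⟨K₁, hK₁⟩ := exists_le_card_slice (k := k) (η := 1 / (k : ℝ) ^ 3) hk3 (by positivity)
    (one_div_le_one_div_of_le (by positivity) (pow_le_pow_right₀ hk1' (by norm_num)))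
  obtain ⟨K₀, hK₀⟩ := exists_le_sum_totient_hasIsolatedPrime hμ₁ hμ (ε := 1 / (k : ℝ)) (by positivity)
  have hev := (tendsto_rpow_atTop (y := 1 / 2) (by norm_num)).comp tendsto_natCast_atTop_atTop
    |>.eventually (hK₀ (max K₀ K₁) (le_max_left _ _))
  have hev2 := (tendsto_rpow_atTop (y := 1 / 2) (by norm_num)).comp tendsto_natCast_atTop_atTop
    |>.eventually (eventually_gt_atTop μ₂)
  obtain ⟨N, hN⟩ := eventually_atTop.mp (hev.and hev2)
  refine ⟨max N 2, fun p hp hNp P hP => ?_⟩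
  obtain ⟨h1, h2⟩ := hN p (by have := le_max_left N 2; omega)
  have hp2 : p ≠ 2 := by have := le_max_right N 2; omega
  simp only [Function.comp, ← Real.sqrt_eq_rpow] at h1 h2
  set t := √(p : ℝ) with ht
  have ht0 : 0 < t := hμ₂.trans h2
  have htt : t * t = p := Real.mul_self_sqrt (by positivity)
  set S := (Ioc ⌊μ₁ * t⌋₊ ⌊μ₂ * t⌋₊).filter (HasIsolatedPrime (max K₀ K₁)) with hS
  have hmem : ∀ m ∈ S, μ₁ * t < m ∧ (m : ℝ) ≤ μ₂ * t ∧ HasIsolatedPrime (max K₀ K₁) m := by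
    intro m hm
    rw [hS, mem_filter, mem_Ioc] at hm
    exact ⟨(Nat.floor_lt (by positivity)).mp hm.1.1,
      (Nat.le_floor_iff (by positivity)).mp hm.1.2, hm.2⟩
  have hslice : ∀ m ∈ S, (A - 2 * (1 / k)) ^ 2 * (1 - 1 / k) * (8 * μ₁ * t) *
      (((8 * m).totient : ℝ) / (8 * m)) ≤ (P.filter fun z => z.2.2 = (m : ℤ)).card := by
    intro m hm
    obtain ⟨hm1, hm2, hm3⟩ := hmem m hm
    have hm0 : (0 : ℝ) < m := lt_trans (by positivity) hm1
    have hm8 : (0 : ℝ) < 8 * m := by positivity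
    have hmp : m < p := by
      have : (m : ℝ) < p := by
        rw [← htt]; exact hm2.trans_lt (mul_lt_mul_of_pos_right h2 ht0)
      exact_mod_cast this
    have hL : A ≤ ℓ * t / (8 * m) := by
      rw [hA, div_le_div_iff₀ (by positivity) hm8]
      nlinarith
    have hAk : 0 ≤ A - 2 * (1 / k) := by
      have : 2 * (1 / (k : ℝ)) ≤ A := by
        rw [mul_one_div, div_le_iff₀ hk0]; linarith
      linarith
    have hY' : Y₂ * t / (8 * m) - Y₁ * t / (8 * m) = ℓ * t / (8 * m) := by
      rw [← sub_div, ← sub_mul, hY]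
    have hX' : X₂ * t / (8 * m) - X₁ * t / (8 * m) = ℓ * t / (8 * m) := by
      rw [← sub_div, ← sub_mul, hX]
    have hb := hK₁ (max K₀ K₁) (le_max_right _ _) m p hm3 hp hp2 (by exact_mod_cast hm0) hmp δ
      (X₁ := X₁ * t / (8 * m)) (X₂ := X₂ * t / (8 * m))
      (Y₁ := Y₁ * t / (8 * m)) (Y₂ := Y₂ * t / (8 * m))
      (by rw [hY']; exact hk2.trans (mul_le_mul_of_nonneg_left hL hk0.le))
      ((P.filter fun z => z.2.2 = (m : ℤ)).image fun z => (z.1, z.2.1))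
      (fun x y a1 a2 a3 a4 a5 => by
        rw [div_le_div_iff_of_pos_right hm8] at a1 a2 a3 a4
        refine mem_image.mpr ⟨(x, y, m), mem_filter.mpr ⟨hP x y m ?_ ?_ ?_ ?_ ?_ ?_ a5, rfl⟩, rfl⟩
        · rwa [le_div_iff₀ ht0]
        · rwa [div_le_iff₀ ht0]
        · rwa [le_div_iff₀ ht0]
        · rwa [div_le_iff₀ ht0]
        · rw [le_div_iff₀ ht0]; exact_mod_cast hm1.le
        · rw [div_le_iff₀ ht0]; exact_mod_cast hm2)
    refine le_trans ?_ (hb.trans (by exact_mod_cast card_image_le))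
    rw [hY', hX']
    have e1 : (k * (ℓ * t / (8 * m)) - 2) * (k * (ℓ * t / (8 * m)) - 2) *
        ((1 / (k : ℝ) ^ 2 - 1 / (k : ℝ) ^ 3) * (8 * m).totient) =
        (ℓ * t / (8 * m) - 2 * (1 / k)) ^ 2 * (1 - 1 / k) * (8 * m) *
          (((8 * m).totient : ℝ) / (8 * m)) := by
      generalize ((8 * m).totient : ℝ) = F
      field_simp
    rw [e1]
    have hk4 : (0 : ℝ) ≤ 1 - 1 / k := by
      rw [sub_nonneg, div_le_one hk0]; exact hk1'
    refine mul_le_mul_of_nonneg_right (mul_le_mul (mul_le_mul_of_nonneg_right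
      (pow_le_pow_left₀ hAk (by linarith) 2) hk4) (by linarith) (by positivity) (by positivity))
      (by positivity)
  have hsum : ∑ m ∈ S, ((P.filter fun z => z.2.2 = (m : ℤ)).card : ℝ) ≤ P.card := by
    have h := card_biUnion (s := S) (t := fun m : ℕ => P.filter fun z => z.2.2 = (m : ℤ))
      (fun a _ b _ hab => disjoint_left.mpr fun z hz hz' => hab (by
        have h1 := (mem_filter.mp hz).2
        have h2 := (mem_filter.mp hz').2
        exact_mod_cast h1.symm.trans h2))
    have h' : (S.biUnion fun m : ℕ => P.filter fun z => z.2.2 = (m : ℤ)).card ≤ P.card :=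
      card_le_card (biUnion_subset.mpr fun m _ => filter_subset _ _)
    rw [h] at h'
    exact_mod_cast h'
  have hAk2 : 0 ≤ (A - 2 * (1 / k)) ^ 2 * (1 - 1 / k) * (8 * μ₁ * t) := by
    have hk4 : (0 : ℝ) ≤ 1 - 1 / k := by
      rw [sub_nonneg, div_le_one hk0]; exact hk1'
    positivity
  calc _ ≤ p * G (1 / k) := by
        rw [← hG0]; exact mul_le_mul_of_nonneg_left hk1.le (by positivity)
    _ = (A - 2 * (1 / k)) ^ 2 * (1 - 1 / k) * (8 * μ₁ * t) *
        (t * ((μ₂ - μ₁) * (4 / Real.pi ^ 2) - 1 / k)) := by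
        rw [← htt]; simp only [hG]; ring
    _ ≤ (A - 2 * (1 / k)) ^ 2 * (1 - 1 / k) * (8 * μ₁ * t) *
        ∑ m ∈ S, ((8 * m).totient : ℝ) / (8 * m) := by
        refine mul_le_mul_of_nonneg_left ?_ hAk2
        convert h1 using 2
    _ ≤ ∑ m ∈ S, ((P.filter fun z => z.2.2 = (m : ℤ)).card : ℝ) := by
        rw [mul_sum]; exact sum_le_sum hslice
    _ ≤ _ := hsum

end BoxCount

section LogIntegral

open Filter Topology MeasureTheory

/-- `∫₀^∞ log (1 + a² / u²) du = π a`. -/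
lemma lintegral_log_one_add_div_sq {a : ℝ} (ha : 0 < a) :
    ∫⁻ u in Set.Ioi (0 : ℝ), ENNReal.ofReal (Real.log (1 + a ^ 2 / u ^ 2)) =
      ENNReal.ofReal (Real.pi * a) := by
  set F : ℝ → ℝ := fun u => u * Real.log (u ^ 2 + a ^ 2) - 2 * (u * Real.log u) +
    2 * a * Real.arctan (u / a) with hF
  have hpos : ∀ u ∈ Set.Ioi (0 : ℝ), 0 ≤ Real.log (1 + a ^ 2 / u ^ 2) := fun u _ =>
    Real.log_nonneg (le_add_of_nonneg_right (by positivity))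
  have hcont : Continuous F := by
    have h1 := Real.continuous_mul_log
    have h2 : Continuous fun u : ℝ => Real.log (u ^ 2 + a ^ 2) :=
      Continuous.log (by fun_prop) (fun u => by positivity)
    have h3 : Continuous fun u : ℝ => Real.arctan (u / a) :=
      Real.continuous_arctan.comp (by fun_prop)
    exact ((continuous_id.mul h2).sub (continuous_const.mul h1)).add (continuous_const.mul h3)
  have hderiv : ∀ u ∈ Set.Ioi (0 : ℝ), HasDerivAt F (Real.log (1 + a ^ 2 / u ^ 2)) u := by
    intro u hu
    have hu0 : 0 < u := hu
    have hne : u ^ 2 + a ^ 2 ≠ 0 := by positivity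
    have e1 : HasDerivAt (fun u : ℝ => u ^ 2 + a ^ 2) (2 * u) u := by
      simpa using (hasDerivAt_pow 2 u).add_const (a ^ 2)
    have e2 := (hasDerivAt_id u).mul (e1.log hne)
    have e3 := ((hasDerivAt_id u).mul (Real.hasDerivAt_log hu0.ne')).const_mul 2
    have e4 := (((hasDerivAt_id u).div_const a).arctan).const_mul (2 * a)
    refine ((e2.sub e3).add e4).congr_deriv ?_
    have e5 : 1 + a ^ 2 / u ^ 2 = (u ^ 2 + a ^ 2) / u ^ 2 := by field_simp
    rw [e5, Real.log_div hne (by positivity), Real.log_pow]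
    simp only [id]
    push_cast
    field_simp
    ring
  have hlim : Tendsto F atTop (𝓝 (Real.pi * a)) := by
    have h1 : Tendsto (fun u : ℝ => 2 * a * Real.arctan (u / a)) atTop
        (𝓝 (2 * a * (Real.pi / 2))) :=
      (((Real.tendsto_arctan_atTop.mono_right nhdsWithin_le_nhds).comp
        (tendsto_id.atTop_div_const ha))).const_mul _
    have h2 : Tendsto (fun u : ℝ => u * Real.log (u ^ 2 + a ^ 2) - 2 * (u * Real.log u)) atTop
        (𝓝 0) := by
      have h3 : Tendsto (fun u : ℝ => a ^ 2 / u) atTop (𝓝 0) :=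
        tendsto_const_nhds.div_atTop tendsto_id
      have heq : ∀ u : ℝ, 0 < u → u * Real.log (u ^ 2 + a ^ 2) - 2 * (u * Real.log u) =
          u * Real.log (1 + a ^ 2 / u ^ 2) := fun u hu => by
        have e5 : 1 + a ^ 2 / u ^ 2 = (u ^ 2 + a ^ 2) / u ^ 2 := by field_simp
        rw [e5, Real.log_div (by positivity) (by positivity), Real.log_pow]
        push_cast; ring
      refine tendsto_of_tendsto_of_tendsto_of_le_of_le' tendsto_const_nhds h3 ?_ ?_
      · filter_upwards [eventually_gt_atTop 0] with u hu
        rw [heq u hu]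
        exact mul_nonneg hu.le (hpos u hu)
      · filter_upwards [eventually_gt_atTop 0] with u hu
        rw [heq u hu]
        have h4 := Real.log_le_sub_one_of_pos (show 0 < 1 + a ^ 2 / u ^ 2 by positivity)
        calc _ ≤ u * (a ^ 2 / u ^ 2) := mul_le_mul_of_nonneg_left (by linarith) hu.le
          _ = _ := by field_simp
    convert h2.add h1 using 2
    ring
  rw [← ofReal_integral_eq_lintegral_ofReal
    (integrableOn_Ioi_deriv_of_nonneg hcont.continuousWithinAt hderiv hpos hlim)
    ((ae_restrict_mem measurableSet_Ioi).mono fun u hu => hpos u hu),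
    integral_Ioi_of_hasDerivAt_of_nonneg hcont.continuousWithinAt hderiv hpos hlim]
  simp [hF]

lemma lintegral_log_one_add_div_sq_univ {a : ℝ} (ha : 0 < a) :
    ∫⁻ u : ℝ, ENNReal.ofReal (Real.log (1 + a ^ 2 / u ^ 2)) =
      ENNReal.ofReal (2 * Real.pi * a) := by
  set f : ℝ → ENNReal := fun u => ENNReal.ofReal (Real.log (1 + a ^ 2 / u ^ 2)) with hf
  have hneg : ∫⁻ u in Set.Iio (0 : ℝ), f u = ∫⁻ u in Set.Ioi (0 : ℝ), f u := by
    rw [← lintegral_indicator measurableSet_Iio, ← lintegral_indicator measurableSet_Ioi,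
      ← lintegral_neg_eq_self]
    congr 1
    ext u
    simp [Set.indicator, hf]
  have h := lintegral_add_compl f (measurableSet_Ioi (a := (0 : ℝ))) (μ := volume)
  rw [← h, Set.compl_Ioi, setLIntegral_congr Iio_ae_eq_Iic.symm, hneg,
    lintegral_log_one_add_div_sq ha, ← ENNReal.ofReal_add (by positivity) (by positivity)]
  congr 1; ring

/-- `∫₋₁¹ v² √(1 - v²) dv = π / 8`. -/
lemma integral_sq_mul_sqrt_one_sub_sq :
    ∫ v in (-1 : ℝ)..1, v ^ 2 * √(1 - v ^ 2) = Real.pi / 8 := by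
  set F : ℝ → ℝ := fun v => Real.arcsin v / 8 - v * (1 - 2 * v ^ 2) * √(1 - v ^ 2) / 8 with hF
  have hcont : Continuous F := by
    have := Real.continuous_arcsin
    simp only [hF]; fun_prop
  have h := intervalIntegral.integral_eq_sub_of_hasDerivAt_of_le (a := -1) (b := 1) (by norm_num)
    (f := F) (f' := fun v => v ^ 2 * √(1 - v ^ 2)) hcont.continuousOn (fun v hv => ?_)
    (Continuous.intervalIntegrable (by fun_prop) _ _)
  · rw [h]; simp [hF]; ring
  · have h1 : 0 < 1 - v ^ 2 := by nlinarith [hv.1, hv.2]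
    have hs := Real.sqrt_pos.mpr h1
    have e0 := Real.hasDerivAt_arcsin (x := v) (by linarith [hv.1]) (by linarith [hv.2])
    have e1 : HasDerivAt (fun v : ℝ => 1 - v ^ 2) (-(2 * v)) v := by
      simpa using (hasDerivAt_pow 2 v).const_sub 1
    have e2 := e1.sqrt h1.ne'
    have e3 : HasDerivAt (fun v : ℝ => v * (1 - 2 * v ^ 2)) (1 - 6 * v ^ 2) v := by
      have := (hasDerivAt_id v).mul (((hasDerivAt_pow 2 v).const_mul 2).const_sub 1)
      refine this.congr_deriv ?_
      simp; ring
    refine ((e0.div_const 8).sub ((e3.mul e2).div_const 8)).congr_deriv ?_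
    have hsq : √(1 - v ^ 2) ^ 2 = 1 - v ^ 2 := Real.sq_sqrt h1.le
    generalize √(1 - v ^ 2) = s at *
    have hv2 : v ^ 2 = 1 - s ^ 2 := by linarith
    field_simp
    linear_combination (-2 * v ^ 2 - 1) * hv2
end LogIntegral

section Region

open Filter Topology MeasureTheory

/-- The region swept out by the rescaled coefficients of the matrices of determinant `p` whose
fixed points lie in the standard fundamental domain for `Γ(2)`. -/
def traceRegion : Set (ℝ × ℝ × ℝ) :=
  {z | 0 < z.2.2 ∧ |z.1 - z.2.1| < 4 * z.2.2 ∧ z.2.2 * |z.1 - z.2.1| < 1 - z.1 * z.2.1}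

/-- The squared trace times the limiting density of the matrix coefficients. -/
noncomputable def traceDensity (z : ℝ × ℝ × ℝ) : ℝ :=
  (z.1 + z.2.1) ^ 2 / (2 * Real.pi ^ 2 * z.2.2)

lemma isOpen_traceRegion : IsOpen traceRegion := by
  have h (f g : ℝ × ℝ × ℝ → ℝ) (hf : Continuous f) (hg : Continuous g) :
    IsOpen {z | f z < g z} := isOpen_lt hf hg
  exact (h _ _ (by fun_prop) (by fun_prop)).inter
    ((h _ _ (by fun_prop) (by fun_prop)).inter (h _ _ (by fun_prop) (by fun_prop)))

lemma measurable_traceDensity : Measurable traceDensity := by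
  unfold traceDensity; fun_prop

lemma lintegral_Ioo_const_div {a b c : ℝ} (ha : 0 < a) (hab : a ≤ b) (hc : 0 ≤ c) :
    ∫⁻ μ in Set.Ioo a b, ENNReal.ofReal (c / μ) = ENNReal.ofReal (c * Real.log (b / a)) := by
  have hinteg : IntervalIntegrable (fun μ : ℝ => c / μ) volume a b := by
    refine ContinuousOn.intervalIntegrable ?_
    rw [Set.uIcc_of_le hab]
    exact continuousOn_const.div continuousOn_id fun x hx => (ha.trans_le hx.1).ne'
  rw [setLIntegral_congr Ioo_ae_eq_Ioc, ← ofReal_integral_eq_lintegral_ofReal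
    ((intervalIntegrable_iff_integrableOn_Ioc_of_le hab).mp hinteg)
    ((ae_restrict_mem measurableSet_Ioc).mono fun x hx =>
      div_nonneg hc (ha.trans hx.1).le), ← intervalIntegral.integral_of_le hab]
  simp only [div_eq_mul_inv c]
  rw [intervalIntegral.integral_const_mul, integral_inv_of_pos ha (ha.trans_le hab)]

/-- The integral of the trace density over a fibre, as a function of `x + y` and `x - y`. -/
noncomputable def fibreMass (T V : ℝ) : ENNReal :=
  if |T| < 2 then ENNReal.ofReal (T ^ 2 / (2 * Real.pi ^ 2)) *
    ENNReal.ofReal (Real.log (1 + √(4 - T ^ 2) ^ 2 / V ^ 2)) else 0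

lemma measurable_fibreMass : Measurable fun w : ℝ × ℝ => fibreMass w.1 w.2 := by
  unfold fibreMass
  refine Measurable.ite (measurableSet_lt (by fun_prop) (by fun_prop)) (by fun_prop) (by fun_prop)

lemma fibreMass_le (x y : ℝ) : fibreMass (x + y) (x - y) ≤
    ∫⁻ μ : ℝ, traceRegion.indicator (fun z => ENNReal.ofReal (traceDensity z)) (x, y, μ) := by
  unfold fibreMass
  split_ifs with hT
  swap
  · simp
  have hT4 : 0 < 4 - (x + y) ^ 2 := by nlinarith [abs_lt.mp hT]
  rcases eq_or_ne x y with rfl | hxy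
  · simp
  set D := |x - y| with hD
  have hD0 : 0 < D := abs_pos.mpr (sub_ne_zero.mpr hxy)
  have hDsq : D ^ 2 = (x - y) ^ 2 := sq_abs _
  have hP : D ^ 2 < 4 * (1 - x * y) := by rw [hDsq]; nlinarith
  have hab : D / 4 ≤ (1 - x * y) / D := by
    rw [div_le_div_iff₀ (by norm_num) hD0]; nlinarith
  have hP0 : 0 < 1 - x * y := by nlinarith [sq_nonneg D]
  have hlog : ((1 - x * y) / D) / (D / 4) = 1 + √(4 - (x + y) ^ 2) ^ 2 / (x - y) ^ 2 := by
    rw [Real.sq_sqrt hT4.le, ← hDsq]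
    field_simp
    rw [hDsq]; ring
  rw [← hlog, ← ENNReal.ofReal_mul (by positivity), ← lintegral_Ioo_const_div (by positivity) hab
    (by positivity), ← lintegral_indicator measurableSet_Ioo]
  refine lintegral_mono fun μ => ?_
  by_cases hμ : μ ∈ Set.Ioo (D / 4) ((1 - x * y) / D)
  swap
  · rw [Set.indicator_of_notMem hμ]
    simp
  have hμ0 : 0 < μ := lt_trans (by positivity) hμ.1
  have hmem : (x, y, μ) ∈ traceRegion := ⟨hμ0, by
      have := hμ.1; change D < 4 * μ; linarith, (lt_div_iff₀ hD0).mp hμ.2⟩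
  rw [Set.indicator_of_mem hμ, Set.indicator_of_mem hmem]
  refine le_of_eq (congrArg _ ?_)
  simp only [traceDensity]
  rw [div_div]

lemma lintegral_fibreMass :
    ∫⁻ x : ℝ, ∫⁻ v : ℝ, fibreMass (2 * x) v = 1 := by
  have h1 : ∀ x : ℝ, ∫⁻ v : ℝ, fibreMass (2 * x) v =
      (Set.Ioo (-1 : ℝ) 1).indicator
        (fun x => ENNReal.ofReal (8 / Real.pi * (x ^ 2 * √(1 - x ^ 2)))) x := by
    intro x
    unfold fibreMass
    by_cases hx : x ∈ Set.Ioo (-1 : ℝ) 1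
    · have hx1 : |2 * x| < 2 := by rw [abs_lt]; constructor <;> linarith [hx.1, hx.2]
      have h4 : 0 < 4 - (2 * x) ^ 2 := by nlinarith [hx.1, hx.2]
      simp only [if_pos hx1]
      rw [Set.indicator_of_mem hx, lintegral_const_mul _ (by fun_prop),
        lintegral_log_one_add_div_sq_univ (Real.sqrt_pos.mpr h4),
        ← ENNReal.ofReal_mul (by positivity)]
      have h5 : √(4 - (2 * x) ^ 2) = 2 * √(1 - x ^ 2) := by
        rw [show 4 - (2 * x) ^ 2 = 2 ^ 2 * (1 - x ^ 2) by ring, Real.sqrt_mul (by norm_num),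
          Real.sqrt_sq (by norm_num)]
      rw [h5]
      congr 1
      have := Real.pi_pos.ne'
      field_simp
      ring
    · have hx1 : ¬ |2 * x| < 2 := fun h => hx (by
        rw [abs_lt] at h; constructor <;> linarith [h.1, h.2])
      simp only [if_neg hx1]
      rw [Set.indicator_of_notMem hx, lintegral_zero]
  have hcont : Continuous fun x : ℝ => 8 / Real.pi * (x ^ 2 * √(1 - x ^ 2)) := by fun_prop
  simp only [h1]
  rw [lintegral_indicator measurableSet_Ioo, setLIntegral_congr Ioo_ae_eq_Ioc,
    ← ofReal_integral_eq_lintegral_ofReal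
      ((intervalIntegrable_iff_integrableOn_Ioc_of_le (by norm_num)).mp
        (hcont.intervalIntegrable _ _))
      (Eventually.of_forall fun x => by positivity),
    ← intervalIntegral.integral_of_le (by norm_num), intervalIntegral.integral_const_mul,
    integral_sq_mul_sqrt_one_sub_sq, ← ENNReal.ofReal_one]
  congr 1
  have := Real.pi_pos.ne'
  field_simp

/-- The trace density has mass at least `1` on the region. -/
theorem one_le_lintegral_traceDensity :
    1 ≤ ∫⁻ z in traceRegion, ENNReal.ofReal (traceDensity z) := by
  have hmeas : Measurable (traceRegion.indicator fun z => ENNReal.ofReal (traceDensity z)) :=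
    (measurable_traceDensity.ennreal_ofReal).indicator isOpen_traceRegion.measurableSet
  have hm (f g : ℝ × ℝ → ℝ) (hf : Measurable f) (hg : Measurable g) :
      AEMeasurable (fun w : ℝ × ℝ => fibreMass (f w) (g w)) (volume.prod volume) :=
    (measurable_fibreMass.comp (hf.prodMk hg)).aemeasurable
  rw [← lintegral_indicator isOpen_traceRegion.measurableSet, Measure.volume_eq_prod,
    lintegral_prod _ hmeas.aemeasurable]
  calc (1 : ENNReal) = ∫⁻ x : ℝ, ∫⁻ v : ℝ, fibreMass (2 * x) v := lintegral_fibreMass.symm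
    _ = ∫⁻ v : ℝ, ∫⁻ x : ℝ, fibreMass (2 * x) v :=
        lintegral_lintegral_swap (hm (fun w => 2 * w.1) (fun w => w.2) (by fun_prop) (by fun_prop))
    _ = ∫⁻ v : ℝ, ∫⁻ x : ℝ, fibreMass (2 * x - v) v := by
        refine lintegral_congr fun v => ?_
        rw [← lintegral_sub_right_eq_self (fun x => fibreMass (2 * x) v) (v / 2)]
        refine lintegral_congr fun x => ?_
        congr 1; ring
    _ = ∫⁻ x : ℝ, ∫⁻ v : ℝ, fibreMass (2 * x - v) v :=
        lintegral_lintegral_swap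
          (hm (fun w => 2 * w.2 - w.1) (fun w => w.1) (by fun_prop) (by fun_prop))
    _ = ∫⁻ x : ℝ, ∫⁻ y : ℝ, fibreMass (x + y) (x - y) := by
        refine lintegral_congr fun x => ?_
        rw [← lintegral_sub_left_eq_self (fun v => fibreMass (2 * x - v) v) x]
        refine lintegral_congr fun y => ?_
        congr 1; ring
    _ ≤ _ := by
        refine lintegral_mono fun x => ?_
        have h : Measurable fun w : ℝ × ℝ =>
            traceRegion.indicator (fun z => ENNReal.ofReal (traceDensity z)) (x, w) :=
          hmeas.comp (measurable_const.prodMk measurable_id)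
        rw [Measure.volume_eq_prod, lintegral_prod _ h.aemeasurable]
        exact lintegral_mono fun y => fibreMass_le x y

end Region

section TraceSum

open Filter Topology MeasureTheory

/-- The coefficient triples rescaled by `√p`. -/
noncomputable def rescale (p : ℕ) (z : ℤ × ℤ × ℤ) : ℝ × ℝ × ℝ :=
  (z.1 / √p, z.2.1 / √p, z.2.2 / √p)

open scoped Classical in
/-- Triples `(x, y, m)` which are entries of a matrix `!![x, -2 n; 2 m, y]` of determinant `p`
with `n ≡ δ` modulo `2`, whose fixed point lies in the fundamental domain. -/
noncomputable def coeffTriples (p : ℕ) (δ : ℤ) : Finset (ℤ × ℤ × ℤ) :=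
  (Icc (-p : ℤ) p ×ˢ Icc (-p : ℤ) p ×ˢ Icc (-p : ℤ) p).filter fun z =>
    rescale p z ∈ traceRegion ∧ 8 * z.2.2 ∣ z.1 * z.2.1 - (p + 4 * z.2.2 * δ)

lemma mem_coeffTriples {p : ℕ} {δ : ℤ} {z : ℤ × ℤ × ℤ} : z ∈ coeffTriples p δ ↔
    (z.1 ∈ Icc (-p : ℤ) p ∧ z.2.1 ∈ Icc (-p : ℤ) p ∧ z.2.2 ∈ Icc (-p : ℤ) p) ∧
      rescale p z ∈ traceRegion ∧ 8 * z.2.2 ∣ z.1 * z.2.1 - (p + 4 * z.2.2 * δ) := by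
  simp only [coeffTriples, mem_filter, mem_product]

/-- A ball on which the trace sum attains `1 - η` times its expected value. -/
def IsGoodBall (δ : ℤ) (η : ℝ) (z : ℝ × ℝ × ℝ) (r : ℝ) : Prop :=
  ∃ I : ℝ, 0 ≤ I ∧
    ∫⁻ w in Metric.closedBall z r, ENNReal.ofReal (traceDensity w) ≤ ENNReal.ofReal I ∧
    ∃ N : ℕ, ∀ p : ℕ, p.Prime → N < p → ∀ P : Finset (ℤ × ℤ × ℤ),
      (∀ w ∈ coeffTriples p δ, rescale p w ∈ Metric.closedBall z r → w ∈ P) →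
      (∀ w ∈ P, rescale p w ∈ Metric.closedBall z r) →
      (1 - η) * I * (p : ℝ) ^ 2 ≤ ∑ w ∈ P, ((w.1 : ℝ) + w.2.1) ^ 2

lemma mem_closedBall_triple {z w : ℝ × ℝ × ℝ} {r : ℝ} : w ∈ Metric.closedBall z r ↔
    |w.1 - z.1| ≤ r ∧ |w.2.1 - z.2.1| ≤ r ∧ |w.2.2 - z.2.2| ≤ r := by
  rw [Metric.mem_closedBall, Prod.dist_eq, max_le_iff, Prod.dist_eq, max_le_iff, Real.dist_eq,
    Real.dist_eq, Real.dist_eq]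

lemma volume_closedBall_triple (z : ℝ × ℝ × ℝ) {r : ℝ} (hr : 0 ≤ r) :
    volume (Metric.closedBall z r) = ENNReal.ofReal ((2 * r) ^ 3) := by
  obtain ⟨x, y, m⟩ := z
  rw [← closedBall_prod_same, ← closedBall_prod_same, Measure.volume_eq_prod, Measure.prod_prod,
    Measure.volume_eq_prod, Measure.prod_prod, Real.volume_closedBall, Real.volume_closedBall,
    Real.volume_closedBall, ← ENNReal.ofReal_mul (by positivity),
    ← ENNReal.ofReal_mul (by positivity)]
  congr 1; ring

lemma isGoodBall_of_small (δ : ℤ) {η : ℝ} {z : ℝ × ℝ × ℝ} {r W : ℝ} (hr : 0 < r)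
    (hsub : Metric.closedBall z r ⊆ traceRegion) (hW : |z.1 + z.2.1| = W) (hWr : 2 * r < W)
    (hm : r < z.2.2)
    (hη : 1 - η < (W - 2 * r) ^ 2 / (W + 2 * r) ^ 2 * ((z.2.2 - r) ^ 2 / (z.2.2 + r) ^ 2)) :
    IsGoodBall δ η z r := by
  obtain ⟨X, Y, μ⟩ := z
  simp only at hW hm hη
  have hπ := Real.pi_pos
  have hμr : 0 < μ - r := by linarith
  have hWr' : 0 < W - 2 * r := by linarith
  have hWr2 : 0 < W + 2 * r := by linarith
  have hsum : ∀ w ∈ Metric.closedBall (X, Y, μ) r,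
      W - 2 * r ≤ |w.1 + w.2.1| ∧ |w.1 + w.2.1| ≤ W + 2 * r := by
    intro w hw
    obtain ⟨h1, h2, -⟩ := mem_closedBall_triple.mp hw
    have h3 : |(w.1 + w.2.1) - (X + Y)| ≤ 2 * r := by
      rw [show (w.1 + w.2.1) - (X + Y) = (w.1 - X) + (w.2.1 - Y) by ring]
      exact (abs_add_le _ _).trans (by simp only at h1 h2; linarith)
    have h4 := abs_sub_abs_le_abs_sub (X + Y) (w.1 + w.2.1)
    have h5 := abs_sub_abs_le_abs_sub (w.1 + w.2.1) (X + Y)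
    rw [abs_sub_comm] at h4
    rw [hW] at h4 h5
    constructor <;> linarith
  set I := (2 * r) ^ 3 * ((W + 2 * r) ^ 2 / (2 * Real.pi ^ 2 * (μ - r))) with hI
  have hI0 : 0 < I := by positivity
  set Q := (W - 2 * r) ^ 2 / (W + 2 * r) ^ 2 * ((μ - r) ^ 2 / (μ + r) ^ 2) with hQ
  obtain ⟨N, hN⟩ := exists_le_card_box (X₁ := X - r) (X₂ := X + r) (Y₁ := Y - r) (Y₂ := Y + r)
    (μ₁ := μ - r) (μ₂ := μ + r) (ℓ := 2 * r) (by positivity) (by ring) (by ring) hμr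
    (by linarith) δ (η := (Q - (1 - η)) * I / (W - 2 * r) ^ 2)
    (div_pos (mul_pos (by linarith) hI0) (by positivity))
  refine ⟨I, hI0.le, ?_, max N ⌈(|X| + |Y| + |μ| + r) ^ 2⌉₊, fun p hp hNp P hP hP' => ?_⟩
  · calc _ ≤ ∫⁻ w in Metric.closedBall (X, Y, μ) r,
          ENNReal.ofReal ((W + 2 * r) ^ 2 / (2 * Real.pi ^ 2 * (μ - r))) := by
          refine setLIntegral_mono' Metric.isClosed_closedBall.measurableSet fun w hw => ?_
          refine ENNReal.ofReal_le_ofReal ?_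
          obtain ⟨-, -, h3⟩ := mem_closedBall_triple.mp hw
          have h4 : μ - r ≤ w.2.2 := by
            have := (abs_le.mp h3).1; simp only at this; linarith
          unfold traceDensity
          rw [← sq_abs]
          gcongr
          exact (hsum w hw).2
      _ = _ := by
          rw [setLIntegral_const, volume_closedBall_triple _ hr.le,
            ← ENNReal.ofReal_mul (by positivity), mul_comm]
  · have hp0 : (0 : ℝ) < p := by exact_mod_cast hp.pos
    have ht0 : 0 < √(p : ℝ) := Real.sqrt_pos.mpr hp0
    have htt : √(p : ℝ) * √(p : ℝ) = p := Real.mul_self_sqrt hp0.le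
    have hbig : |X| + |Y| + |μ| + r ≤ √(p : ℝ) := by
      refine Real.le_sqrt_of_sq_le ?_
      refine (Nat.le_ceil _).trans ?_
      exact_mod_cast (le_max_right _ _).trans hNp.le
    have hbd : ∀ (x : ℤ) (A : ℝ), A + r ≤ √(p : ℝ) → |(x : ℝ) / √(p : ℝ)| ≤ A + r →
        x ∈ Icc (-p : ℤ) p := fun x A hA hx => by
      rw [abs_div, abs_of_pos ht0, div_le_iff₀ ht0] at hx
      have : |(x : ℝ)| ≤ p := hx.trans ((mul_le_mul_of_nonneg_right hA ht0.le).trans htt.le)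
      rw [mem_Icc]
      exact abs_le.mp (by exact_mod_cast this)
    have hcard := hN p hp (by omega) P (fun x y m h1 h2 h3 h4 h5 h6 h7 => by
      have hball : rescale p (x, y, m) ∈ Metric.closedBall (X, Y, μ) r := by
        refine mem_closedBall_triple.mpr ⟨?_, ?_, ?_⟩ <;>
        · simp only [rescale]
          rw [abs_le]; constructor <;> linarith
      refine hP _ ?_ hball
      obtain ⟨b1, b2, b3⟩ := mem_closedBall_triple.mp hball
      have hX := abs_nonneg X
      have hY := abs_nonneg Y
      have hμ := abs_nonneg μ
      refine mem_coeffTriples.mpr ⟨?_, hsub hball, h7⟩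
      refine ⟨hbd x |X| (by linarith) ?_, hbd y |Y| (by linarith) ?_, hbd m |μ| (by linarith) ?_⟩
      · have := abs_sub_abs_le_abs_sub ((x : ℝ) / √(p : ℝ)) X
        simp only [rescale] at b1; linarith
      · have := abs_sub_abs_le_abs_sub ((y : ℝ) / √(p : ℝ)) Y
        simp only [rescale] at b2; linarith
      · have := abs_sub_abs_le_abs_sub ((m : ℝ) / √(p : ℝ)) μ
        simp only [rescale] at b3; linarith)
    have hterm : ∀ w ∈ P, p * (W - 2 * r) ^ 2 ≤ ((w.1 : ℝ) + w.2.1) ^ 2 := by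
      intro w hw
      have h1 := (hsum _ (hP' w hw)).1
      simp only [rescale] at h1
      rw [← add_div, abs_div, abs_of_pos ht0, le_div_iff₀ ht0] at h1
      calc p * (W - 2 * r) ^ 2 = ((W - 2 * r) * √(p : ℝ)) ^ 2 := by
            rw [mul_pow, Real.sq_sqrt hp0.le]; ring
        _ ≤ |(w.1 : ℝ) + w.2.1| ^ 2 := pow_le_pow_left₀ (by positivity) h1 2
        _ = _ := sq_abs _
    calc (1 - η) * I * (p : ℝ) ^ 2 = p * ((2 * r) ^ 2 * (μ + r - (μ - r)) * (μ - r) /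
          (μ + r) ^ 2 / (2 * Real.pi ^ 2) - (Q - (1 - η)) * I / (W - 2 * r) ^ 2) *
          (p * (W - 2 * r) ^ 2) := by
          have hμr2 : 0 < μ + r := by linarith
          have : (2 * r) ^ 2 * (μ + r - (μ - r)) * (μ - r) / (μ + r) ^ 2 / (2 * Real.pi ^ 2) =
              Q * I / (W - 2 * r) ^ 2 := by
            rw [hQ, hI]; field_simp; ring
          rw [this, ← sub_div]
          field_simp
          ring
      _ ≤ P.card * (p * (W - 2 * r) ^ 2) :=
          mul_le_mul_of_nonneg_right hcard (by positivity)
      _ = ∑ w ∈ P, p * (W - 2 * r) ^ 2 := by rw [sum_const, nsmul_eq_mul]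
      _ ≤ _ := sum_le_sum hterm

lemma exists_isGoodBall (δ : ℤ) {η : ℝ} (hη : 0 < η) {z : ℝ × ℝ × ℝ} (hz : z ∈ traceRegion)
    (hne : z.1 + z.2.1 ≠ 0) {ε : ℝ} (hε : 0 < ε) : ∃ r ∈ Set.Ioo 0 ε, IsGoodBall δ η z r := by
  have hW : 0 < |z.1 + z.2.1| := abs_pos.mpr hne
  have hm : 0 < z.2.2 := hz.1
  set W := |z.1 + z.2.1|
  obtain ⟨ρ, hρ, hball⟩ := Metric.isOpen_iff.mp isOpen_traceRegion z hz
  have hlim : Tendsto (fun r : ℝ => (W - 2 * r) ^ 2 / (W + 2 * r) ^ 2 *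
      ((z.2.2 - r) ^ 2 / (z.2.2 + r) ^ 2)) (𝓝[>] 0) (𝓝 1) := by
    have hc : ContinuousAt (fun r : ℝ => (W - 2 * r) ^ 2 / (W + 2 * r) ^ 2 *
      ((z.2.2 - r) ^ 2 / (z.2.2 + r) ^ 2)) 0 := by
      refine ContinuousAt.mul ?_ ?_ <;> refine ContinuousAt.div (by fun_prop) (by fun_prop) ?_
      · simpa using hW.ne'
      · simpa using hm.ne'
    have h := hc.tendsto.mono_left (nhdsWithin_le_nhds (s := Set.Ioi 0))
    convert h using 2
    have h1 := hW.ne'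
    have h2 := hm.ne'
    simp only [mul_zero, sub_zero, add_zero]
    field_simp
  have hsmall : ∀ c : ℝ, 0 < c → ∀ᶠ r : ℝ in 𝓝[>] 0, r ∈ Set.Ioo 0 c := fun c hc =>
    Ioo_mem_nhdsGT hc
  obtain ⟨r, h1, h2, h3, h4, h5⟩ := ((hlim.eventually (lt_mem_nhds (show 1 - η < 1 by linarith))).and
    ((hsmall ε hε).and ((hsmall ρ hρ).and ((hsmall _ hm).and
      (hsmall (W / 2) (by positivity)))))).exists
  exact ⟨r, h2, isGoodBall_of_small δ h2.1
    ((Metric.closedBall_subset_ball h3.2).trans hball) rfl (by linarith [h5.2]) h4.2 h1⟩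

/-- A lower bound for the sum of squared traces, sharp to leading order. -/
theorem exists_le_sum_coeffTriples (δ : ℤ) {η : ℝ} (hη : 0 < η) :
    ∃ N : ℕ, ∀ p : ℕ, p.Prime → N < p →
      (1 - η) * (p : ℝ) ^ 2 ≤ ∑ w ∈ coeffTriples p δ, ((w.1 : ℝ) + w.2.1) ^ 2 := by
  classical
  set κ := min (η / 2) (1 / 2) with hκ
  have hκ0 : 0 < κ := lt_min (by positivity) (by norm_num)
  have hκ1 : κ ≤ 1 / 2 := min_le_right _ _
  set s : Set (ℝ × ℝ × ℝ) := {z | z ∈ traceRegion ∧ z.1 + z.2.1 ≠ 0} with hs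
  obtain ⟨t, r, htc, hts, hr, hcov, hdisj⟩ := Besicovitch.exists_disjoint_closedBall_covering_ae
    (volume : Measure (ℝ × ℝ × ℝ)) (fun z => {r | IsGoodBall δ κ z r}) s
    (fun z hz ε hε => by
      obtain ⟨r, hr, hg⟩ := exists_isGoodBall δ hκ0 hz.1 hz.2 hε
      exact ⟨r, hg, hr⟩) (fun _ => 1) (fun _ _ => one_pos)
  have hgood : ∀ z : t, IsGoodBall δ κ z (r z) := fun z => (hr z z.2).1
  choose I hI0 hI hN using hgood
  choose N hN using hN
  have hmass : (1 : ENNReal) ≤ ∑' z : t, ENNReal.ofReal (I z) := by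
    have : Countable t := htc
    set g : ℝ × ℝ × ℝ → ENNReal := fun z => ENNReal.ofReal (traceDensity z)
    calc (1 : ENNReal) ≤ ∫⁻ z in traceRegion, g z := one_le_lintegral_traceDensity
      _ ≤ ∫⁻ z in s ∪ {z | z.1 + z.2.1 = 0}, g z := lintegral_mono_set fun z hz => by
          by_cases h : z.1 + z.2.1 = 0
          · exact Or.inr h
          · exact Or.inl ⟨hz, h⟩
      _ ≤ (∫⁻ z in s, g z) + ∫⁻ z in {z | z.1 + z.2.1 = 0}, g z := lintegral_union_le _ _ _
      _ = ∫⁻ z in s, g z := by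
          rw [setLIntegral_congr_fun (g := fun _ => 0)
            (measurableSet_eq_fun (by fun_prop) (by fun_prop))
            (fun z hz => by
              have hz' : z.1 + z.2.1 = 0 := hz
              simp [g, traceDensity, hz']), lintegral_zero, add_zero]
      _ ≤ ∫⁻ z in (⋃ z ∈ t, Metric.closedBall z (r z)) ∪
            (s \ ⋃ z ∈ t, Metric.closedBall z (r z)), g z :=
          lintegral_mono_set (by rw [Set.union_sdiff_self]; exact Set.subset_union_right)
      _ ≤ (∫⁻ z in ⋃ z ∈ t, Metric.closedBall z (r z), g z) +
            ∫⁻ z in s \ ⋃ z ∈ t, Metric.closedBall z (r z), g z := lintegral_union_le _ _ _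
      _ = ∫⁻ z in ⋃ z : t, Metric.closedBall (z : ℝ × ℝ × ℝ) (r z), g z := by
          rw [setLIntegral_measure_zero _ _ hcov, add_zero, Set.biUnion_eq_iUnion]
      _ ≤ ∑' z : t, ∫⁻ w in Metric.closedBall (z : ℝ × ℝ × ℝ) (r z), g w :=
          lintegral_iUnion_le _ _
      _ ≤ _ := ENNReal.tsum_le_tsum hI
  have hlt : ENNReal.ofReal (1 - κ) < ∑' z : t, ENNReal.ofReal (I z) :=
    lt_of_lt_of_le (b := 1) (by
      rw [← ENNReal.ofReal_one]
      exact (ENNReal.ofReal_lt_ofReal_iff one_pos).mpr (by linarith)) hmass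
  rw [ENNReal.tsum_eq_iSup_sum, lt_iSup_iff] at hlt
  obtain ⟨F, hF⟩ := hlt
  rw [← ENNReal.ofReal_sum_of_nonneg (fun z _ => hI0 z)] at hF
  have hF' : 1 - κ < ∑ z ∈ F, I z := by
    by_contra h
    exact absurd hF (not_lt.mpr (ENNReal.ofReal_le_ofReal (not_lt.mp h)))
  refine ⟨F.sup N, fun p hp hNp => ?_⟩
  set P : t → Finset (ℤ × ℤ × ℤ) := fun z =>
    (coeffTriples p δ).filter fun w => rescale p w ∈ Metric.closedBall (z : ℝ × ℝ × ℝ) (r z)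
  have hP : ∀ z ∈ F, (1 - κ) * I z * (p : ℝ) ^ 2 ≤ ∑ w ∈ P z, ((w.1 : ℝ) + w.2.1) ^ 2 :=
    fun z hz => hN z p hp ((le_sup hz).trans_lt hNp) (P z)
      (fun w hw hw' => mem_filter.mpr ⟨hw, hw'⟩) (fun w hw => (mem_filter.mp hw).2)
  calc (1 - η) * (p : ℝ) ^ 2 ≤ (1 - κ) * (1 - κ) * (p : ℝ) ^ 2 := by
        refine mul_le_mul_of_nonneg_right ?_ (by positivity)
        have : κ ≤ η / 2 := min_le_left _ _
        nlinarith
    _ ≤ (1 - κ) * (∑ z ∈ F, I z) * (p : ℝ) ^ 2 := by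
        refine mul_le_mul_of_nonneg_right (mul_le_mul_of_nonneg_left hF'.le (by linarith))
          (by positivity)
    _ = ∑ z ∈ F, (1 - κ) * I z * (p : ℝ) ^ 2 := by rw [mul_sum, sum_mul]
    _ ≤ ∑ z ∈ F, ∑ w ∈ P z, ((w.1 : ℝ) + w.2.1) ^ 2 := sum_le_sum hP
    _ = ∑ w ∈ F.biUnion P, ((w.1 : ℝ) + w.2.1) ^ 2 := by
        refine (sum_biUnion fun a _ b _ hab => disjoint_left.mpr fun w ha hb => ?_).symm
        exact Set.disjoint_left.mp (hdisj a.2 b.2 fun h => hab (Subtype.ext h))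
          (mem_filter.mp ha).2 (mem_filter.mp hb).2
    _ ≤ _ := sum_le_sum_of_subset_of_nonneg
        (biUnion_subset.mpr fun z _ => filter_subset _ _) fun w _ _ => sq_nonneg _

end TraceSum

section Matrices

variable {p : ℕ} [hp : Fact p.Prime]

/-- The matrix of determinant `p` with given diagonal and lower left entry. -/
def coeffMatrix (p : ℕ) (w : ℤ × ℤ × ℤ) : Matrix (Fin 2) (Fin 2) ℤ :=
  !![w.1, -(2 * ((p - w.1 * w.2.1) / (4 * w.2.2))); 2 * w.2.2, w.2.1]

/-- The fixed point in the upper half plane of an elliptic matrix of determinant `p`. -/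
noncomputable def ellipticPoint (p : ℕ) (M : Matrix (Fin 2) (Fin 2) ℤ) : ℂ :=
  ⟨(M 0 0 - M 1 1) / (2 * M 1 0), √(4 * p - (M 0 0 + M 1 1) ^ 2) / (2 * M 1 0)⟩

lemma exists_of_mem_coeffTriples {δ : ℤ} {w : ℤ × ℤ × ℤ} (hw : w ∈ coeffTriples p δ) :
    ∃ n : ℤ, n.negOnePow = δ.negOnePow ∧ w.1 * w.2.1 + 4 * w.2.2 * n = p ∧ 0 < w.2.2 ∧ 0 < n ∧
      |w.1 - w.2.1| < 4 * w.2.2 ∧ |w.1 - w.2.1| < 4 * n ∧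
      coeffMatrix p w = !![w.1, -(2 * n); 2 * w.2.2, w.2.1] := by
  obtain ⟨x, y, m⟩ := w
  obtain ⟨-, ⟨h1, h2, h3⟩, k, hk⟩ := mem_coeffTriples.mp hw
  simp only [rescale] at h1 h2 h3 hk ⊢
  have hp0 : (0 : ℝ) < p := by exact_mod_cast hp.out.pos
  have ht : 0 < √(p : ℝ) := Real.sqrt_pos.mpr hp0
  have htt : √(p : ℝ) * √(p : ℝ) = p := Real.mul_self_sqrt hp0.le
  have hm : 0 < m := by
    have := (div_pos_iff_of_pos_right ht).mp h1
    exact_mod_cast this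
  rw [← sub_div, abs_div, abs_of_pos ht] at h2 h3
  have h2' : |x - y| < 4 * m := by
    rw [← mul_div_assoc, div_lt_div_iff_of_pos_right ht] at h2
    exact_mod_cast h2
  have h3' : m * |x - y| < p - x * y := by
    have : (m : ℝ) * |(x : ℝ) - y| < p - x * y := by
      rw [div_mul_div_comm, div_mul_div_comm, htt, div_lt_iff₀ hp0, sub_mul,
        div_mul_cancel₀ _ hp0.ne', one_mul] at h3
      exact h3
    exact_mod_cast this
  have heq : x * y + 4 * m * (-(δ + 2 * k)) = p := by linear_combination hk
  have hn4 : |x - y| < 4 * (-(δ + 2 * k)) := by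
    have : m * |x - y| < m * (4 * (-(δ + 2 * k))) := by linarith
    exact lt_of_mul_lt_mul_left this hm.le
  refine ⟨-(δ + 2 * k), ?_, heq, hm, ?_, h2', hn4, ?_⟩
  · rw [Int.negOnePow_neg, Int.negOnePow_add, Int.negOnePow_two_mul, mul_one]
  · have := abs_nonneg (x - y); linarith
  · have : ((p : ℤ) - x * y) / (4 * m) = -(δ + 2 * k) :=
      Int.ediv_eq_of_eq_mul_right (by positivity) (by linarith)
    rw [coeffMatrix]
    simp only [this]

/-- Sums of squared traces over coefficient triples are dominated by squared traces of
Frobenius in the Legendre family. -/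
theorem sum_coeffTriples_le (hp16 : 16 < p) (δ : ℤ) :
    ∑ w ∈ coeffTriples p δ, (w.1 + w.2.1) ^ 2 ≤
      2 * ∑ x with phi p x = (δ.negOnePow : ℤ) ∧ x ≠ 1 ∧ x ≠ -1, ap p x ^ 2 + 20 * (p : ℤ) := by
  classical
  have hinj : Set.InjOn (coeffMatrix p) (coeffTriples p δ) := fun w _ v _ h => by
    have h1 := congrFun (congrFun h 0) 0
    have h2 := congrFun (congrFun h 1) 0
    have h3 := congrFun (congrFun h 1) 1
    simp [coeffMatrix] at h1 h2 h3
    exact Prod.ext h1 (Prod.ext h3 h2)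
  have key := sum_trace_sq_le hp16 δ.negOnePow ((coeffTriples p δ).image (coeffMatrix p))
    (ellipticPoint p)
  simp only [forall_mem_image] at key
  rw [sum_image hinj] at key
  refine (le_of_eq (sum_congr rfl fun w _ => by simp [coeffMatrix])).trans (key ?_ ?_ ?_ ?_ ?_ ?_ ?_)
  all_goals
    intro w hw
    obtain ⟨n, hsgn, hdet, hm, hn, hm4, hn4, hM⟩ := exists_of_mem_coeffTriples hw
    obtain ⟨x, y, m⟩ := w
    simp only at hdet hm hm4 hn4 hM
    rw [hM]
    have hdisc : 0 < 4 * (p : ℤ) - (x + y) ^ 2 := by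
      have : (x - y) ^ 2 < (4 * m) * (4 * n) := by
        rw [← sq_abs, sq]
        exact mul_lt_mul'' hm4 hn4 (abs_nonneg _) (abs_nonneg _)
      rw [← hdet]; linarith
    have hmR : (0 : ℝ) < m := by exact_mod_cast hm
    have hdiscR : (0 : ℝ) < 4 * p - ((x : ℝ) + y) ^ 2 := by exact_mod_cast hdisc
    have hs := Real.sqrt_pos.mpr hdiscR
    have hsq := Real.sq_sqrt hdiscR.le
    have hdetR : (x : ℝ) * y + 4 * m * n = p := by exact_mod_cast hdet
  · have hm4R : |(x : ℝ) - y| < 4 * m := by exact_mod_cast hm4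
    have hn4R : |(x : ℝ) - y| < 4 * n := by exact_mod_cast hn4
    simp only [ellipticPoint, Matrix.of_apply, Matrix.cons_val', Matrix.cons_val_zero,
      Matrix.cons_val_one, Matrix.cons_val_fin_one]
    push_cast
    generalize √(4 * (p : ℝ) - ((x : ℝ) + y) ^ 2) = s at *
    set a : ℝ := (x - y) / (2 * (2 * m)) with ha
    set b : ℝ := s / (2 * (2 * m)) with hb
    have hab : a ^ 2 + b ^ 2 = n / m := by
      rw [ha, hb, div_pow, div_pow, hsq, ← hdetR]; field_simp; ring
    have han : |a| < n / m := by
      rw [ha, abs_div, abs_of_pos (show (0 : ℝ) < 2 * (2 * m) by positivity),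
        div_lt_div_iff₀ (by positivity) hmR]
      nlinarith
    have han' := abs_lt.mp han
    have hone : ∀ z : ℂ, 1 < Complex.normSq z → 1 < ‖z‖ := fun z hz => by
      rw [Complex.normSq_eq_norm_sq] at hz
      nlinarith [norm_nonneg z]
    refine ⟨div_pos hs (by positivity), ?_, hone _ ?_, hone _ ?_⟩
    · change |a| < 1
      rw [ha, abs_div, abs_of_pos (show (0 : ℝ) < 2 * (2 * m) by positivity),
        div_lt_one (by positivity)]
      linarith
    · rw [Complex.normSq_apply]
      simp
      nlinarith
    · rw [Complex.normSq_apply]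
      simp
      nlinarith
  · set a : ℝ := (x - y) / (2 * (2 * m)) with ha
    set b : ℝ := √(4 * p - ((x : ℝ) + y) ^ 2) / (2 * (2 * m)) with hb
    have hb0 : 0 < b := by positivity
    have hab : m * (a ^ 2 + b ^ 2) = n := by
      rw [ha, hb, div_pow, div_pow, hsq, ← hdetR]; field_simp; ring
    have ha' : (x : ℝ) - y = 4 * m * a := by rw [ha]; field_simp; ring
    have hτ : ellipticPoint p !![x, -(2 * n); 2 * m, y] = ⟨a, b⟩ := by
      simp [ellipticPoint, ha, hb]
    rw [hτ, mob, div_eq_iff]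
    · simp only [Matrix.of_apply, Matrix.cons_val', Matrix.cons_val_zero, Matrix.cons_val_one,
        Matrix.cons_val_fin_one]
      apply Complex.ext
      · simp
        linear_combination a * ha' + 2 * hab
      · simp
        linear_combination b * ha'
    · intro h
      have := congrArg Complex.im h
      simp at this
      rcases this with h | h
      · linarith
      · exact hb0.ne' h
  · rw [isOneModTwo_iff]
    have hodd : Odd (x * y) := by
      have : Odd (p : ℤ) := by exact_mod_cast hp.out.odd_of_ne_two (by omega)
      rw [← hdet] at this
      rcases this with ⟨j, hj⟩
      exact ⟨j - 2 * m * n, by linarith⟩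
    have := Int.odd_mul.mp hodd
    simp [this]
  · rw [Matrix.det_fin_two_of]; linarith
  · simpa using hm
  · rw [upperSign, ← hsgn, ← Int.negOnePow_neg]
    congr 1
    simp
    omega
  · simp; linarith

end Matrices

lemma eq_signed_sum {p : ℕ} [hp : Fact p.Prime] :
    ∑ l : ZMod p with l ≠ 0 ∧ l ≠ 1 ∧ l ≠ -1, phi p l * ap p l ^ 2 =
      ∑ x with phi p x = 1 ∧ x ≠ 1 ∧ x ≠ -1, ap p x ^ 2 -
        ∑ x with phi p x = -1 ∧ x ≠ 1 ∧ x ≠ -1, ap p x ^ 2 := by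
  simp only [sum_filter]
  rw [← sum_sub_distrib]
  refine sum_congr rfl fun x _ => ?_
  by_cases h1 : x = 1 <;> by_cases h2 : x = -1 <;> by_cases h0 : x = 0 <;>
    by_cases h3 : IsSquare x <;> simp [h1, h2, phi, h0, h3]

lemma signed_sums_add_le {p : ℕ} [hp : Fact p.Prime] (hp2 : p ≠ 2) :
    ∑ x with phi p x = 1 ∧ x ≠ 1 ∧ x ≠ -1, ap p x ^ 2 +
      ∑ x with phi p x = -1 ∧ x ≠ 1 ∧ x ≠ -1, ap p x ^ 2 ≤ (p : ℤ) ^ 2 := by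
  refine le_trans ?_ (sum_ap_sq_le hp2)
  rw [← sum_union (disjoint_left.mpr fun x hx hx' => by
    have h1 := (mem_filter.mp hx).2.1
    have h2 := (mem_filter.mp hx').2.1
    omega)]
  exact sum_le_sum_of_subset_of_nonneg (subset_univ _) fun _ _ _ => sq_nonneg _

/-- `Σ_{λ ∈ F_p∖{0,±1}} φ(λ) a_p(λ)² = o(p²)` as `p → ∞`. -/
theorem twisted_second_moment_trace_asymptotic :
    ∀ ε : ℝ, 0 < ε → ∃ N : ℕ, ∀ p : ℕ, ∀ _hp : p.Prime, ∀ hN : N < p,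
      haveI : NeZero p := ⟨by omega⟩
      |((∑ l ∈ Finset.univ.filter (fun l : ZMod p => l ≠ 0 ∧ l ≠ 1 ∧ l ≠ -1),
          phi p l * (ap p l) ^ 2 : ℤ) : ℝ)| < ε * (p : ℝ) ^ 2 := by
  intro ε hε
  obtain ⟨N₀, hN₀⟩ := exists_le_sum_coeffTriples 0 (half_pos hε)
  obtain ⟨N₁, hN₁⟩ := exists_le_sum_coeffTriples 1 (half_pos hε)
  refine ⟨N₀ + N₁ + 16 + ⌈40 / ε⌉₊, fun p hp hN => ?_⟩
  have hfact : Fact p.Prime := ⟨hp⟩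
  have h₀ := hN₀ p hp (by omega)
  have h₁ := hN₁ p hp (by omega)
  have hp16 : 16 < p := by omega
  have hpε : 40 / ε < p := (Nat.le_ceil _).trans_lt (by
    have : ⌈40 / ε⌉₊ < p := by omega
    exact_mod_cast this)
  have hp0 : (0 : ℝ) < p := by positivity
  have b₀ := sum_coeffTriples_le hp16 0
  have b₁ := sum_coeffTriples_le hp16 1
  have hadd := signed_sums_add_le (p := p) (by omega)
  have heq := eq_signed_sum (p := p)
  rw [Int.negOnePow_zero, Units.val_one] at b₀
  rw [Int.negOnePow_one, Units.val_neg, Units.val_one] at b₁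
  rw [div_lt_iff₀ hε] at hpε
  have hsmall : 20 * (p : ℝ) < ε / 2 * p ^ 2 := by nlinarith
  change |((∑ l : ZMod p with l ≠ 0 ∧ l ≠ 1 ∧ l ≠ -1, phi p l * ap p l ^ 2 : ℤ) : ℝ)| < _
  rw [heq]
  generalize ∑ x with phi p x = 1 ∧ x ≠ 1 ∧ x ≠ -1, ap p x ^ 2 = A at *
  generalize ∑ x with phi p x = -1 ∧ x ≠ 1 ∧ x ≠ -1, ap p x ^ 2 = B at *
  have b₀' : ∑ w ∈ coeffTriples p 0, ((w.1 : ℝ) + w.2.1) ^ 2 ≤ 2 * A + 20 * p := by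
    exact_mod_cast b₀
  have b₁' : ∑ w ∈ coeffTriples p 1, ((w.1 : ℝ) + w.2.1) ^ 2 ≤ 2 * B + 20 * p := by
    exact_mod_cast b₁
  have hadd' : (A : ℝ) + B ≤ p ^ 2 := by exact_mod_cast hadd
  rw [Int.cast_sub, abs_lt]
  constructor <;> linarith
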